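/- Let U be a domain in ℝ² such that no straight line contains ∂U. Then U fails to be uniquely determined in the class of all domains in ℝ² by the relative metric of its Hausdorff boundary if and only if there exist a domain V ⊆ ℝ² not isometric to U (i.e. V ≠ J(U) for every Euclidean isometry J of ℝ²), a family of Euclidean isometries Q_i : ℝ² → ℝ², and a homeomorphism θ : ∂F_U → ∂F_V satisfying: (IIa) Q_i(U_i) = V_i for each connected component U_i of U ∩ Int(conv ∂U), and every connected component V_i of V ∩ Int(conv ∂V) arises this way; (IIb) x ∈ U ∩ ∂U_i if and only if Q_i(x) ∈ V ∩ ∂V_i, and when these containments hold, θ(x) = Q_i(x); (IIc) θ preserves arc length, i.e. for any two points x, y ∈ ∂F_U the length of the arc joining x and y within ∂F_U equals the length of its image under θ. -/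

import Mathlib

open Set Metric Filter

noncomputable section

/-- Euclidean `n`-space. -/
abbrev Euc (n : ℕ) := EuclideanSpace ℝ (Fin n)

/-- A domain: a nonempty open connected subset of Euclidean space. -/
def IsEucDomain {n : ℕ} (U : Set (Euc n)) : Prop := IsOpen U ∧ IsConnected U

/-- Intrinsic extended distance inside `S`: the infimum of the lengths (total
variations) of continuous paths joining `x` and `y` within `S`. -/
def intrinsicDist {n : ℕ} (S : Set (Euc n)) (x y : Euc n) : ENNReal :=
  ⨅ (γ : ℝ → Euc n) (_ : ContinuousOn γ (Icc (0:ℝ) 1)) (_ : γ 0 = x) (_ : γ 1 = y)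
    (_ : MapsTo γ (Icc (0:ℝ) 1) S), eVariationOn γ (Icc (0:ℝ) 1)

/-- A Cauchy sequence (in the intrinsic metric) of points of `U` that does not
converge (in the intrinsic metric) to a point of `U`; such sequences represent
elements of the Hausdorff boundary of `U`. -/
structure HBSeq {n : ℕ} (U : Set (Euc n)) where
  seq : ℕ → Euc n
  mem : ∀ k, seq k ∈ U
  cauchy : ∀ ε : ENNReal, 0 < ε → ∃ N : ℕ, ∀ j ≥ N, ∀ k ≥ N,
    intrinsicDist U (seq j) (seq k) < ε
  notConv : ¬ ∃ u ∈ U, Tendsto (fun k => intrinsicDist U (seq k) u) atTop (nhds 0)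

/-- Two Cauchy sequences represent the same Hausdorff-boundary element iff the
intrinsic distance between corresponding terms tends to `0`. -/
def HBEquiv {n : ℕ} (U : Set (Euc n)) (s t : HBSeq U) : Prop :=
  Tendsto (fun k => intrinsicDist U (s.seq k) (t.seq k)) atTop (nhds 0)

/-- The Hausdorff boundary of `U`: points of the completion of `(U, ρ_U)` not
corresponding to points of `U`. -/
def HausdorffBoundary {n : ℕ} (U : Set (Euc n)) : Type := Quot (HBEquiv U)

/-- The relative metric on the Hausdorff boundary (the completion metric). -/
def hbDist {n : ℕ} {U : Set (Euc n)} (a b : HausdorffBoundary U) : ENNReal :=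
  limsup (fun k => intrinsicDist U ((Quot.out a).seq k) ((Quot.out b).seq k)) atTop

/-- The support of a Hausdorff-boundary element: the Euclidean limit of a
representing Cauchy sequence. -/
def hbSupport {n : ℕ} {U : Set (Euc n)} (a : HausdorffBoundary U) : Euc n :=
  limUnder atTop (Quot.out a).seq

/-- A (bijective) isometry of Hausdorff boundaries in the relative metrics. -/
def IsHBIsometry {n : ℕ} {U V : Set (Euc n)}
    (f : HausdorffBoundary U → HausdorffBoundary V) : Prop :=
  Function.Bijective f ∧ ∀ a b : HausdorffBoundary U, hbDist (f a) (f b) = hbDist a b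

/-- `U` is uniquely determined in the class `𝒰` by the relative metric of its
Hausdorff boundary: any member of `𝒰` with Hausdorff boundary isometric (in the
relative metrics) to that of `U` is the image of `U` under a Euclidean isometry. -/
def UniquelyDeterminedIn {n : ℕ} (𝒰 : Set (Set (Euc n))) (U : Set (Euc n)) : Prop :=
  ∀ V ∈ 𝒰, (∃ f : HausdorffBoundary U → HausdorffBoundary V, IsHBIsometry f) →
    ∃ J : Euc n ≃ᵢ Euc n, J '' U = V

/-- `F_U = U \ cl (conv ∂U)`. -/
def FPart (U : Set (Euc 2)) : Set (Euc 2) := U \ closure (convexHull ℝ (frontier U))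

/-- `U ∩ Int (conv ∂U)`, whose connected components are the `U_i`. -/
def corePart (U : Set (Euc 2)) : Set (Euc 2) := U ∩ interior (convexHull ℝ (frontier U))

/-- The connected components of a set `W`. -/
def componentsOf (W : Set (Euc 2)) : Set (Set (Euc 2)) :=
  {C | ∃ x ∈ W, C = connectedComponentIn W x}

namespace HBoundary

/-- The Euclidean plane. -/
abbrev E2 := Euc 2

theorem intrinsicDist_le_of_path {S : Set E2} {γ : ℝ → E2} {a b : ℝ} (hab : a ≤ b)
    (hγ : ContinuousOn γ (Icc a b)) (hm : MapsTo γ (Icc a b) S) :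
    intrinsicDist S (γ a) (γ b) ≤ eVariationOn γ (Icc a b) := by
  have hφm : MapsTo (fun t : ℝ => a + t * (b - a)) (Icc 0 1) (Icc a b) := by
    rintro t ⟨h0, h1⟩
    constructor <;> simp only [] <;> nlinarith
  have hφ : MonotoneOn (fun t : ℝ => a + t * (b - a)) (Icc 0 1) := by
    intro s _ t _ hst
    simp only []
    nlinarith
  refine le_trans ?_ (eVariationOn.comp_le_of_monotoneOn γ _ hφ hφm)
  unfold intrinsicDist
  refine iInf_le_of_le (γ ∘ fun t : ℝ => a + t * (b - a)) ?_
  refine iInf_le_of_le (hγ.comp (by fun_prop) hφm) ?_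
  refine iInf_le_of_le (by simp) ?_
  refine iInf_le_of_le (by simp) ?_
  exact iInf_le_of_le (hm.comp hφm) le_rfl

theorem exists_path_of_intrinsicDist_lt {S : Set E2} {x y : E2} {r : ENNReal}
    (h : intrinsicDist S x y < r) : ∃ γ : ℝ → E2, ContinuousOn γ (Icc 0 1) ∧ γ 0 = x ∧ γ 1 = y ∧
      MapsTo γ (Icc 0 1) S ∧ eVariationOn γ (Icc 0 1) < r := by
  unfold intrinsicDist at h
  simp only [iInf_lt_iff] at h
  obtain ⟨γ, h1, h2, h3, h4, h5⟩ := h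
  exact ⟨γ, h1, h2, h3, h4, h5⟩

theorem edist_le_intrinsicDist (S : Set E2) (x y : E2) : edist x y ≤ intrinsicDist S x y := by
  unfold intrinsicDist
  refine le_iInf fun γ => le_iInf fun _ => le_iInf fun h0 => le_iInf fun h1 => le_iInf fun _ => ?_
  rw [← h0, ← h1]
  exact eVariationOn.edist_le γ (by simp) (by simp)

theorem intrinsicDist_triangle (S : Set E2) (x y z : E2) :
    intrinsicDist S x z ≤ intrinsicDist S x y + intrinsicDist S y z := by
  refine le_of_forall_gt fun r hr => ?_
  have hxy : intrinsicDist S x y ≠ ⊤ := ne_top_of_lt (lt_of_le_of_lt le_self_add hr)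
  have hyz : intrinsicDist S y z ≠ ⊤ := ne_top_of_lt (lt_of_le_of_lt le_add_self hr)
  obtain ⟨p, hp, q, hq, hpq⟩ : ∃ p > intrinsicDist S x y, ∃ q > intrinsicDist S y z, p + q < r := by
    obtain ⟨δ, hδ, h⟩ := ENNReal.lt_iff_exists_add_pos_lt.1 hr
    have hδ' : ((δ / 2 : NNReal) : ENNReal) ≠ 0 := by simpa using hδ.ne'
    refine ⟨_ + (δ / 2 : NNReal), ENNReal.lt_add_right hxy hδ', _ + (δ / 2 : NNReal),
      ENNReal.lt_add_right hyz hδ', ?_⟩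
    have : ((δ / 2 : NNReal) : ENNReal) + (δ / 2 : NNReal) = δ := by
      rw [← ENNReal.coe_add, add_halves]
    calc _ = intrinsicDist S x y + intrinsicDist S y z + (((δ / 2 : NNReal) : ENNReal) +
        (δ / 2 : NNReal)) := by ring
      _ < r := by rwa [this]
  obtain ⟨γ, c1, a1, b1, m1, v1⟩ := exists_path_of_intrinsicDist_lt hp
  obtain ⟨δ, c2, a2, b2, m2, v2⟩ := exists_path_of_intrinsicDist_lt hq
  set σ : ℝ → E2 := fun t => if t ≤ 1 then γ t else δ (t - 1) with hσ
  have e1 : EqOn σ γ (Icc 0 1) := fun t ht => by simp [hσ, ht.2]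
  have e2 : EqOn σ (δ ∘ fun t => t - 1) (Icc 1 2) := by
    intro t ht
    rcases eq_or_lt_of_le ht.1 with h | h
    · simp [hσ, ← h, a2, b1]
    · simp [hσ, not_le.2 h]
  have hm2 : MapsTo (fun t : ℝ => t - 1) (Icc 1 2) (Icc 0 1) := fun t ht =>
    ⟨by simp only []; linarith [ht.1], by simp only []; linarith [ht.2]⟩
  have hU : Icc (0:ℝ) 1 ∪ Icc 1 2 = Icc 0 2 := Icc_union_Icc_eq_Icc (by norm_num) (by norm_num)
  have hc : ContinuousOn σ (Icc 0 2) := by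
    rw [← hU]
    exact (c1.congr e1).union_of_isClosed ((c2.comp (by fun_prop) hm2).congr e2) isClosed_Icc
      isClosed_Icc
  have hmap : MapsTo σ (Icc 0 2) S := by
    rw [← hU]
    rintro t (ht | ht)
    · rw [e1 ht]; exact m1 ht
    · rw [e2 ht]; exact m2 (hm2 ht)
  have := intrinsicDist_le_of_path (by norm_num) hc hmap
  have h0 : σ 0 = x := by rw [e1 (by simp), a1]
  have h2 : σ 2 = z := by
    rw [e2 (by constructor <;> norm_num)]; simp only [Function.comp]; norm_num [b2]
  rw [h0, h2] at this
  refine this.trans_lt ?_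
  have hadd := eVariationOn.Icc_add_Icc σ (s := univ) (a := 0) (b := 1) (c := 2) (by norm_num)
    (by norm_num) (mem_univ _)
  simp only [univ_inter] at hadd
  rw [← hadd, eVariationOn.congr e1, eVariationOn.congr e2]
  refine lt_of_le_of_lt (add_le_add le_rfl
    (eVariationOn.comp_le_of_monotoneOn δ _ (fun s _ t _ h => sub_le_sub_right h 1) hm2)) ?_
  exact (ENNReal.add_lt_add v1 v2).trans hpq

theorem intrinsicDist_comm_le (S : Set E2) (x y : E2) :
    intrinsicDist S x y ≤ intrinsicDist S y x := by
  refine le_of_forall_gt fun r hr => ?_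
  obtain ⟨γ, c1, a1, b1, m1, v1⟩ := exists_path_of_intrinsicDist_lt hr
  have hm : MapsTo (fun t : ℝ => 1 - t) (Icc 0 1) (Icc 0 1) := fun t ht =>
    ⟨by simp only []; linarith [ht.2], by simp only []; linarith [ht.1]⟩
  have := intrinsicDist_le_of_path (S := S) (γ := γ ∘ fun t => 1 - t) (a := 0) (b := 1) (by norm_num)
    (c1.comp (by fun_prop) hm) (m1.comp hm)
  simp only [Function.comp, sub_zero, sub_self, a1, b1] at this
  refine this.trans_lt (lt_of_le_of_lt ?_ v1)
  exact eVariationOn.comp_le_of_antitoneOn γ _ (fun s _ t _ h => sub_le_sub_left h 1) hm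

theorem intrinsicDist_comm (S : Set E2) (x y : E2) :
    intrinsicDist S x y = intrinsicDist S y x :=
  le_antisymm (intrinsicDist_comm_le S x y) (intrinsicDist_comm_le S y x)

theorem eVariationOn_segment_le (x y : E2) :
    eVariationOn (fun t : ℝ => x + t • (y - x)) (Icc 0 1) ≤ edist x y := by
  have hL : LipschitzOnWith (nndist x y) (fun t : ℝ => x + t • (y - x)) univ := by
    refine LipschitzOnWith.of_dist_le_mul fun s _ t _ => ?_
    rw [dist_add_left, dist_eq_norm, ← sub_smul, norm_smul, coe_nndist, dist_comm x y,
      dist_eq_norm y x, Real.dist_eq, Real.norm_eq_abs, mul_comm]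
  have h := hL.comp_eVariationOn_le (g := id) (s := Icc (0:ℝ) 1) (mapsTo_univ _ _)
  have h2 : eVariationOn (id : ℝ → ℝ) (Icc 0 1) = 1 := by
    have := (monotone_id.monotoneOn (univ : Set ℝ)).eVariationOn_eq (mem_univ (0:ℝ)) (mem_univ 1)
    simpa using this
  rw [h2, mul_one] at h
  rw [edist_nndist]
  exact h

theorem intrinsicDist_le_of_segment {S : Set E2} {x y : E2} (h : segment ℝ x y ⊆ S) :
    intrinsicDist S x y ≤ edist x y := by
  refine le_trans ?_ (eVariationOn_segment_le x y)
  have := intrinsicDist_le_of_path (S := S) (γ := fun t : ℝ => x + t • (y - x)) (a := 0) (b := 1)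
    (by norm_num) (by fun_prop) ?_
  · simpa using this
  · intro t ht
    apply h
    rw [segment_eq_image']
    exact ⟨t, ht, rfl⟩

theorem intrinsicDist_eq_of_segment {S : Set E2} {x y : E2} (h : segment ℝ x y ⊆ S) :
    intrinsicDist S x y = edist x y :=
  le_antisymm (intrinsicDist_le_of_segment h) (edist_le_intrinsicDist _ _ _)

theorem intrinsicDist_ne_top {S : Set E2} (hS : IsEucDomain S) {x y : E2} (hx : x ∈ S)
    (hy : y ∈ S) : intrinsicDist S x y ≠ ⊤ := by
  refine hS.2.isPreconnected.induction₂ (fun x y => intrinsicDist S x y ≠ ⊤) ?_ ?_ ?_ hx hy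
  · intro x hx
    obtain ⟨r, hr, hb⟩ := Metric.isOpen_iff.1 hS.1 x hx
    refine mem_nhdsWithin_of_mem_nhds ?_
    filter_upwards [Metric.ball_mem_nhds x hr] with y hy
    have := intrinsicDist_le_of_segment (S := S) (x := x) (y := y)
      (((convex_ball x r).segment_subset (mem_ball_self hr) hy).trans hb)
    exact ne_top_of_le_ne_top (edist_ne_top x y) this
  · intro x y z _ _ _ h1 h2
    exact ne_top_of_le_ne_top (ENNReal.add_ne_top.2 ⟨h1, h2⟩) (intrinsicDist_triangle S x y z)
  · intro x y _ _ h
    rwa [intrinsicDist_comm]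

/-- A plane domain, bundled. -/
structure Dom where
  /-- the underlying set -/
  set : Set E2
  isDom : IsEucDomain set

variable {U V W : Dom} {x y : E2} {C : Set E2}

theorem mem_oseg {z : E2} :
    z ∈ openSegment ℝ x y ↔ ∃ t ∈ Ioo (0 : ℝ) 1, (1 - t) • x + t • y = z := by
  rw [openSegment_eq_image]; rfl

theorem oseg_mem {t : ℝ} (ht : t ∈ Ioo (0 : ℝ) 1) :
    (1 - t) • x + t • y ∈ openSegment ℝ x y := mem_oseg.2 ⟨t, ht, rfl⟩

theorem tendsto_sub_one_mul (c : ℝ) :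
    Tendsto (fun l : ℝ => (l - 1) * c) (nhdsWithin 1 (Ioi 1)) (nhds 0) := by
  have : Continuous fun l : ℝ => (l - 1) * c := by fun_prop
  simpa using (this.tendsto 1).mono_left nhdsWithin_le_nhds

/-- The domain `W` with its intrinsic metric. -/
def IM (W : Dom) : Type := {x : E2 // x ∈ W.set}

instance (W : Dom) : EMetricSpace (IM W) where
  edist x y := intrinsicDist W.set x.1 y.1
  edist_self x := by
    have := intrinsicDist_le_of_segment (S := W.set) (x := x.1) (y := x.1)
      (by simpa using x.2)
    simp at this
    exact this
  edist_comm x y := intrinsicDist_comm _ _ _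
  edist_triangle x y z := intrinsicDist_triangle _ _ _ _
  eq_of_edist_eq_zero := by
    intro x y h
    apply Subtype.ext
    have := edist_le_intrinsicDist W.set x.1 y.1
    rw [show intrinsicDist W.set x.1 y.1 = 0 from h] at this
    exact edist_le_zero.1 this

instance (W : Dom) : MetricSpace (IM W) :=
  EMetricSpace.toMetricSpace fun x y => intrinsicDist_ne_top W.isDom x.2 y.2

theorem IM.edist_eq (x y : IM W) : edist x y = intrinsicDist W.set x.1 y.1 := rfl

/-- The completion of a domain in its intrinsic metric. -/
abbrev X (W : Dom) : Type := UniformSpace.Completion (IM W)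

/-- The inclusion of the domain in its completion. -/
def ι (x : E2) (hx : x ∈ W.set) : X W :=
  UniformSpace.Completion.coe' (α := IM W) ⟨x, hx⟩

theorem dist_val_le (x y : IM W) : dist x.1 y.1 ≤ dist x y := by
  have := edist_le_intrinsicDist W.set x.1 y.1
  rw [← IM.edist_eq, edist_dist, edist_dist] at this
  exact (ENNReal.ofReal_le_ofReal_iff dist_nonneg).1 this

theorem lipschitz_val (W : Dom) : LipschitzWith 1 (fun x : IM W => (x.1 : E2)) :=
  LipschitzWith.of_dist_le_mul fun x y => by simpa using dist_val_le x y

/-- The support map of the completion to the plane. -/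
def sp : X W → E2 := UniformSpace.Completion.extension (fun x : IM W => (x.1 : E2))

theorem lipschitz_sp (W : Dom) : LipschitzWith 1 (sp : X W → E2) :=
  (lipschitz_val W).completion_extension

theorem dist_sp_le (ξ ζ : X W) : dist (sp ξ) (sp ζ) ≤ dist ξ ζ := by
  simpa using (lipschitz_sp W).dist_le_mul ξ ζ

@[simp] theorem sp_ι (x : E2) (hx : x ∈ W.set) : sp (ι x hx : X W) = x :=
  UniformSpace.Completion.extension_coe (lipschitz_val W).uniformContinuous ⟨x, hx⟩

theorem edist_ι (hx : x ∈ W.set) (hy : y ∈ W.set) :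
    edist (ι x hx : X W) (ι y hy) = intrinsicDist W.set x y :=
  UniformSpace.Completion.edist_eq _ _

/-- The set of boundary elements in the completion. -/
def bd (W : Dom) : Set (X W) := (range (UniformSpace.Completion.coe' : IM W → X W))ᶜ

theorem ι_notMem_bd (hx : x ∈ W.set) : (ι x hx : X W) ∉ bd W :=
  fun h => h ⟨_, rfl⟩

theorem exists_ι_of_notMem_bd {ξ : X W} (h : ξ ∉ bd W) :
    ∃ x, ∃ hx : x ∈ W.set, ξ = ι x hx := by
  rw [bd, notMem_compl_iff] at h
  obtain ⟨x, rfl⟩ := h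
  exact ⟨x.1, x.2, rfl⟩

theorem dist_ι_of_segment (hx : x ∈ W.set) (hy : y ∈ W.set)
    (h : segment ℝ x y ⊆ W.set) : dist (ι x hx : X W) (ι y hy) = dist x y := by
  have := edist_ι hx hy
  rw [intrinsicDist_eq_of_segment h, edist_dist, edist_dist] at this
  exact (ENNReal.ofReal_eq_ofReal_iff dist_nonneg dist_nonneg).1 this

theorem dist_ι_of_ball {x y o : E2} {r : ℝ} (h : ball o r ⊆ W.set)
    (hx : x ∈ ball o r) (hy : y ∈ ball o r) :
    dist (ι x (h hx) : X W) (ι y (h hy)) = dist x y :=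
  dist_ι_of_segment _ _ (((convex_ball o r).segment_subset hx hy).trans h)

theorem exists_ι_near (ξ : X W) {ε : ℝ} (hε : 0 < ε) :
    ∃ x, ∃ hx : x ∈ W.set, dist ξ (ι x hx) < ε := by
  obtain ⟨x, hx⟩ := UniformSpace.Completion.denseRange_coe.exists_dist_lt ξ hε
  exact ⟨x.1, x.2, hx⟩

theorem continuousOn_ι : Continuous (fun x : W.set => (ι x.1 x.2 : X W)) := by
  rw [Metric.continuous_iff]
  intro x ε hε
  obtain ⟨r, hr, hb⟩ := Metric.isOpen_iff.1 W.isDom.1 x.1 x.2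
  refine ⟨min r ε, lt_min hr hε, fun y hy => ?_⟩
  have h1 : dist y.1 x.1 < min r ε := hy
  have := dist_ι_of_ball hb (mem_ball.2 (h1.trans_le (min_le_left _ _))) (mem_ball_self hr)
  rw [this]
  exact h1.trans_le (min_le_right _ _)

theorem sp_mem_frontier {ξ : X W} (hξ : ξ ∈ bd W) : sp ξ ∈ frontier W.set := by
  rw [W.isDom.1.frontier_eq]
  constructor
  · rw [Metric.mem_closure_iff]
    intro ε hε
    obtain ⟨x, hx, h⟩ := exists_ι_near ξ hε
    refine ⟨x, hx, ?_⟩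
    have := dist_sp_le ξ (ι x hx)
    rw [sp_ι] at this
    exact this.trans_lt h
  · intro hx
    apply hξ
    refine ⟨⟨sp ξ, hx⟩, ?_⟩
    change ι (sp ξ) hx = ξ
    obtain ⟨r, hr, hb⟩ := Metric.isOpen_iff.1 W.isDom.1 _ hx
    rw [← dist_le_zero]
    refine le_of_forall_pos_le_add fun ε hε => ?_
    obtain ⟨y, hy, h⟩ := exists_ι_near ξ (lt_min hr (half_pos hε))
    have h1 := dist_sp_le ξ (ι y hy)
    rw [sp_ι] at h1
    have h2 : y ∈ ball (sp ξ) r := by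
      rw [mem_ball, dist_comm]; exact h1.trans_lt (h.trans_le (min_le_left _ _))
    have h3 := dist_ι_of_ball hb (mem_ball_self hr) h2
    have h4 := dist_triangle (ι (sp ξ) hx) (ι y hy) ξ
    rw [dist_comm (ι y hy) ξ] at h4
    have h5 := h.trans_le (min_le_right _ _)
    linarith

theorem sp_notMem_of_bd {ξ : X W} (hξ : ξ ∈ bd W) : sp ξ ∉ W.set := by
  have := sp_mem_frontier hξ
  rw [W.isDom.1.frontier_eq] at this
  exact this.2

theorem mem_bd_of_sp_notMem {ξ : X W} (h : sp ξ ∉ W.set) : ξ ∈ bd W := by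
  by_contra hb
  obtain ⟨x, hx, rfl⟩ := exists_ι_of_notMem_bd hb
  simp [hx] at h

theorem mem_bd_iff {ξ : X W} : ξ ∈ bd W ↔ sp ξ ∉ W.set :=
  ⟨sp_notMem_of_bd, mem_bd_of_sp_notMem⟩

theorem eq_ι_of_sp_mem {ξ : X W} (h : sp ξ ∈ W.set) : ξ = ι (sp ξ) h := by
  have : ξ ∉ bd W := fun hb => sp_notMem_of_bd hb h
  obtain ⟨x, hx, rfl⟩ := exists_ι_of_notMem_bd this
  simp

theorem edist_ι_le_of_path {γ : ℝ → E2} {a b : ℝ} (hab : a ≤ b)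
    (hγ : ContinuousOn γ (Icc a b)) (hm : MapsTo γ (Icc a b) W.set) :
    edist (ι (γ a) (hm ⟨le_rfl, hab⟩) : X W) (ι (γ b) (hm ⟨hab, le_rfl⟩)) ≤
      eVariationOn γ (Icc a b) := by
  rw [edist_ι]
  exact intrinsicDist_le_of_path hab hγ hm

theorem exists_path_near (hx : x ∈ W.set) (hy : y ∈ W.set) {r : ℝ}
    (h : dist (ι x hx : X W) (ι y hy) < r) : ∃ γ : ℝ → E2, ContinuousOn γ (Icc 0 1) ∧ γ 0 = x ∧
      γ 1 = y ∧ MapsTo γ (Icc 0 1) W.set ∧ eVariationOn γ (Icc 0 1) < ENNReal.ofReal r := by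
  apply exists_path_of_intrinsicDist_lt
  rw [← edist_ι hx hy, edist_dist]
  exact (ENNReal.ofReal_lt_ofReal_iff (dist_nonneg.trans_lt h)).2 h

theorem eVariationOn_Icc_add (γ : ℝ → E2) {a b c : ℝ} (hab : a ≤ b) (hbc : b ≤ c) :
    eVariationOn γ (Icc a b) + eVariationOn γ (Icc b c) = eVariationOn γ (Icc a c) := by
  simpa using eVariationOn.Icc_add_Icc γ (s := univ) hab hbc (mem_univ _)

theorem exists_between (ξ ζ : X W) {t ε : ℝ} (ht : 0 ≤ t) (ht' : t ≤ dist ξ ζ)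
    (hε : 0 < ε) : ∃ x, ∃ hx : x ∈ W.set, dist ξ (ι x hx) ≤ t + ε ∧
      dist (ι x hx) ζ ≤ dist ξ ζ - t + ε := by
  obtain ⟨x, hx, hxξ⟩ := exists_ι_near ξ (show 0 < ε / 4 by positivity)
  obtain ⟨y, hy, hyζ⟩ := exists_ι_near ζ (show 0 < ε / 4 by positivity)
  set d0 := dist (ι x hx : X W) (ι y hy) with hd0
  obtain ⟨γ, hc, h0, h1, hm, hv⟩ := exists_path_near hx hy (r := d0 + ε / 4) (by linarith)
  have hcι : Continuous (fun s : Icc (0:ℝ) 1 => (ι (γ s.1) (hm s.2) : X W)) :=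
    continuousOn_ι.comp (f := fun s : Icc (0:ℝ) 1 => (⟨γ s.1, hm s.2⟩ : W.set))
      (Continuous.subtype_mk hc.domRestrict _)
  have hg : Continuous (fun s : Icc (0:ℝ) 1 => dist (ι x hx : X W) (ι (γ s.1) (hm s.2))) :=
    continuous_const.dist hcι
  have hmem : min t d0 ∈ range (fun s : Icc (0:ℝ) 1 => dist (ι x hx : X W) (ι (γ s.1) (hm s.2))) := by
    refine mem_range_of_exists_le_of_exists_ge hg ⟨⟨0, by simp⟩, ?_⟩ ⟨⟨1, by simp⟩, ?_⟩
    · simp only [h0, dist_self]; exact le_min ht dist_nonneg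
    · simp only [h1]; exact min_le_right _ _
  obtain ⟨⟨s, hs⟩, hs'⟩ := hmem
  simp only at hs'
  refine ⟨γ s, hm hs, ?_, ?_⟩
  · have := dist_triangle ξ (ι x hx) (ι (γ s) (hm hs))
    have := min_le_left t d0
    linarith
  · have e1 := edist_ι_le_of_path (W := W) hs.1 (hc.mono (Icc_subset_Icc_right hs.2))
      (fun u hu => hm ⟨hu.1, hu.2.trans hs.2⟩)
    have e2 := edist_ι_le_of_path (W := W) hs.2 (hc.mono (Icc_subset_Icc_left hs.1))
      (fun u hu => hm ⟨hs.1.trans hu.1, hu.2⟩)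
    simp only [h0] at e1
    simp only [h1] at e2
    have e3 := (add_le_add e1 e2).trans_lt ((eVariationOn_Icc_add γ hs.1 hs.2).trans_lt hv)
    rw [edist_dist, edist_dist, ← ENNReal.ofReal_add dist_nonneg dist_nonneg,
      ENNReal.ofReal_lt_ofReal_iff (by positivity), hs'] at e3
    have t1 := dist_triangle (ι (γ s) (hm hs)) (ι y hy) ζ
    rw [dist_comm (ι y hy) ζ] at t1
    have t2 : d0 ≤ dist (ι x hx) ξ + dist ξ ζ + dist ζ (ι y hy) := dist_triangle4 _ _ _ _
    rw [dist_comm (ι x hx) ξ] at t2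
    rcases min_cases t d0 with ⟨h, _⟩ | ⟨h, _⟩ <;> linarith

theorem exists_lim (s : HBSeq W.set) :
    ∃ ξ ∈ bd W, Tendsto (fun k => (ι (s.seq k) (s.mem k) : X W)) atTop (nhds ξ) := by
  have hc : CauchySeq (fun k => (ι (s.seq k) (s.mem k) : X W)) := by
    rw [EMetric.cauchySeq_iff]
    intro ε hε
    obtain ⟨N, hN⟩ := s.cauchy ε hε
    exact ⟨N, fun m hm n hn => by rw [edist_ι]; exact hN m hm n hn⟩
  obtain ⟨ξ, hξ⟩ := cauchySeq_tendsto_of_complete hc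
  refine ⟨ξ, ?_, hξ⟩
  by_contra hb
  obtain ⟨x, hx, rfl⟩ := exists_ι_of_notMem_bd hb
  refine s.notConv ⟨x, hx, ?_⟩
  have := tendsto_iff_edist_tendsto_0.1 hξ
  simpa only [edist_ι] using this

/-- The boundary element represented by a sequence. -/
def limOf (s : HBSeq W.set) : X W := (exists_lim s).choose

theorem limOf_mem (s : HBSeq W.set) : limOf s ∈ bd W := (exists_lim s).choose_spec.1

theorem tendsto_limOf (s : HBSeq W.set) :
    Tendsto (fun k => (ι (s.seq k) (s.mem k) : X W)) atTop (nhds (limOf s)) :=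
  (exists_lim s).choose_spec.2

theorem tendsto_intrinsicDist (s t : HBSeq W.set) :
    Tendsto (fun k => intrinsicDist W.set (s.seq k) (t.seq k)) atTop
      (nhds (edist (limOf s) (limOf t))) := by
  have := (tendsto_limOf s).edist (tendsto_limOf t)
  simpa only [edist_ι] using this

theorem hbEquiv_iff (s t : HBSeq W.set) : HBEquiv W.set s t ↔ limOf s = limOf t := by
  unfold HBEquiv
  constructor
  · intro h
    exact edist_eq_zero.1 (tendsto_nhds_unique (tendsto_intrinsicDist s t) h)
  · intro h
    have := tendsto_intrinsicDist s t
    rwa [h, edist_self] at this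

theorem exists_hbSeq {ξ : X W} (hξ : ξ ∈ bd W) : ∃ s : HBSeq W.set, limOf s = ξ := by
  choose x hx hd using fun k : ℕ => exists_ι_near ξ (show 0 < 1 / ((k:ℝ) + 1) by positivity)
  have ht : Tendsto (fun k => (ι (x k) (hx k) : X W)) atTop (nhds ξ) := by
    rw [tendsto_iff_dist_tendsto_zero]
    refine squeeze_zero (fun _ => dist_nonneg) (fun k => ?_) tendsto_one_div_add_atTop_nhds_zero_nat
    rw [dist_comm]; exact (hd k).le
  refine ⟨⟨x, hx, ?_, ?_⟩, ?_⟩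
  · intro ε hε
    obtain ⟨N, hN⟩ := EMetric.cauchySeq_iff.1 ht.cauchySeq ε hε
    exact ⟨N, fun m hm n hn => by have := hN m hm n hn; rwa [edist_ι] at this⟩
  · rintro ⟨u, hu, h⟩
    apply ι_notMem_bd (W := W) hu
    have : Tendsto (fun k => (ι (x k) (hx k) : X W)) atTop (nhds (ι u hu)) := by
      rw [tendsto_iff_edist_tendsto_0]
      simpa only [edist_ι] using h
    rwa [← tendsto_nhds_unique ht this]
  · exact tendsto_nhds_unique (tendsto_limOf _) ht

variable (W) in
theorem exists_hbEquiv : ∃ e : HausdorffBoundary W.set ≃ bd W,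
    ∀ a b, hbDist a b = edist (e a : X W) (e b : X W) := by
  let F : HausdorffBoundary W.set → bd W :=
    Quot.lift (fun s => ⟨limOf s, limOf_mem s⟩) fun s t h => Subtype.ext ((hbEquiv_iff s t).1 h)
  have hF : Function.Bijective F := by
    constructor
    · intro a b
      induction a using Quot.ind with | _ s
      induction b using Quot.ind with | _ t
      intro h
      exact Quot.sound ((hbEquiv_iff s t).2 (Subtype.ext_iff.1 h))
    · rintro ⟨ξ, hξ⟩
      obtain ⟨s, hs⟩ := exists_hbSeq hξ
      exact ⟨Quot.mk _ s, Subtype.ext hs⟩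
  refine ⟨Equiv.ofBijective F hF, fun a b => ?_⟩
  have ha : (F a : X W) = limOf (Quot.out a) := by conv_lhs => rw [← Quot.out_eq a]
  have hb : (F b : X W) = limOf (Quot.out b) := by conv_lhs => rw [← Quot.out_eq b]
  change _ = edist (F a : X W) (F b : X W)
  rw [ha, hb]
  exact (tendsto_intrinsicDist _ _).limsup_eq

theorem exists_isHBIsometry_iff (U V : Dom) :
    (∃ f : HausdorffBoundary U.set → HausdorffBoundary V.set, IsHBIsometry f) ↔
      Nonempty (bd U ≃ᵢ bd V) := by
  obtain ⟨eU, hU⟩ := exists_hbEquiv U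
  obtain ⟨eV, hV⟩ := exists_hbEquiv V
  constructor
  · rintro ⟨f, hf, hd⟩
    refine ⟨⟨(eU.symm.trans (Equiv.ofBijective f hf)).trans eV, fun a b => ?_⟩⟩
    have := hd (eU.symm a) (eU.symm b)
    rw [hU, hV, Equiv.apply_symm_apply, Equiv.apply_symm_apply] at this
    exact this
  · rintro ⟨g⟩
    refine ⟨fun a => eV.symm (g (eU a)), ?_, fun a b => ?_⟩
    · exact eV.symm.bijective.comp (g.bijective.comp eU.bijective)
    · rw [hU, hV, Equiv.apply_symm_apply, Equiv.apply_symm_apply]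
      exact g.isometry.edist_eq _ _

/-- `α` is a boundary element accessible from every point of `S` along a straight line. -/
def AccOn (S : Set E2) (α : X W) : Prop :=
  α ∈ bd W ∧ ∀ q ∈ S, ∃ hq : q ∈ W.set, dist (ι q hq : X W) α = dist q (sp α)

theorem AccOn.mono {S T : Set E2} {α : X W} (h : AccOn T α) (hST : S ⊆ T) : AccOn S α :=
  ⟨h.1, fun q hq => h.2 q (hST hq)⟩

theorem AccOn.subset {S : Set E2} {α : X W} (h : AccOn S α) : S ⊆ W.set :=
  fun q hq => (h.2 q hq).1

theorem AccOn.dist_eq {S : Set E2} {α : X W} (h : AccOn S α) {q : E2} (hq : q ∈ S)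
    (hqW : q ∈ W.set) : dist (ι q hqW : X W) α = dist q (sp α) := (h.2 q hq).2

theorem exists_accOn {S : Set E2} (hS : Convex ℝ S) (hSW : S ⊆ W.set) {a : E2}
    (ha : a ∈ closure S) (haW : a ∉ W.set) : ∃ α : X W, sp α = a ∧ AccOn S α := by
  obtain ⟨u, hu, hua⟩ := mem_closure_iff_seq_limit.1 ha
  have hd : ∀ p (hp : p ∈ S) q (hq : q ∈ S), dist (ι p (hSW hp) : X W) (ι q (hSW hq)) = dist p q :=
    fun p hp q hq => dist_ι_of_segment _ _ ((hS.segment_subset hp hq).trans hSW)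
  have hc : CauchySeq (fun k => (ι (u k) (hSW (hu k)) : X W)) := by
    rw [Metric.cauchySeq_iff]
    intro ε hε
    obtain ⟨N, hN⟩ := Metric.cauchySeq_iff.1 hua.cauchySeq ε hε
    exact ⟨N, fun m hm n hn => by rw [hd _ (hu m) _ (hu n)]; exact hN m hm n hn⟩
  obtain ⟨α, hα⟩ := cauchySeq_tendsto_of_complete hc
  have hsp : sp α = a := by
    have h1 := ((lipschitz_sp W).continuous.tendsto α).comp hα
    simp only [Function.comp_def, sp_ι] at h1
    exact tendsto_nhds_unique h1 hua
  refine ⟨α, hsp, mem_bd_of_sp_notMem (hsp ▸ haW), fun q hq => ⟨hSW hq, ?_⟩⟩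
  rw [hsp]
  have h1 : Tendsto (fun k => dist (ι q (hSW hq) : X W) (ι (u k) (hSW (hu k)))) atTop
    (nhds (dist (ι q (hSW hq)) α)) := tendsto_const_nhds.dist hα
  have h2 : Tendsto (fun k => dist q (u k)) atTop (nhds (dist q a)) := tendsto_const_nhds.dist hua
  simp only [hd _ hq _ (hu _)] at h1
  exact tendsto_nhds_unique h1 h2

theorem AccOn.eq {S T : Set E2} {α β : X W} (hα : AccOn S α) (hβ : AccOn T β)
    (h : sp α = sp β) (hcl : sp α ∈ closure (S ∩ T)) : α = β := by
  rw [← dist_le_zero]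
  refine le_of_forall_pos_le_add fun ε hε => ?_
  obtain ⟨q, hq, hqa⟩ := Metric.mem_closure_iff.1 hcl (ε / 2) (half_pos hε)
  have h1 := hα.dist_eq hq.1 (hα.subset hq.1)
  have h2 := hβ.dist_eq hq.2 (hα.subset hq.1)
  have h3 := dist_triangle_left α β (ι q (hα.subset hq.1))
  rw [h1, h2, ← h, dist_comm q] at h3
  linarith

theorem AccOn.convex {S T : Set E2} {α : X W} (hα : AccOn S α) (hT : Convex ℝ T)
    (hTW : T ⊆ W.set) (hcl : sp α ∈ closure (S ∩ T)) : AccOn T α := by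
  obtain ⟨β, h1, h2⟩ := exists_accOn hT hTW (closure_mono inter_subset_right hcl)
    (sp_notMem_of_bd hα.1)
  rwa [hα.eq h2 h1.symm hcl]

/-- Mutual visibility of two boundary elements. -/
def Vis (ξ ζ : X W) : Prop :=
  AccOn (openSegment ℝ (sp ξ) (sp ζ)) ξ ∧ AccOn (openSegment ℝ (sp ξ) (sp ζ)) ζ

theorem Vis.symm {ξ ζ : X W} (h : Vis ξ ζ) : Vis ζ ξ := by
  unfold Vis
  rw [openSegment_symm]
  exact ⟨h.2, h.1⟩

theorem Vis.subset {ξ ζ : X W} (h : Vis ξ ζ) : openSegment ℝ (sp ξ) (sp ζ) ⊆ W.set :=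
  h.1.subset

theorem Vis.sp_ne {ξ ζ : X W} (h : Vis ξ ζ) : sp ξ ≠ sp ζ := by
  intro he
  have := h.subset (show sp ξ ∈ openSegment ℝ (sp ξ) (sp ζ) by rw [← he]; simp)
  exact sp_notMem_of_bd h.1.1 this

theorem Vis.ne {ξ ζ : X W} (h : Vis ξ ζ) : ξ ≠ ζ := fun he => h.sp_ne (by rw [he])

theorem dist_add_openSegment {x y z : E2} (h : z ∈ openSegment ℝ x y) :
    dist x z + dist z y = dist x y :=
  dist_add_dist_of_mem_segment (openSegment_subset_segment _ _ _ h)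

theorem Vis.dist_eq {ξ ζ : X W} (h : Vis ξ ζ) : dist ξ ζ = dist (sp ξ) (sp ζ) := by
  refine le_antisymm ?_ (dist_sp_le _ _)
  have hm : midpoint ℝ (sp ξ) (sp ζ) ∈ openSegment ℝ (sp ξ) (sp ζ) :=
    midpoint_mem_openSegment _ _
  have h1 := h.1.dist_eq hm (h.subset hm)
  have h2 := h.2.dist_eq hm (h.subset hm)
  have := dist_triangle_left ξ ζ (ι _ (h.subset hm))
  have h3 := dist_add_openSegment hm
  rw [dist_comm (sp ξ)] at h3
  linarith

theorem AccOn.vis {S : Set E2} {α β : X W} (hα : AccOn S α) (hβ : AccOn S β)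
    (h : openSegment ℝ (sp α) (sp β) ⊆ S) : Vis α β := ⟨hα.mono h, hβ.mono h⟩

/-- Metric criterion for visibility. -/
def VisCrit (ξ ζ : X W) : Prop :=
  ∀ ε > 0, ∃ δ > 0, ∀ η ∈ bd W, dist ξ η + dist η ζ < dist ξ ζ + δ → dist ξ η < ε ∨ dist η ζ < ε

theorem Vis.visCrit {ξ ζ : X W} (h : Vis ξ ζ) : VisCrit ξ ζ := by
  intro ε hε
  by_contra! hcon
  choose η hη hs h1 h2 using fun n : ℕ => hcon (1 / ((n:ℝ) + 1)) (by positivity)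
  have hd := h.dist_eq
  have hinv : Tendsto (fun n : ℕ => 1 / ((n:ℝ) + 1)) atTop (nhds 0) :=
    tendsto_one_div_add_atTop_nhds_zero_nat
  have hin : ∀ n, sp (η n) ∈ closedBall (sp ξ) (dist ξ ζ + 1) := by
    intro n
    have h3 : 1 / ((n:ℝ) + 1) ≤ 1 := by
      rw [div_le_one (by positivity)]; linarith [(Nat.cast_nonneg n : (0:ℝ) ≤ n)]
    rw [mem_closedBall, dist_comm]
    have h4 := dist_sp_le ξ (η n)
    have h5 := hs n
    have h6 : 0 ≤ dist (η n) ζ := dist_nonneg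
    linarith
  obtain ⟨q, -, φ, hφ, hq⟩ := (isCompact_closedBall _ _).tendsto_subseq hin
  have hinv' := hinv.comp hφ.tendsto_atTop
  have hqW : q ∉ W.set := by
    have : q ∈ (W.set)ᶜ := W.isDom.1.isClosed_compl.mem_of_tendsto hq
      (Eventually.of_forall fun n => sp_notMem_of_bd (hη (φ n)))
    exact this
  have hle : dist (sp ξ) q + dist q (sp ζ) ≤ dist (sp ξ) (sp ζ) := by
    have hl : Tendsto (fun n => dist (sp ξ) (sp (η (φ n))) + dist (sp (η (φ n))) (sp ζ)) atTop
      (nhds (dist (sp ξ) q + dist q (sp ζ))) :=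
      (tendsto_const_nhds.dist hq).add (hq.dist tendsto_const_nhds)
    have hr : Tendsto (fun n => dist (sp ξ) (sp ζ) + 1 / ((φ n:ℝ) + 1)) atTop
      (nhds (dist (sp ξ) (sp ζ) + 0)) := tendsto_const_nhds.add hinv'
    rw [add_zero] at hr
    refine le_of_tendsto_of_tendsto' hl hr fun n => ?_
    have := dist_sp_le ξ (η (φ n))
    have := dist_sp_le (η (φ n)) ζ
    have := hs (φ n)
    simp only [← hd]
    linarith
  have hseg : q ∈ segment ℝ (sp ξ) (sp ζ) := by
    rw [mem_segment_iff_wbtw, ← dist_add_dist_eq_iff]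
    exact le_antisymm hle (dist_triangle _ _ _)
  have hends : q = sp ξ ∨ q = sp ζ := by
    by_contra! hne
    exact hqW (h.subset (mem_openSegment_of_ne_left_right hne.1.symm hne.2.symm hseg))
  rcases hends with rfl | rfl
  · have hl : Tendsto (fun n => dist ξ ζ + 1 / ((φ n:ℝ) + 1) - dist (sp (η (φ n))) (sp ζ)) atTop
      (nhds (dist ξ ζ + 0 - dist (sp ξ) (sp ζ))) :=
      (tendsto_const_nhds.add hinv').sub (hq.dist tendsto_const_nhds)
    have : ε ≤ dist ξ ζ + 0 - dist (sp ξ) (sp ζ) := by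
      refine ge_of_tendsto' hl fun n => ?_
      have := dist_sp_le (η (φ n)) ζ
      have := hs (φ n)
      have := h1 (φ n)
      linarith
    linarith
  · have hl : Tendsto (fun n => dist ξ ζ + 1 / ((φ n:ℝ) + 1) - dist (sp ξ) (sp (η (φ n)))) atTop
      (nhds (dist ξ ζ + 0 - dist (sp ξ) (sp ζ))) :=
      (tendsto_const_nhds.add hinv').sub (tendsto_const_nhds.dist hq)
    have : ε ≤ dist ξ ζ + 0 - dist (sp ξ) (sp ζ) := by
      refine ge_of_tendsto' hl fun n => ?_
      have := dist_sp_le ξ (η (φ n))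
      have := hs (φ n)
      have := h2 (φ n)
      linarith
    linarith

theorem exists_nearest_bd (hW : W.set ≠ univ) (hx : x ∈ W.set) :
    ∃ η : X W, η ∈ bd W ∧ AccOn (ball x (infDist x W.setᶜ)) η ∧
      dist (ι x hx) η = infDist x W.setᶜ ∧ 0 < infDist x W.setᶜ := by
  have hne : (W.setᶜ).Nonempty := nonempty_compl.2 hW
  obtain ⟨a, ha, hxa⟩ := W.isDom.1.isClosed_compl.exists_infDist_eq_dist hne x
  have hpos : 0 < infDist x W.setᶜ :=
    (W.isDom.1.isClosed_compl.notMem_iff_infDist_pos hne).1 (by simpa using hx)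
  have hcl : a ∈ closure (ball x (infDist x W.setᶜ)) := by
    rw [closure_ball _ hpos.ne', mem_closedBall, hxa, dist_comm]
  obtain ⟨η, h1, h2⟩ := exists_accOn (W := W) (convex_ball x (infDist x W.setᶜ))
    ball_infDist_compl_subset hcl ha
  refine ⟨η, h2.1, h2, ?_, hpos⟩
  rw [h2.dist_eq (mem_ball_self hpos), h1, hxa]

theorem ne_univ_of_mem_bd {ξ : X W} (hξ : ξ ∈ bd W) : W.set ≠ univ := fun h =>
  sp_notMem_of_bd hξ (h ▸ mem_univ _)

theorem VisCrit.exists_clearance {ξ ζ : X W} (h : VisCrit ξ ζ) (hξ : ξ ∈ bd W) {ε : ℝ}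
    (hε : 0 < ε) : ∃ ρ > 0, ∀ x (hx : x ∈ W.set),
      dist ξ (ι x hx) + dist (ι x hx) ζ ≤ dist ξ ζ + ρ → 2 * ε ≤ dist ξ (ι x hx) →
      2 * ε ≤ dist (ι x hx) ζ → ball x ρ ⊆ W.set := by
  obtain ⟨δ, hδ, hη⟩ := h ε hε
  refine ⟨min (δ / 4) (ε / 2), by positivity, fun x hx hs h1 h2 => ?_⟩
  obtain ⟨η, hηb, -, hd, hpos⟩ := exists_nearest_bd (ne_univ_of_mem_bd hξ) hx
  set r := infDist x W.setᶜ
  by_cases hr : min (δ / 4) (ε / 2) ≤ r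
  · exact (ball_subset_ball hr).trans ball_infDist_compl_subset
  exfalso
  have hr1 : r < δ / 4 := (not_le.1 hr).trans_le (min_le_left _ _)
  have hr2 : r < ε / 2 := (not_le.1 hr).trans_le (min_le_right _ _)
  have hs1 : dist ξ (ι x hx) + dist (ι x hx) ζ ≤ dist ξ ζ + δ / 4 :=
    hs.trans (by linarith [min_le_left (δ / 4) (ε / 2)])
  have t1 := dist_triangle ξ (ι x hx) η
  have t2 := dist_triangle_left η ζ (ι x hx)
  have t3 := dist_triangle_right ξ (ι x hx) η
  have t4 := dist_triangle (ι x hx) η ζ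
  rcases hη η hηb (by linarith) with h | h <;> linarith

theorem VisCrit.exists_exact {ξ ζ : X W} (h : VisCrit ξ ζ) (hξ : ξ ∈ bd W) {p q : X W} {u : ℝ}
    (hch : dist ξ p + dist p q + dist q ζ = dist ξ ζ) (hu : 0 < u) (hu' : u < dist p q) :
    ∃ x, ∃ hx : x ∈ W.set, dist p (ι x hx) = u ∧ dist (ι x hx) q = dist p q - u := by
  set ε := min u (dist p q - u) / 4 with hεd
  have hε : 0 < ε := by
    have : 0 < dist p q - u := by linarith
    positivity
  have hε1 : 4 * ε ≤ u := by have := min_le_left u (dist p q - u); linarith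
  have hε2 : 4 * ε ≤ dist p q - u := by have := min_le_right u (dist p q - u); linarith
  obtain ⟨ρ, hρ, hclear⟩ := h.exists_clearance hξ hε
  set σ := min (ρ / 2) ε with hσ
  have hσp : 0 < σ := by positivity
  choose x hx h1 h2 using fun n : ℕ =>
    exists_between p q hu.le hu'.le (show 0 < σ / ((n:ℝ) + 1) by positivity)
  have hsm : ∀ n : ℕ, σ / ((n:ℝ) + 1) ≤ σ := fun n =>
    div_le_self hσp.le (by linarith [(Nat.cast_nonneg n : (0:ℝ) ≤ n)])
  have hσ1 : σ ≤ ρ / 2 := min_le_left _ _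
  have hσ2 : σ ≤ ε := min_le_right _ _
  have hball : ∀ n, ball (x n) ρ ⊆ W.set := by
    intro n
    have t1 := dist_triangle ξ p (ι (x n) (hx n))
    have t2 := dist_triangle (ι (x n) (hx n)) q ζ
    have t3 := dist_triangle ξ (ι (x n) (hx n)) ζ
    have := h1 n
    have := h2 n
    have := hsm n
    have t5 : (0:ℝ) ≤ dist ξ p := dist_nonneg
    have t6 : (0:ℝ) ≤ dist q ζ := dist_nonneg
    refine hclear _ (hx n) ?_ ?_ ?_ <;> linarith
  have hb : ∀ n, x n ∈ closedBall (sp p) (u + σ) := by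
    intro n
    rw [mem_closedBall, dist_comm]
    have := dist_sp_le p (ι (x n) (hx n))
    rw [sp_ι] at this
    linarith [h1 n, hsm n]
  obtain ⟨y, -, φ, hφ, hy⟩ := (isCompact_closedBall _ _).tendsto_subseq hb
  obtain ⟨N, hN⟩ := ((Metric.tendsto_nhds.1 hy) ρ hρ).exists
  have hyW : y ∈ W.set := hball (φ N) (by rw [mem_ball, dist_comm]; exact hN)
  have hyt : Tendsto (fun n => (ι (x (φ n)) (hx _) : X W)) atTop (nhds (ι y hyW)) :=
    (continuousOn_ι.tendsto ⟨y, hyW⟩).comp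
      (f := fun n => (⟨x (φ n), hx _⟩ : W.set)) (tendsto_subtype_rng.2 hy)
  have hz : Tendsto (fun n : ℕ => σ / ((n:ℝ) + 1)) atTop (nhds 0) := by
    have := tendsto_one_div_add_atTop_nhds_zero_nat (𝕜 := ℝ) |>.const_mul σ
    simpa only [mul_one_div, mul_zero] using this
  have hz' := hz.comp hφ.tendsto_atTop
  have l1 : dist p (ι y hyW) ≤ u + 0 := le_of_tendsto_of_tendsto'
    (tendsto_const_nhds.dist hyt) (tendsto_const_nhds.add hz') fun n => h1 (φ n)
  have l2 : dist (ι y hyW) q ≤ dist p q - u + 0 := le_of_tendsto_of_tendsto'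
    (hyt.dist tendsto_const_nhds) (tendsto_const_nhds.add hz') fun n => h2 (φ n)
  have t := dist_triangle p (ι y hyW) q
  exact ⟨y, hyW, by linarith, by linarith⟩

theorem VisCrit.dist_eq_of_chain {ξ ζ : X W} (h : VisCrit ξ ζ) (hξ : ξ ∈ bd W) {ε : ℝ}
    (hε : 0 < ε) (hx : x ∈ W.set) (hy : y ∈ W.set)
    (hch : dist ξ (ι x hx) + dist (ι x hx) (ι y hy) + dist (ι y hy) ζ = dist ξ ζ)
    (h1 : 2 * ε ≤ dist ξ (ι x hx)) (h2 : 2 * ε ≤ dist (ι y hy) ζ) :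
    dist (ι x hx : X W) (ι y hy) = dist x y := by
  obtain ⟨ρ, hρ, hclear⟩ := h.exists_clearance hξ hε
  have key : ∀ n : ℕ, ∀ x y : E2, ∀ hx : x ∈ W.set, ∀ hy : y ∈ W.set,
      dist ξ (ι x hx) + dist (ι x hx) (ι y hy) + dist (ι y hy) ζ = dist ξ ζ →
      2 * ε ≤ dist ξ (ι x hx) → 2 * ε ≤ dist (ι y hy) ζ →
      dist (ι x hx : X W) (ι y hy) ≤ ρ / 2 * (3 / 2) ^ n →
      dist (ι x hx : X W) (ι y hy) = dist x y := by
    intro n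
    induction n with
    | zero =>
      intro x y hx hy hch h1 h2 hle
      have hb := hclear x hx (by
        have := dist_triangle (ι x hx) (ι y hy) ζ
        linarith) h1 (by
        have := dist_triangle ξ (ι x hx) ζ
        have : (0:ℝ) ≤ dist (ι x hx : X W) (ι y hy) := dist_nonneg
        linarith)
      have hlt : dist x y < ρ := by
        have := dist_sp_le (ι x hx) (ι y hy)
        rw [sp_ι, sp_ι] at this
        simp only [pow_zero, mul_one] at hle
        linarith
      exact dist_ι_of_ball hb (mem_ball_self hρ) (by rwa [mem_ball, dist_comm])
    | succ n ih =>
      intro x y hx hy hch h1 h2 hle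
      set l := dist (ι x hx : X W) (ι y hy) with hl
      rcases eq_or_lt_of_le (show 0 ≤ l from dist_nonneg) with h0 | hpos
      · have := dist_sp_le (ι x hx) (ι y hy)
        rw [sp_ι, sp_ι, ← hl, ← h0] at this
        rw [← h0]
        exact le_antisymm dist_nonneg this
      rw [pow_succ] at hle
      obtain ⟨a, ha, a1, a2⟩ := h.exists_exact hξ hch (u := l / 3) (by linarith) (by linarith)
      have ta := dist_triangle ξ (ι x hx) (ι a ha)
      have ta' := dist_triangle ξ (ι a ha) ζ
      have ta'' := dist_triangle (ι a ha) (ι y hy) ζ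
      obtain ⟨b, hb, b1, b2⟩ := h.exists_exact hξ (p := ι a ha) (q := ι y hy) (u := l / 3)
        (by linarith) (by linarith) (by linarith)
      have tb1 := dist_triangle (ι x hx) (ι a ha) (ι b hb)
      have tb2 := dist_triangle (ι x hx) (ι b hb) (ι y hy)
      have tb3 := dist_triangle (ι b hb) (ι y hy) ζ
      have tb4 := dist_triangle4 ξ (ι x hx) (ι b hb) ζ
      have tb5 := dist_triangle ξ (ι a ha) (ι b hb)
      have tb6 := dist_triangle ξ (ι b hb) ζ
      have e1 := ih x b hx hb (by linarith) h1 (by linarith) (by linarith)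
      have e2 := ih a y ha hy (by linarith) (by linarith) h2 (by linarith)
      have e3 := ih x a hx ha (by linarith) h1 (by linarith) (by linarith)
      have e4 := ih a b ha hb (by linarith) (by linarith) (by linarith) (by linarith)
      have e5 := ih b y hb hy (by linarith) (by linarith) h2 (by linarith)
      have m1 : a = midpoint ℝ x b := eq_midpoint_of_dist_eq_half
        (by linarith) (by linarith)
      have m2 : b = midpoint ℝ a y := eq_midpoint_of_dist_eq_half
        (by linarith) (by linarith)
      have hv : y - x = (3:ℝ) • (a - x) := by
        have hb' : b - a = a - x := by
          have : (2:ℝ) • a = x + b := by rw [m1, midpoint_eq_smul_add]; simp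
          rw [two_smul] at this
          rw [sub_eq_sub_iff_add_eq_add, add_comm b, ← this]
        have hy' : y - b = b - a := by
          have : (2:ℝ) • b = a + y := by rw [m2, midpoint_eq_smul_add]; simp
          rw [two_smul] at this
          rw [sub_eq_sub_iff_add_eq_add, add_comm y, ← this]
        have : y - x = (y - b) + (b - a) + (a - x) := by abel
        rw [this, hy', hb']
        module
      rw [dist_comm x y, dist_eq_norm y x, hv, norm_smul, ← dist_eq_norm, dist_comm a x, ← e3, a1]
      norm_num
      ring
  obtain ⟨n, hn⟩ := pow_unbounded_of_one_lt (dist (ι x hx : X W) (ι y hy) / (ρ / 2))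
    (show (1:ℝ) < 3 / 2 by norm_num)
  refine key n x y hx hy hch h1 h2 ?_
  rw [div_lt_iff₀ (by positivity)] at hn
  linarith

theorem VisCrit.dist_eq {ξ ζ : X W} (h : VisCrit ξ ζ) (hξ : ξ ∈ bd W) (hne : ξ ≠ ζ) :
    dist ξ ζ = dist (sp ξ) (sp ζ) := by
  refine le_antisymm ?_ (dist_sp_le _ _)
  have hd : 0 < dist ξ ζ := dist_pos.2 hne
  refine le_of_forall_pos_le_add fun e he => ?_
  set t := min (e / 4) (dist ξ ζ / 4) with ht
  have htp : 0 < t := by positivity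
  have ht1 : t ≤ e / 4 := min_le_left _ _
  have ht2 : t ≤ dist ξ ζ / 4 := min_le_right _ _
  obtain ⟨x, hx, x1, x2⟩ := h.exists_exact hξ (p := ξ) (q := ζ) (u := t) (by simp) htp
    (by linarith)
  obtain ⟨y, hy, y1, y2⟩ := h.exists_exact hξ (p := ι x hx) (q := ζ) (u := dist ξ ζ - 2 * t)
    (by simp [x1, x2]) (by linarith) (by linarith)
  have e1 := h.dist_eq_of_chain hξ (ε := t / 2) (by positivity) hx hy (by linarith) (by linarith)
    (by linarith)
  have s1 := dist_sp_le ξ (ι x hx)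
  have s2 := dist_sp_le (ι y hy) ζ
  rw [sp_ι] at s1 s2
  have := dist_triangle4 x (sp ξ) (sp ζ) y
  rw [dist_comm x (sp ξ), dist_comm (sp ζ) y] at this
  linarith

theorem VisCrit.vis {ξ ζ : X W} (h : VisCrit ξ ζ) (hξ : ξ ∈ bd W) (hζ : ζ ∈ bd W) (hne : ξ ≠ ζ) :
    Vis ξ ζ := by
  have hd := h.dist_eq hξ hne
  have key : ∀ q ∈ openSegment ℝ (sp ξ) (sp ζ), ∃ hq : q ∈ W.set,
      dist (ι q hq : X W) ξ = dist q (sp ξ) ∧ dist (ι q hq : X W) ζ = dist q (sp ζ) := by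
    intro q hq
    have hpos := dist_pos.2 hne
    have hs : sp ξ ≠ sp ζ := by
      rw [← dist_pos, ← hd]; exact hpos
    obtain ⟨t, ⟨ht0, ht1⟩, rfl⟩ := (openSegment_eq_image' ℝ (sp ξ) (sp ζ)) ▸ hq
    obtain ⟨x, hx, x1, x2⟩ := h.exists_exact hξ (p := ξ) (q := ζ) (u := t * dist ξ ζ) (by simp)
      (by positivity) (by nlinarith)
    have s1 := dist_sp_le ξ (ι x hx)
    have s2 := dist_sp_le (ι x hx) ζ
    rw [sp_ι] at s1 s2
    have s3 := dist_triangle (sp ξ) x (sp ζ)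
    have hxe : x = AffineMap.lineMap (sp ξ) (sp ζ) t := by
      refine eq_lineMap_of_dist_eq_mul_of_dist_eq_mul ?_ ?_
      · rw [← hd]; linarith
      · rw [← hd]; linarith
    have hxe' : sp ξ + t • (sp ζ - sp ξ) = x := by
      rw [hxe, AffineMap.lineMap_apply]; simp [add_comm]
    simp only [hxe']
    refine ⟨hx, ?_, ?_⟩
    · rw [dist_comm, x1, dist_comm x]; linarith
    · rw [x2]; linarith
  exact ⟨⟨hξ, fun q hq => ⟨(key q hq).1, (key q hq).2.1⟩⟩,
    ⟨hζ, fun q hq => ⟨(key q hq).1, (key q hq).2.2⟩⟩⟩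

theorem vis_iff {ξ ζ : X W} (hξ : ξ ∈ bd W) (hζ : ζ ∈ bd W) :
    Vis ξ ζ ↔ ξ ≠ ζ ∧ VisCrit ξ ζ :=
  ⟨fun h => ⟨h.ne, h.visCrit⟩, fun h => h.2.vis hξ hζ h.1⟩

variable (f : bd U ≃ᵢ bd V)

theorem Vis.map {ξ ζ : bd U} (h : Vis (ξ : X U) ζ) :
    Vis (f ξ : X V) (f ζ) := by
  have hd : ∀ a b : bd U, dist (f a : X V) (f b) = dist (a : X U) b := fun a b =>
    f.isometry.dist_eq a b
  rw [vis_iff (f ξ).2 (f ζ).2]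
  constructor
  · intro he
    exact h.ne (congrArg Subtype.val (f.injective (Subtype.ext he)))
  · intro ε hε
    obtain ⟨δ, hδ, hη⟩ := h.visCrit ε hε
    refine ⟨δ, hδ, fun η hηb hlt => ?_⟩
    obtain ⟨κ, hκ⟩ := f.surjective ⟨η, hηb⟩
    have hκ' : (f κ : X V) = η := congrArg Subtype.val hκ
    rw [← hκ', hd, hd, hd] at hlt
    rw [← hκ', hd, hd]
    exact hη κ κ.2 hlt

theorem Vis.dist_map {ξ ζ : bd U} (h : Vis (ξ : X U) ζ) :
    dist (sp (f ξ : X V)) (sp (f ζ : X V)) = dist (sp (ξ : X U)) (sp (ζ : X U)) := by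
  rw [← (h.map f).dist_eq, ← h.dist_eq]
  exact f.isometry.dist_eq ξ ζ

/-- The power of a point with respect to the circle with centre `D.1` and squared radius
`D.2 + ‖D.1‖ ^ 2`. -/
def pw (D : E2 × ℝ) (y : E2) : ℝ := ‖y‖ ^ 2 - 2 * inner ℝ D.1 y - D.2

/-- The open disk of negative power. -/
def disk (D : E2 × ℝ) : Set E2 := {q | pw D q < 0}

theorem continuous_pw_right (D : E2 × ℝ) : Continuous (pw D) := by
  unfold pw
  fun_prop

theorem continuous_pw_left (y : E2) : Continuous (fun D => pw D y) := by
  unfold pw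
  fun_prop

theorem pw_combo (D : E2 × ℝ) (x y : E2) (t : ℝ) :
    pw D ((1 - t) • x + t • y) = (1 - t) * pw D x + t * pw D y - t * (1 - t) * ‖x - y‖ ^ 2 := by
  unfold pw
  have h1 : ‖(1 - t) • x + t • y‖ ^ 2 = (1 - t) ^ 2 * ‖x‖ ^ 2 + 2 * ((1 - t) * t * inner ℝ x y) +
      t ^ 2 * ‖y‖ ^ 2 := by
    rw [norm_add_sq_real, norm_smul, norm_smul, inner_smul_left, inner_smul_right, mul_pow, mul_pow,
      Real.norm_eq_abs, Real.norm_eq_abs, sq_abs, sq_abs]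
    simp only [conj_trivial]
    ring
  rw [h1, norm_sub_sq_real, inner_add_right, inner_smul_right, inner_smul_right]
  ring

theorem pw_sub_pw (D D' : E2 × ℝ) (y z : E2) :
    (pw D z - pw D' z) - (pw D y - pw D' y) = 2 * inner ℝ (D'.1 - D.1) (z - y) := by
  unfold pw
  simp only [inner_sub_left, inner_sub_right]
  ring

theorem sum_inner {I : Type} [Fintype I] {w : I → ℝ} {a : I → E2}
    (h : ∑ i, w i • a i = y) (v : E2) : ∑ i, w i * inner ℝ v (a i) = inner ℝ v y := by
  rw [← h, inner_sum]
  simp [inner_smul_right]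

theorem sum_pw {I : Type} [Fintype I] {w : I → ℝ} {a : I → E2}
    (hw : ∑ i, w i = 1) (h : ∑ i, w i • a i = y) (D : E2 × ℝ) :
    ∑ i, w i * pw D (a i) = pw D y + ∑ i, w i * ‖a i - y‖ ^ 2 := by
  have e1 : ∑ i, w i * ‖a i - y‖ ^ 2 = ∑ i, w i * ‖a i‖ ^ 2 - ‖y‖ ^ 2 := by
    have : ∀ i, w i * ‖a i - y‖ ^ 2 = w i * ‖a i‖ ^ 2 - 2 * (w i * inner ℝ y (a i)) +
        w i * ‖y‖ ^ 2 := by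
      intro i
      rw [norm_sub_sq_real, real_inner_comm]
      ring
    simp only [this, Finset.sum_add_distrib, Finset.sum_sub_distrib, ← Finset.mul_sum,
      ← Finset.sum_mul, hw, sum_inner h, real_inner_self_eq_norm_sq]
    ring
  have e2 : ∑ i, w i * pw D (a i) = ∑ i, w i * ‖a i‖ ^ 2 - 2 * inner ℝ D.1 y - D.2 := by
    have : ∀ i, w i * pw D (a i) = w i * ‖a i‖ ^ 2 - 2 * (w i * inner ℝ D.1 (a i)) - w i * D.2 := by
      intro i
      unfold pw
      ring
    simp only [this, Finset.sum_sub_distrib, ← Finset.mul_sum, ← Finset.sum_mul, hw, sum_inner h,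
      one_mul]
  rw [e1, e2]
  unfold pw
  ring

theorem sum_pw_sub {I : Type} [Fintype I] {w : I → ℝ} {a : I → E2}
    (hw : ∑ i, w i = 1) (h : ∑ i, w i • a i = y) (D D' : E2 × ℝ) :
    ∑ i, w i * (pw D (a i) - pw D' (a i)) = pw D y - pw D' y := by
  simp only [mul_sub, Finset.sum_sub_distrib, sum_pw hw h]
  ring

theorem disk_eq_ball (D : E2 × ℝ) : disk D = ball D.1 (√(D.2 + ‖D.1‖ ^ 2)) := by
  ext q
  rw [mem_ball, Real.lt_sqrt dist_nonneg, dist_eq_norm, norm_sub_sq_real, real_inner_comm]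
  unfold disk pw
  simp only [mem_ofPred_eq]
  constructor <;> intro h <;> linarith

theorem convex_disk (D : E2 × ℝ) : Convex ℝ (disk D) := by
  rw [disk_eq_ball]; exact convex_ball _ _

theorem openSegment_subset_disk {D : E2 × ℝ} (hx : pw D x ≤ 0) (hy : pw D y ≤ 0)
    (hne : x ≠ y) : openSegment ℝ x y ⊆ disk D := by
  intro q hq
  obtain ⟨t, ⟨h0, h1⟩, rfl⟩ := mem_oseg.1 hq
  change pw D _ < 0
  rw [pw_combo]
  have : 0 < ‖x - y‖ := norm_pos_iff.2 (sub_ne_zero.2 hne)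
  have : 0 < t * (1 - t) * ‖x - y‖ ^ 2 := by
    have : 0 < 1 - t := by linarith
    positivity
  nlinarith

theorem mem_closure_disk {D : E2 × ℝ} (hx : pw D x < 0) (hy : pw D y = 0) :
    y ∈ closure (disk D) := by
  have hne : x ≠ y := by
    rintro rfl
    linarith
  have h := closure_mono (openSegment_subset_disk hx.le hy.le hne)
  rw [closure_openSegment] at h
  exact h (right_mem_segment ℝ x y)

theorem exists_mem_frontier_of_isPreconnected {X : Type*} [TopologicalSpace X] {s t : Set X}
    (hs : IsPreconnected s) {x y : X} (hx : x ∈ s) (hxt : x ∈ t) (hy : y ∈ s) (hyt : y ∉ t) :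
    ∃ p ∈ s, p ∈ frontier t := by
  by_contra! h
  have hcov : s ⊆ interior t ∪ (closure t)ᶜ := by
    intro p hp
    by_cases hpc : p ∈ closure t
    · exact Or.inl (by_contra fun hi => h p hp ⟨hpc, hi⟩)
    · exact Or.inr hpc
  have hx' : x ∈ interior t := by
    rcases hcov hx with h' | h'
    · exact h'
    · exact absurd (subset_closure hxt) h'
  have hy' : y ∈ (closure t)ᶜ := by
    rcases hcov hy with h' | h'
    · exact absurd (interior_subset h') hyt
    · exact h'
  obtain ⟨p, -, hp1, hp2⟩ := hs _ _ isOpen_interior isClosed_closure.isOpen_compl hcov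
    ⟨x, hx, hx'⟩ ⟨y, hy, hy'⟩
  exact hp2 (subset_closure (interior_subset hp1))

/-- The disk `D` contains no boundary points. -/
def EmptyDisk (W : Dom) (D : E2 × ℝ) : Prop := ∀ p ∈ frontier W.set, 0 ≤ pw D p

theorem emptyDisk_zero (W : Dom) : EmptyDisk W (0, 0) := by
  intro p _
  unfold pw
  simp

theorem EmptyDisk.disk_subset {D : E2 × ℝ} (h : EmptyDisk W D) (hy : y ∈ W.set)
    (hyD : y ∈ disk D) : disk D ⊆ W.set := by
  by_contra hn
  obtain ⟨z, hz, hzW⟩ := not_subset.1 hn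
  obtain ⟨p, hp, hpf⟩ := exists_mem_frontier_of_isPreconnected (convex_disk D).isPreconnected
    hyD hy hz hzW
  exact absurd (h p hpf) (not_le.2 hp)

theorem EmptyDisk.le_of_mem_convexHull {D : E2 × ℝ} (h : EmptyDisk W D)
    {I : Type} [Fintype I] {w : I → ℝ} {a : I → E2} (hw0 : ∀ i, 0 ≤ w i) (hw : ∑ i, w i = 1)
    (ha : ∀ i, a i ∈ frontier W.set) (hy : ∑ i, w i • a i = y) :
    -pw D y ≤ ∑ i, w i * ‖a i - y‖ ^ 2 := by
  have h1 := sum_pw hw hy D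
  have h2 : 0 ≤ ∑ i, w i * pw D (a i) :=
    Finset.sum_nonneg fun i _ => mul_nonneg (hw0 i) (h _ (ha i))
  linarith

theorem exists_weights {s : Set E2} (hy : y ∈ convexHull ℝ s) :
    ∃ (I : Type) (_ : Fintype I) (w : I → ℝ) (a : I → E2), (∀ i, 0 < w i) ∧ ∑ i, w i = 1 ∧
      (∀ i, a i ∈ s) ∧ ∑ i, w i • a i = y ∧ AffineIndependent ℝ a := by
  obtain ⟨I, hI, z, w, h1, h2, h3, h4, h5⟩ := eq_pos_convex_span_of_mem_convexHull hy
  exact ⟨I, hI, w, z, h3, h4, fun i => h1 (mem_range_self i), h5, h2⟩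

theorem isCompact_convexHull_of_isCompact {A : Set E2} (hA : IsCompact A) :
    IsCompact (convexHull ℝ A) := by
  rcases A.eq_empty_or_nonempty with rfl | ⟨a₀, ha₀⟩
  · simp
  have hc : IsCompact (stdSimplex ℝ (Fin 3) ×ˢ (Set.univ.pi fun _ : Fin 3 => A)) :=
    (isCompact_stdSimplex ℝ (Fin 3)).prod (isCompact_univ_pi fun _ => hA)
  have himg : convexHull ℝ A = (fun q : (Fin 3 → ℝ) × (Fin 3 → E2) => ∑ i, q.1 i • q.2 i) ''
      (stdSimplex ℝ (Fin 3) ×ˢ (Set.univ.pi fun _ : Fin 3 => A)) := by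
    apply Subset.antisymm
    · intro x hx
      obtain ⟨I, _, w, a, hw0, hw, ha, hx, hind⟩ := exists_weights hx
      have hcard : Fintype.card I ≤ 3 := by
        have h1 := hind.card_le_finrank_succ
        have h2 := Submodule.finrank_le (vectorSpan ℝ (Set.range a))
        rw [finrank_euclideanSpace_fin] at h2
        omega
      obtain ⟨e⟩ : Nonempty (I ↪ Fin 3) :=
        Function.Embedding.nonempty_of_card_le (by simpa using hcard)
      classical
      have hs : ∀ {E : Type} [AddCommMonoid E] (u : Fin 3 → E), (∀ j, j ∉ Set.range e → u j = 0) →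
          ∑ j, u j = ∑ i, u (e i) := by
        intro E _ u hu
        rw [← Finset.sum_map Finset.univ e u]
        symm
        refine Finset.sum_subset (Finset.subset_univ _) fun j _ hj => hu j ?_
        rintro ⟨i, rfl⟩
        exact hj (by simp)
      refine ⟨(Function.extend e w 0, Function.extend e a fun _ => a₀), ⟨⟨?_, ?_⟩, ?_⟩, ?_⟩
      · intro j
        by_cases hj : ∃ i, e i = j
        · obtain ⟨i, rfl⟩ := hj
          simpa [e.injective.extend_apply] using (hw0 i).le
        · simp [Function.extend_apply' _ _ _ hj]
      · rw [hs _ (fun j hj => by simp [Function.extend_apply' _ _ _ hj])]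
        simpa [e.injective.extend_apply] using hw
      · intro j _
        by_cases hj : ∃ i, e i = j
        · obtain ⟨i, rfl⟩ := hj
          simpa [e.injective.extend_apply] using ha i
        · simpa [Function.extend_apply' _ _ _ hj] using ha₀
      · simp only
        rw [hs _ (fun j hj => by simp [Function.extend_apply' _ _ _ hj])]
        simpa [e.injective.extend_apply] using hx
    · rintro _ ⟨q, ⟨hq1, hq2⟩, rfl⟩
      exact (convex_convexHull ℝ A).sum_mem (fun i _ => hq1.1 i) hq1.2
        (fun i _ => subset_convexHull ℝ A (hq2 i (mem_univ i)))
  rw [himg]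
  exact hc.image (by fun_prop)

theorem exists_bound_of_mem_convexHull (hy : y ∈ convexHull ℝ (frontier W.set)) :
    ∃ M : ℝ, ∀ D, EmptyDisk W D → D.2 + 2 * inner ℝ D.1 y ≤ M := by
  obtain ⟨I, _, w, a, hw0, hw, ha, hay, -⟩ := exists_weights hy
  refine ⟨∑ i, w i * ‖a i - y‖ ^ 2 + ‖y‖ ^ 2, fun D hD => ?_⟩
  have := hD.le_of_mem_convexHull (fun i => (hw0 i).le) hw ha hay
  unfold pw at this
  linarith

theorem exists_center_bound (hy : y ∈ interior (convexHull ℝ (frontier W.set))) :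
    ∃ s > 0, ∃ C : ℝ, ∀ z ∈ ball y s, ∀ D, EmptyDisk W D → 0 ≤ D.2 + 2 * inner ℝ D.1 z →
      ‖D.1‖ ≤ C ∧ |D.2| ≤ C := by
  obtain ⟨r, hr, hb⟩ := Metric.isOpen_iff.1 isOpen_interior y hy
  have hmem : ∀ (i : Fin 2) (c : ℝ), |c| < r → y + EuclideanSpace.single i c ∈
      convexHull ℝ (frontier W.set) := by
    intro i c hc
    refine interior_subset (hb ?_)
    rw [mem_ball, dist_eq_norm]
    simpa using hc
  have hr2 : |r / 2| < r := by rw [abs_of_pos (by positivity)]; linarith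
  have hr2' : |-(r / 2)| < r := by rwa [abs_neg]
  choose M hM using fun i : Fin 2 => exists_bound_of_mem_convexHull (hmem i _ hr2)
  choose M' hM' using fun i : Fin 2 => exists_bound_of_mem_convexHull (hmem i _ hr2')
  obtain ⟨M0, hM0⟩ := exists_bound_of_mem_convexHull (interior_subset hy)
  set N := |M 0| + |M 1| + |M' 0| + |M' 1| + |M0| with hN
  have hN0 : 0 ≤ N := by positivity
  refine ⟨r / 8, by positivity, 8 * N / r + 2 * (8 * N / r) * (‖y‖ + r) + N, fun z hz D hD h0 => ?_⟩
  have hin : ∀ (i : Fin 2) (c : ℝ), inner ℝ D.1 (y + EuclideanSpace.single i c) =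
      inner ℝ D.1 y + D.1 i * c := by
    intro i c
    rw [inner_add_right, EuclideanSpace.inner_single_right]
    simp [mul_comm]
  have hzy : dist z y < r / 8 := hz
  have hiz : |inner ℝ D.1 (z - y)| ≤ ‖D.1‖ * (r / 8) := by
    refine (abs_real_inner_le_norm _ _).trans ?_
    rw [← dist_eq_norm]
    exact mul_le_mul_of_nonneg_left hzy.le (norm_nonneg _)
  rw [inner_sub_right] at hiz
  have hL : -(2 * ‖D.1‖ * (r / 8)) ≤ D.2 + 2 * inner ℝ D.1 y := by
    have := (abs_le.1 hiz).2
    linarith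
  have hc : ∀ i : Fin 2, r * |D.1 i| ≤ N + 2 * ‖D.1‖ * (r / 8) := by
    intro i
    have a1 := hM i D hD
    have a2 := hM' i D hD
    rw [hin] at a1 a2
    have b1 : M i ≤ N := by
      have := le_abs_self (M i)
      fin_cases i <;> simp only [hN] <;> simp at this ⊢ <;>
      linarith [abs_nonneg (M 0), abs_nonneg (M 1), abs_nonneg (M' 0), abs_nonneg (M' 1),
        abs_nonneg M0]
    have b2 : M' i ≤ N := by
      have := le_abs_self (M' i)
      fin_cases i <;> simp only [hN] <;> simp at this ⊢ <;>
      linarith [abs_nonneg (M 0), abs_nonneg (M 1), abs_nonneg (M' 0), abs_nonneg (M' 1),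
        abs_nonneg M0]
    rcases abs_cases (D.1 i) with ⟨h, _⟩ | ⟨h, _⟩ <;> rw [h] <;> nlinarith
  have hnorm : ‖D.1‖ ≤ |D.1 0| + |D.1 1| := by
    rw [EuclideanSpace.norm_eq, Fin.sum_univ_two, Real.norm_eq_abs, Real.norm_eq_abs]
    rw [Real.sqrt_le_left (by positivity)]
    nlinarith [abs_nonneg (D.1 0), abs_nonneg (D.1 1)]
  have hD1 : ‖D.1‖ ≤ 8 * N / r := by
    rw [le_div_iff₀ hr]
    nlinarith [hc 0, hc 1, norm_nonneg D.1]
  have hQ : 0 ≤ 8 * N / r := by positivity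
  have hp : 0 ≤ 2 * (8 * N / r) * (‖y‖ + r) := by positivity
  refine ⟨by linarith, ?_⟩
  have hi : |inner ℝ D.1 y| ≤ 8 * N / r * ‖y‖ := (abs_real_inner_le_norm _ _).trans
    (mul_le_mul_of_nonneg_right hD1 (norm_nonneg _))
  have hi' := abs_le.1 hi
  have hr8 : ‖D.1‖ * (r / 8) ≤ 8 * N / r * r := by
    have := mul_le_mul_of_nonneg_right hD1 hr.le
    nlinarith [norm_nonneg D.1]
  have hM0' : M0 ≤ N := by
    have := le_abs_self M0
    linarith [abs_nonneg (M 0), abs_nonneg (M 1), abs_nonneg (M' 0), abs_nonneg (M' 1)]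
  have := hM0 D hD
  rw [abs_le]
  constructor <;> nlinarith

theorem exists_optimal (hy : y ∈ interior (convexHull ℝ (frontier W.set))) :
    ∃ D, EmptyDisk W D ∧ ∀ D', EmptyDisk W D' → pw D y ≤ pw D' y := by
  obtain ⟨s, hs, C, hC⟩ := exists_center_bound hy
  set S : Set (E2 × ℝ) := {D | EmptyDisk W D ∧ 0 ≤ D.2 + 2 * inner ℝ D.1 y} with hS
  have hcl : IsClosed S := by
    have h1 : IsClosed {D : E2 × ℝ | EmptyDisk W D} := by
      have : {D : E2 × ℝ | EmptyDisk W D} = ⋂ p ∈ frontier W.set, {D | 0 ≤ pw D p} := by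
        ext D; simp [EmptyDisk]
      rw [this]
      exact isClosed_biInter fun p _ => isClosed_le continuous_const (continuous_pw_left p)
    have h2 : Continuous fun D : E2 × ℝ => D.2 + 2 * inner ℝ D.1 y := by fun_prop
    exact h1.inter (isClosed_le continuous_const h2)
  have hbd : Bornology.IsBounded S := by
    refine (isBounded_closedBall (x := ((0 : E2), (0:ℝ))) (r := C)).subset fun D hD => ?_
    have := hC y (mem_ball_self hs) D hD.1 hD.2
    rw [mem_closedBall, Prod.dist_eq, max_le_iff]
    simpa [Real.norm_eq_abs] using this
  have hcomp : IsCompact S := Metric.isCompact_of_isClosed_isBounded hcl hbd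
  obtain ⟨D, hD, hmin⟩ := hcomp.exists_isMinOn ⟨(0, 0), emptyDisk_zero W, by simp⟩
    (continuous_pw_left y).continuousOn
  refine ⟨D, hD.1, fun D' hD' => ?_⟩
  by_cases h : 0 ≤ D'.2 + 2 * inner ℝ D'.1 y
  · exact hmin ⟨hD', h⟩
  · have h2 := hD.2
    unfold pw
    linarith

theorem mem_convexHull_of_optimal {D : E2 × ℝ} (hD : EmptyDisk W D)
    (hopt : ∀ D', EmptyDisk W D' → pw D y ≤ pw D' y) :
    y ∈ convexHull ℝ {a ∈ frontier W.set | pw D a = 0} := by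
  set A := {a ∈ frontier W.set | pw D a = 0} with hA
  have hgrow : ∀ p : E2, ‖p‖ ^ 2 / 2 - 2 * ‖D.1‖ ^ 2 - D.2 ≤ pw D p := by
    intro p
    have := real_inner_le_norm D.1 p
    unfold pw
    nlinarith [sq_nonneg (‖p‖ - 2 * ‖D.1‖)]
  have hAc : IsCompact A := by
    refine Metric.isCompact_of_isClosed_isBounded
      (isClosed_frontier.inter (isClosed_eq (continuous_pw_right D) continuous_const)) ?_
    refine (isBounded_closedBall (x := (0:E2)) (r := 1 + 4 * ‖D.1‖ ^ 2 + 2 * |D.2|)).subset ?_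
    rintro a ⟨-, ha⟩
    rw [mem_closedBall, dist_zero_right]
    have := hgrow a
    nlinarith [le_abs_self D.2, sq_nonneg (‖a‖ - 1), sq_nonneg ‖D.1‖, abs_nonneg D.2]
  by_contra hy
  obtain ⟨f, u, h1, h2⟩ := geometric_hahn_banach_closed_point (convex_convexHull ℝ A)
    (isCompact_convexHull_of_isCompact hAc).isClosed hy
  set v := (InnerProductSpace.toDual ℝ E2).symm f with hv
  have hf : ∀ x, f x = inner ℝ v x := fun x => by rw [hv, InnerProductSpace.toDual_symm_apply]
  have hvc : Continuous fun p : E2 => inner ℝ v p := by fun_prop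
  have hR : ∃ t > 0, ∀ p ∈ frontier W.set, t * (inner ℝ v p - u) ≤ pw D p := by
    set R := 2 * ‖v‖ + 2 + 4 * ‖D.1‖ ^ 2 + 2 * |D.2| + 2 * |u| with hRd
    have hRn : 0 ≤ 4 * ‖D.1‖ ^ 2 + 2 * |D.2| + 2 * |u| := by positivity
    set T := {p ∈ frontier W.set | u ≤ inner ℝ v p} ∩ closedBall 0 R with hT
    have hTc : IsCompact T :=
      (isCompact_closedBall _ _).inter_left
        (isClosed_frontier.inter (isClosed_le continuous_const hvc))
    have hTp : ∀ p ∈ T, 0 < pw D p := by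
      intro p hp
      refine lt_of_le_of_ne (hD p hp.1.1) fun h0 => ?_
      have := h1 p (subset_convexHull ℝ A ⟨hp.1.1, h0.symm⟩)
      rw [hf] at this
      exact absurd hp.1.2 (not_le.2 this)
    obtain ⟨m, hm, hmT⟩ : ∃ m > 0, ∀ p ∈ T, m ≤ pw D p := by
      rcases T.eq_empty_or_nonempty with he | hne
      · exact ⟨1, one_pos, by simp [he]⟩
      · obtain ⟨q, hq, hqm⟩ := hTc.exists_isMinOn hne (continuous_pw_right D).continuousOn
        exact ⟨pw D q, hTp q hq, fun p hp => hqm hp⟩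
    have hRp : 0 < R := by positivity
    refine ⟨min 1 (m / (‖v‖ * R + |u| + 1)), by positivity, fun p hp => ?_⟩
    set t := min 1 (m / (‖v‖ * R + |u| + 1)) with ht
    have ht0 : 0 < t := by positivity
    by_cases hpu : inner ℝ v p < u
    · exact (mul_nonpos_of_nonneg_of_nonpos ht0.le (by linarith)).trans (hD p hp)
    push Not at hpu
    have hin := real_inner_le_norm v p
    by_cases hpR : ‖p‖ ≤ R
    · have h3 := hmT p ⟨⟨hp, hpu⟩, by simpa using hpR⟩
      refine le_trans ?_ h3
      have h4 : inner ℝ v p - u ≤ ‖v‖ * R + |u| + 1 := by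
        have := mul_le_mul_of_nonneg_left hpR (norm_nonneg v)
        linarith [neg_abs_le u]
      have h5 : t ≤ m / (‖v‖ * R + |u| + 1) := min_le_right _ _
      rw [le_div_iff₀ (by positivity)] at h5
      exact (mul_le_mul_of_nonneg_left h4 ht0.le).trans h5
    · push Not at hpR
      have h6 : t * (inner ℝ v p - u) ≤ inner ℝ v p - u := by
        have : t ≤ 1 := min_le_left _ _
        nlinarith
      refine h6.trans (le_trans ?_ (hgrow p))
      have h7 := neg_abs_le u
      have h8 := le_abs_self D.2
      nlinarith [norm_nonneg p, norm_nonneg v]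
  obtain ⟨t, ht, htp⟩ := hR
  have key : ∀ p, pw (D.1 + (t / 2) • v, D.2 - t * u) p = pw D p - t * (inner ℝ v p - u) := by
    intro p
    unfold pw
    simp only [inner_add_left, inner_smul_left, conj_trivial]
    ring
  have := hopt (D.1 + (t / 2) • v, D.2 - t * u) (fun p hp => by
    rw [key]; linarith [htp p hp])
  rw [key] at this
  rw [hf] at h2
  nlinarith

open Classical in
/-- The support of the image of a boundary element. -/
def im (ξ : X U) : E2 := if h : ξ ∈ bd U then sp (f ⟨ξ, h⟩ : X V) else 0

theorem im_of_mem {ξ : X U} (h : ξ ∈ bd U) : im f ξ = sp (f ⟨ξ, h⟩ : X V) :=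
  dif_pos h

theorem dist_im_le {ξ ζ : X U} (hξ : ξ ∈ bd U) (hζ : ζ ∈ bd U) :
    dist (im f ξ) (im f ζ) ≤ dist ξ ζ := by
  rw [im_of_mem f hξ, im_of_mem f hζ]
  refine (dist_sp_le _ _).trans (le_of_eq ?_)
  exact f.isometry.dist_eq ⟨ξ, hξ⟩ ⟨ζ, hζ⟩

theorem Vis.dist_im {ξ ζ : X U} (h : Vis ξ ζ) :
    dist (im f ξ) (im f ζ) = dist (sp ξ) (sp ζ) := by
  rw [im_of_mem f h.1.1, im_of_mem f h.2.1]
  exact Vis.dist_map (ξ := ⟨ξ, h.1.1⟩) (ζ := ⟨ζ, h.2.1⟩) f h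

theorem mem_closure_disk_inter {D D' : E2 × ℝ} (hx : pw D x < 0) (hx' : pw D' x < 0)
    (hy : pw D y ≤ 0) (hy' : pw D' y ≤ 0) : y ∈ closure (disk D ∩ disk D') := by
  rcases eq_or_ne x y with rfl | hne
  · exact subset_closure ⟨hx, hx'⟩
  have h := closure_mono (subset_inter (openSegment_subset_disk hx.le hy hne)
    (openSegment_subset_disk hx'.le hy' hne))
  rw [closure_openSegment] at h
  exact h (right_mem_segment ℝ x y)

theorem AccOn.eq_or_vis {D : E2 × ℝ} (hy : y ∈ disk D) {α β : X W}
    (hα : AccOn (disk D) α) (hβ : AccOn (disk D) β) (ha : pw D (sp α) = 0) (hb : pw D (sp β) = 0) :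
    α = β ∨ Vis α β := by
  by_cases h : sp α = sp β
  · left
    exact hα.eq hβ h (by rw [inter_self]; exact mem_closure_disk hy ha)
  · right
    exact hα.vis hβ (openSegment_subset_disk ha.le hb.le h)

theorem AccOn.transfer {D D' : E2 × ℝ} (hy : y ∈ disk D) (hy' : y ∈ disk D') {α : X W}
    (hα : AccOn (disk D) α) (hD' : EmptyDisk W D') (ha : pw D (sp α) = 0)
    (ha' : pw D' (sp α) ≤ 0) : AccOn (disk D') α :=
  hα.convex (convex_disk D') (hD'.disk_subset (hα.subset hy) hy')
    (mem_closure_disk_inter hy hy' ha.le ha')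

theorem pair_estimate {D D' : E2 × ℝ} {α γ : X W} (hα : AccOn (disk D) α) (hγ : AccOn (disk D') γ)
    (hD : EmptyDisk W D) (hD' : EmptyDisk W D') (ha : pw D (sp α) = 0) (hc : pw D' (sp γ) = 0) (hy : pw D y = pw D' y) {m₀ M : ℝ} (hm₀ : 0 < m₀) (hym : pw D y ≤ -m₀)
    (hMa : dist y (sp α) ≤ M) (hMc : dist y (sp γ) ≤ M) :
    dist α γ ^ 2 ≤ dist (sp α) (sp γ) ^ 2 + (M / m₀) ^ 2 * (pw D' (sp α) * pw D (sp γ)) := by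
  have hP := hD' _ (sp_mem_frontier hα.1)
  have hQ := hD _ (sp_mem_frontier hγ.1)
  have hyD : y ∈ disk D := show pw D y < 0 by linarith
  have hyD' : y ∈ disk D' := show pw D' y < 0 by linarith
  have exact : α = γ ∨ Vis α γ → dist α γ ^ 2 ≤ dist (sp α) (sp γ) ^ 2 := by
    rintro (rfl | h)
    · simp
    · rw [h.dist_eq]
  rcases hP.eq_or_lt with h0 | hP
  · have := exact (AccOn.eq_or_vis hyD' (hα.transfer hyD hyD' hD' ha h0.ge) hγ h0.symm hc)
    rw [← h0]
    simpa using this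
  rcases hQ.eq_or_lt with h0 | hQ
  · have := exact (AccOn.eq_or_vis hyD hα (hγ.transfer hyD' hyD hD hc h0.ge) ha h0.symm)
    rw [← h0]
    simpa using this
  clear exact
  set a := sp α
  set c := sp γ
  set P := pw D' a
  set Q := pw D c
  have hPQ : 0 < P + Q := by positivity
  set τ := P / (P + Q) with hτ
  have hτ0 : 0 < τ := by positivity
  have hτ1 : 1 - τ = Q / (P + Q) := by rw [hτ]; field_simp; ring
  have hτ1' : 0 < 1 - τ := by rw [hτ1]; positivity
  set m := (1 - τ) • a + τ • c with hm
  set E := P * Q / (P + Q) with hE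
  have hE0 : 0 < E := by positivity
  have hE1 : τ * Q = E := by rw [hτ, hE]; ring
  have hE2 : (1 - τ) * P = E := by rw [hτ1, hE]; ring
  have hmD : pw D m ≤ E := by
    rw [hm, pw_combo, ha, ← hE1]
    have : 0 ≤ τ * (1 - τ) * ‖a - c‖ ^ 2 := by positivity
    linarith
  have hmD' : pw D' m ≤ E := by
    rw [hm, pw_combo, hc, ← hE2]
    have : 0 ≤ τ * (1 - τ) * ‖a - c‖ ^ 2 := by positivity
    linarith
  have hym' : dist y m ≤ M := by
    have h1 : m ∈ closedBall y M := (convex_closedBall y M) (x := a) (y := c)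
      (by rw [mem_closedBall, dist_comm]; exact hMa) (by rw [mem_closedBall, dist_comm]; exact hMc)
      hτ1'.le hτ0.le (by ring)
    rw [dist_comm]
    exact h1
  have hM0 : 0 ≤ M := dist_nonneg.trans hym'
  obtain ⟨w, hwD, hwD', hwm⟩ : ∃ w, w ∈ disk D ∧ w ∈ disk D' ∧ dist w m ≤ E / m₀ * M := by
    by_cases he : E / m₀ < 1
    · have he0 : 0 < E / m₀ := by positivity
      set e := E / m₀ with hed
      have hem : e * m₀ = E := by rw [hed]; field_simp
      refine ⟨(1 - e) • m + e • y, ?_, ?_, ?_⟩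
      · change pw D _ < 0
        rw [pw_combo]
        have : 0 ≤ e * (1 - e) * ‖m - y‖ ^ 2 :=
          mul_nonneg (mul_nonneg he0.le (by linarith)) (sq_nonneg _)
        nlinarith
      · change pw D' _ < 0
        rw [pw_combo]
        have : 0 ≤ e * (1 - e) * ‖m - y‖ ^ 2 :=
          mul_nonneg (mul_nonneg he0.le (by linarith)) (sq_nonneg _)
        nlinarith
      · have : (1 - e) • m + e • y - m = e • (y - m) := by module
        rw [dist_eq_norm, this, norm_smul, Real.norm_of_nonneg he0.le, ← dist_eq_norm]
        exact mul_le_mul_of_nonneg_left hym' he0.le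
    · push Not at he
      exact ⟨y, hyD, hyD', hym'.trans (le_mul_of_one_le_left hM0 he)⟩
  have hd1 := hα.dist_eq hwD (hα.subset hwD)
  have hd2 := hγ.dist_eq hwD' (hα.subset hwD)
  have htri := dist_triangle_left α γ (ι w (hα.subset hwD))
  rw [hd1, hd2] at htri
  have hst : (1 - τ) * dist w a ^ 2 + τ * dist w c ^ 2 =
      dist w m ^ 2 + τ * (1 - τ) * dist a c ^ 2 := by
    have h1 := pw_combo (0, 0) (w - a) (w - c) τ
    have h2 : (1 - τ) • (w - a) + τ • (w - c) = w - m := by rw [hm]; module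
    have h3 : w - a - (w - c) = c - a := by abel
    rw [h2, h3] at h1
    simp only [pw, inner_zero_left, mul_zero, sub_zero] at h1
    rw [dist_eq_norm, dist_eq_norm, dist_eq_norm, dist_comm, dist_eq_norm]
    linarith
  have hsq : τ * (1 - τ) * (dist w a + dist w c) ^ 2 ≤ (1 - τ) * dist w a ^ 2 +
      τ * dist w c ^ 2 := by
    nlinarith [sq_nonneg ((1 - τ) * dist w a - τ * dist w c)]
  have hwm2 : dist w m ^ 2 ≤ τ * (1 - τ) * ((M / m₀) ^ 2 * (P * Q)) := by
    have h1 : dist w m ^ 2 ≤ (E / m₀ * M) ^ 2 := by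
      exact pow_le_pow_left₀ dist_nonneg hwm 2
    have h2 : (E / m₀ * M) ^ 2 = τ * (1 - τ) * ((M / m₀) ^ 2 * (P * Q)) := by
      have : E ^ 2 = (τ * Q) * ((1 - τ) * P) := by rw [hE1, hE2]; ring
      rw [mul_pow, div_pow, this, div_pow]
      ring
    linarith
  have hττ : 0 < τ * (1 - τ) := by positivity
  have hfin : τ * (1 - τ) * dist α γ ^ 2 ≤
      τ * (1 - τ) * (dist a c ^ 2 + (M / m₀) ^ 2 * (P * Q)) := by
    have : dist α γ ^ 2 ≤ (dist w a + dist w c) ^ 2 := pow_le_pow_left₀ dist_nonneg htri 2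
    have := mul_le_mul_of_nonneg_left this hττ.le
    linarith
  exact le_of_mul_le_mul_left hfin hττ

/-! ### Representations of points of the core -/

/-- A representation of `y` by boundary elements on an empty circle around `y`. -/
structure Rep (W : Dom) (y : E2) where
  /-- index type -/
  I : Type
  /-- finiteness -/
  fin : Fintype I
  /-- the empty disk -/
  D : E2 × ℝ
  /-- the weights -/
  w : I → ℝ
  /-- the elements -/
  el : I → X W
  w_nonneg : ∀ i, 0 ≤ w i
  w_sum : ∑ i, w i = 1
  acc : ∀ i, AccOn (disk D) (el i)
  on : ∀ i, pw D (sp (el i)) = 0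
  empty : EmptyDisk W D
  mem : y ∈ disk D
  rep : ∑ i, w i • sp (el i) = y

attribute [instance] Rep.fin

namespace Rep

variable {y z : E2}

/-- The image of the point under the representation. -/
def val (R : Rep W y) (f : bd W ≃ᵢ bd V) : E2 := ∑ i, R.w i • im f (R.el i)

theorem mem_carrier (R : Rep W y) : y ∈ W.set := by
  obtain ⟨i⟩ : Nonempty R.I := by
    by_contra h
    rw [not_nonempty_iff] at h
    simpa using R.w_sum
  exact (R.acc i).subset R.mem

theorem frontier (R : Rep W y) (i : R.I) : sp (R.el i) ∈ _root_.frontier W.set :=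
  sp_mem_frontier (R.acc i).1

theorem sum_pw_eq (R : Rep W y) (D' : E2 × ℝ) :
    ∑ i, R.w i * pw D' (sp (R.el i)) = pw D' y - pw R.D y := by
  rw [← sum_pw_sub R.w_sum R.rep]
  simp [R.on]

theorem neg_pw (R : Rep W y) : -pw R.D y = ∑ i, R.w i * ‖sp (R.el i) - y‖ ^ 2 := by
  have := sum_pw R.w_sum R.rep R.D
  simp only [R.on, mul_zero, Finset.sum_const_zero] at this
  linarith

theorem optimal (R : Rep W y) {D' : E2 × ℝ} (h : EmptyDisk W D') : pw R.D y ≤ pw D' y := by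
  have := R.sum_pw_eq D'
  have h2 : 0 ≤ ∑ i, R.w i * pw D' (sp (R.el i)) :=
    Finset.sum_nonneg fun i _ => mul_nonneg (R.w_nonneg i) (h _ (R.frontier i))
  linarith

theorem dist_im (R : Rep W y) (f : bd W ≃ᵢ bd V) (i j : R.I) :
    dist (im f (R.el i)) (im f (R.el j)) = dist (sp (R.el i)) (sp (R.el j)) := by
  rcases (R.acc i).eq_or_vis R.mem (R.acc j) (R.on i) (R.on j) with h | h
  · rw [h, dist_self, dist_self]
  · exact h.dist_im f

end Rep

theorem sum_sum_dist {I J : Type} [Fintype I] [Fintype J] {w : I → ℝ} {v : J → ℝ} {a : I → E2}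
    {c : J → E2} (hw : ∑ i, w i = 1) (hv : ∑ j, v j = 1) :
    ∑ i, ∑ j, w i * v j * dist (a i) (c j) ^ 2 = ∑ i, w i * ‖a i‖ ^ 2 + ∑ j, v j * ‖c j‖ ^ 2 -
      2 * inner ℝ (∑ i, w i • a i) (∑ j, v j • c j) := by
  have h1 : ∀ i, ∑ j, w i * v j * dist (a i) (c j) ^ 2 = w i * ‖a i‖ ^ 2 +
      w i * (∑ j, v j * ‖c j‖ ^ 2) - w i * (2 * inner ℝ (a i) (∑ j, v j • c j)) := by
    intro i
    rw [← sum_inner (y := ∑ j, v j • c j) rfl (a i)]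
    have : ∀ j, w i * v j * dist (a i) (c j) ^ 2 = w i * ‖a i‖ ^ 2 * v j +
        w i * (v j * ‖c j‖ ^ 2) - w i * (2 * (v j * inner ℝ (a i) (c j))) := by
      intro j
      rw [dist_eq_norm, norm_sub_sq_real]
      ring
    simp only [this, Finset.sum_sub_distrib, Finset.sum_add_distrib, ← Finset.mul_sum, hv]
    ring
  simp only [h1, Finset.sum_sub_distrib, Finset.sum_add_distrib, ← Finset.sum_mul, hw]
  congr 1
  · ring
  · rw [_root_.sum_inner, Finset.mul_sum]
    refine Finset.sum_congr rfl fun i _ => ?_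
    rw [inner_smul_left]; simp; ring

theorem dist_sum_sq {I J : Type} [Fintype I] [Fintype J] {w : I → ℝ} {v : J → ℝ} {a : I → E2}
    {c : J → E2} (hw : ∑ i, w i = 1) (hv : ∑ j, v j = 1) :
    dist (∑ i, w i • a i) (∑ j, v j • c j) ^ 2 = ∑ i, ∑ j, w i * v j * dist (a i) (c j) ^ 2 -
      (∑ i, ∑ k, w i * w k * dist (a i) (a k) ^ 2) / 2 -
      (∑ j, ∑ k, v j * v k * dist (c j) (c k) ^ 2) / 2 := by
  rw [sum_sum_dist hw hv, sum_sum_dist hw hw, sum_sum_dist hv hv, dist_eq_norm, norm_sub_sq_real,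
    real_inner_self_eq_norm_sq, real_inner_self_eq_norm_sq]
  ring

namespace Rep

variable {y z : E2}

theorem dist_val_sq (R : Rep W y) (S : Rep W z) (f : bd W ≃ᵢ bd V) :
    dist (R.val f) (S.val f) ^ 2 = dist y z ^ 2 + ∑ i, ∑ j, R.w i * S.w j *
      (dist (im f (R.el i)) (im f (S.el j)) ^ 2 - dist (sp (R.el i)) (sp (S.el j)) ^ 2) := by
  have h1 := dist_sum_sq (a := fun i => im f (R.el i)) (c := fun i => im f (S.el i))
    R.w_sum S.w_sum
  have h2 := dist_sum_sq (a := fun i => sp (R.el i)) (c := fun i => sp (S.el i)) R.w_sum S.w_sum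
  rw [R.rep, S.rep] at h2
  simp only [R.dist_im, S.dist_im] at h1
  simp only [mul_sub, Finset.sum_sub_distrib]
  unfold val
  linarith

theorem val_eq (R S : Rep W y) (f : bd W ≃ᵢ bd V) : R.val f = S.val f := by
  have hopt : pw R.D y = pw S.D y := le_antisymm (R.optimal S.empty) (S.optimal R.empty)
  have h0 := S.sum_pw_eq R.D
  rw [hopt, sub_self, Finset.sum_eq_zero_iff_of_nonneg
    fun i _ => mul_nonneg (S.w_nonneg i) (R.empty _ (S.frontier i))] at h0
  have key : ∀ i j, R.w i * S.w j * (dist (im f (R.el i)) (im f (S.el j)) ^ 2 -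
      dist (sp (R.el i)) (sp (S.el j)) ^ 2) = 0 := by
    intro i j
    rcases mul_eq_zero.1 (h0 j (Finset.mem_univ j)) with h | h
    · simp [h]
    · have hj := (S.acc j).transfer S.mem R.mem R.empty (S.on j) h.le
      rcases (R.acc i).eq_or_vis R.mem hj (R.on i) h with h' | h'
      · simp [h']
      · rw [h'.dist_im f]
        simp
  have := R.dist_val_sq S f
  simp only [key, Finset.sum_const_zero, dist_self] at this
  simpa using this

theorem dist_val_sq_le (R : Rep W y) (S : Rep W z) (f : bd W ≃ᵢ bd V) {K : ℝ} (hK0 : 0 ≤ K)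
    (hK : ∀ i j, dist (R.el i) (S.el j) ^ 2 ≤ dist (sp (R.el i)) (sp (S.el j)) ^ 2 +
      K * (pw S.D (sp (R.el i)) * pw R.D (sp (S.el j)))) :
    dist (R.val f) (S.val f) ^ 2 ≤ dist y z ^ 2 * (1 + K * dist R.D.1 S.D.1 ^ 2) := by
  rw [R.dist_val_sq S f]
  have h1 : ∑ i, ∑ j, R.w i * S.w j * (dist (im f (R.el i)) (im f (S.el j)) ^ 2 -
      dist (sp (R.el i)) (sp (S.el j)) ^ 2) ≤ ∑ i, ∑ j, R.w i * S.w j *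
        (K * (pw S.D (sp (R.el i)) * pw R.D (sp (S.el j)))) := by
    refine Finset.sum_le_sum fun i _ => Finset.sum_le_sum fun j _ => ?_
    refine mul_le_mul_of_nonneg_left ?_ (mul_nonneg (R.w_nonneg i) (S.w_nonneg j))
    have := pow_le_pow_left₀ dist_nonneg (dist_im_le f (R.acc i).1 (S.acc j).1) 2
    linarith [hK i j]
  have h2 : ∑ i, ∑ j, R.w i * S.w j * (K * (pw S.D (sp (R.el i)) * pw R.D (sp (S.el j)))) =
      K * ((pw S.D y - pw R.D y) * (pw R.D z - pw S.D z)) := by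
    rw [← R.sum_pw_eq, ← S.sum_pw_eq, Finset.sum_mul_sum, Finset.mul_sum]
    refine Finset.sum_congr rfl fun i _ => ?_
    rw [Finset.mul_sum]
    exact Finset.sum_congr rfl fun j _ => by ring
  have hp : 0 ≤ pw S.D y - pw R.D y := by linarith [R.optimal S.empty]
  have hq : 0 ≤ pw R.D z - pw S.D z := by linarith [S.optimal R.empty]
  have hpq : (pw S.D y - pw R.D y) + (pw R.D z - pw S.D z) ≤ 2 * (dist R.D.1 S.D.1 * dist y z) := by
    have h3 := pw_sub_pw R.D S.D y z
    have h4 := real_inner_le_norm (S.D.1 - R.D.1) (z - y)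
    rw [← dist_eq_norm, ← dist_eq_norm, dist_comm S.D.1, dist_comm z] at h4
    linarith
  have h5 : (pw S.D y - pw R.D y) * (pw R.D z - pw S.D z) ≤ (dist R.D.1 S.D.1 * dist y z) ^ 2 := by
    nlinarith [sq_nonneg ((pw S.D y - pw R.D y) - (pw R.D z - pw S.D z))]
  have h6 := mul_le_mul_of_nonneg_left h5 hK0
  calc _ ≤ dist y z ^ 2 + K * (dist R.D.1 S.D.1 * dist y z) ^ 2 := by linarith
    _ = _ := by ring

theorem exists_of_optimal {D : E2 × ℝ} (hy : y ∈ W.set) (hD : EmptyDisk W D)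
    (hopt : ∀ D', EmptyDisk W D' → pw D y ≤ pw D' y) : ∃ R : Rep W y, R.D = D := by
  obtain ⟨I, _, w, a, hw0, hw, ha, hay, -⟩ := exists_weights (mem_convexHull_of_optimal hD hopt)
  have hyf : y ∉ _root_.frontier W.set := by
    rw [W.isDom.1.frontier_eq]
    exact fun h => h.2 hy
  have hyD : y ∈ disk D := by
    change pw D y < 0
    have h1 := sum_pw hw hay D
    rw [Finset.sum_eq_zero (fun i _ => by rw [(ha i).2, mul_zero])] at h1
    obtain ⟨i⟩ : Nonempty I := by
      by_contra h
      rw [not_nonempty_iff] at h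
      simpa using hw
    have h2 : 0 < ∑ i, w i * ‖a i - y‖ ^ 2 := by
      refine Finset.sum_pos (fun i _ => mul_pos (hw0 i) ?_) ⟨i, Finset.mem_univ i⟩
      have : a i ≠ y := fun h => hyf (h ▸ (ha i).1)
      have := norm_pos_iff.2 (sub_ne_zero.2 this)
      positivity
    linarith
  choose el hel hacc using fun i => exists_accOn (W := W) (convex_disk D) (hD.disk_subset hy hyD)
    (mem_closure_disk hyD (ha i).2) (by
      have := (ha i).1
      rw [W.isDom.1.frontier_eq] at this
      exact this.2)
  exact ⟨⟨I, inferInstance, D, w, el, fun i => (hw0 i).le, hw, hacc, fun i => by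
    rw [hel]; exact (ha i).2, hD, hyD, by simpa [hel] using hay⟩, rfl⟩

end Rep

/-- The core of a domain. -/
def core (W : Dom) : Set E2 := corePart W.set

theorem exists_rep (hy : y ∈ core W) : Nonempty (Rep W y) := by
  obtain ⟨D, hD, hopt⟩ := exists_optimal hy.2
  obtain ⟨R, -⟩ := Rep.exists_of_optimal hy.1 hD hopt
  exact ⟨R⟩

open Classical in
/-- The unfolding map of the core. -/
def unf (y : E2) : E2 := if h : Nonempty (Rep U y) then h.some.val f else 0

theorem Rep.unf_eq (R : Rep U y) (f : bd U ≃ᵢ bd V) : unf f y = R.val f := by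
  unfold unf
  rw [dif_pos ⟨R⟩]
  exact Rep.val_eq _ _ f

theorem exists_mem_segment_pw_eq {D D' : E2 × ℝ} {y z : E2} (hy : pw D y ≤ pw D' y)
    (hz : pw D' z ≤ pw D z) : ∃ q ∈ segment ℝ y z, pw D q = pw D' q := by
  have hc : ContinuousOn (fun q => pw D q - pw D' q) (segment ℝ y z) :=
    ((continuous_pw_right D).sub (continuous_pw_right D')).continuousOn
  have := (convex_segment y z).isPreconnected.intermediate_value (left_mem_segment ℝ y z)
    (right_mem_segment ℝ y z) hc
  obtain ⟨q, hq, h⟩ := this (show (0:ℝ) ∈ _ from ⟨by linarith, by linarith⟩)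
  exact ⟨q, hq, by simpa [sub_eq_zero] using h⟩

theorem tendsto_pw {D : ℕ → E2 × ℝ} {z : ℕ → E2} {D₀ : E2 × ℝ} {z₀ : E2}
    (h : Tendsto D atTop (nhds D₀)) (hz : Tendsto z atTop (nhds z₀)) :
    Tendsto (fun n => pw (D n) (z n)) atTop (nhds (pw D₀ z₀)) := by
  have h1 : Tendsto (fun n => (D n).1) atTop (nhds D₀.1) := (continuous_fst.tendsto D₀).comp h
  have h2 : Tendsto (fun n => (D n).2) atTop (nhds D₀.2) := (continuous_snd.tendsto D₀).comp h
  unfold pw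
  exact ((hz.norm.pow 2).sub ((h1.inner hz).const_mul 2)).sub h2

theorem norm_le_of_pw_eq_zero {D : E2 × ℝ} {C : ℝ} (h1 : ‖D.1‖ ≤ C) (h2 : |D.2| ≤ C) {a : E2}
    (ha : pw D a = 0) : ‖a‖ ≤ 2 * C + 1 := by
  unfold pw at ha
  have h3 := real_inner_le_norm D.1 a
  have h4 := mul_le_mul_of_nonneg_right h1 (norm_nonneg a)
  have h5 := le_abs_self D.2
  have h6 : 0 ≤ C := (norm_nonneg _).trans h1
  by_contra! h
  nlinarith [norm_nonneg a]

theorem exists_unf_dist_le (hy : y ∈ core U) {ε : ℝ} (hε : 0 < ε) :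
    ∃ δ > 0, ∀ z ∈ ball y δ, z ∈ core U →
      dist (unf f y) (unf f z) ≤ (1 + ε) * dist y z := by
  by_contra! hcon
  obtain ⟨s, hs, C, hC⟩ := exists_center_bound hy.2
  choose z hz hzc hzd using fun n : ℕ => hcon (s * (1 / ((n:ℝ) + 1))) (by positivity)
  have hinv : Tendsto (fun n : ℕ => 1 / ((n:ℝ) + 1)) atTop (nhds 0) :=
    tendsto_one_div_add_atTop_nhds_zero_nat
  have hzy : Tendsto z atTop (nhds y) := by
    rw [tendsto_iff_dist_tendsto_zero]
    refine squeeze_zero (fun _ => dist_nonneg) (fun n => (mem_ball.1 (hz n)).le) ?_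
    have := hinv.const_mul s
    rwa [mul_zero] at this
  have hzs : ∀ n, z n ∈ ball y s := by
    intro n
    refine ball_subset_ball ?_ (hz n)
    have : 1 / ((n:ℝ) + 1) ≤ 1 := by
      rw [div_le_one (by positivity)]
      linarith [n.cast_nonneg (α := ℝ)]
    nlinarith
  have S : ∀ n, Rep U (z n) := fun n => (exists_rep (hzc n)).some
  have hSC : ∀ n, ‖(S n).D.1‖ ≤ C ∧ |(S n).D.2| ≤ C := by
    intro n
    refine hC _ (hzs n) _ (S n).empty ?_
    have := (S n).optimal (emptyDisk_zero U)
    unfold pw at this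
    simp at this
    linarith
  have hSb : ∀ n, (S n).D ∈ closedBall (0 : E2 × ℝ) C := by
    intro n
    rw [mem_closedBall, dist_zero_right, Prod.norm_def, max_le_iff]
    exact hSC n
  obtain ⟨D, hDb, φ, hφ, hDl⟩ := (isCompact_closedBall (0 : E2 × ℝ) C).tendsto_subseq hSb
  have hDl' : Tendsto (fun n => (S (φ n)).D) atTop (nhds D) := hDl
  clear hDl
  have hDC : ‖D.1‖ ≤ C ∧ |D.2| ≤ C := by
    rw [mem_closedBall, dist_zero_right, Prod.norm_def, max_le_iff] at hDb
    exact hDb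
  have hzφ : Tendsto (z ∘ φ) atTop (nhds y) := hzy.comp hφ.tendsto_atTop
  have hDe : EmptyDisk U D := by
    intro p hp
    have h1 : Tendsto (fun n => pw (S (φ n)).D p) atTop (nhds (pw D p)) :=
      by
      have h2 := (continuous_pw_left p).tendsto D
      exact h2.comp hDl'
    refine ge_of_tendsto h1 (Eventually.of_forall fun n => ?_)
    exact (S (φ n)).empty p hp
  have hopt : ∀ D', EmptyDisk U D' → pw D y ≤ pw D' y := by
    intro D' hD'
    have h1 : Tendsto (fun n => pw (S (φ n)).D (z (φ n))) atTop (nhds (pw D y)) :=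
tendsto_pw hDl' hzφ
    have h2 : Tendsto (fun n => pw D' (z (φ n))) atTop (nhds (pw D' y)) :=
      ((continuous_pw_right D').tendsto y).comp hzφ
    exact le_of_tendsto_of_tendsto' h1 h2 fun n => (S (φ n)).optimal hD'
  obtain ⟨R, rfl⟩ := Rep.exists_of_optimal hy.1 hDe hopt
  have hneg : pw R.D y < 0 := R.mem
  obtain ⟨δ, hδ, hδb⟩ := Metric.isOpen_iff.1
    (isOpen_lt (continuous_pw_right R.D) (continuous_const (y := pw R.D y / 2))) y
    (show pw R.D y < pw R.D y / 2 by linarith)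
  set M := 2 * C + 1 + ‖y‖ + δ with hM
  have hK0 : 0 ≤ (M / (-pw R.D y / 2)) ^ 2 := sq_nonneg _
  have hev1 : ∀ᶠ n in atTop, z (φ n) ∈ ball y δ := hzφ (ball_mem_nhds y hδ)
  have hev2 : ∀ᶠ n in atTop, (M / (-pw R.D y / 2)) ^ 2 * dist R.D.1 (S (φ n)).D.1 ^ 2 < ε := by
    have h1 : Tendsto (fun n => (S (φ n)).D.1) atTop (nhds R.D.1) :=
      (continuous_fst.tendsto R.D).comp hDl'
    have h2 : Tendsto (fun n => (M / (-pw R.D y / 2)) ^ 2 * dist R.D.1 (S (φ n)).D.1 ^ 2) atTop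
        (nhds ((M / (-pw R.D y / 2)) ^ 2 * dist R.D.1 R.D.1 ^ 2)) :=
      ((tendsto_const_nhds.dist h1).pow 2).const_mul _
    rw [dist_self] at h2
    exact h2.eventually_lt_const (by simpa using hε)
  obtain ⟨n, h1, h2⟩ := (hev1.and hev2).exists
  have hbad := hzd (φ n)
  rw [R.unf_eq f, (S (φ n)).unf_eq f] at hbad
  obtain ⟨q, hq, hqe⟩ := exists_mem_segment_pw_eq (R.optimal (S (φ n)).empty)
    ((S (φ n)).optimal R.empty)
  have hqb : q ∈ ball y δ := (convex_ball y δ).segment_subset (mem_ball_self hδ) h1 hq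
  have hq2 : pw R.D q < pw R.D y / 2 := hδb hqb
  have hdist : ∀ a : E2, ‖a‖ ≤ 2 * C + 1 → dist q a ≤ M := by
    intro a ha
    have h3 := dist_triangle4 q y 0 a
    rw [dist_zero_right, dist_zero_left] at h3
    have h4 := mem_ball.1 hqb
    linarith
  have key := R.dist_val_sq_le (S (φ n)) f hK0 fun i j =>
    pair_estimate (R.acc i) ((S (φ n)).acc j) R.empty (S (φ n)).empty (R.on i) ((S (φ n)).on j) hqe
      (show 0 < -pw R.D y / 2 by linarith) (by linarith)
      (hdist _ (norm_le_of_pw_eq_zero hDC.1 hDC.2 (R.on i)))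
      (hdist _ (norm_le_of_pw_eq_zero (hSC _).1 (hSC _).2 ((S (φ n)).on j)))
  have h5 : dist (R.val f) ((S (φ n)).val f) ^ 2 ≤ ((1 + ε) * dist y (z (φ n))) ^ 2 := by
    refine key.trans ?_
    rw [mul_pow, mul_comm ((1 + ε) ^ 2)]
    refine mul_le_mul_of_nonneg_left ?_ (sq_nonneg _)
    nlinarith
  have h6 := abs_le_of_sq_le_sq h5 (by positivity)
  rw [abs_of_nonneg dist_nonneg] at h6
  linarith

theorem dist_le_of_pointwise {E : Type*} [PseudoMetricSpace E] {g : E2 → E} {y z : E2}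
    (h : ∀ p ∈ segment ℝ y z, ∀ ε > 0, ∃ δ > 0, ∀ q ∈ ball p δ, q ∈ segment ℝ y z →
      dist (g p) (g q) ≤ (1 + ε) * dist p q) : dist (g y) (g z) ≤ dist y z := by
  set c : ℝ → E2 := fun t => y + t • (z - y) with hc
  have hcd : ∀ s t, dist (c s) (c t) = |s - t| * dist y z := by
    intro s t
    rw [hc]
    simp only
    rw [dist_add_left, dist_eq_norm, ← sub_smul, norm_smul, Real.norm_eq_abs, dist_comm y z,
      dist_eq_norm]
  have hcm : ∀ t ∈ Icc (0:ℝ) 1, c t ∈ segment ℝ y z := by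
    intro t ht
    rw [segment_eq_image']
    exact ⟨t, ht, rfl⟩
  have hcc : Continuous c := by rw [hc]; fun_prop
  set k : ℝ → ℝ := fun t => dist (g y) (g (c t)) with hk
  have hgc : ContinuousOn (fun t => g (c t)) (Icc 0 1) := by
    intro t ht
    obtain ⟨δ, hδ, hq⟩ := h _ (hcm t ht) 1 one_pos
    rw [ContinuousWithinAt, tendsto_iff_dist_tendsto_zero]
    have h1 : Tendsto (fun s => (1 + 1) * dist (c t) (c s)) (nhdsWithin t (Icc 0 1)) (nhds 0) := by
      have : Tendsto (fun s => (1 + 1) * dist (c t) (c s)) (nhds t)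
          (nhds ((1 + 1) * dist (c t) (c t))) :=
        ((tendsto_const_nhds.dist (hcc.tendsto t)).const_mul _)
      rw [dist_self, mul_zero] at this
      exact this.mono_left nhdsWithin_le_nhds
    refine squeeze_zero' (Eventually.of_forall fun _ => dist_nonneg) ?_ h1
    have h2 : ∀ᶠ s in nhdsWithin t (Icc 0 1), c s ∈ ball (c t) δ :=
      nhdsWithin_le_nhds ((hcc.tendsto t) (ball_mem_nhds _ hδ))
    filter_upwards [h2, self_mem_nhdsWithin] with s hs hs'
    rw [dist_comm]
    exact hq _ hs (hcm s hs')
  have hkc : ContinuousOn k (Icc 0 1) := fun t ht => tendsto_const_nhds.dist (hgc t ht)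
  have := image_le_of_liminf_slope_right_le_deriv_boundary hkc (B := fun t => t * dist y z)
    (B' := fun _ => dist y z) (by simp [hk, hc]) (by fun_prop)
    (fun x _ => by simpa using ((hasDerivAt_id x).mul_const (dist y z)).hasDerivWithinAt) ?_
    (right_mem_Icc.2 zero_le_one)
  · simpa [hk, hc] using this
  intro t ht r hr
  refine Eventually.frequently ?_
  have hd0 : 0 ≤ dist y z := dist_nonneg
  set ε := (r - dist y z) / (dist y z + 1) / 2 with hε
  have hε0 : 0 < ε := by
    have : 0 < r - dist y z := by linarith
    positivity
  have hεr : (1 + ε) * dist y z < r := by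
    have h1 : ε * 2 * (dist y z + 1) = r - dist y z := by rw [hε]; field_simp
    nlinarith
  obtain ⟨δ, hδ, hq⟩ := h _ (hcm t (Ico_subset_Icc_self ht)) ε hε0
  have h2 : ∀ᶠ s in nhdsWithin t (Ioi t), c s ∈ ball (c t) δ :=
    nhdsWithin_le_nhds ((hcc.tendsto t) (ball_mem_nhds _ hδ))
  have h3 : ∀ᶠ s in nhdsWithin t (Ioi t), s ∈ Ioo t 1 := Ioo_mem_nhdsGT ht.2
  filter_upwards [h2, h3] with s hs hs'
  have h4 := hq _ hs (hcm s ⟨ht.1.trans hs'.1.le, hs'.2.le⟩)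
  rw [hcd, abs_sub_comm, abs_of_pos (by linarith [hs'.1] : 0 < s - t)] at h4
  rw [slope_def_field, div_lt_iff₀ (by linarith [hs'.1])]
  have h5 := dist_triangle (g y) (g (c t)) (g (c s))
  have h6 : 0 < s - t := by linarith [hs'.1]
  have h7 : k s - k t ≤ (1 + ε) * dist y z * (s - t) := by
    simp only [hk]
    linarith
  nlinarith

theorem dist_unf_le {y z : E2} (h : segment ℝ y z ⊆ core U) :
    dist (unf f y) (unf f z) ≤ dist y z := by
  refine dist_le_of_pointwise fun p hp ε hε => ?_
  obtain ⟨δ, hδ, hq⟩ := exists_unf_dist_le f (h hp) hε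
  exact ⟨δ, hδ, fun q hq1 hq2 => hq q hq1 (h hq2)⟩

theorem isOpen_core (W : Dom) : IsOpen (core W) := W.isDom.1.inter isOpen_interior

theorem Rep.dist_unf_im_le (R : Rep U y) (f : bd U ≃ᵢ bd V) {ξ : X U} (hξ : ξ ∈ bd U) :
    dist (unf f y) (im f ξ) ≤ √(-pw R.D y) + dist (ι y R.mem_carrier) ξ := by
  rw [R.unf_eq f]
  have h1 : R.val f - im f ξ = ∑ i, R.w i • (im f (R.el i) - im f ξ) := by
    simp only [smul_sub, Finset.sum_sub_distrib, ← Finset.sum_smul, R.w_sum, one_smul]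
    rfl
  have h2 : ‖R.val f - im f ξ‖ ≤ ∑ i, R.w i * (dist (sp (R.el i)) y + dist (ι y R.mem_carrier) ξ) := by
    rw [h1]
    refine (norm_sum_le _ _).trans (Finset.sum_le_sum fun i _ => ?_)
    rw [norm_smul, Real.norm_of_nonneg (R.w_nonneg i), ← dist_eq_norm]
    refine mul_le_mul_of_nonneg_left ?_ (R.w_nonneg i)
    have h3 := dist_im_le f (R.acc i).1 hξ
    have h4 := dist_triangle_left (R.el i) ξ (ι y R.mem_carrier)
    rw [(R.acc i).dist_eq R.mem R.mem_carrier, dist_comm y] at h4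
    linarith
  simp only [mul_add, Finset.sum_add_distrib, ← Finset.sum_mul, R.w_sum, one_mul] at h2
  rw [dist_eq_norm]
  refine h2.trans (add_le_add_left ?_ _)
  refine Real.le_sqrt_of_sq_le ?_
  rw [R.neg_pw]
  have h6 := Finset.sum_mul_sq_le_sq_mul_sq Finset.univ (fun i => √(R.w i))
    (fun i => √(R.w i) * dist (sp (R.el i)) y)
  have h7 : ∀ i, √(R.w i) ^ 2 = R.w i := fun i => Real.sq_sqrt (R.w_nonneg i)
  simp only [← mul_assoc, ← pow_two, mul_pow, h7, R.w_sum, one_mul] at h6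
  simpa only [dist_eq_norm] using h6

theorem exists_pw_bound {x a : E2} (hx : x ∈ convexHull ℝ (frontier U.set))
    (ha : a ∈ frontier U.set) : ∃ C : ℝ, ∀ t ∈ Icc (0:ℝ) 1, ∀ D : E2 × ℝ,
      EmptyDisk U D → -pw D ((1 - t) • x + t • a) ≤ (1 - t) * C := by
  obtain ⟨I, _, w, p, hw0, hw, hp, hpx, -⟩ := exists_weights hx
  refine ⟨∑ i, w i * (‖p i - x‖ + ‖a - x‖) ^ 2 + ‖a - x‖ ^ 2, fun t ht D hD => ?_⟩
  have h1 : 0 ≤ pw D a := hD a ha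
  have h2 : -pw D x ≤ ∑ i, w i * ‖p i - x‖ ^ 2 :=
    hD.le_of_mem_convexHull (fun i => (hw0 i).le) hw hp hpx
  have h3 := pw_combo D x a t
  have h4 : ∑ i, w i * ‖p i - x‖ ^ 2 ≤ ∑ i, w i * (‖p i - x‖ + ‖a - x‖) ^ 2 := by
    refine Finset.sum_le_sum fun i _ => mul_le_mul_of_nonneg_left ?_ (hw0 i).le
    exact pow_le_pow_left₀ (norm_nonneg _) (le_add_of_nonneg_right (norm_nonneg _)) 2
  rw [norm_sub_rev x a] at h3
  have h5 : 0 ≤ 1 - t := by linarith [ht.2]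
  have h6 : t * (1 - t) * ‖a - x‖ ^ 2 ≤ (1 - t) * ‖a - x‖ ^ 2 := by
    have : t * ((1 - t) * ‖a - x‖ ^ 2) ≤ 1 * ((1 - t) * ‖a - x‖ ^ 2) :=
      mul_le_mul_of_nonneg_right ht.2 (by positivity)
    linarith
  have h7 : 0 ≤ t * pw D a := mul_nonneg ht.1 h1
  have h8 := mul_le_mul_of_nonneg_left (h2.trans h4) h5
  rw [mul_neg] at h8
  rw [h3, mul_add]
  linarith

theorem exists_unf_bound {x a : E2} (hx : x ∈ convexHull ℝ (frontier U.set))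
    (ha : a ∈ frontier U.set) : ∃ C : ℝ, ∀ t ∈ Icc (0:ℝ) 1,
      ∀ hy : (1 - t) • x + t • a ∈ core U, ∀ ξ ∈ bd U,
        dist (unf f ((1 - t) • x + t • a)) (im f ξ) ≤
          √((1 - t) * C) + dist (ι ((1 - t) • x + t • a) hy.1) ξ := by
  obtain ⟨C, hC⟩ := exists_pw_bound hx ha
  refine ⟨C, fun t ht hy ξ hξ => ?_⟩
  obtain ⟨R⟩ := exists_rep hy
  refine (R.dist_unf_im_le f hξ).trans ?_
  exact add_le_add_left (Real.sqrt_le_sqrt (hC t ht _ R.empty)) _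

theorem unf_bound_of_subset {A : Set E2} {x a : E2} {M t : ℝ}
    (hA : A ⊆ frontier U.set) (hM : A ⊆ closedBall a M) (hx : x ∈ convexHull ℝ A)
    (ha : a ∈ frontier U.set) (ht : t ∈ Icc (0:ℝ) 1)
    (hy : (1 - t) • x + t • a ∈ core U) {ξ : X U} (hξ : ξ ∈ bd U) :
    dist (unf f ((1 - t) • x + t • a)) (im f ξ) ≤
      √((1 - t) * (5 * M ^ 2)) + dist (ι ((1 - t) • x + t • a) hy.1) ξ := by
  obtain ⟨I, _, w, p, hw0, hw, hp, hpx, -⟩ := exists_weights hx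
  have hxM : ‖a - x‖ ≤ M := by
    have := convexHull_min hM (convex_closedBall a M) hx
    rwa [mem_closedBall, dist_comm, dist_eq_norm] at this
  have hpM : ∀ i, ‖p i - x‖ ≤ 2 * M := fun i => by
    have h1 := hM (hp i)
    rw [mem_closedBall, dist_eq_norm] at h1
    have h2 := norm_add_le (p i - a) (a - x)
    rw [sub_add_sub_cancel] at h2
    linarith
  obtain ⟨R⟩ := exists_rep hy
  refine (R.dist_unf_im_le f hξ).trans ?_
  refine add_le_add_left (Real.sqrt_le_sqrt ?_) _
  have h1 : 0 ≤ pw R.D a := R.empty a ha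
  have h2 : -pw R.D x ≤ ∑ i, w i * ‖p i - x‖ ^ 2 :=
    R.empty.le_of_mem_convexHull (fun i => (hw0 i).le) hw (fun i => hA (hp i)) hpx
  have h3 := pw_combo R.D x a t
  have h4 : ∑ i, w i * ‖p i - x‖ ^ 2 ≤ ∑ i, w i * (2 * M) ^ 2 := by
    refine Finset.sum_le_sum fun i _ => mul_le_mul_of_nonneg_left ?_ (hw0 i).le
    exact pow_le_pow_left₀ (norm_nonneg _) (hpM i) 2
  rw [← Finset.sum_mul, hw] at h4
  rw [norm_sub_rev x a] at h3
  have h5 : 0 ≤ 1 - t := by linarith [ht.2]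
  have h9 : ‖a - x‖ ^ 2 ≤ M ^ 2 := pow_le_pow_left₀ (norm_nonneg _) hxM 2
  have h6 : t * (1 - t) * ‖a - x‖ ^ 2 ≤ (1 - t) * M ^ 2 := by
    have h10 : t * ((1 - t) * ‖a - x‖ ^ 2) ≤ 1 * ((1 - t) * ‖a - x‖ ^ 2) :=
      mul_le_mul_of_nonneg_right ht.2 (by positivity)
    have h11 := mul_le_mul_of_nonneg_left h9 h5
    linarith
  have h7 : 0 ≤ t * pw R.D a := mul_nonneg ht.1 h1
  have h8 := mul_le_mul_of_nonneg_left (h2.trans h4) h5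
  rw [h3]
  linarith

theorem unf_near_im (hx : x ∈ convexHull ℝ (frontier U.set))
    {α : X U} (hα : AccOn (openSegment ℝ x (sp α)) α) {ε : ℝ} (hε : 0 < ε) :
    ∃ t₀ ∈ Ico (0:ℝ) 1, ∀ t ∈ Ioo t₀ 1, (1 - t) • x + t • sp α ∈ core U →
      dist (unf f ((1 - t) • x + t • sp α)) (im f α) < ε := by
  obtain ⟨C, hC⟩ := exists_unf_bound f hx (sp_mem_frontier hα.1)
  have hlim : Tendsto (fun t : ℝ => √((1 - t) * C) + (1 - t) * dist x (sp α)) (nhds 1)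
      (nhds (√((1 - 1) * C) + (1 - 1) * dist x (sp α))) :=
    (by fun_prop : Continuous fun t : ℝ => √((1 - t) * C) + (1 - t) * dist x (sp α)).tendsto 1
  simp only [sub_self, zero_mul, Real.sqrt_zero, add_zero] at hlim
  obtain ⟨δ, hδ, hb⟩ := Metric.eventually_nhds_iff.1 (hlim.eventually_lt_const hε)
  refine ⟨max 0 (1 - δ), ⟨le_max_left _ _, max_lt one_pos (by linarith)⟩, fun t ht hy => ?_⟩
  have h0 : 0 < t := lt_of_le_of_lt (le_max_left _ _) ht.1
  have h1 : 1 - δ < t := lt_of_le_of_lt (le_max_right _ _) ht.1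
  have hm : (1 - t) • x + t • sp α ∈ openSegment ℝ x (sp α) := by
    exact oseg_mem ⟨h0, ht.2⟩
  refine (hC t ⟨h0.le, ht.2.le⟩ hy α hα.1).trans_lt ?_
  rw [hα.dist_eq hm]
  have h2 : dist ((1 - t) • x + t • sp α) (sp α) = (1 - t) * dist x (sp α) := by
    have : (1 - t) • x + t • sp α - sp α = (1 - t) • (x - sp α) := by module
    rw [dist_eq_norm, this, norm_smul, dist_eq_norm, Real.norm_of_nonneg (by linarith [ht.2])]
  rw [h2]
  refine hb ?_
  rw [Real.dist_eq, abs_sub_comm, abs_of_pos] <;> linarith [ht.2]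

theorem openSegment_subset_left {a b q : E2} (hq : q ∈ openSegment ℝ a b) :
    openSegment ℝ q b ⊆ openSegment ℝ a b := by
  intro p hp
  obtain ⟨s, ⟨hs0, hs1⟩, rfl⟩ := mem_oseg.1 hp
  obtain ⟨t, ⟨ht0, ht1⟩, rfl⟩ := mem_oseg.1 hq
  rw [openSegment_eq_image]
  refine ⟨t + s - s * t, ⟨by nlinarith, by nlinarith⟩, ?_⟩
  simp only
  module

theorem dist_unf_im_le (hx : x ∈ core U) {α : X U}
    (hα : AccOn (openSegment ℝ x (sp α)) α) (hc : openSegment ℝ x (sp α) ⊆ core U) :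
    dist (unf f x) (im f α) ≤ dist x (sp α) := by
  refine le_of_forall_pos_lt_add fun ε hε => ?_
  obtain ⟨t₀, ht₀, h⟩ := unf_near_im f (interior_subset hx.2) hα hε
  obtain ⟨t, ht⟩ := _root_.exists_between ht₀.2
  have hm : (1 - t) • x + t • sp α ∈ openSegment ℝ x (sp α) := by
    exact oseg_mem ⟨ht₀.1.trans_lt ht.1, ht.2⟩
  have h1 := h t ht (hc hm)
  have h2 : dist (unf f x) (unf f ((1 - t) • x + t • sp α)) ≤
      dist x ((1 - t) • x + t • sp α) := by
    refine dist_unf_le f fun q hq => ?_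
    rcases eq_or_ne q x with rfl | hqx
    · exact hx
    · rw [← insert_endpoints_openSegment] at hq
      rcases hq with rfl | rfl | hq
      · exact hx
      · exact hc hm
      · refine hc ?_
        rw [openSegment_symm] at hm hq ⊢
        exact openSegment_subset_left hm hq
  have h3 := dist_add_openSegment hm
  have h4 := dist_triangle (unf f x) (unf f ((1 - t) • x + t • sp α)) (im f α)
  have h5 : 0 ≤ dist ((1 - t) • x + t • sp α) (sp α) := dist_nonneg
  linarith

theorem eq_of_dist_le {A B p : E2} {t : ℝ}
    (h1 : dist A p ≤ t * dist A B) (h2 : dist p B ≤ (1 - t) * dist A B) :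
    p = (1 - t) • A + t • B := by
  have h3 := dist_triangle A p B
  have := eq_lineMap_of_dist_eq_mul_of_dist_eq_mul (x := A) (y := p) (z := B) (r := t)
    (by linarith) (by linarith)
  rw [this, AffineMap.lineMap_apply_module]

theorem mem_hull_of_bd {α : X W} (h : α ∈ bd W) : sp α ∈ convexHull ℝ (frontier W.set) :=
  subset_convexHull ℝ _ (sp_mem_frontier h)

theorem openSegment_subset_interior_hull {a b q : E2} (ha : a ∈ convexHull ℝ (frontier W.set))
    (hb : b ∈ convexHull ℝ (frontier W.set)) (hq : q ∈ openSegment ℝ a b)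
    (hqi : q ∈ interior (convexHull ℝ (frontier W.set))) :
    openSegment ℝ a b ⊆ interior (convexHull ℝ (frontier W.set)) := by
  have hK := convex_convexHull ℝ (frontier W.set)
  intro p hp
  obtain ⟨s, ⟨hs0, hs1⟩, rfl⟩ := mem_oseg.1 hp
  obtain ⟨t, ⟨ht0, ht1⟩, rfl⟩ := mem_oseg.1 hq
  rcases lt_trichotomy s t with h | rfl | h
  · refine hK.openSegment_self_interior_subset_interior ha hqi ?_
    rw [openSegment_eq_image]
    refine ⟨s / t, ⟨by positivity, by rwa [div_lt_one ht0]⟩, ?_⟩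
    simp only
    rw [smul_add, smul_smul, smul_smul, ← add_assoc, ← add_smul, div_mul_cancel₀ _ ht0.ne']
    congr 2
    field_simp
    ring
  · exact hqi
  · refine hK.openSegment_interior_self_subset_interior hqi hb ?_
    rw [openSegment_eq_image]
    have h1 : 0 < 1 - t := by linarith
    refine ⟨(s - t) / (1 - t), ⟨div_pos (by linarith) h1, by rw [div_lt_one h1]; linarith⟩, ?_⟩
    simp only
    rw [smul_add, smul_smul, smul_smul, add_assoc, ← add_smul]
    congr 2
    · field_simp; ring
    · field_simp; ring

theorem Vis.openSegment_subset_core {α β : X W} (h : Vis α β) {q : E2}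
    (hq : q ∈ openSegment ℝ (sp α) (sp β)) (hqc : q ∈ core W) :
    openSegment ℝ (sp α) (sp β) ⊆ core W :=
  subset_inter h.subset (openSegment_subset_interior_hull (mem_hull_of_bd h.1.1)
    (mem_hull_of_bd h.2.1) hq hqc.2)

theorem Vis.unf_eq {α β : X U} (h : Vis α β) {t : ℝ} (ht : t ∈ Ioo (0:ℝ) 1)
    (hq : (1 - t) • sp α + t • sp β ∈ core U) :
    unf f ((1 - t) • sp α + t • sp β) = (1 - t) • im f α + t • im f β := by
  set q := (1 - t) • sp α + t • sp β with hqd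
  have hm : q ∈ openSegment ℝ (sp α) (sp β) := by
    exact oseg_mem ht
  have hm' : q ∈ openSegment ℝ (sp β) (sp α) := by rwa [openSegment_symm]
  have hc := h.openSegment_subset_core hm hq
  have hs2 := openSegment_subset_left hm
  have hs1 := openSegment_subset_left hm'
  rw [openSegment_symm ℝ (sp β) (sp α)] at hs1
  have h1 := dist_unf_im_le f hq (h.1.mono hs1) (hs1.trans hc)
  have h2 := dist_unf_im_le f hq (h.2.mono hs2) (hs2.trans hc)
  have e1 : dist q (sp α) = t * dist (sp α) (sp β) := by
    have : q - sp α = t • (sp β - sp α) := by rw [hqd]; module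
    rw [dist_eq_norm, this, norm_smul, dist_comm (sp α), dist_eq_norm,
      Real.norm_of_nonneg ht.1.le]
  have e2 : dist q (sp β) = (1 - t) * dist (sp α) (sp β) := by
    have : q - sp β = (1 - t) • (sp α - sp β) := by rw [hqd]; module
    rw [dist_eq_norm, this, norm_smul, dist_eq_norm, Real.norm_of_nonneg (by linarith [ht.2])]
  rw [e1, ← h.dist_im f, dist_comm] at h1
  rw [e2, ← h.dist_im f] at h2
  exact eq_of_dist_le h1 h2

theorem Vis.map_im {α β : X U} (h : Vis α β) :
    openSegment ℝ (im f α) (im f β) ⊆ V.set := by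
  rw [im_of_mem f h.1.1, im_of_mem f h.2.1]
  exact (Vis.map f (ξ := ⟨α, h.1.1⟩) (ζ := ⟨β, h.2.1⟩) h).subset

theorem im_coe (α : bd U) : im f (α : X U) = sp (f α : X V) :=
  im_of_mem f α.2

theorem im_symm_coe (α : bd U) : im f.symm (f α : X V) = sp (α : X U) := by
  rw [im_coe, f.symm_apply_apply]

theorem im_mem_frontier {α : X U} (h : α ∈ bd U) :
    im f α ∈ frontier V.set := by
  rw [im_of_mem f h]
  exact sp_mem_frontier (f ⟨α, h⟩).2

theorem exists_exit {p z : E2} (hp : p ∈ W.set) (hz : z ∉ W.set) :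
    ∃ t ∈ Ioc (0:ℝ) 1, (1 - t) • p + t • z ∉ W.set ∧
      ∀ s ∈ Ico (0:ℝ) t, (1 - s) • p + s • z ∈ W.set := by
  have hc : Continuous fun t : ℝ => (1 - t) • p + t • z := by fun_prop
  have hcl : IsCompact (Icc (0:ℝ) 1 ∩ (fun t : ℝ => (1 - t) • p + t • z) ⁻¹' W.setᶜ) :=
    isCompact_Icc.inter_right (W.isDom.1.isClosed_compl.preimage hc)
  obtain ⟨t, ht, hmin⟩ := hcl.exists_isLeast ⟨1, ⟨by simp, by simpa using hz⟩⟩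
  refine ⟨t, ⟨lt_of_le_of_ne ht.1.1 ?_, ht.1.2⟩, ht.2, fun s hs => ?_⟩
  · rintro rfl
    exact ht.2 (by simpa using hp)
  · by_contra hn
    exact (hmin ⟨⟨hs.1, hs.2.le.trans ht.1.2⟩, hn⟩).not_gt hs.2

theorem mem_openSegment_of_smul_add_eq_zero {x y p : E2} {A B : ℝ} (hA : 0 < A) (hB : 0 < B)
    (h : A • (x - p) + B • (y - p) = 0) : p ∈ openSegment ℝ x y := by
  refine ⟨A / (A + B), B / (A + B), by positivity, by positivity, by field_simp, ?_⟩
  have h1 : A • x + B • y = (A + B) • p := by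
    rw [← sub_eq_zero, ← h]; module
  rw [div_eq_inv_mul, div_eq_inv_mul, ← smul_smul, ← smul_smul, ← smul_add, h1, smul_smul,
    inv_mul_cancel₀ (by positivity), one_smul]

theorem openSegment_subset_of_mem {x y p : E2} {S : Set E2} (hp : p ∈ openSegment ℝ x y)
    (hpS : p ∈ S) (h1 : openSegment ℝ p x ⊆ S) (h2 : openSegment ℝ p y ⊆ S) :
    openSegment ℝ x y ⊆ S := by
  have hr : p ∈ range (AffineMap.lineMap x y : ℝ → E2) := by
    rw [openSegment_eq_image_lineMap] at hp
    exact image_subset_range _ _ hp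
  refine (openSegment_subset_union x y hr).trans (insert_subset hpS (union_subset ?_ h2))
  rwa [openSegment_symm]

theorem openSegment_subset_of_exit {p z : E2} {t : ℝ} {S : Set E2} (ht : 0 < t)
    (h : ∀ s ∈ Ico (0:ℝ) t, (1 - s) • p + s • z ∈ S) :
    openSegment ℝ p ((1 - t) • p + t • z) ⊆ S := by
  rw [openSegment_eq_image]
  rintro _ ⟨r, hr, rfl⟩
  have := h (r * t) ⟨mul_nonneg hr.1.le ht.le, mul_lt_of_lt_one_left ht hr.2⟩
  convert this using 1
  simp only
  module

theorem exists_vis {a b : E2} (h : openSegment ℝ a b ⊆ W.set) (ha : a ∉ W.set)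
    (hb : b ∉ W.set) : ∃ α β : bd W, sp (α : X W) = a ∧ sp (β : X W) = b ∧
      Vis (α : X W) β := by
  have hcv := convex_openSegment (𝕜 := ℝ) a b
  obtain ⟨α, hαs, hα⟩ := exists_accOn hcv h
    (segment_subset_closure_openSegment (left_mem_segment ℝ a b)) ha
  obtain ⟨β, hβs, hβ⟩ := exists_accOn hcv h
    (segment_subset_closure_openSegment (right_mem_segment ℝ a b)) hb
  exact ⟨⟨α, hα.1⟩, ⟨β, hβ.1⟩, hαs, hβs, hα.vis hβ (by simp [hαs, hβs])⟩

theorem exists_vis_chord {p z₁ z₂ : E2} (hp : p ∈ W.set) (h₁ : z₁ ∉ W.set)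
    (h₂ : z₂ ∉ W.set) (hpz : p ∈ openSegment ℝ z₁ z₂) :
    ∃ α β : bd W, Vis (α : X W) β ∧ p ∈ openSegment ℝ (sp (α : X W)) (sp (β : X W)) ∧
      (∃ s ∈ Ioc (0:ℝ) 1, sp (α : X W) = (1 - s) • p + s • z₁) ∧
      (∃ t ∈ Ioc (0:ℝ) 1, sp (β : X W) = (1 - t) • p + t • z₂) := by
  obtain ⟨s, hs, hs1, hs2⟩ := exists_exit hp h₁
  obtain ⟨t, ht, ht1, ht2⟩ := exists_exit hp h₂
  have hm : p ∈ openSegment ℝ ((1 - s) • p + s • z₁) ((1 - t) • p + t • z₂) := by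
    obtain ⟨A, B, hA, hB, hAB, h⟩ := hpz
    refine mem_openSegment_of_smul_add_eq_zero (div_pos hA hs.1) (div_pos hB ht.1) ?_
    have e1 : (1 - s) • p + s • z₁ - p = s • (z₁ - p) := by module
    have e2 : (1 - t) • p + t • z₂ - p = t • (z₂ - p) := by module
    rw [e1, e2, smul_smul, smul_smul, div_mul_cancel₀ _ hs.1.ne', div_mul_cancel₀ _ ht.1.ne',
      ← sub_eq_zero_of_eq h]
    have : A • (z₁ - p) + B • (z₂ - p) = A • z₁ + B • z₂ - (A + B) • p := by module
    rw [this, hAB, one_smul]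
  obtain ⟨α, β, h1, h2, h3⟩ := exists_vis (openSegment_subset_of_mem hm hp
    (openSegment_subset_of_exit hs.1 hs2) (openSegment_subset_of_exit ht.1 ht2)) hs1 ht1
  exact ⟨α, β, h3, by rwa [h1, h2], ⟨s, hs, h1⟩, ⟨t, ht, h2⟩⟩

theorem dist_combo_sq (x B C : E2) (t : ℝ) : dist x ((1 - t) • B + t • C) ^ 2 =
    (1 - t) * dist x B ^ 2 + t * dist x C ^ 2 - t * (1 - t) * dist B C ^ 2 := by
  have h := pw_combo (x, -‖x‖ ^ 2) B C t
  have h2 : ∀ y : E2, pw (x, -‖x‖ ^ 2) y = dist x y ^ 2 := fun y => by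
    unfold pw
    rw [dist_eq_norm, norm_sub_sq_real]
    simp only
    ring
  rwa [h2, h2, h2, ← dist_eq_norm] at h

theorem unf_near_segment {A : Set E2} (hA : A ⊆ frontier U.set)
    (hAb : Bornology.IsBounded A) {β : X U} {p : E2} (hp : p ∈ U.set)
    (hβ : AccOn (openSegment ℝ p (sp β)) β) {ε : ℝ} (hε : 0 < ε) :
    ∃ δ > 0, ∀ v ∈ core U ∩ convexHull ℝ A, dist v p < δ →
      dist (unf f v) (im f β) ≤ dist p (sp β) + ε := by
  set b := sp β with hb
  obtain ⟨M, hM⟩ := hAb.subset_closedBall b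
  have hlim : Tendsto (fun t : ℝ => √((1 - t) * (5 * M ^ 2))) (nhds 1)
      (nhds (√((1 - 1) * (5 * M ^ 2)))) :=
    (by fun_prop : Continuous fun t : ℝ => √((1 - t) * (5 * M ^ 2))).tendsto 1
  simp only [sub_self, zero_mul, Real.sqrt_zero] at hlim
  obtain ⟨τ, hτ, hτb⟩ := Metric.eventually_nhds_iff.1
    (hlim.eventually_lt_const (half_pos hε))
  obtain ⟨t, ht1, ht2⟩ := _root_.exists_between (show max 0 (1 - τ) < 1 from
    max_lt one_pos (by linarith))
  have ht0 : 0 < t := (le_max_left _ _).trans_lt ht1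
  have hsq : √((1 - t) * (5 * M ^ 2)) < ε / 2 := hτb (by
    have := (le_max_right 0 (1 - τ)).trans_lt ht1
    rw [Real.dist_eq, abs_sub_comm, abs_of_pos] <;> linarith)
  set q := (1 - t) • p + t • b with hq
  have hqm : q ∈ openSegment ℝ p b := by
    exact oseg_mem ⟨ht0, ht2⟩
  have hseg : segment ℝ p q ⊆ U.set := by
    intro x hx
    rw [← insert_endpoints_openSegment] at hx
    rcases hx with rfl | rfl | hx
    · exact hp
    · exact hβ.subset hqm
    · rw [openSegment_symm] at hx hqm
      have := openSegment_subset_left hqm hx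
      rw [openSegment_symm] at this
      exact hβ.subset this
  have hcomp : IsCompact (segment ℝ p q) := by
    rw [segment_eq_image]
    exact isCompact_Icc.image (by fun_prop)
  obtain ⟨r, hr, hrs⟩ := hcomp.exists_thickening_subset_open U.isDom.1 hseg
  refine ⟨min r (ε / 4), lt_min hr (by positivity), fun v hv hvp => ?_⟩
  have hv1 : dist v p < r := hvp.trans_le (min_le_left _ _)
  have hv2 : dist v p < ε / 4 := hvp.trans_le (min_le_right _ _)
  have hdd : ∀ s : ℝ, dist ((1 - s) • v + s • b) ((1 - s) • p + s • b) = |1 - s| * dist v p := by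
    intro s
    rw [dist_eq_norm, add_sub_add_right_eq_sub, ← smul_sub, norm_smul, Real.norm_eq_abs,
      dist_eq_norm]
  have hmem : ∀ s ∈ Icc (0:ℝ) t, (1 - s) • v + s • b ∈ core U := by
    intro s hs
    have hs1 : s < 1 := hs.2.trans_lt ht2
    refine ⟨hrs ?_, ?_⟩
    · refine mem_thickening_iff.2 ⟨(1 - s) • p + s • b, ?_, ?_⟩
      · rw [segment_eq_image]
        refine ⟨s / t, ⟨div_nonneg hs.1 ht0.le, by rw [div_le_one ht0]; exact hs.2⟩, ?_⟩
        simp only [hq]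
        rw [smul_add, smul_smul, smul_smul, ← add_assoc, ← add_smul, div_mul_cancel₀ _ ht0.ne']
        congr 2
        field_simp
        ring
      · rw [hdd, abs_of_pos (by linarith)]
        exact (mul_le_of_le_one_left dist_nonneg (by linarith [hs.1])).trans_lt hv1
    · rcases eq_or_lt_of_le hs.1 with rfl | h0
      · simpa using hv.1.2
      · exact (convex_convexHull ℝ (frontier U.set)).openSegment_interior_self_subset_interior
          hv.1.2 (mem_hull_of_bd hβ.1) (by
            exact oseg_mem ⟨h0, hs1⟩)
  have hyc := hmem t ⟨ht0.le, le_rfl⟩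
  have h1 := unf_bound_of_subset f hA hM hv.2 (sp_mem_frontier hβ.1) ⟨ht0.le, ht2.le⟩ hyc hβ.1
  have h2 : dist (unf f v) (unf f ((1 - t) • v + t • b)) ≤ dist v ((1 - t) • v + t • b) := by
    refine dist_unf_le f ?_
    rw [segment_eq_image]
    rintro _ ⟨s, hs, rfl⟩
    have := hmem (s * t) ⟨mul_nonneg hs.1 ht0.le, mul_le_of_le_one_left ht0.le hs.2⟩
    convert this using 1
    simp only
    module
  have h3 : dist v ((1 - t) • v + t • b) = t * dist v b := by
    have : v - ((1 - t) • v + t • b) = t • (v - b) := by module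
    rw [dist_eq_norm, this, norm_smul, Real.norm_of_nonneg ht0.le, dist_eq_norm]
  have hb2 : ball q r ⊆ U.set := by
    refine Subset.trans ?_ hrs
    exact ball_subset_thickening (right_mem_segment ℝ p q) r
  have hyd := hdd t
  rw [← hq, abs_of_pos (by linarith)] at hyd
  have h4 := dist_ι_of_ball (W := U) hb2 (x := (1 - t) • v + t • b) (y := q)
    (by rw [mem_ball, hyd]
        exact (mul_le_of_le_one_left dist_nonneg (by linarith)).trans_lt hv1)
    (mem_ball_self hr)
  have h5 := hβ.dist_eq hqm (hβ.subset hqm)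
  have h6 : dist q b = (1 - t) * dist p b := by
    have : q - b = (1 - t) • (p - b) := by rw [hq]; module
    rw [dist_eq_norm, this, norm_smul, Real.norm_of_nonneg (by linarith), dist_eq_norm]
  have h7 := dist_triangle (ι ((1 - t) • v + t • b) hyc.1 : X U) (ι q (hβ.subset hqm)) β
  have h8 := dist_triangle v p b
  have h9 := dist_triangle (unf f v) (unf f ((1 - t) • v + t • b)) (im f β)
  rw [h4, hyd, h5, ← hb, h6] at h7
  have h10 : t * dist v b ≤ t * (dist v p + dist p b) := mul_le_mul_of_nonneg_left h8 ht0.le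
  have h11 : (dist v p) * 1 < ε / 4 := by linarith
  linarith

theorem Vis.unf_near {A : Set E2} (hA : A ⊆ frontier U.set)
    (hAb : Bornology.IsBounded A) {β γ : X U} (h : Vis β γ) {t : ℝ} (ht : t ∈ Ioo (0:ℝ) 1) {ε : ℝ}
    (hε : 0 < ε) : ∃ δ > 0, ∀ v ∈ core U ∩ convexHull ℝ A,
      dist v ((1 - t) • sp β + t • sp γ) < δ →
      dist (unf f v) ((1 - t) • im f β + t • im f γ) < ε := by
  set p := (1 - t) • sp β + t • sp γ with hpd
  have hm : p ∈ openSegment ℝ (sp β) (sp γ) := by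
    exact oseg_mem ht
  have hm' : p ∈ openSegment ℝ (sp γ) (sp β) := by rwa [openSegment_symm]
  have hs2 := openSegment_subset_left hm
  have hs1 := openSegment_subset_left hm'
  rw [openSegment_symm ℝ (sp γ) (sp β)] at hs1
  set L := dist (sp β) (sp γ) with hL
  have e1 : dist p (sp β) = t * L := by
    have : p - sp β = t • (sp γ - sp β) := by rw [hpd]; module
    rw [dist_eq_norm, this, norm_smul, hL, dist_comm (sp β), dist_eq_norm,
      Real.norm_of_nonneg ht.1.le]
  have e2 : dist p (sp γ) = (1 - t) * L := by
    have : p - sp γ = (1 - t) • (sp β - sp γ) := by rw [hpd]; module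
    rw [dist_eq_norm, this, norm_smul, hL, dist_eq_norm, Real.norm_of_nonneg (by linarith [ht.2])]
  have hlim : Tendsto (fun r : ℝ => 4 * L * r + r ^ 2) (nhds 0) (nhds (4 * L * 0 + 0 ^ 2)) :=
    (by fun_prop : Continuous fun r : ℝ => 4 * L * r + r ^ 2).tendsto 0
  simp only [mul_zero, ne_eq, OfNat.ofNat_ne_zero, not_false_eq_true, zero_pow, add_zero] at hlim
  obtain ⟨r₀, hr₀, hr⟩ := Metric.eventually_nhds_iff.1
    (hlim.eventually_lt_const (pow_pos hε 2))
  have hr1 := hr (y := r₀ / 2) (by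
    rw [Real.dist_eq, sub_zero, abs_of_pos (by positivity)]; linarith)
  set r := r₀ / 2
  have hr0 : 0 < r := half_pos hr₀
  obtain ⟨δ₁, hδ₁, h1⟩ := unf_near_segment f hA hAb (h.subset hm) (h.1.mono hs1) hr0
  obtain ⟨δ₂, hδ₂, h2⟩ := unf_near_segment f hA hAb (h.subset hm) (h.2.mono hs2) hr0
  refine ⟨min δ₁ δ₂, lt_min hδ₁ hδ₂, fun v hv hvp => ?_⟩
  have k1 := h1 v hv (hvp.trans_le (min_le_left _ _))
  have k2 := h2 v hv (hvp.trans_le (min_le_right _ _))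
  rw [e1] at k1
  rw [e2] at k2
  refine lt_of_pow_lt_pow_left₀ 2 hε.le (lt_of_le_of_lt ?_ hr1)
  rw [dist_combo_sq, h.dist_im f, ← hL]
  have k1' := pow_le_pow_left₀ dist_nonneg k1 2
  have k2' := pow_le_pow_left₀ dist_nonneg k2 2
  have ht1 : 0 < 1 - t := by linarith [ht.2]
  have m1 := mul_le_mul_of_nonneg_left k1' ht1.le
  have m2 := mul_le_mul_of_nonneg_left k2' ht.1.le
  have hL0 : 0 ≤ L := dist_nonneg
  have m3 : t * (1 - t) * (L * r) ≤ 1 * (L * r) :=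
    mul_le_mul_of_nonneg_right (by nlinarith [ht.1, ht.2]) (by positivity)
  nlinarith

/-- The planar cross product. -/
def cr (x y : E2) : ℝ := x 0 * y 1 - x 1 * y 0

/-- Barycentric coordinate at the first vertex. -/
def bary (a b c x : E2) : ℝ := cr (b - x) (c - x) / cr (b - a) (c - a)

theorem continuous_bary (a b c : E2) : Continuous (bary a b c) := by
  unfold bary cr
  fun_prop

theorem cr_rot (a b c : E2) : cr (c - b) (a - b) = cr (b - a) (c - a) := by
  simp only [cr, PiLp.sub_apply]; ring

theorem cr_swap (a b c : E2) : cr (c - a) (b - a) = -cr (b - a) (c - a) := by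
  simp only [cr, PiLp.sub_apply]; ring

theorem bary_combo {a b c : E2} (h : cr (b - a) (c - a) ≠ 0) {u v w : ℝ} (hs : u + v + w = 1) :
    bary a b c (u • a + v • b + w • c) = u := by
  unfold bary
  rw [div_eq_iff h]
  obtain rfl : u = 1 - v - w := by linarith
  simp only [cr, PiLp.sub_apply, PiLp.add_apply, PiLp.smul_apply, smul_eq_mul]
  ring

theorem exists_coords {a b c : E2} (h : cr (b - a) (c - a) ≠ 0) (x : E2) :
    ∃ u v w : ℝ, u + v + w = 1 ∧ x = u • a + v • b + w • c := by
  have h' := h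
  refine ⟨bary a b c x, cr (c - x) (a - x) / cr (b - a) (c - a),
    cr (a - x) (b - x) / cr (b - a) (c - a), ?_, ?_⟩
  · unfold bary
    rw [← add_div, ← add_div, div_eq_one_iff_eq h]
    simp only [cr, PiLp.sub_apply]
    ring
  · unfold bary
    simp only [cr, PiLp.sub_apply] at h' ⊢
    ext i
    fin_cases i
    · simp only [Fin.zero_eta, PiLp.add_apply, PiLp.smul_apply, smul_eq_mul]
      field_simp
      ring
    · simp only [Fin.mk_one, PiLp.add_apply, PiLp.smul_apply, smul_eq_mul]
      field_simp
      ring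

theorem combo_mem {a b c : E2} {S : Set E2} (hS : Convex ℝ S) (ha : a ∈ S) (hb : b ∈ S)
    (hc : c ∈ S) {u v w : ℝ} (hs : u + v + w = 1) (hu : 0 ≤ u) (hv : 0 ≤ v) (hw : 0 ≤ w) :
    u • a + v • b + w • c ∈ S := by
  have := hS.sum_mem (t := Finset.univ) (w := ![u, v, w]) (z := ![a, b, c])
    (by intro i _; fin_cases i <;> assumption) (by simpa [Fin.sum_univ_three] using hs)
    (by intro i _; fin_cases i <;> assumption)
  simpa [Fin.sum_univ_three] using this

theorem combo_mem_interior {a b c : E2} {S : Set E2} (hS : Convex ℝ S) (ha : a ∈ S) (hb : b ∈ S)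
    (hc : c ∈ S) (h : cr (b - a) (c - a) ≠ 0) {u v w : ℝ} (hs : u + v + w = 1) (hu : 0 < u)
    (hv : 0 < v) (hw : 0 < w) : u • a + v • b + w • c ∈ interior S := by
  have h2 : cr (c - b) (a - b) ≠ 0 := by rwa [cr_rot]
  have h3 : cr (a - c) (b - c) ≠ 0 := by rwa [cr_rot]
  have ho : IsOpen {x | 0 < bary a b c x ∧ 0 < bary b c a x ∧ 0 < bary c a b x} :=
    (isOpen_lt continuous_const (continuous_bary a b c)).inter
      ((isOpen_lt continuous_const (continuous_bary b c a)).inter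
        (isOpen_lt continuous_const (continuous_bary c a b)))
  have e2 : ∀ u v w : ℝ, u • a + v • b + w • c = v • b + w • c + u • a := fun u v w => by abel
  have e3 : ∀ u v w : ℝ, u • a + v • b + w • c = w • c + u • a + v • b := fun u v w => by abel
  refine mem_interior.2 ⟨_, ?_, ho, ?_⟩
  · intro x hx
    obtain ⟨u, v, w, hs, rfl⟩ := exists_coords h x
    obtain ⟨k1, k2, k3⟩ := hx
    rw [bary_combo h hs] at k1
    rw [e2, bary_combo h2 (by linarith)] at k2
    rw [e3, bary_combo h3 (by linarith)] at k3
    exact combo_mem hS ha hb hc hs k1.le k2.le k3.le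
  · refine ⟨?_, ?_, ?_⟩
    · rwa [bary_combo h hs]
    · rwa [e2, bary_combo h2 (by linarith)]
    · rwa [e3, bary_combo h3 (by linarith)]

/-- A nondegenerate triangle of boundary elements on the boundary circle of an empty disk. -/
structure Tri (U : Dom) where
  /-- the empty disk -/
  D : E2 × ℝ
  /-- first vertex -/
  α : bd U
  /-- second vertex -/
  β : bd U
  /-- third vertex -/
  γ : bd U
  empty : EmptyDisk U D
  accα : AccOn (disk D) (α : X U)
  accβ : AccOn (disk D) (β : X U)
  accγ : AccOn (disk D) (γ : X U)
  onα : pw D (sp (α : X U)) = 0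
  onβ : pw D (sp (β : X U)) = 0
  onγ : pw D (sp (γ : X U)) = 0
  ne : cr (sp (β : X U) - sp (α : X U)) (sp (γ : X U) - sp (α : X U)) ≠ 0

variable (T : Tri U) (f : bd U ≃ᵢ bd V) {u v w : ℝ}

theorem exists_ratio {a d : ℝ} (ha : 0 < a) (hd : a < d) : ∃ x ∈ Ioo (0 : ℝ) 1, x * d = a :=
  have h := ha.trans hd
  ⟨a / d, ⟨div_pos ha h, (div_lt_one h).2 hd⟩, div_mul_cancel₀ _ h.ne'⟩

namespace Tri

/-- Cyclic relabelling. -/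
def rot : Tri U where
  D := T.D
  α := T.β
  β := T.γ
  γ := T.α
  empty := T.empty
  accα := T.accβ
  accβ := T.accγ
  accγ := T.accα
  onα := T.onβ
  onβ := T.onγ
  onγ := T.onα
  ne := by rw [cr_rot]; exact T.ne

/-- Exchange of the last two vertices. -/
def swap : Tri U where
  D := T.D
  α := T.α
  β := T.γ
  γ := T.β
  empty := T.empty
  accα := T.accα
  accβ := T.accγ
  accγ := T.accβ
  onα := T.onα
  onβ := T.onγ
  onγ := T.onβ
  ne := by rw [cr_swap]; exact neg_ne_zero.2 T.ne

/-- Points of the plane in barycentric coordinates. -/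
def pt (u v w : ℝ) : E2 := u • sp (T.α : X U) + v • sp (T.β : X U) + w • sp (T.γ : X U)

/-- Points of the plane in barycentric coordinates of the image triangle. -/
def pt' (u v w : ℝ) : E2 :=
  u • sp (f T.α : X V) + v • sp (f T.β : X V) + w • sp (f T.γ : X V)

theorem rot_pt (u v w : ℝ) : T.rot.pt u v w = T.pt w u v := by
  simp only [pt, rot]; abel

theorem rot_pt' (u v w : ℝ) : T.rot.pt' f u v w = T.pt' f w u v := by
  simp only [pt', rot]; abel

theorem swap_pt (u v w : ℝ) : T.swap.pt u v w = T.pt u w v := by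
  simp only [pt, swap]; abel

theorem swap_pt' (u v w : ℝ) :
    T.swap.pt' f u v w = T.pt' f u w v := by
  simp only [pt', swap]; abel

theorem exists_pt (x : E2) : ∃ u v w : ℝ, u + v + w = 1 ∧ x = T.pt u v w :=
  exists_coords T.ne x

theorem pt_inj {u v w u' v' w' : ℝ} (h : u + v + w = 1) (h' : u' + v' + w' = 1)
    (he : T.pt u v w = T.pt u' v' w') : u = u' ∧ v = v' ∧ w = w' := by
  have key : ∀ (T : Tri U) {u v w u' v' w' : ℝ}, u + v + w = 1 → u' + v' + w' = 1 →
      T.pt u v w = T.pt u' v' w' → u = u' := fun T u v w u' v' w' h h' he => by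
    rw [← bary_combo T.ne h, ← bary_combo T.ne h']
    exact congrArg _ he
  refine ⟨key T h h' he, key T.rot (u := v) (v := w) (w := u) (u' := v') (v' := w') (w' := u')
    (by linarith) (by linarith) (by rw [rot_pt, rot_pt, he]), key T.rot.rot (u := w) (v := u)
    (w := v) (u' := w') (v' := u') (w' := v') (by linarith) (by linarith) ?_⟩
  rw [rot_pt, rot_pt, rot_pt, rot_pt, he]

theorem pt_combo (t u v w u' v' w' : ℝ) :
    (1 - t) • T.pt u v w + t • T.pt u' v' w' =
      T.pt ((1 - t) * u + t * u') ((1 - t) * v + t * v') ((1 - t) * w + t * w') := by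
  simp only [pt]; module

theorem pt'_combo (t u v w u' v' w' : ℝ) :
    (1 - t) • T.pt' f u v w + t • T.pt' f u' v' w' =
      T.pt' f ((1 - t) * u + t * u') ((1 - t) * v + t * v') ((1 - t) * w + t * w') := by
  simp only [pt']; module

theorem pt_one : T.pt 1 0 0 = sp (T.α : X U) := by simp [pt]

theorem pt'_one : T.pt' f 1 0 0 = sp (f T.α : X V) := by simp [pt']

theorem pt_mem_disk (h : u + v + w = 1) (hu : 0 ≤ u) (hv : 0 ≤ v)
    (hw : 0 ≤ w) (hu1 : u < 1) (hv1 : v < 1) (hw1 : w < 1) : T.pt u v w ∈ disk T.D := by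
  have key : ∀ (T : Tri U) {u v w : ℝ}, u + v + w = 1 → 0 ≤ u → 0 ≤ v → 0 ≤ w → u < 1 →
      0 < u * ‖sp (T.α : X U) - T.pt u v w‖ ^ 2 ∨ u = 0 := fun T u v w h hu hv hw hu1 => by
    rcases hu.eq_or_lt with h0 | h0
    · exact Or.inr h0.symm
    · refine Or.inl (mul_pos h0 (pow_pos (norm_pos_iff.2 (sub_ne_zero.2 fun he => ?_)) 2))
      rw [← T.pt_one] at he
      exact hu1.ne' (T.pt_inj (by norm_num) h he).1
  have h1 := sum_pw (y := T.pt u v w) (w := ![u, v, w])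
    (a := ![sp (T.α : X U), sp (T.β : X U), sp (T.γ : X U)])
    (by simpa [Fin.sum_univ_three] using h) (by simp [Fin.sum_univ_three, pt]) T.D
  simp only [Fin.sum_univ_three, Matrix.cons_val_zero, Matrix.cons_val_one,
    Matrix.cons_val, T.onα, T.onβ, T.onγ, mul_zero, add_zero] at h1
  have k1 := key T h hu hv hw hu1
  have k2 := key T.rot (u := v) (v := w) (w := u) (by linarith) hv hw hu hv1
  have k3 := key T.rot.rot (u := w) (v := u) (w := v) (by linarith) hw hu hv hw1
  rw [rot_pt] at k2
  rw [rot_pt, rot_pt] at k3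
  simp only [rot] at k2 k3
  have n1 : 0 ≤ u * ‖sp (T.α : X U) - T.pt u v w‖ ^ 2 := by positivity
  have n2 : 0 ≤ v * ‖sp (T.β : X U) - T.pt u v w‖ ^ 2 := by positivity
  have n3 : 0 ≤ w * ‖sp (T.γ : X U) - T.pt u v w‖ ^ 2 := by positivity
  show pw T.D (T.pt u v w) < 0
  rcases k1 with k1 | k1
  · linarith
  rcases k2 with k2 | k2
  · linarith
  rcases k3 with k3 | k3
  · linarith
  · linarith

theorem disk_subset : disk T.D ⊆ U.set :=
  T.accα.subset

/-- Every nonvertex point of the closed triangle has an obvious representation. -/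
def rep (h : u + v + w = 1) (hu : 0 ≤ u) (hv : 0 ≤ v)
    (hw : 0 ≤ w) (hu1 : u < 1) (hv1 : v < 1) (hw1 : w < 1) : Rep U (T.pt u v w) where
  I := Fin 3
  fin := inferInstance
  D := T.D
  w := ![u, v, w]
  el := ![T.α, T.β, T.γ]
  w_nonneg := by intro i; fin_cases i <;> assumption
  w_sum := by simpa [Fin.sum_univ_three] using h
  acc := by
    intro i
    fin_cases i
    · exact T.accα
    · exact T.accβ
    · exact T.accγ
  on := by
    intro i
    fin_cases i
    · exact T.onα
    · exact T.onβ
    · exact T.onγ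
  empty := T.empty
  mem := T.pt_mem_disk h hu hv hw hu1 hv1 hw1
  rep := by simp [Fin.sum_univ_three, pt]

theorem unf_pt (h : u + v + w = 1) (hu : 0 ≤ u)
    (hv : 0 ≤ v) (hw : 0 ≤ w) (hu1 : u < 1) (hv1 : v < 1) (hw1 : w < 1) :
    unf f (T.pt u v w) = T.pt' f u v w := by
  rw [(T.rep h hu hv hw hu1 hv1 hw1).unf_eq f]
  refine (Fin.sum_univ_three (fun i : Fin 3 => ![u, v, w] i •
    im f ((![(T.α : X U), T.β, T.γ] : Fin 3 → X U) i))).trans ?_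
  simp only [pt', Matrix.cons_val_zero, Matrix.cons_val_one, Matrix.cons_val, im_coe]

theorem visβγ : Vis (T.β : X U) T.γ := by
  refine T.accβ.vis T.accγ ?_
  rw [openSegment_eq_image]
  rintro _ ⟨t, ht, rfl⟩
  have h := T.pt_mem_disk (u := 0) (v := 1 - t) (w := t) (by ring) le_rfl (by linarith [ht.2])
    ht.1.le one_pos (by linarith [ht.1]) ht.2
  simpa [pt] using h

theorem visαβ : Vis (T.α : X U) T.β := T.rot.rot.visβγ

theorem dist_sp :
    dist (sp (f T.β : X V)) (sp (f T.γ : X V)) = dist (sp (T.β : X U)) (sp (T.γ : X U)) := by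
  rw [← im_coe, ← im_coe, T.visβγ.dist_im f]

theorem norm_smul_add_smul_sq (x y : E2) (s t : ℝ) : ‖s • x + t • y‖ ^ 2 =
    s ^ 2 * ‖x‖ ^ 2 + t ^ 2 * ‖y‖ ^ 2 + s * t * (‖x‖ ^ 2 + ‖y‖ ^ 2 - ‖x - y‖ ^ 2) := by
  rw [norm_add_sq_real, norm_sub_sq_real, norm_smul, norm_smul, inner_smul_left, inner_smul_right,
    mul_pow, mul_pow, Real.norm_eq_abs, Real.norm_eq_abs, sq_abs, sq_abs]
  simp only [conj_trivial]
  ring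

theorem dist_pt {u v w u' v' w' : ℝ} (h : u + v + w = 1)
    (h' : u' + v' + w' = 1) :
    dist (T.pt' f u v w) (T.pt' f u' v' w') = dist (T.pt u v w) (T.pt u' v' w') := by
  have d1 := T.dist_sp f
  have d2 := T.rot.dist_sp f
  have d3 := T.rot.rot.dist_sp f
  simp only [rot] at d2 d3
  rw [dist_comm, dist_comm (sp (T.γ : X U))] at d2
  rw [dist_eq_norm, dist_eq_norm] at d1 d2 d3
  refine (pow_left_inj₀ dist_nonneg dist_nonneg two_ne_zero).1 ?_
  obtain rfl : u = 1 - v - w := by linarith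
  obtain rfl : u' = 1 - v' - w' := by linarith
  have e1 : T.pt' f (1 - v - w) v w - T.pt' f (1 - v' - w') v' w' =
      (v' - v) • (sp (f T.α : X V) - sp (f T.β : X V)) +
        (w' - w) • (sp (f T.α : X V) - sp (f T.γ : X V)) := by
    simp only [pt']; module
  have e2 : T.pt (1 - v - w) v w - T.pt (1 - v' - w') v' w' =
      (v' - v) • (sp (T.α : X U) - sp (T.β : X U)) +
        (w' - w) • (sp (T.α : X U) - sp (T.γ : X U)) := by
    simp only [pt]; module
  rw [dist_eq_norm, dist_eq_norm, e1, e2, norm_smul_add_smul_sq, norm_smul_add_smul_sq,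
    sub_sub_sub_cancel_left, sub_sub_sub_cancel_left, d2, d3, norm_sub_rev (sp (f T.γ : X V)),
    norm_sub_rev (sp (T.γ : X U)), d1]

theorem cr_sq (x y : E2) : cr x y ^ 2 =
    ‖x‖ ^ 2 * ‖y‖ ^ 2 - ((‖x‖ ^ 2 + ‖y‖ ^ 2 - ‖x - y‖ ^ 2) / 2) ^ 2 := by
  simp only [cr, EuclideanSpace.norm_sq_eq, Fin.sum_univ_two, PiLp.sub_apply, Real.norm_eq_abs,
    sq_abs]
  ring

theorem ne' :
    cr (sp (f T.β : X V) - sp (f T.α : X V)) (sp (f T.γ : X V) - sp (f T.α : X V)) ≠ 0 := by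
  have d1 := T.dist_sp f
  have d2 := T.rot.dist_sp f
  have d3 := T.rot.rot.dist_sp f
  simp only [rot] at d2 d3
  rw [dist_eq_norm, dist_eq_norm] at d1 d2 d3
  have h := T.ne
  rw [← sq_pos_iff, cr_sq, sub_sub_sub_cancel_right] at h ⊢
  rwa [d1, d2, norm_sub_rev (sp (f T.β : X V)), d3, norm_sub_rev (sp (T.α : X U))]

theorem exists_pt' (x : E2) :
    ∃ u v w : ℝ, u + v + w = 1 ∧ x = T.pt' f u v w :=
  exists_coords (T.ne' f) x

theorem pt'_inj {u v w u' v' w' : ℝ} (h : u + v + w = 1)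
    (h' : u' + v' + w' = 1) (he : T.pt' f u v w = T.pt' f u' v' w') : u = u' ∧ v = v' ∧ w = w' := by
  have := T.dist_pt f h h'
  rw [he, dist_self] at this
  exact T.pt_inj h h' (dist_eq_zero.1 this.symm)

theorem pt_mem_core (h : u + v + w = 1) (hu : 0 < u) (hv : 0 < v)
    (hw : 0 < w) : T.pt u v w ∈ core U :=
  ⟨T.disk_subset (T.pt_mem_disk h hu.le hv.le hw.le (by linarith) (by linarith) (by linarith)),
    combo_mem_interior (convex_convexHull ℝ _) (mem_hull_of_bd T.α.2) (mem_hull_of_bd T.β.2)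
      (mem_hull_of_bd T.γ.2) T.ne h hu hv hw⟩

theorem pt'_mem_core (h : u + v + w = 1) (hu : 0 < u)
    (hv : 0 < v) (hw : 0 < w) (hV : T.pt' f u v w ∈ V.set) : T.pt' f u v w ∈ core V :=
  ⟨hV, combo_mem_interior (convex_convexHull ℝ _) (mem_hull_of_bd (f T.α).2)
    (mem_hull_of_bd (f T.β).2) (mem_hull_of_bd (f T.γ).2) (T.ne' f) h hu hv hw⟩

theorem edge {t : ℝ} (ht : t ∈ Ioo (0:ℝ) 1) :
    T.pt' f 0 (1 - t) t ∈ V.set := by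
  refine (T.visβγ.map f (ξ := T.β) (ζ := T.γ)).subset ?_
  exact mem_oseg.2 ⟨t, ht, by simp [pt']⟩

theorem edge_γ {t : ℝ} (ht : t ∈ Ioo (0:ℝ) 1) :
    T.pt' f (1 - t) t 0 ∈ V.set := by
  have := T.rot.rot.edge f ht
  rwa [rot_pt', rot_pt'] at this

theorem edge_β {t : ℝ} (ht : t ∈ Ioo (0:ℝ) 1) :
    T.pt' f (1 - t) 0 t ∈ V.set := by
  have := T.swap.edge_γ f ht
  rwa [swap_pt'] at this

end Tri

theorem Vis.dist_unf_le {A : Set E2} (hA : A ⊆ frontier U.set)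
    (hAb : Bornology.IsBounded A) {β γ : X U} (h : Vis β γ) {t : ℝ} (ht : t ∈ Ioo (0:ℝ) 1) {v : E2}
    (hv : v ∈ core U)
    (hs : openSegment ℝ ((1 - t) • sp β + t • sp γ) v ⊆ core U ∩ convexHull ℝ A) :
    dist (unf f v) ((1 - t) • im f β + t • im f γ) ≤
      dist v ((1 - t) • sp β + t • sp γ) := by
  set p := (1 - t) • sp β + t • sp γ with hp
  refine le_of_forall_pos_lt_add fun ε hε => ?_
  obtain ⟨δ, hδ, hn⟩ := h.unf_near f hA hAb ht hε
  have hlim : Tendsto (fun s : ℝ => s * dist v p) (nhds 0) (nhds (0 * dist v p)) :=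
    (by fun_prop : Continuous fun s : ℝ => s * dist v p).tendsto 0
  rw [zero_mul] at hlim
  obtain ⟨r, hr, hrb⟩ := Metric.eventually_nhds_iff.1 (hlim.eventually_lt_const hδ)
  obtain ⟨s, hs0, hs1⟩ := _root_.exists_between (lt_min hr one_pos)
  have hsr := hrb (y := s) (by
    rw [Real.dist_eq, sub_zero, abs_of_pos hs0]; exact hs1.trans_le (min_le_left _ _))
  have hs1' : s < 1 := hs1.trans_le (min_le_right _ _)
  set q := (1 - s) • p + s • v with hq
  have hqm : q ∈ openSegment ℝ p v := by
    exact oseg_mem ⟨hs0, hs1'⟩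
  have hqp : dist q p = s * dist v p := by
    have : q - p = s • (v - p) := by rw [hq]; module
    rw [dist_eq_norm, this, norm_smul, Real.norm_of_nonneg hs0.le, dist_eq_norm]
  have h1 := hn q (hs hqm) (by rw [hqp]; exact hsr)
  have h2 : dist (unf f v) (unf f q) ≤ dist v q := by
    refine HBoundary.dist_unf_le f fun x hx => ?_
    rw [segment_symm, ← insert_endpoints_openSegment] at hx
    rcases hx with rfl | rfl | hx
    · exact (hs hqm).1
    · exact hv
    · exact (hs (openSegment_subset_left hqm hx)).1
  have h3 := dist_add_openSegment hqm
  have h4 := dist_triangle (unf f v) (unf f q) ((1 - t) • im f β + t • im f γ)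
  have h5 : 0 ≤ dist p q := dist_nonneg
  rw [dist_comm q v, dist_comm p v] at h3
  linarith

namespace Tri

/-- The vertices of the image triangle. -/
def vert' : Set E2 :=
  {sp (f T.α : X V), sp (f T.β : X V), sp (f T.γ : X V)}

theorem vert'_subset : T.vert' f ⊆ frontier V.set := by
  rintro x (rfl | rfl | rfl)
  · exact sp_mem_frontier (f T.α).2
  · exact sp_mem_frontier (f T.β).2
  · exact sp_mem_frontier (f T.γ).2

theorem isBounded_vert' : Bornology.IsBounded (T.vert' f) := by
  unfold vert'
  exact (toFinite _).isBounded

theorem pt'_mem_hull (h : u + v + w = 1) (hu : 0 ≤ u)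
    (hv : 0 ≤ v) (hw : 0 ≤ w) : T.pt' f u v w ∈ convexHull ℝ (T.vert' f) :=
  combo_mem (convex_convexHull ℝ _) (subset_convexHull ℝ _ (by simp [vert']))
    (subset_convexHull ℝ _ (by simp [vert'])) (subset_convexHull ℝ _ (by simp [vert'])) h hu hv hw

theorem dist_edge_le {t u v w : ℝ} (ht : t ∈ Ioo (0:ℝ) 1)
    (h : u + v + w = 1) (hu : 0 < u) (hv : 0 < v) (hw : 0 < w)
    (hs : openSegment ℝ (T.pt' f (1 - t) t 0) (T.pt' f u v w) ⊆ V.set)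
    (hV : T.pt' f u v w ∈ V.set) :
    dist (unf f.symm (T.pt' f u v w)) (T.pt (1 - t) t 0) ≤
      dist (T.pt' f u v w) (T.pt' f (1 - t) t 0) := by
  have hvis : Vis (f T.α : X V) (f T.β) := T.visαβ.map f
  have := hvis.dist_unf_le f.symm (T.vert'_subset f) (T.isBounded_vert' f) ht
    (T.pt'_mem_core f h hu hv hw hV) (by
      have e : (1 - t) • sp (f T.α : X V) + t • sp (f T.β : X V) = T.pt' f (1 - t) t 0 := by
        simp [pt']
      rw [e]
      intro x hx
      have hxV := hs hx
      obtain ⟨s, hs, rfl⟩ := mem_oseg.1 hx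
      rw [pt'_combo] at hxV ⊢
      have h1 : 0 < 1 - s := by linarith [hs.2]
      have h2 : 0 < 1 - t := by linarith [ht.2]
      have h3 := mul_pos hs.1 hu
      have h4 := mul_pos hs.1 hv
      have h5 := mul_pos hs.1 hw
      have h6 := mul_pos h1 h2
      have h7 := mul_pos h1 ht.1
      have hsum : (1 - s) * (1 - t) + s * u + ((1 - s) * t + s * v) + ((1 - s) * 0 + s * w) = 1 := by
        linear_combination s * h
      exact ⟨T.pt'_mem_core f hsum (by linarith) (by linarith) (by linarith) hxV,
        T.pt'_mem_hull f hsum (by linarith) (by linarith) (by linarith)⟩)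
  rw [im_symm_coe, im_symm_coe] at this
  simpa [pt, pt'] using this

theorem crosscut {l m τ : ℝ} (hl : l ∈ Ioo (0:ℝ) 1)
    (hm : m ∈ Ioo (0:ℝ) 1) (hτ : τ ∈ Ioo (0:ℝ) 1)
    (h : segment ℝ (T.pt' f (1 - l) l 0) (T.pt' f (1 - m) 0 m) ⊆ V.set) :
    unf f.symm (T.pt' f ((1 - τ) * (1 - l) + τ * (1 - m)) ((1 - τ) * l) (τ * m)) =
      T.pt ((1 - τ) * (1 - l) + τ * (1 - m)) ((1 - τ) * l) (τ * m) := by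
  set u := (1 - τ) * (1 - l) + τ * (1 - m) with hu
  set v := (1 - τ) * l with hv
  set w := τ * m with hw
  have h1 : 0 < 1 - τ := by linarith [hτ.2]
  have hu0 : 0 < u := by
    have := mul_pos h1 (show 0 < 1 - l by linarith [hl.2])
    have := mul_pos hτ.1 (show 0 < 1 - m by linarith [hm.2])
    linarith
  have hv0 : 0 < v := mul_pos h1 hl.1
  have hw0 : 0 < w := mul_pos hτ.1 hm.1
  have hs : u + v + w = 1 := by rw [hu, hv, hw]; ring
  have e : T.pt' f u v w = (1 - τ) • T.pt' f (1 - l) l 0 + τ • T.pt' f (1 - m) 0 m := by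
    rw [pt'_combo]; congr 1 <;> simp [hv, hw]
  have e' : T.pt u v w = (1 - τ) • T.pt (1 - l) l 0 + τ • T.pt (1 - m) 0 m := by
    rw [pt_combo]; congr 1 <;> simp [hv, hw]
  have hmem : T.pt' f u v w ∈ openSegment ℝ (T.pt' f (1 - l) l 0) (T.pt' f (1 - m) 0 m) := by
    exact mem_oseg.2 ⟨τ, hτ, e.symm⟩
  have hmem' := hmem
  rw [openSegment_symm] at hmem'
  have hos := (openSegment_subset_segment ℝ _ _).trans h
  have hV := hos hmem
  have s2 := (openSegment_subset_left hmem).trans hos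
  have s1 := (openSegment_subset_left hmem').trans
    ((openSegment_symm ℝ _ _).le.trans hos)
  rw [openSegment_symm] at s1 s2
  have k1 := T.dist_edge_le f hl hs hu0 hv0 hw0 s1 hV
  have k2 := T.swap.dist_edge_le f hm (u := u) (v := w) (w := v) (by linarith) hu0 hw0 hv0
    (by rwa [swap_pt', swap_pt']) (by rwa [swap_pt'])
  rw [swap_pt', swap_pt', swap_pt] at k2
  have d := T.dist_pt f (u := 1 - l) (v := l) (w := 0) (u' := 1 - m) (v' := 0) (w' := m) (by ring)
    (by ring)
  rw [e']
  refine eq_of_dist_le ?_ ?_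
  · rw [dist_comm]
    refine k1.trans (le_of_eq ?_)
    have : T.pt' f u v w - T.pt' f (1 - l) l 0 =
        τ • (T.pt' f (1 - m) 0 m - T.pt' f (1 - l) l 0) := by rw [e]; module
    rw [dist_eq_norm, this, norm_smul, Real.norm_of_nonneg hτ.1.le, ← dist_eq_norm, dist_comm, d]
  · refine k2.trans (le_of_eq ?_)
    have : T.pt' f u v w - T.pt' f (1 - m) 0 m =
        (1 - τ) • (T.pt' f (1 - l) l 0 - T.pt' f (1 - m) 0 m) := by rw [e]; module
    rw [dist_eq_norm, this, norm_smul, Real.norm_of_nonneg h1.le, ← dist_eq_norm, d]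

/-- The open image triangle lies in the image domain. -/
def Free : Prop :=
  ∀ u v w : ℝ, u + v + w = 1 → 0 < u → 0 < v → 0 < w → T.pt' f u v w ∈ V.set

theorem Free.rot {T : Tri U} {f : bd U ≃ᵢ bd V} (h : T.rot.Free f) : T.Free f :=
  fun u v w hs hu hv hw => by
    have := h v w u (by linarith) hv hw hu
    rwa [rot_pt'] at this

theorem Free.swap {T : Tri U} {f : bd U ≃ᵢ bd V} (h : T.swap.Free f) : T.Free f :=
  fun u v w hs hu hv hw => by
    have := h u w v (by linarith) hu hw hv
    rwa [swap_pt'] at this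

theorem Free.unf_pt' {T : Tri U} {f : bd U ≃ᵢ bd V} (h : T.Free f)
    (hs : u + v + w = 1) (hu : 0 < u) (hv : 0 < v) (hw : 0 < w) :
    unf f.symm (T.pt' f u v w) = T.pt u v w := by
  have hl : v + w ∈ Ioo (0:ℝ) 1 := ⟨by linarith, by linarith⟩
  have hτ : w / (v + w) ∈ Ioo (0:ℝ) 1 := ⟨by positivity, by rw [div_lt_one hl.1]; linarith⟩
  have := T.crosscut f hl hl hτ (by
    rw [← insert_endpoints_openSegment, insert_subset_iff, insert_subset_iff]
    refine ⟨T.edge_γ f hl, T.edge_β f hl, ?_⟩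
    rw [openSegment_eq_image]
    rintro _ ⟨s, hs', rfl⟩
    simp only [pt'_combo]
    have h1 : 0 < 1 - s := by linarith [hs'.2]
    have h2 := mul_pos h1 hl.1
    have h3 := mul_pos hs'.1 hl.1
    exact h _ _ _ (by ring) (by linarith) (by linarith) (by linarith))
  have e1 : (1 - w / (v + w)) * (v + w) = v := by field_simp; ring
  have e2 : w / (v + w) * (v + w) = w := div_mul_cancel₀ _ hl.1.ne'
  have e3 : (1 - w / (v + w)) * (1 - (v + w)) + w / (v + w) * (1 - (v + w)) = u := by
    linear_combination -hs
  rwa [e1, e2, e3] at this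

theorem free_of_crosscut {l m : ℝ} (hl : l ∈ Ioo (0:ℝ) 1)
    (hm : m ∈ Ioo (0:ℝ) 1)
    (h : segment ℝ (T.pt' f (1 - l) l 0) (T.pt' f (1 - m) 0 m) ⊆ V.set) : T.Free f := by
  intro u v w hs hu hv hw
  by_contra hz
  set l₁ := v + w with hl₁d
  have hl₁ : l₁ ∈ Ioo (0:ℝ) 1 := ⟨by linarith, by linarith⟩
  set L : ℝ → ℝ := fun s => (1 - s) * l + s * l₁ with hL
  set M : ℝ → ℝ := fun s => (1 - s) * m + s * l₁ with hM
  set Y : ℝ → ℝ → E2 := fun s τ =>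
    T.pt' f ((1 - τ) * (1 - L s) + τ * (1 - M s)) ((1 - τ) * L s) (τ * M s) with hY
  have hLm : ∀ s ∈ Icc (0:ℝ) 1, L s ∈ Ioo (0:ℝ) 1 := fun s hs' =>
    (convex_Ioo (0:ℝ) 1) hl hl₁ (by linarith [hs'.2]) hs'.1 (by ring)
  have hMm : ∀ s ∈ Icc (0:ℝ) 1, M s ∈ Ioo (0:ℝ) 1 := fun s hs' =>
    (convex_Ioo (0:ℝ) 1) hm hl₁ (by linarith [hs'.2]) hs'.1 (by ring)
  have hYc : Continuous fun q : ℝ × ℝ => Y q.1 q.2 := by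
    simp only [hY, hL, hM, pt']; fun_prop
  have hseg : ∀ s τ, Y s τ = (1 - τ) • T.pt' f (1 - L s) (L s) 0 + τ • T.pt' f (1 - M s) 0 (M s) := by
    intro s τ
    rw [pt'_combo]
    simp only [hY, mul_zero, add_zero, zero_add]
  have hcl : IsCompact ((Icc (0:ℝ) 1 ×ˢ Icc (0:ℝ) 1) ∩ (fun q : ℝ × ℝ => Y q.1 q.2) ⁻¹' V.setᶜ) :=
    (isCompact_Icc.prod isCompact_Icc).inter_right (V.isDom.1.isClosed_compl.preimage hYc)
  obtain ⟨⟨s, τ⟩, ⟨⟨hs1, hτ1⟩, hbad⟩, hmin⟩ := hcl.exists_isMinOn ⟨(1, w / l₁), by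
    refine ⟨⟨by simp, div_nonneg hw.le hl₁.1.le, by rw [div_le_one hl₁.1]; linarith⟩, ?_⟩
    simp only [mem_preimage, mem_compl_iff]
    convert hz using 2
    simp only [hY, hL, hM]
    have e1 : (1 - w / l₁) * l₁ = v := by
      have := hl₁.1.ne'
      field_simp
      ring
    have e2 : w / l₁ * l₁ = w := div_mul_cancel₀ _ hl₁.1.ne'
    have e3 : (1 - w / l₁) * (1 - l₁) + w / l₁ * (1 - l₁) = u := by
      linear_combination -hs
    norm_num [e1, e2, e3]⟩ continuous_fst.continuousOn
  simp only at hs1 hτ1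
  have hbad' : Y s τ ∉ V.set := hbad
  have hgood : ∀ s' ∈ Ico (0:ℝ) s, ∀ τ' ∈ Icc (0:ℝ) 1, Y s' τ' ∈ V.set := by
    intro s' hs' τ' hτ'
    by_contra hn
    have := hmin (show (s', τ') ∈ _ from ⟨⟨⟨hs'.1, hs'.2.le.trans hs1.2⟩, hτ'⟩, hn⟩)
    exact (show s ≤ s' from this).not_gt hs'.2
  have hτ2 : τ ∈ Ioo (0:ℝ) 1 := by
    refine ⟨lt_of_le_of_ne hτ1.1 ?_, lt_of_le_of_ne hτ1.2 ?_⟩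
    · rintro rfl
      apply hbad'
      rw [hseg]
      simpa using T.edge_γ f (hLm s hs1)
    · rintro rfl
      apply hbad'
      rw [hseg]
      simpa using T.edge_β f (hMm s hs1)
  have hs0 : 0 < s := by
    refine lt_of_le_of_ne hs1.1 ?_
    rintro rfl
    apply hbad'
    apply h
    rw [hseg, segment_eq_image]
    exact ⟨τ, hτ1, by simp [hL, hM]⟩
  have hcore : ∀ s' ∈ Icc (0:ℝ) 1, Y s' τ ∈ V.set → Y s' τ ∈ core V := by
    intro s' hs' hV
    have h1 : 0 < 1 - τ := by linarith [hτ2.2]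
    have := mul_pos h1 (show 0 < 1 - L s' by linarith [(hLm s' hs').2])
    have := mul_pos hτ2.1 (show 0 < 1 - M s' by linarith [(hMm s' hs').2])
    exact T.pt'_mem_core f (by ring) (by linarith) (mul_pos h1 (hLm s' hs').1)
      (mul_pos hτ2.1 (hMm s' hs').1) hV
  have hG : ∀ s' ∈ Ico (0:ℝ) s, unf f.symm (Y s' τ) =
      T.pt ((1 - τ) * (1 - L s') + τ * (1 - M s')) ((1 - τ) * L s') (τ * M s') := by
    intro s' hs'
    have hs'' : s' ∈ Icc (0:ℝ) 1 := ⟨hs'.1, hs'.2.le.trans hs1.2⟩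
    refine T.crosscut f (hLm s' hs'') (hMm s' hs'') hτ2 ?_
    rw [segment_eq_image]
    rintro _ ⟨τ', hτ', rfl⟩
    have := hgood s' hs' τ' hτ'
    rwa [hseg] at this
  have hline : ∀ t : ℝ, Y (t * s) τ = (1 - t) • Y 0 τ + t • Y s τ := by
    intro t
    simp only [hY, hL, hM, pt'_combo]
    congr 1 <;> ring
  have hsub : openSegment ℝ (Y 0 τ) (Y s τ) ⊆ V.set := by
    rw [openSegment_eq_image]
    rintro _ ⟨t, ht, rfl⟩
    have := hgood (t * s) ⟨mul_nonneg ht.1.le hs0.le, mul_lt_of_lt_one_left hs0 ht.2⟩ τ hτ1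
    rwa [hline] at this
  obtain ⟨ζ, hζs, hζ⟩ := exists_accOn (convex_openSegment (𝕜 := ℝ) _ _) hsub
    (segment_subset_closure_openSegment (right_mem_segment ℝ (Y 0 τ) (Y s τ))) hbad'
  have h0 : Y 0 τ ∈ convexHull ℝ (frontier V.set) :=
    interior_subset (hcore 0 (by simp) (hgood 0 ⟨le_rfl, hs0⟩ τ hτ1)).2
  have hlim : ∀ ε > 0, dist (T.pt ((1 - τ) * (1 - L s) + τ * (1 - M s)) ((1 - τ) * L s) (τ * M s))
      (im f.symm ζ) ≤ ε := by
    intro ε hε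
    obtain ⟨t₀, ht₀, hn⟩ := unf_near_im f.symm (x := Y 0 τ) h0 (by rwa [hζs]) (half_pos hε)
    set z : ℝ → E2 := fun t => T.pt ((1 - τ) * (1 - L (t * s)) + τ * (1 - M (t * s)))
      ((1 - τ) * L (t * s)) (τ * M (t * s)) with hzd
    have hzc : Continuous z := by simp only [hzd, hL, hM, pt]; fun_prop
    obtain ⟨δ, hδ, hz1⟩ := Metric.continuous_iff.1 hzc 1 (ε / 2) (half_pos hε)
    obtain ⟨t, ht, ht'⟩ := _root_.exists_between (show max t₀ (1 - δ) < 1 from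
      max_lt ht₀.2 (by linarith))
    have ht1 : t₀ < t := (le_max_left _ _).trans_lt ht
    have ht2 : 1 - δ < t := (le_max_right _ _).trans_lt ht
    have ht3 : 0 ≤ t := ht₀.1.trans ht1.le
    have hts : t * s ∈ Ico 0 s := ⟨mul_nonneg ht3 hs0.le, mul_lt_of_lt_one_left hs0 ht'⟩
    have k1 := hz1 t (by rw [Real.dist_eq, abs_sub_comm, abs_of_pos] <;> linarith)
    have k2 := hn t ⟨ht1, ht'⟩ (by
      rw [hζs, ← hline]
      exact hcore _ ⟨hts.1, hts.2.le.trans hs1.2⟩ (hgood _ hts τ hτ1))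
    rw [hζs, ← hline, hG _ hts] at k2
    have k3 := dist_triangle_left (z 1) (im f.symm ζ) (z t)
    simp only [hzd, one_mul] at k1 k2 k3 ⊢
    linarith
  have heq := dist_le_zero.1 (le_of_forall_pos_le_add fun ε hε => by simpa using hlim ε hε)
  have hfr := im_mem_frontier f.symm hζ.1
  rw [← heq, U.isDom.1.frontier_eq] at hfr
  have h1 : 0 < 1 - τ := by linarith [hτ2.2]
  have p1 := mul_pos h1 (show 0 < 1 - L s by linarith [(hLm s hs1).2])
  have p2 := mul_pos hτ2.1 (show 0 < 1 - M s by linarith [(hMm s hs1).2])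
  exact hfr.2 (T.pt_mem_core (by ring) (by linarith) (mul_pos h1 (hLm s hs1).1)
      (mul_pos hτ2.1 (hMm s hs1).1)).1

end Tri

theorem Vis.subset' {α β : X W} (h : Vis α β) :
    openSegment ℝ (sp α) (sp β) ⊆ W.set := h.1.subset

theorem sp_bd_notMem (α : bd W) : sp (α : X W) ∉ W.set := by
  have := sp_mem_frontier α.2
  rw [W.isDom.1.frontier_eq] at this
  exact this.2

theorem notMem_of_frontier (h : x ∈ frontier W.set) : x ∉ W.set := by
  rw [W.isDom.1.frontier_eq] at h
  exact h.2

theorem AccOn.dist_le_of_openSegment {p : E2} (hp : p ∈ W.set) {α : X W}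
    (h : AccOn (openSegment ℝ p (sp α)) α) : dist (ι p hp : X W) α ≤ dist p (sp α) := by
  refine le_of_forall_pos_le_add fun ε hε => ?_
  obtain ⟨r, hr, hb⟩ := Metric.isOpen_iff.1 W.isDom.1 p hp
  have hpa : p ≠ sp α := fun he => by
    have := h.1
    rw [mem_bd_iff] at this
    exact this (he ▸ hp)
  have hd : 0 < dist p (sp α) := dist_pos.2 hpa
  obtain ⟨s, hs0, hs1⟩ := _root_.exists_between (lt_min one_pos
    (div_pos (lt_min hr (half_pos hε)) hd))
  have hs1' : s < 1 := hs1.trans_le (min_le_left _ _)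
  have hs2 : s * dist p (sp α) < min r (ε / 2) := by
    rw [← lt_div_iff₀ hd]; exact hs1.trans_le (min_le_right _ _)
  set q := (1 - s) • p + s • sp α with hq
  have hqm : q ∈ openSegment ℝ p (sp α) := by
    exact oseg_mem ⟨hs0, hs1'⟩
  have hqp : dist q p = s * dist p (sp α) := by
    have : q - p = s • (sp α - p) := by rw [hq]; module
    rw [dist_eq_norm, this, norm_smul, Real.norm_of_nonneg hs0.le, dist_comm, dist_eq_norm]
  have h1 := h.dist_eq hqm (h.subset hqm)
  have h2 := dist_ι_of_ball hb (mem_ball_self hr)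
    (show q ∈ ball p r by rw [mem_ball, hqp]; exact hs2.trans_le (min_le_left _ _))
  have h3 := dist_triangle (ι p hp : X W) (ι q (h.subset hqm)) α
  have h4 := dist_add_openSegment hqm
  have h5 : dist p q < ε / 2 := by
    rw [dist_comm, hqp]; exact hs2.trans_le (min_le_right _ _)
  have h6 : dist (ι p hp : X W) (ι q (h.subset hqm)) = dist p q := h2
  linarith

namespace Tri

theorem free_of_vis {κ ζ : X U} (h : Vis κ ζ) {l m : ℝ}
    (hl : l ∈ Ioo (0:ℝ) 1) (hm : m ∈ Ioo (0:ℝ) 1)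
    (h1 : T.pt (1 - l) l 0 ∈ openSegment ℝ (sp κ) (sp ζ))
    (h2 : T.pt (1 - m) 0 m ∈ openSegment ℝ (sp κ) (sp ζ)) : T.Free f := by
  have hc : openSegment ℝ (sp κ) (sp ζ) ⊆ core U := by
    have := (convex_openSegment (𝕜 := ℝ) (sp κ) (sp ζ)) h1 h2 (show (0:ℝ) ≤ 1 - 1 / 2 by norm_num)
      (show (0:ℝ) ≤ 1 / 2 by norm_num) (by norm_num)
    rw [pt_combo] at this
    refine h.openSegment_subset_core this (T.pt_mem_core ?_ ?_ ?_ ?_)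
    · ring
    · linarith [hl.2, hm.2]
    · linarith [hl.1]
    · linarith [hm.1]
  have key : ∀ {u v w : ℝ}, u + v + w = 1 → 0 ≤ u → 0 ≤ v → 0 ≤ w → u < 1 → v < 1 → w < 1 →
      T.pt u v w ∈ openSegment ℝ (sp κ) (sp ζ) →
      T.pt' f u v w ∈ openSegment ℝ (im f κ) (im f ζ) := by
    intro u v w hs hu hv hw hu1 hv1 hw1 hm
    have hmc := hc hm
    rw [← T.unf_pt f hs hu hv hw hu1 hv1 hw1]
    obtain ⟨t, ht, he⟩ := mem_oseg.1 hm
    rw [← he] at hmc ⊢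
    rw [h.unf_eq f ht hmc]
    exact oseg_mem ht
  refine T.free_of_crosscut f hl hm (Subset.trans ?_ (h.map_im f))
  exact (convex_openSegment (𝕜 := ℝ) _ _).segment_subset
    (key (by ring) (by linarith [hl.2]) hl.1.le le_rfl (by linarith [hl.1]) hl.2 one_pos h1)
    (key (by ring) (by linarith [hm.2]) le_rfl hm.1.le (by linarith [hm.1]) one_pos hm.2 h2)

theorem vertexα_notMem : T.pt 1 0 0 ∉ U.set := by
  rw [pt_one]; exact sp_bd_notMem T.α

theorem pt_mem_openSegment {x u v w u' v' w' : ℝ} (hx : x ∈ Ioo (0:ℝ) 1) :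
    T.pt ((1 - x) * u + x * u') ((1 - x) * v + x * v') ((1 - x) * w + x * w') ∈
      openSegment ℝ (T.pt u v w) (T.pt u' v' w') := by
  exact mem_oseg.2 ⟨x, hx, T.pt_combo _ _ _ _ _ _ _⟩

theorem pt'_mem_openSegment {x u v w u' v' w' : ℝ}
    (hx : x ∈ Ioo (0:ℝ) 1) :
    T.pt' f ((1 - x) * u + x * u') ((1 - x) * v + x * v') ((1 - x) * w + x * w') ∈
      openSegment ℝ (T.pt' f u v w) (T.pt' f u' v' w') := by
  exact mem_oseg.2 ⟨x, hx, T.pt'_combo f _ _ _ _ _ _ _⟩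

theorem free_of_exit {κ ζ : X U} (h : Vis κ ζ) {t u v w : ℝ}
    (ht : t ∈ Ioo (0:ℝ) 1) (hs : u + v + w = 1) (hu : 0 < u) (hv : v < 0)
    (hd : 0 < (1 - t) * w - t * v) (hp : T.pt 0 (1 - t) t ∈ openSegment ℝ (sp κ) (sp ζ))
    (hκ : sp κ = T.pt u v w) : T.Free f := by
  have h1 : 0 < 1 - t := by linarith [ht.2]
  have hden : 0 < (1 - t) - v := by linarith
  obtain ⟨x, hxm, hxe⟩ := exists_ratio h1 (d := (1 - t) - v) (by linarith)
  set m := (1 - x) * t + x * w with hm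
  have hm0 : 0 < m := by
    have : m = ((1 - t) * w - t * v) / ((1 - t) - v) := by
      rw [eq_div_iff hden.ne', hm]; linear_combination (-t + w) * hxe
    rw [this]; exact div_pos hd hden
  have hsum : x * u + m = 1 := by rw [hm]; linear_combination x * hs + hxe
  have hm1 : m < 1 := by have := mul_pos hxm.1 hu; linarith
  have hq : T.pt (1 - m) 0 m ∈ openSegment ℝ (sp κ) (sp ζ) := by
    have := T.pt_mem_openSegment (u := 0) (v := 1 - t) (w := t) (u' := u) (v' := v) (w' := w) hxm
    rw [← hκ] at this
    rw [openSegment_symm] at hp ⊢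
    convert openSegment_subset_left hp this using 2
    · linear_combination -hsum
    · linear_combination hxe
  refine (free_of_vis T.rot.rot f h (l := 1 - m) (m := 1 - t) ⟨by linarith, by linarith⟩
    ⟨h1, by linarith [ht.1]⟩ ?_ ?_).rot.rot
  · rw [rot_pt, rot_pt]; convert hq using 2; ring
  · rw [rot_pt, rot_pt]; convert hp using 2; ring

theorem eq_of_vis (hF : ¬ T.Free f) {κ ζ : X U} (h : Vis κ ζ)
    (hb : sp κ ∉ U.set) {t u v w : ℝ}
    (ht : t ∈ Ioo (0:ℝ) 1) (hs : u + v + w = 1) (hu : 0 < u)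
    (hp : T.pt 0 (1 - t) t ∈ openSegment ℝ (sp κ) (sp ζ))
    (hκ : sp κ = T.pt u v w) : κ = T.α := by
  have h1 : 0 < 1 - t := by linarith [ht.2]
  have hswap : w < 0 → 0 < t * v - (1 - t) * w → False := fun hw hd => hF <| Free.swap <|
    T.swap.free_of_exit f h (t := 1 - t) (u := u) (v := w) (w := v) ⟨h1, by linarith [ht.1]⟩
      (by linarith) hu hw (by linarith) (by rw [swap_pt]; convert hp using 2; ring)
      (by rw [swap_pt]; exact hκ)
  rcases lt_or_ge v 0 with hv | hv
  · exfalso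
    rcases lt_trichotomy ((1 - t) * w - t * v) 0 with hd | hd | hd
    · refine hswap ?_ (by linarith)
      by_contra! hw
      have := mul_nonneg h1.le hw
      have := mul_neg_of_pos_of_neg ht.1 hv
      linarith
    · have hden : 0 < (1 - t) - v := by linarith
      obtain ⟨x, hxm, hxe⟩ := exists_ratio h1 (d := (1 - t) - v) (by linarith)
      have := T.pt_mem_openSegment (u := 0) (v := 1 - t) (w := t) (u' := u) (v' := v) (w' := w) hxm
      rw [← hκ] at this
      rw [openSegment_symm] at hp
      have hw0 : (1 - x) * t + x * w = 0 := by
        have : ((1 - x) * t + x * w) * ((1 - t) - v) = 0 := by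
          linear_combination (-t + w) * hxe + hd
        exact (mul_eq_zero.1 this).resolve_right hden.ne'
      have := openSegment_subset_left hp this
      rw [openSegment_symm] at this
      apply T.vertexα_notMem
      convert h.subset' this using 2
      · linear_combination -x * hs - hxe + hw0
      · linear_combination hxe
      · exact hw0.symm
    · exact hF (T.free_of_exit f h ht hs hu hv hd hp hκ)
  · rcases lt_or_ge w 0 with hw | hw
    · exfalso
      refine hswap hw ?_
      have := mul_nonneg ht.1.le hv
      have := mul_neg_of_pos_of_neg h1 hw
      linarith
    · have hu1 : u = 1 := by
        by_contra hne
        have hu1 : u < 1 := lt_of_le_of_ne (by linarith) hne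
        exact hb (hκ ▸ T.disk_subset (T.pt_mem_disk hs hu.le hv hw hu1 (by linarith)
          (by linarith)))
      have hv0 : v = 0 := by linarith
      have hw0 : w = 0 := by linarith
      subst hu1 hv0 hw0
      have hκ' : sp κ = sp (T.α : X U) := hκ.trans T.pt_one
      refine h.1.eq T.accα hκ' ?_
      have hpd : T.pt 0 (1 - t) t ∈ disk T.D := T.pt_mem_disk (by ring) le_rfl h1.le ht.1.le one_pos
        (by linarith [ht.1]) ht.2
      refine closure_mono (subset_inter ?_ ?_)
        (segment_subset_closure_openSegment (left_mem_segment ℝ (sp κ) (T.pt 0 (1 - t) t)))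
      · rw [openSegment_symm] at hp
        have := openSegment_subset_left hp
        rwa [openSegment_symm ℝ _ (sp κ), openSegment_symm ℝ _ (sp κ)] at this
      · rw [hκ', openSegment_symm]
        exact openSegment_subset_disk hpd.le T.onα.le fun he => hpd.ne (he ▸ T.onα)

theorem eq_or_eq_of_vis {κ ζ : X U} (h : Vis κ ζ)
    (hb : sp κ ∉ U.set) {t v w : ℝ} (ht : t ∈ Ioo (0:ℝ) 1) (hs : v + w = 1)
    (hp : T.pt 0 (1 - t) t ∈ openSegment ℝ (sp κ) (sp ζ))
    (hκ : sp κ = T.pt 0 v w) : κ = T.β ∨ κ = T.γ := by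
  have key : ∀ (T : Tri U) {t v w : ℝ}, t ∈ Ioo (0:ℝ) 1 → v + w = 1 →
      T.pt 0 (1 - t) t ∈ openSegment ℝ (sp κ) (sp ζ) → sp κ = T.pt 0 v w → 0 ≤ v ∧
      (v = 1 → κ = T.β) := by
    intro T t v w ht hs hp hκ
    have h1 : 0 < 1 - t := by linarith [ht.2]
    rw [openSegment_symm] at hp
    refine ⟨?_, ?_⟩
    · by_contra! hv
      have hden : 0 < (1 - t) - v := by linarith
      obtain ⟨x, hxm, hxe⟩ := exists_ratio h1 (d := (1 - t) - v) (by linarith)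
      have := T.pt_mem_openSegment (u := 0) (v := 1 - t) (w := t) (u' := 0) (v' := v) (w' := w) hxm
      rw [← hκ] at this
      have := openSegment_subset_left hp this
      rw [openSegment_symm] at this
      refine sp_bd_notMem T.γ ?_
      have e : sp (T.γ : X U) = T.pt 0 0 1 := by simp [pt]
      rw [e]
      convert h.subset' this using 2
      · ring
      · linear_combination hxe
      · linear_combination -x * hs - hxe
    · rintro rfl
      have hw0 : w = 0 := by linarith
      subst hw0
      have hκ' : sp κ = sp (T.β : X U) := by rw [hκ]; simp [pt]
      refine h.1.eq T.accβ hκ' ?_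
      have hpd : T.pt 0 (1 - t) t ∈ disk T.D := T.pt_mem_disk (by ring) le_rfl h1.le ht.1.le one_pos
        (by linarith [ht.1]) ht.2
      refine closure_mono (subset_inter ?_ ?_)
        (segment_subset_closure_openSegment (left_mem_segment ℝ (sp κ) (T.pt 0 (1 - t) t)))
      · have := openSegment_subset_left hp
        rwa [openSegment_symm ℝ _ (sp κ), openSegment_symm ℝ _ (sp κ)] at this
      · rw [hκ', openSegment_symm]
        exact openSegment_subset_disk hpd.le T.onβ.le fun he => hpd.ne (he ▸ T.onβ)
  have k1 := key T ht hs hp hκ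
  have k2 := key T.swap (t := 1 - t) (v := w) (w := v) ⟨by linarith [ht.2], by linarith [ht.1]⟩
    (by linarith) (by rw [swap_pt]; convert hp using 2; ring) (by rw [swap_pt]; exact hκ)
  by_cases hv : v = 1
  · exact Or.inl (k1.2 hv)
  by_cases hw : w = 1
  · exact Or.inr (k2.2 hw)
  exfalso
  exact hb (hκ ▸ T.disk_subset (T.pt_mem_disk (by linarith) le_rfl k1.1 k2.1 one_pos
    (lt_of_le_of_ne (by linarith [k2.1]) hv) (lt_of_le_of_ne (by linarith [k1.1]) hw)))

theorem frontier_nonneg (T : Tri U) (f : bd U ≃ᵢ bd V) (hF : ¬ T.Free f) {u v w : ℝ}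
    (hs : u + v + w = 1) (hfr : T.pt' f u v w ∈ frontier V.set) : 0 ≤ u := by
  have key : ∀ (T : Tri U), ¬ T.Free f → ∀ {u v w : ℝ}, u + v + w = 1 →
      T.pt' f u v w ∈ frontier V.set → u < 0 → 0 < w → False := by
    clear hF hs hfr T
    intro T hF u v w hs hfr hu hw
    have hden : 0 < -u + |u + v| + 1 := by have := abs_nonneg (u + v); linarith
    set s := -u / (-u + |u + v| + 1) with hsd
    have hs0 : 0 < s := div_pos (by linarith) hden
    have hs1 : s < 1 := by
      rw [hsd, div_lt_one hden]; have := abs_nonneg (u + v); linarith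
    have hse : s * (-u + |u + v| + 1) = -u := div_mul_cancel₀ _ hden.ne'
    have hr : 0 < s - u := by linarith
    set r := s / (s - u) with hrd
    have hr0 : 0 < r := div_pos hs0 hr
    have hr1 : r < 1 := by rw [hrd, div_lt_one hr]; linarith
    have hre : r * (s - u) = s := div_mul_cancel₀ _ hr.ne'
    set t := r * w with htd
    have ht0 : 0 < t := mul_pos hr0 hw
    have ht1' : (1 - r) * (1 - s) + r * v = 1 - t := by
      rw [htd]; linear_combination r * hs + hre
    have ht1 : t < 1 := by
      have h1 : (1 - t) * (s - u) = -u + s * (u + v) := by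
        rw [← ht1']; linear_combination (-(1 - s) + v) * hre
      have h2 : 0 < -u + s * (u + v) := by
        have := mul_le_mul_of_nonneg_left (neg_abs_le (u + v)) hs0.le
        have := mul_pos hs0 (show 0 < 1 - u by linarith)
        linarith
      have := (mul_pos_iff_of_pos_right hr).1 (h1 ▸ h2)
      linarith
    have hp'k : T.pt' f 0 (1 - t) t ∈ openSegment ℝ (T.pt' f s (1 - s) 0) (T.pt' f u v w) := by
      convert T.pt'_mem_openSegment f (u := s) (v := 1 - s) (w := 0) (u' := u) (v' := v) (w' := w)
        ⟨hr0, hr1⟩ using 2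
      · linear_combination hre
      · exact ht1'.symm
      · rw [htd]; ring
    have hp'V := T.edge f (t := t) ⟨ht0, ht1⟩
    have hnot : ¬ segment ℝ (T.pt' f 0 (1 - t) t) (T.pt' f s (1 - s) 0) ⊆ V.set := fun h => hF <|
      Free.rot <| T.rot.free_of_crosscut f (l := t) (m := s) ⟨ht0, ht1⟩ ⟨hs0, hs1⟩
        (by rwa [rot_pt', rot_pt'])
    obtain ⟨z, hz, hzV⟩ := not_subset.1 hnot
    rw [segment_eq_image] at hz
    obtain ⟨σ, hσ, rfl⟩ := hz
    simp only at hzV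
    have hσ0 : 0 < σ := by
      refine lt_of_le_of_ne hσ.1 ?_
      rintro rfl
      exact hzV (by simpa using hp'V)
    set p := T.pt' f 0 (1 - t) t with hpd
    set q := T.pt' f s (1 - s) 0 with hqd
    set k := T.pt' f u v w with hkd
    have hpz : p ∈ openSegment ℝ ((1 - σ) • p + σ • q) k := by
      refine mem_openSegment_of_smul_add_eq_zero (A := 1 - r) (B := σ * r) (by linarith)
        (mul_pos hσ0 hr0) ?_
      have : p = (1 - r) • q + r • k := by
        rw [hpd, hqd, hkd, pt'_combo, ht1']
        congr 1
        · linear_combination hre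
        · rw [htd]; ring
      have e : (1 - r) • ((1 - σ) • p + σ • q - p) + (σ * r) • (k - p) =
        σ • ((1 - r) • q + r • k - p) := by module
      rw [e, ← this, sub_self, smul_zero]
    obtain ⟨ζ', κ', hvis, hpm, ⟨a, ha, hζ⟩, ⟨b, hb, hκ⟩⟩ :=
      exists_vis_chord hp'V hzV (notMem_of_frontier hfr) hpz
    have ht2 : 0 < 1 - t := by linarith
    have hs2 : 0 < 1 - s := by linarith
    have haσ : 0 < a * σ := mul_pos ha.1 hσ0
    have hζ' : sp (ζ' : X V) = T.pt' f (a * σ * s) ((1 - a * σ) * (1 - t) + a * σ * (1 - s))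
        ((1 - a * σ) * t) := by
      have : (1 - a) • p + a • ((1 - σ) • p + σ • q) = (1 - a * σ) • p + (a * σ) • q := by module
      rw [hζ, this, hpd, hqd, pt'_combo]
      simp
    have haσ1 : a * σ < 1 := by
      refine lt_of_le_of_ne (mul_le_one₀ ha.2 hσ.1 hσ.2) fun h => sp_bd_notMem ζ' ?_
      rw [hζ', h]
      convert T.edge_γ f (t := 1 - s) ⟨hs2, by linarith⟩ using 2 <;> ring
    have haσ2 : 0 < 1 - a * σ := by linarith
    have hκ' : sp (κ' : X V) = T.pt' f (b * u) ((1 - b) * (1 - t) + b * v)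
        ((1 - b) * t + b * w) := by
      rw [hκ, hpd, hkd, pt'_combo]
      simp
    have m1 := mul_pos haσ hs0
    have m2 := mul_pos haσ hs2
    have m3 := mul_pos haσ2 ht0
    have m4 := mul_pos haσ2 ht2
    have hcore : openSegment ℝ (sp (ζ' : X V)) (sp (κ' : X V)) ⊆ core V := by
      have hm : T.pt' f ((1 - 1 / 2) * 0 + 1 / 2 * (a * σ * s))
          ((1 - 1 / 2) * (1 - t) + 1 / 2 * ((1 - a * σ) * (1 - t) + a * σ * (1 - s)))
          ((1 - 1 / 2) * t + 1 / 2 * ((1 - a * σ) * t)) ∈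
          openSegment ℝ (sp (ζ' : X V)) (sp (κ' : X V)) := by
        have := T.pt'_mem_openSegment f (u := 0) (v := 1 - t) (w := t) (u' := a * σ * s)
          (v' := (1 - a * σ) * (1 - t) + a * σ * (1 - s)) (w' := (1 - a * σ) * t) (x := 1 / 2)
          ⟨by norm_num, by norm_num⟩
        rw [← hζ'] at this
        rw [openSegment_symm] at hpm ⊢
        exact openSegment_subset_left hpm this
      exact hvis.openSegment_subset_core hm (T.pt'_mem_core f (by ring) (by linarith)
        (by linarith) (by linarith) (hvis.subset' hm))
    obtain ⟨ζ, rfl⟩ := f.surjective ζ'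
    obtain ⟨κ, rfl⟩ := f.surjective κ'
    have hv : Vis (ζ : X U) κ := by simpa using hvis.map f.symm
    have hpc := hcore hpm
    have g1 : unf f.symm p = T.pt 0 (1 - t) t := by
      have e : p = (1 - t) • sp (f T.β : X V) + t • sp (f T.γ : X V) := by simp [hpd, pt']
      rw [e, (T.visβγ.map f (ξ := T.β) (ζ := T.γ)).unf_eq f.symm ⟨ht0, ht1⟩ (e ▸ hpc), im_symm_coe,
        im_symm_coe]
      simp [pt]
    have hpU : T.pt 0 (1 - t) t ∈ openSegment ℝ (sp (ζ : X U)) (sp (κ : X U)) := by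
      rw [← g1]
      obtain ⟨c, hc, he⟩ := mem_oseg.1 hpm
      rw [← he] at hpc ⊢
      rw [hvis.unf_eq f.symm hc hpc, im_symm_coe, im_symm_coe]
      exact oseg_mem hc
    obtain ⟨u₁, v₁, w₁, hs₁, e₁⟩ := T.exists_pt (sp (ζ : X U))
    obtain ⟨u₂, v₂, w₂, hs₂, e₂⟩ := T.exists_pt (sp (κ : X U))
    have hI : ∃ c ∈ Ioo (0:ℝ) 1, (1 - c) * u₁ + c * u₂ = 0 := by
      have := hpU
      obtain ⟨c, hc, he⟩ := mem_oseg.1 this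
      simp only [e₁, e₂, pt_combo] at he
      exact ⟨c, hc, (T.pt_inj (by linear_combination (1 - c) * hs₁ + c * hs₂) (by ring) he).1⟩
    obtain ⟨c, hc, hcu⟩ := hI
    have hsζ : a * σ * s + ((1 - a * σ) * (1 - t) + a * σ * (1 - s)) + (1 - a * σ) * t = 1 := by ring
    rcases lt_trichotomy u₁ 0 with h | h | h
    · have hu₂ : 0 < u₂ := by
        by_contra! h'
        have := mul_neg_of_pos_of_neg (show 0 < 1 - c by linarith [hc.2]) h
        have := mul_nonpos_of_nonneg_of_nonpos hc.1.le h'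
        linarith
      have he := T.eq_of_vis f hF hv.symm (sp_bd_notMem κ) ⟨ht0, ht1⟩ hs₂ hu₂
        (by rwa [openSegment_symm]) e₂
      rw [Subtype.coe_injective he, ← T.pt'_one] at hκ'
      have := (T.pt'_inj f (by norm_num) (by linear_combination b * hs) hκ').1
      have := mul_neg_of_pos_of_neg hb.1 hu
      linarith
    · rcases T.eq_or_eq_of_vis hv (sp_bd_notMem ζ) ⟨ht0, ht1⟩ (by linarith) hpU (h ▸ e₁) with he | he
      all_goals
        rw [Subtype.coe_injective he] at hζ'
      · have e : sp (f T.β : X V) = T.pt' f 0 1 0 := by simp [pt']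
        rw [e] at hζ'
        have := (T.pt'_inj f (by norm_num) hsζ hζ').1
        linarith
      · have e : sp (f T.γ : X V) = T.pt' f 0 0 1 := by simp [pt']
        rw [e] at hζ'
        have := (T.pt'_inj f (by norm_num) hsζ hζ').1
        linarith
    · have he := T.eq_of_vis f hF hv (sp_bd_notMem ζ) ⟨ht0, ht1⟩ hs₁ h hpU e₁
      rw [Subtype.coe_injective he, ← T.pt'_one] at hζ'
      have := (T.pt'_inj f (by norm_num) hsζ hζ').2.2
      linarith
  by_contra! hu
  rcases lt_or_ge 0 w with hw | hw
  · exact key T hF hs hfr hu hw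
  · exact key T.swap (fun h => hF h.swap) (u := u) (v := w) (w := v) (by linarith)
      (by rwa [swap_pt']) hu (by linarith)

theorem frontier_cone (hF : ¬ T.Free f)
    (hs : u + v + w = 1) (hfr : T.pt u v w ∈ frontier U.set) (hv : 0 < v) (hw : 0 < w) :
    False := by
  have hn := notMem_of_frontier hfr
  have hu : u < 0 := by
    by_contra! hu
    exact hn (T.disk_subset (T.pt_mem_disk hs hu hv.le hw.le (by linarith) (by linarith)
      (by linarith)))
  have hvw : 0 < v + w := by linarith
  set t := w / (v + w) with htd
  have hte : t * (v + w) = w := div_mul_cancel₀ _ hvw.ne'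
  have ht : t ∈ Ioo (0:ℝ) 1 := ⟨div_pos hw hvw, by rw [htd, div_lt_one hvw]; linarith⟩
  have ht2 : 0 < 1 - t := by linarith [ht.2]
  have hpd : T.pt 0 (1 - t) t ∈ disk T.D := T.pt_mem_disk (by ring) le_rfl ht2.le ht.1.le one_pos
    (by linarith [ht.1]) ht.2
  set p := T.pt 0 (1 - t) t with hp
  obtain ⟨τ, hτ, hτn, hτW⟩ := exists_exit (T.disk_subset hpd) hn
  set k := (1 - τ) • p + τ • T.pt u v w with hk
  have hkc : k = T.pt (τ * u) ((1 - τ) * (1 - t) + τ * v) ((1 - τ) * t + τ * w) := by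
    rw [hk, hp, pt_combo]; simp
  set A := sp (T.α : X U) with hA
  have hAe : A = T.pt 1 0 0 := T.pt_one.symm
  have hAp : openSegment ℝ p A ⊆ disk T.D :=
    openSegment_subset_disk (le_of_lt hpd) T.onα.le fun he =>
      (show pw T.D p < 0 from hpd).ne (by rw [he]; exact T.onα)
  have hden : 0 < 1 - τ * u := by have := mul_neg_of_pos_of_neg hτ.1 hu; linarith
  set r := 1 / (1 - τ * u) with hr
  have hre : r * (1 - τ * u) = 1 := div_mul_cancel₀ _ hden.ne'
  have hτu := mul_neg_of_pos_of_neg hτ.1 hu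
  have hrm : r ∈ Ioo (0:ℝ) 1 := ⟨div_pos one_pos hden, by rw [hr, div_lt_one hden]; linarith⟩
  have hpe : p = (1 - r) • A + r • k := by
    rw [hAe, hkc, pt_combo, hp]
    have e2 : t * (1 - u) = w := by rw [← hte]; linear_combination -t * hs
    congr 1
    · linear_combination hre
    · linear_combination (t - 1) * hre - r * τ * (hs + e2)
    · linear_combination -t * hre + r * τ * e2
  have hpm : p ∈ openSegment ℝ A k := by
    exact mem_oseg.2 ⟨r, hrm, hpe.symm⟩
  have hAk : openSegment ℝ A k ⊆ U.set :=
    openSegment_subset_of_mem hpm (T.disk_subset hpd) (hAp.trans T.disk_subset)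
      (openSegment_subset_of_exit hτ.1 hτW)
  obtain ⟨κ, hκs, hκ⟩ := exists_accOn (convex_openSegment (𝕜 := ℝ) _ _) hAk
    (segment_subset_closure_openSegment (right_mem_segment ℝ A k)) hτn
  have hα : AccOn (openSegment ℝ A k) (T.α : X U) := by
    refine T.accα.convex (convex_openSegment _ _) hAk ?_
    refine closure_mono (subset_inter ?_ ?_)
      (segment_subset_closure_openSegment (left_mem_segment ℝ A p))
    · rwa [openSegment_symm]
    · rw [openSegment_symm] at hpm
      have := openSegment_subset_left hpm
      rwa [openSegment_symm ℝ _ A, openSegment_symm ℝ _ A] at this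
  have hvis : Vis (T.α : X U) κ := by rw [← hκs] at hα hκ; exact ⟨hα, hκ⟩
  have hm : T.pt ((1 - 1 / 2) * 0 + 1 / 2 * 1) ((1 - 1 / 2) * (1 - t) + 1 / 2 * 0)
      ((1 - 1 / 2) * t + 1 / 2 * 0) ∈ openSegment ℝ A k := by
    have h1 := T.pt_mem_openSegment (u := 0) (v := 1 - t) (w := t) (u' := 1)
      (v' := 0) (w' := 0) (x := 1 / 2) ⟨by norm_num, by norm_num⟩
    rw [← hAe] at h1
    rw [openSegment_symm] at hpm ⊢
    exact openSegment_subset_left hpm h1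
  rw [← hκs] at hm hpm hpe
  have hcore := hvis.openSegment_subset_core hm (T.pt_mem_core (by ring) (by norm_num)
        (by linarith) (by linarith [ht.1]))
  have hpc := hcore hpm
  have g := hvis.unf_eq f hrm (hpe ▸ hpc)
  rw [← hpe, hp, T.unf_pt f (by ring) le_rfl ht2.le ht.1.le one_pos
    (by linarith [ht.1]) ht.2, im_coe, ← T.pt'_one] at g
  obtain ⟨u', v', w', hs', e'⟩ := T.exists_pt' f (im f κ)
  have hnn := T.frontier_nonneg f hF hs' (e' ▸ im_mem_frontier f hκ.1)
  rw [e', pt'_combo] at g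
  have := (T.pt'_inj f (by ring) (by linear_combination r * hs') g).1
  have := mul_nonneg hrm.1.le hnn
  linarith [hrm.2]

theorem free (T : Tri U) (f : bd U ≃ᵢ bd V) : T.Free f := by
  have key : ∀ T : Tri U, 0 < inner ℝ (sp (T.α : X U) - sp (T.β : X U))
      (sp (T.γ : X U) - sp (T.β : X U)) → T.Free f := by
    clear T
    intro T hI
    by_contra hF
    set a := sp (T.α : X U) with ha
    set b := sp (T.β : X U) with hb
    set c := sp (T.γ : X U) with hc
    set I := inner ℝ (a - b) (c - b) with hId
    have hab : 0 < ‖a - b‖ ^ 2 := by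
      refine pow_pos (norm_pos_iff.2 fun h => ?_) 2
      rw [hId, h, inner_zero_left] at hI; exact hI.false
    have hbc : 0 < ‖c - b‖ := by
      refine norm_pos_iff.2 fun h => ?_
      rw [hId, h, inner_zero_right] at hI; exact hI.false
    have hrne : cr (sp (T.rot.β : X U) - sp (T.rot.α : X U)) (sp (T.rot.γ : X U) - sp (T.rot.α : X U)) ≠ 0 :=
      T.rot.ne
    obtain ⟨δ, hδ, hball⟩ := Metric.eventually_nhds_iff.1
      ((continuous_bary b c a).tendsto b |>.eventually_const_lt (u := 0) (by
        have := bary_combo (a := b) (b := c) (c := a) hrne (u := 1) (v := 0) (w := 0) (by norm_num)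
        have e : (1:ℝ) • b + (0:ℝ) • c + (0:ℝ) • a = b := by simp
        rw [e] at this
        rw [this]; exact one_pos))
    obtain ⟨t, ht0, ht⟩ := _root_.exists_between (lt_min (lt_min one_pos (div_pos hab hI))
      (div_pos hδ (mul_pos two_pos hbc)))
    have ht1 : t < 1 := ht.trans_le ((min_le_left _ _).trans (min_le_left _ _))
    have htI : t * I < ‖a - b‖ ^ 2 := by
      rw [← lt_div_iff₀ hI]; exact ht.trans_le ((min_le_left _ _).trans (min_le_right _ _))
    have htδ : t * (2 * ‖c - b‖) < δ := by
      rw [← lt_div_iff₀ (by positivity)]; exact ht.trans_le (min_le_right _ _)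
    set σ := t * I / ‖a - b‖ ^ 2 with hσ
    have hσ0 : 0 < σ := div_pos (mul_pos ht0 hI) hab
    have hσ1 : σ < 1 := by rw [hσ, div_lt_one hab]; exact htI
    have hσe : σ * ‖a - b‖ ^ 2 = t * I := div_mul_cancel₀ _ hab.ne'
    have hnot : ¬ segment ℝ (T.pt' f 0 (1 - t) t) (T.pt' f σ (1 - σ) 0) ⊆ V.set := fun h => hF <|
      Free.rot <| T.rot.free_of_crosscut f (l := t) (m := σ) ⟨ht0, ht1⟩ ⟨hσ0, hσ1⟩
        (by rwa [rot_pt', rot_pt'])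
    obtain ⟨z, hz, hzV⟩ := not_subset.1 hnot
    have hpV := T.edge f (t := t) ⟨ht0, ht1⟩
    set p := T.pt' f 0 (1 - t) t with hp
    set q := T.pt' f σ (1 - σ) 0 with hq
    obtain ⟨τ, hτ, hτn, hτV⟩ := exists_exit hpV hzV
    have hsub := openSegment_subset_of_exit hτ.1 hτV
    obtain ⟨ε', hεs, hε⟩ := exists_accOn (convex_openSegment (𝕜 := ℝ) _ _) hsub
      (segment_subset_closure_openSegment (right_mem_segment ℝ _ _)) hτn
    rw [← hεs] at hε
    have hzq : dist p z ≤ dist p q := by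
      have := (convex_closedBall p (dist p q)).segment_subset (mem_closedBall_self dist_nonneg)
        (show q ∈ closedBall p (dist p q) by rw [mem_closedBall, dist_comm]) hz
      rwa [mem_closedBall, dist_comm] at this
    have hεz : dist p (sp ε') ≤ dist p q := by
      refine le_trans ?_ hzq
      have e : (1 - τ) • p + τ • z - p = τ • (z - p) := by module
      rw [hεs, dist_comm, dist_eq_norm, e, norm_smul, Real.norm_of_nonneg hτ.1.le, ← dist_eq_norm,
        dist_comm]
      exact mul_le_of_le_one_left dist_nonneg hτ.2
    have hpq : dist p q < t * ‖c - b‖ := by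
      rw [hp, hq, T.dist_pt f (by ring) (by ring), dist_eq_norm]
      have e : T.pt 0 (1 - t) t - T.pt σ (1 - σ) 0 = t • (c - b) - σ • (a - b) := by
        simp only [pt]; rw [← ha, ← hb, ← hc]; module
      rw [e]
      refine lt_of_pow_lt_pow_left₀ 2 (by positivity) ?_
      rw [norm_sub_sq_real, norm_smul, norm_smul, inner_smul_left, inner_smul_right,
        real_inner_comm, ← hId, mul_pow, mul_pow, Real.norm_of_nonneg ht0.le,
        Real.norm_of_nonneg hσ0.le]
      have h1 : 0 < σ * (t * I) := mul_pos hσ0 (mul_pos ht0 hI)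
      have h2 : σ ^ 2 * ‖a - b‖ ^ 2 = σ * (t * I) := by rw [← hσe]; ring
      simp only [conj_trivial]
      rw [h2]
      linarith
    have hβγ : Vis (f T.β : X V) (f T.γ) := T.visβγ.map f
    have hbc' : dist (sp (f T.β : X V)) (sp (f T.γ : X V)) = ‖c - b‖ := by
      rw [T.dist_sp f, dist_comm, dist_eq_norm]
    have hpm : p ∈ openSegment ℝ (sp (f T.β : X V)) (sp (f T.γ : X V)) := by
      exact mem_oseg.2 ⟨t, ⟨ht0, ht1⟩, by simp [hp, pt']⟩
    have hdb : dist p (sp (f T.β : X V)) = t * ‖c - b‖ := by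
      have : p - sp (f T.β : X V) = t • (sp (f T.γ : X V) - sp (f T.β : X V)) := by
        rw [hp]; simp only [pt']; module
      rw [dist_eq_norm, this, norm_smul, Real.norm_of_nonneg ht0.le, ← dist_eq_norm, dist_comm, hbc']
    have hdc := dist_add_openSegment hpm
    rw [dist_comm _ p, hdb, hbc'] at hdc
    have k1 := hε.dist_le_of_openSegment hpV
    have k2 := hβγ.1.dist_eq hpm hpV
    have k3 := hβγ.2.dist_eq hpm hpV
    obtain ⟨ε, hεε⟩ := f.surjective ⟨ε', hε.1⟩
    have hεε' : (f ε : X V) = ε' := by rw [hεε]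
    have l1 : dist (ε : X U) T.γ < ‖c - b‖ := by
      have h1 : dist (ε : X U) T.γ = dist (f ε : X V) (f T.γ) := (f.isometry.dist_eq ε T.γ).symm
      rw [h1, hεε']
      have := dist_triangle_left ε' (f T.γ : X V) (ι p hpV)
      linarith
    have l2 : dist (ε : X U) T.β < δ := by
      have h1 : dist (ε : X U) T.β = dist (f ε : X V) (f T.β) := (f.isometry.dist_eq ε T.β).symm
      rw [h1, hεε']
      have := dist_triangle_left ε' (f T.β : X V) (ι p hpV)
      linarith
    obtain ⟨u, v, w, hs, he⟩ := T.exists_pt (sp (ε : X U))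
    have hefr : T.pt u v w ∈ frontier U.set := he ▸ sp_mem_frontier ε.2
    have hv : 0 < v := by
      have := hball ((dist_sp_le _ _).trans_lt l2)
      have e : sp (ε : X U) = v • b + w • c + u • a := by
        rw [he, pt]; abel
      rw [e, bary_combo (a := b) (b := c) (c := a) hrne (by linarith)] at this
      exact this
    have hw : w ≤ 0 := by
      by_contra! hw
      exact T.frontier_cone f hF hs hefr hv hw
    have hu : u ≤ 0 := by
      by_contra! hu
      exact T.rot.rot.frontier_cone f (fun h => hF h.rot.rot) (u := w) (v := u) (w := v)
        (by linarith) (by rwa [rot_pt, rot_pt]) hu hv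
    have hfin : ‖c - b‖ ^ 2 ≤ dist (sp (ε : X U)) c ^ 2 := by
      have e : sp (ε : X U) - c = (u • (a - b) + w • (c - b)) - (c - b) := by
        rw [he, pt, ← ha, ← hb, ← hc]
        have : v = 1 - u - w := by linarith
        rw [this]; module
      rw [dist_eq_norm, e, norm_sub_sq_real (u • (a - b) + w • (c - b)), inner_add_left, inner_smul_left, inner_smul_left,
        ← hId, real_inner_self_eq_norm_sq]
      simp only [conj_trivial]
      have h1 := mul_nonneg (neg_nonneg.2 hu) hI.le
      have h2 := mul_nonneg (neg_nonneg.2 hw) (sq_nonneg ‖c - b‖)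
      have h3 := sq_nonneg ‖u • (a - b) + w • (c - b)‖
      linarith
    have := pow_le_pow_left₀ dist_nonneg ((dist_sp_le _ _).trans l1.le) 2
    have h1 := pow_lt_pow_left₀ ((dist_sp_le _ _).trans_lt l1) dist_nonneg two_ne_zero
    linarith
  by_cases h : 0 < inner ℝ (sp (T.α : X U) - sp (T.β : X U)) (sp (T.γ : X U) - sp (T.β : X U))
  · exact key T h
  · refine (key T.swap ?_).swap
    have hne : sp (T.γ : X U) - sp (T.β : X U) ≠ 0 := sub_ne_zero.2 T.visβγ.symm.sp_ne
    have h1 : 0 < inner ℝ (sp (T.γ : X U) - sp (T.β : X U)) (sp (T.γ : X U) - sp (T.β : X U)) :=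
      real_inner_self_pos.2 hne
    have e : inner ℝ (sp (T.α : X U) - sp (T.γ : X U)) (sp (T.β : X U) - sp (T.γ : X U)) =
        inner ℝ (sp (T.γ : X U) - sp (T.β : X U)) (sp (T.γ : X U) - sp (T.β : X U)) -
        inner ℝ (sp (T.α : X U) - sp (T.β : X U)) (sp (T.γ : X U) - sp (T.β : X U)) := by
      rw [← inner_sub_left, ← inner_neg_neg]
      simp
    show 0 < inner ℝ (sp (T.α : X U) - sp (T.γ : X U)) (sp (T.β : X U) - sp (T.γ : X U))
    rw [e]; linarith

end Tri

theorem cr_ne_zero {z : Fin 3 → E2} (h : AffineIndependent ℝ z) :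
    cr (z 1 - z 0) (z 2 - z 0) ≠ 0 := by
  intro hc
  rw [affineIndependent_iff] at h
  have key : ∀ i : Fin 2, (z 2 - z 0) i = 0 := by
    intro i
    have := h Finset.univ
      ![(z 1 - z 0) i - (z 2 - z 0) i, (z 2 - z 0) i, - (z 1 - z 0) i]
      (by simp [Fin.sum_univ_three]) (by
        ext j
        simp only [cr, PiLp.sub_apply] at hc
        simp only [Fin.sum_univ_three, PiLp.add_apply, PiLp.smul_apply, PiLp.sub_apply,
          Matrix.cons_val_zero, Matrix.cons_val_one, Matrix.cons_val_two, Matrix.tail_cons,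
          Matrix.head_cons, smul_eq_mul, PiLp.zero_apply]
        fin_cases i <;> fin_cases j <;> simp <;> linarith) 1 (Finset.mem_univ _)
    simpa using this
  have e : z 2 = z 0 := by
    ext i
    have := key i
    rw [PiLp.sub_apply] at this
    linarith
  have := h Finset.univ ![1, 0, -1] (by simp [Fin.sum_univ_three]) (by
    simp [Fin.sum_univ_three, e]) 0 (Finset.mem_univ _)
  simp at this

theorem Rep.exists_cell (R : Rep W y) :
    (∃ α β : bd W, Vis (α : X W) β ∧ y ∈ openSegment ℝ (sp (α : X W)) (sp (β : X W)) ∧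
      AccOn (disk R.D) (α : X W) ∧ AccOn (disk R.D) (β : X W) ∧
      pw R.D (sp (α : X W)) = 0 ∧ pw R.D (sp (β : X W)) = 0) ∨
    ∃ T : Tri W, T.D = R.D ∧
      ∃ u v w : ℝ, u + v + w = 1 ∧ 0 < u ∧ 0 < v ∧ 0 < w ∧ y = T.pt u v w := by
  have hmem : y ∈ convexHull ℝ (range fun i => sp (R.el i)) := by
    have := (convex_convexHull ℝ (range fun i => sp (R.el i))).sum_mem
      (fun i _ => R.w_nonneg i) R.w_sum (fun i (_ : i ∈ Finset.univ) =>
        subset_convexHull ℝ _ (mem_range_self i))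
    rwa [R.rep] at this
  obtain ⟨κ, _, z, w, hz, hind, hw, hws, hsum⟩ := eq_pos_convex_span_of_mem_convexHull hmem
  choose i hi using fun k => hz (mem_range_self k)
  simp only at hi
  have hcard : Fintype.card κ ≤ 3 := by
    have := hind.card_le_finrank_succ
    have h2 : Module.finrank ℝ (vectorSpan ℝ (range z)) ≤ 2 := by
      have := Submodule.finrank_le (vectorSpan ℝ (range z))
      simpa using this
    omega
  have hbd : ∀ k, R.el (i k) ∈ bd W := fun k => (R.acc _).1
  obtain ⟨n, ⟨e⟩⟩ : ∃ n, Nonempty (Fin n ≃ κ) := ⟨_, ⟨(Fintype.equivFin κ).symm⟩⟩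
  have hn : n ≤ 3 := by rwa [← Fintype.card_congr e, Fintype.card_fin] at hcard
  have hws' : ∑ k, w (e k) = 1 := by rw [e.sum_comp w]; exact hws
  have hsum' : ∑ k, w (e k) • z (e k) = y := by rw [e.sum_comp (fun k => w k • z k)]; exact hsum
  have hind' : AffineIndependent ℝ fun k => z (e k) := (affineIndependent_equiv e).2 hind
  interval_cases n
  · simp at hws'
  · exfalso
    simp only [Fin.sum_univ_one] at hws' hsum'
    rw [hws', one_smul] at hsum'
    have h1 := sp_mem_frontier (hbd (e 0))
    rw [hi, hsum'] at h1
    exact notMem_of_frontier h1 R.mem_carrier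
  · left
    simp only [Fin.sum_univ_two] at hws' hsum'
    refine ⟨⟨_, hbd (e 0)⟩, ⟨_, hbd (e 1)⟩, ?_, ?_, R.acc _, R.acc _, R.on _, R.on _⟩
    · refine ((R.acc (i (e 0))).eq_or_vis R.mem (R.acc (i (e 1))) (R.on _) (R.on _)).resolve_left
        fun he => ?_
      have h1 : z (e 0) = z (e 1) := by rw [← hi, ← hi, he]
      have := hind'.injective h1
      simp at this
    · simp only [hi]
      exact ⟨_, _, hw _, hw _, hws', hsum'⟩
  · right
    simp only [Fin.sum_univ_three] at hws' hsum'
    refine ⟨⟨R.D, ⟨_, hbd (e 0)⟩, ⟨_, hbd (e 1)⟩, ⟨_, hbd (e 2)⟩, R.empty, R.acc _, R.acc _, R.acc _,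
      R.on _, R.on _, R.on _, ?_⟩, rfl, w (e 0), w (e 1), w (e 2), hws', hw _, hw _, hw _, ?_⟩
    · simp only [hi]
      exact cr_ne_zero hind'
    · simp only [Tri.pt, hi]
      exact hsum'.symm

theorem exists_cell (hy : y ∈ core W) :
    (∃ α β : bd W, Vis (α : X W) β ∧ y ∈ openSegment ℝ (sp (α : X W)) (sp (β : X W))) ∨
    ∃ T : Tri W, ∃ u v w : ℝ, u + v + w = 1 ∧ 0 < u ∧ 0 < v ∧ 0 < w ∧ y = T.pt u v w := by
  obtain ⟨R⟩ := exists_rep hy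
  rcases R.exists_cell with ⟨α, β, h, hm, -⟩ | ⟨T, -, h⟩
  exacts [Or.inl ⟨α, β, h, hm⟩, Or.inr ⟨T, h⟩]

theorem Vis.eq_or_eq {α β κ ζ : X W} (h : Vis α β) (hα : sp α ∉ W.set) (hβ : sp β ∉ W.set)
    (h' : Vis κ ζ) (hκ : sp κ ∉ W.set) {t x : ℝ} (ht : t ∈ Ioo (0:ℝ) 1)
    (hp : (1 - t) • sp α + t • sp β ∈ openSegment ℝ (sp κ) (sp ζ))
    (he : sp κ = (1 - x) • sp α + x • sp β) : κ = α ∨ κ = β := by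
  have key : ∀ {α β : X W} {t x : ℝ}, Vis α β → sp α ∉ W.set → t ∈ Ioo (0:ℝ) 1 →
      (1 - t) • sp α + t • sp β ∈ openSegment ℝ (sp κ) (sp ζ) →
      sp κ = (1 - x) • sp α + x • sp β → 0 ≤ x ∧ (x = 0 → κ = α) := by
    intro α β t x h hα ht hp he
    set p := (1 - t) • sp α + t • sp β with hpd
    rw [openSegment_symm] at hp
    have hpk := openSegment_subset_left hp
    rw [openSegment_symm ℝ _ (sp κ), openSegment_symm ℝ _ (sp κ)] at hpk
    constructor
    · by_contra! hx
      have hd : 0 < t - x := by linarith [ht.1]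
      refine hα (h'.subset' (hpk ?_))
      rw [openSegment_symm]
      refine mem_openSegment_of_smul_add_eq_zero (A := -x) (B := t) (by linarith) ht.1 ?_
      rw [he, hpd]; module
    · rintro rfl
      have he' : sp κ = sp α := by rw [he]; simp
      refine h'.1.eq h.1 he' ?_
      refine closure_mono (subset_inter hpk ?_)
        (segment_subset_closure_openSegment (left_mem_segment ℝ (sp κ) p))
      have hpm : p ∈ openSegment ℝ (sp β) (sp α) := by
        rw [openSegment_symm, openSegment_eq_image]; exact ⟨t, ht, rfl⟩
      have := openSegment_subset_left hpm
      rw [he', openSegment_symm, openSegment_symm ℝ (sp α) (sp β)]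
      exact this
  have k1 := key h hα ht hp he
  have k2 := key h.symm hβ (t := 1 - t) (x := 1 - x) ⟨by linarith [ht.2], by linarith [ht.1]⟩
    (by rw [add_comm]; simpa using hp) (by rw [he, add_comm]; simp)
  by_cases h0 : x = 0
  · exact Or.inl (k1.2 h0)
  by_cases h1 : x = 1
  · exact Or.inr (k2.2 (by linarith))
  exfalso
  refine hκ (he ▸ h.subset' ?_)
  exact oseg_mem ⟨lt_of_le_of_ne k1.1 (Ne.symm h0), lt_of_le_of_ne (by linarith [k2.1]) h1⟩

theorem cr_add_smul (d x y : E2) (s t : ℝ) : cr d (s • x + t • y) = s * cr d x + t * cr d y := by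
  simp only [cr, PiLp.add_apply, PiLp.smul_apply, smul_eq_mul]; ring

theorem cr_sub (d x y : E2) : cr d (x - y) = cr d x - cr d y := by
  simp only [cr, PiLp.sub_apply]; ring

theorem cr_eq_zero_of {d x y : E2} (hd : d ≠ 0) (hx : cr d x = 0) (hy : cr d y = 0) :
    cr x y = 0 := by
  by_contra hne
  apply hd
  simp only [cr] at hx hy hne
  have h0 : d 0 * (x 0 * y 1 - x 1 * y 0) = 0 := by linear_combination x 0 * hy - y 0 * hx
  have h1 : d 1 * (x 0 * y 1 - x 1 * y 0) = 0 := by linear_combination x 1 * hy - y 1 * hx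
  ext i
  fin_cases i
  · exact (mul_eq_zero.1 h0).resolve_right hne
  · exact (mul_eq_zero.1 h1).resolve_right hne

theorem exists_smul_of_cr {d x : E2} (hd : d ≠ 0) (hx : cr d x = 0) : ∃ s : ℝ, x = s • d := by
  simp only [cr] at hx
  by_cases h0 : d 0 = 0
  · have h1 : d 1 ≠ 0 := fun h1 => hd (by ext i; fin_cases i <;> assumption)
    refine ⟨x 1 / d 1, ?_⟩
    ext i
    fin_cases i
    · simp [h0] at hx ⊢
      exact hx.resolve_left h1
    · simp [h1]
  · refine ⟨x 0 / d 0, ?_⟩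
    ext i
    fin_cases i
    · simp [h0]
    · simp
      field_simp
      linarith

theorem exists_half_ball {S : Set E2} (hS : Convex ℝ S) {a b k p : E2} (ha : a ∈ S) (hb : b ∈ S)
    (hk : k ∈ S) (hp : p ∈ openSegment ℝ a b) (h : 0 < cr (b - a) (k - a)) :
    ∃ r > 0, ∀ z ∈ ball p r, (0 ≤ cr (b - a) (z - a) → z ∈ S) ∧
      (0 < cr (b - a) (z - a) → z ∈ interior S) := by
  obtain ⟨t, ht, rfl⟩ := mem_oseg.1 hp
  set p := (1 - t) • a + t • b with hp
  have hne := h.ne'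
  have hne' : cr (k - b) (a - b) ≠ 0 := by
    have : cr (k - b) (a - b) = cr (b - a) (k - a) := by simp only [cr, PiLp.sub_apply]; ring
    rwa [this]
  have e1 : bary a b k p = 1 - t := by
    have := bary_combo hne (u := 1 - t) (v := t) (w := 0) (by ring)
    rwa [zero_smul, add_zero] at this
  have e2 : bary b k a p = t := by
    have := bary_combo hne' (u := t) (v := 0) (w := 1 - t) (by ring)
    rwa [zero_smul, add_zero, add_comm] at this
  have h1 := (continuous_bary a b k).tendsto p |>.eventually_const_lt (u := 0)
    (by rw [e1]; linarith [ht.2])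
  have h2 := (continuous_bary b k a).tendsto p |>.eventually_const_lt (u := 0)
    (by rw [e2]; exact ht.1)
  obtain ⟨r, hr, hrb⟩ := Metric.eventually_nhds_iff.1 (h1.and h2)
  refine ⟨r, hr, fun z hz => ?_⟩
  obtain ⟨hu, hv⟩ := hrb (mem_ball.1 hz)
  obtain ⟨u, v, w, hs, rfl⟩ := exists_coords hne z
  rw [bary_combo hne hs] at hu
  have e3 : u • a + v • b + w • k = v • b + w • k + u • a := by abel
  rw [e3, bary_combo hne' (by linarith)] at hv
  have e4 : cr (b - a) (u • a + v • b + w • k - a) = w * cr (b - a) (k - a) := by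
    have : u = 1 - v - w := by linarith
    subst this
    simp only [cr, PiLp.sub_apply, PiLp.add_apply, PiLp.smul_apply, smul_eq_mul]; ring
  rw [e4]
  refine ⟨fun hw => combo_mem hS ha hb hk hs hu.le hv.le ?_, fun hw =>
    combo_mem_interior hS ha hb hk hne hs hu hv ?_⟩
  · exact nonneg_of_mul_nonneg_left hw h
  · exact (mul_pos_iff_of_pos_right h).1 hw

theorem unf_mem_hull (hy : y ∈ core U) :
    unf f y ∈ convexHull ℝ (frontier V.set) := by
  obtain ⟨R⟩ := exists_rep hy
  rw [R.unf_eq f]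
  exact (convex_convexHull ℝ _).sum_mem (fun i _ => R.w_nonneg i) R.w_sum
      fun i _ => subset_convexHull ℝ _ (im_mem_frontier f (R.acc i).1)

theorem unf_mem (hy : y ∈ core U) : unf f y ∈ V.set := by
  rcases exists_cell hy with ⟨α, β, h, hm⟩ | ⟨T, u, v, w, hs, hu, hv, hw, rfl⟩
  · have hm' := hm
    obtain ⟨t, ht, he⟩ := mem_oseg.1 hm
    rw [← he] at hy ⊢
    rw [h.unf_eq f ht hy]
    refine h.map_im f ?_
    exact oseg_mem ht
  · rw [T.unf_pt f hs hu.le hv.le hw.le (by linarith) (by linarith) (by linarith)]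
    exact T.free f u v w hs hu hv hw

theorem unf_symm_unf_of_mem (hy : y ∈ core U)
    (hy' : unf f y ∈ core V) : unf f.symm (unf f y) = y := by
  rcases exists_cell hy with ⟨α, β, h, hm⟩ | ⟨T, u, v, w, hs, hu, hv, hw, rfl⟩
  · obtain ⟨t, ht, he⟩ := mem_oseg.1 hm
    rw [← he] at hy hy' ⊢
    rw [h.unf_eq f ht hy, im_coe, im_coe] at hy' ⊢
    rw [(h.map f).unf_eq f.symm ht hy', im_symm_coe, im_symm_coe]
  · rw [T.unf_pt f hs hu.le hv.le hw.le (by linarith) (by linarith) (by linarith)]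
    exact (T.free f).unf_pt' hs hu hv hw

theorem cr_self (d : E2) : cr d d = 0 := by simp only [cr]; ring

theorem cr_smul (d x : E2) (s : ℝ) : cr d (s • x) = s * cr d x := by
  simp only [cr, PiLp.smul_apply, smul_eq_mul]; ring

theorem eq_combo_of_cr {a b q : E2} (hab : a ≠ b) (h : cr (b - a) (q - a) = 0) :
    ∃ s : ℝ, q = (1 - s) • a + s • b := by
  obtain ⟨s, hs⟩ := exists_smul_of_cr (sub_ne_zero.2 hab.symm) h
  refine ⟨s, ?_⟩
  rw [sub_eq_iff_eq_add] at hs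
  rw [hs]; module

theorem cr_combo (d a x y z : E2) (h : u + v + w = 1) :
    cr d (u • x + v • y + w • z - a) = u * cr d (x - a) + v * cr d (y - a) + w * cr d (z - a) := by
  have : u = 1 - v - w := by linarith
  subst this
  simp only [cr, PiLp.sub_apply, PiLp.add_apply, PiLp.smul_apply, smul_eq_mul]; ring

theorem cr_unf_pos {α β : bd U} (h : Vis (α : X U) β) {t : ℝ}
    (ht : t ∈ Ioo (0:ℝ) 1) (hx : (1 - t) • sp (α : X U) + t • sp (β : X U) ∈ core U)
    (hn : ∀ k ∈ convexHull ℝ (frontier V.set),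
      0 ≤ cr (im f (β : X U) - im f (α : X U)) (k - im f (α : X U))) :
    ∃ ε > 0, ball ((1 - t) • sp (α : X U) + t • sp (β : X U)) ε ⊆ core U ∧
      ∀ y ∈ ball ((1 - t) • sp (α : X U) + t • sp (β : X U)) ε,
        cr (sp (β : X U) - sp (α : X U)) (y - sp (α : X U)) ≠ 0 →
        0 < cr (im f (β : X U) - im f (α : X U)) (unf f y - im f (α : X U)) := by
  set x := (1 - t) • sp (α : X U) + t • sp (β : X U) with hxd
  set a' := im f (α : X U) with ha'
  set b' := im f (β : X U) with hb'
  have hab' : a' ≠ b' := by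
    rw [ha', hb', im_coe, im_coe]; exact (h.map f).sp_ne
  obtain ⟨r, hr, hrb⟩ := Metric.isOpen_iff.1 (isOpen_core U) x hx
  have hl : 0 < dist a' b' := dist_pos.2 hab'
  refine ⟨min r (min t (1 - t) * dist a' b'), lt_min hr (mul_pos (lt_min ht.1 (by linarith [ht.2])) hl),
    (ball_subset_ball (min_le_left _ _)).trans hrb, fun y hy hne => ?_⟩
  have hyr : y ∈ ball x r := ball_subset_ball (min_le_left _ _) hy
  have hyc : y ∈ core U := hrb hyr
  have hFx : unf f x = (1 - t) • a' + t • b' := h.unf_eq f ht hx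
  have hdist : dist (unf f y) (unf f x) < min t (1 - t) * dist a' b' := by
    refine (dist_unf_le f (((convex_ball x r).segment_subset hyr (mem_ball_self hr)).trans hrb)).trans_lt ?_
    exact (mem_ball.1 hy).trans_le (min_le_right _ _)
  refine lt_of_le_of_ne (hn _ (unf_mem_hull f hyc)) fun h0 => ?_
  rcases exists_cell hyc with ⟨γ, δ, hγδ, hm⟩ | ⟨T, u, v, w, hs, hu, hv, hw, rfl⟩
  · obtain ⟨s, hs, he⟩ := mem_oseg.1 hm
    have hFy : unf f y = (1 - s) • im f (γ : X U) + s • im f (δ : X U) := by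
      rw [← he] at hyc ⊢
      exact hγδ.unf_eq f hs hyc
    have hcγ := hn _ (subset_convexHull ℝ _ (im_mem_frontier f γ.2))
    have hcδ := hn _ (subset_convexHull ℝ _ (im_mem_frontier f δ.2))
    have hsum := cr_combo (b' - a') a' (im f (γ : X U)) (im f (δ : X U)) a' (u := 1 - s) (v := s)
      (w := 0) (by ring)
    rw [zero_smul, add_zero, ← hFy, ← h0, zero_mul, add_zero] at hsum
    have hγ0 : cr (b' - a') (im f (γ : X U) - a') = 0 := by
      nlinarith [hs.1, hs.2, mul_nonneg (sub_pos.2 hs.2).le hcγ, mul_nonneg hs.1.le hcδ]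
    have hδ0 : cr (b' - a') (im f (δ : X U) - a') = 0 := by
      nlinarith [hs.1, hs.2, mul_nonneg (sub_pos.2 hs.2).le hcγ, mul_nonneg hs.1.le hcδ]
    obtain ⟨xγ, hxγ⟩ := eq_combo_of_cr hab' hγ0
    obtain ⟨xδ, hxδ⟩ := eq_combo_of_cr hab' hδ0
    obtain ⟨τ, hτ⟩ := eq_combo_of_cr hab' h0.symm
    have hτm : τ ∈ Ioo (0:ℝ) 1 := by
      have : dist (unf f y) (unf f x) = |τ - t| * dist a' b' := by
        rw [hτ, hFx, dist_eq_norm, dist_eq_norm, ← norm_neg (a' - b'),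
          ← Real.norm_eq_abs, ← norm_smul]
        congr 1; module
      rw [this] at hdist
      have := lt_of_mul_lt_mul_right hdist hl.le
      have := abs_lt.1 this
      constructor
      · linarith [min_le_left t (1 - t)]
      · linarith [min_le_right t (1 - t)]
    have hmm : (1 - τ) • a' + τ • b' ∈ openSegment ℝ (im f (γ : X U)) (im f (δ : X U)) := by
      rw [← hτ, hFy, openSegment_eq_image]; exact ⟨s, hs, rfl⟩
    rw [ha', hb'] at hmm hxγ hxδ
    simp only [im_coe] at hmm hxγ hxδ
    have eγ := (h.map f).eq_or_eq (sp_bd_notMem _) (sp_bd_notMem _) (hγδ.map f) (sp_bd_notMem _)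
      hτm hmm hxγ
    have eδ := (h.map f).eq_or_eq (sp_bd_notMem _) (sp_bd_notMem _) (hγδ.map f).symm
      (sp_bd_notMem _) hτm (by rwa [openSegment_symm]) hxδ
    simp only [Subtype.coe_inj, f.injective.eq_iff] at eγ eδ
    apply hne
    have e2 := cr_combo (sp (β : X U) - sp (α : X U)) (sp (α : X U)) (sp (γ : X U)) (sp (δ : X U))
      (sp (α : X U)) (u := 1 - s) (v := s) (w := 0) (by ring)
    rw [zero_smul, add_zero, he] at e2
    have z0 : ∀ d : E2, cr d 0 = 0 := by intro d; simp [cr]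
    rw [e2]
    rcases eγ with rfl | rfl <;> rcases eδ with rfl | rfl <;> simp [cr_self, z0]
  · rw [T.unf_pt f hs hu.le hv.le hw.le (by linarith) (by linarith) (by linarith), Tri.pt',
      cr_combo _ _ _ _ _ hs] at h0
    have k1 := hn _ (mem_hull_of_bd (f T.α).2)
    have k2 := hn _ (mem_hull_of_bd (f T.β).2)
    have k3 := hn _ (mem_hull_of_bd (f T.γ).2)
    have m1 := mul_nonneg hu.le k1
    have m2 := mul_nonneg hv.le k2
    have m3 := mul_nonneg hw.le k3
    have n1 := (mul_eq_zero.1 (le_antisymm (by linarith) m1)).resolve_left hu.ne'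
    have n2 := (mul_eq_zero.1 (le_antisymm (by linarith) m2)).resolve_left hv.ne'
    have n3 := (mul_eq_zero.1 (le_antisymm (by linarith) m3)).resolve_left hw.ne'
    have g1 : cr (b' - a') (sp (f T.β : X V) - sp (f T.α : X V)) = 0 := by
      rw [← sub_sub_sub_cancel_right (sp (f T.β : X V)) _ a', cr_sub, n1, n2, sub_zero]
    have g2 : cr (b' - a') (sp (f T.γ : X V) - sp (f T.α : X V)) = 0 := by
      rw [← sub_sub_sub_cancel_right (sp (f T.γ : X V)) _ a', cr_sub, n1, n3, sub_zero]
    exact T.ne' f (cr_eq_zero_of (sub_ne_zero.2 hab'.symm) g1 g2)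

theorem chord_not_supported {α β : bd U} (h : Vis (α : X U) β) {t : ℝ}
    (ht : t ∈ Ioo (0:ℝ) 1) (hx : (1 - t) • sp (α : X U) + t • sp (β : X U) ∈ core U)
    (hn : ∀ k ∈ convexHull ℝ (frontier V.set),
      0 ≤ cr (im f (β : X U) - im f (α : X U)) (k - im f (α : X U))) : False := by
  obtain ⟨ε, hε, hεc, hpos⟩ := cr_unf_pos f h ht hx hn
  have hFx := h.unf_eq f ht hx
  have hsub := h.map_im f
  set x := (1 - t) • sp (α : X U) + t • sp (β : X U) with hxd
  set a' := im f (α : X U) with ha'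
  set b' := im f (β : X U) with hb'
  set d := sp (β : X U) - sp (α : X U) with hd
  have hd0 : d ≠ 0 := sub_ne_zero.2 h.sp_ne.symm
  set u : E2 := !₂[-(d 1), d 0] with hu
  have hcu : 0 < cr d u := by
    simp only [cr, hu]
    have : d 0 ≠ 0 ∨ d 1 ≠ 0 := by
      by_contra! hc
      exact hd0 (by ext i; fin_cases i; exacts [hc.1, hc.2])
    simp
    rcases this with h | h
    · nlinarith [sq_nonneg (d 1), sq_pos_of_ne_zero h]
    · nlinarith [sq_nonneg (d 0), sq_pos_of_ne_zero h]
  have hu0 : 0 < ‖u‖ := by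
    refine norm_pos_iff.2 fun h0 => ?_
    rw [h0] at hcu; simp [cr] at hcu
  have hcx : cr d (x - sp (α : X U)) = 0 := by
    have : x - sp (α : X U) = t • d := by rw [hxd, hd]; module
    rw [this, cr_smul, cr_self, mul_zero]
  have hmv : ∀ s : ℝ, s ≠ 0 → |s| * ‖u‖ < ε →
      x + s • u ∈ ball x ε ∧ 0 < cr (b' - a') (unf f (x + s • u) - a') := by
    intro s hs hsε
    have hm : x + s • u ∈ ball x ε := by
      rw [mem_ball, dist_eq_norm, add_sub_cancel_left, norm_smul]; exact hsε
    refine ⟨hm, hpos _ hm ?_⟩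
    rw [add_sub_right_comm, ← one_smul ℝ (x - _), cr_add_smul, hcx]
    simp [hs, hcu.ne']
  have hx'm : (1 - t) • a' + t • b' ∈ openSegment ℝ a' b' := oseg_mem ht
  have hk := hmv (ε / (2 * ‖u‖)) (by positivity) (by
    rw [abs_of_pos (by positivity)]; field_simp; linarith)
  obtain ⟨r, hr, hrb⟩ := exists_half_ball (convex_convexHull ℝ _)
    (subset_convexHull ℝ _ (im_mem_frontier f α.2)) (subset_convexHull ℝ _ (im_mem_frontier f β.2))
    (unf_mem_hull f (hεc hk.1)) hx'm hk.2
  obtain ⟨r', hr', hrb'⟩ := Metric.isOpen_iff.1 V.isDom.1 _ (hsub hx'm)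
  have hm0 : 0 < min ε (min r r') := lt_min hε (lt_min hr hr')
  set s := min ε (min r r') / (2 * ‖u‖) with hs
  have hs0 : 0 < s := by positivity
  have hsu : s * ‖u‖ < min ε (min r r') := by rw [hs]; field_simp; linarith
  have p1 := hmv s hs0.ne' (by rw [abs_of_pos hs0]; exact hsu.trans_le (min_le_left _ _))
  have p2 := hmv (-s) (by linarith) (by rw [abs_neg, abs_of_pos hs0]; exact hsu.trans_le (min_le_left _ _))
  have hdle : ∀ y ∈ ball x ε, dist (unf f y) ((1 - t) • a' + t • b') ≤ dist y x := by
    intro y hy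
    rw [← hFx]
    exact dist_unf_le f (((convex_ball x ε).segment_subset hy (mem_ball_self hε)).trans hεc)
  have dx : ∀ s : ℝ, dist (x + s • u) x = |s| * ‖u‖ := by
    intro s; rw [dist_eq_norm, add_sub_cancel_left, norm_smul, Real.norm_eq_abs]
  have q1 := hdle _ p1.1
  have q2 := hdle _ p2.1
  rw [dx, abs_of_pos hs0] at q1
  rw [dx, abs_neg, abs_of_pos hs0] at q2
  have hcore : ∀ z, z ∈ ball ((1 - t) • a' + t • b') (min r r') → 0 < cr (b' - a') (z - a') →
      z ∈ core V := fun z hz hc =>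
    ⟨hrb' (ball_subset_ball (min_le_right _ _) hz),
      (hrb z (ball_subset_ball (min_le_left _ _) hz)).2 hc⟩
  have hin : ∀ z, dist z ((1 - t) • a' + t • b') ≤ s * ‖u‖ → z ∈ ball ((1 - t) • a' + t • b') (min r r') :=
    fun z hz => mem_ball.2 (hz.trans_lt (hsu.trans_le (min_le_right _ _)))
  have c1 := hcore _ (hin _ q1) p1.2
  have c2 := hcore _ (hin _ q2) p2.2
  have g1 := unf_symm_unf_of_mem f (hεc p1.1) c1
  have g2 := unf_symm_unf_of_mem f (hεc p2.1) c2
  have hseg : segment ℝ (unf f (x + s • u)) (unf f (x + (-s) • u)) ⊆ core V := by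
    intro z hz
    refine hcore z ((convex_ball _ _).segment_subset (hin _ q1) (hin _ q2) hz) ?_
    obtain ⟨A, B, hA, hB, hAB, rfl⟩ := hz
    have := cr_combo (b' - a') a' (unf f (x + s • u)) (unf f (x + (-s) • u)) a' (u := A) (v := B)
      (w := 0) (by linarith)
    rw [zero_smul, add_zero, zero_mul, add_zero] at this
    rw [this]
    rcases hA.eq_or_lt with rfl | hA
    · have : B = 1 := by linarith
      subst this
      simpa using p2.2
    · have := mul_pos hA p1.2
      have := mul_nonneg hB p2.2.le
      linarith
  have hge := dist_unf_le f.symm hseg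
  rw [g1, g2] at hge
  have hd2 : dist (x + s • u) (x + (-s) • u) = 2 * (s * ‖u‖) := by
    rw [dist_eq_norm, show x + s • u - (x + (-s) • u) = (2 * s) • u by module, norm_smul,
      Real.norm_of_nonneg (by positivity)]; ring
  rw [hd2] at hge
  have hmid := eq_of_dist_le (A := unf f (x + s • u)) (B := unf f (x + (-s) • u))
    (p := (1 - t) • a' + t • b') (t := 1 / 2) (by linarith) (by rw [dist_comm]; linarith)
  have hz : cr (b' - a') ((1 - t) • a' + t • b' - a') = 0 := by
    rw [show (1 - t) • a' + t • b' - a' = t • (b' - a') by module, cr_smul, cr_self, mul_zero]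
  have := cr_combo (b' - a') a' (unf f (x + s • u)) (unf f (x + (-s) • u)) a' (u := 1 - 1 / 2)
    (v := 1 / 2) (w := 0) (by norm_num)
  rw [zero_smul, add_zero, zero_mul, add_zero, ← hmid, hz] at this
  linarith [p1.2, p2.2]

theorem unf_mem_core (hy : y ∈ core U) : unf f y ∈ core V := by
  refine ⟨unf_mem f hy, ?_⟩
  rcases exists_cell hy with ⟨α, β, h, hm⟩ | ⟨T, u, v, w, hs, hu, hv, hw, rfl⟩
  · obtain ⟨t, ht, he⟩ := mem_oseg.1 hm
    rw [← he] at hy ⊢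
    rw [h.unf_eq f ht hy]
    have hpos : ∃ k ∈ convexHull ℝ (frontier V.set),
        cr (im f (β : X U) - im f (α : X U)) (k - im f (α : X U)) < 0 := by
      by_contra! hn
      exact chord_not_supported f h ht hy hn
    have hneg : ∃ k ∈ convexHull ℝ (frontier V.set),
        cr (im f (α : X U) - im f (β : X U)) (k - im f (β : X U)) < 0 := by
      by_contra! hn
      refine chord_not_supported f h.symm (t := 1 - t) ⟨by linarith [ht.2], by linarith [ht.1]⟩
        ?_ hn
      rw [add_comm]; simpa using hy
    obtain ⟨k1, hk1, h1⟩ := hpos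
    obtain ⟨k2, hk2, h2⟩ := hneg
    set a' := im f (α : X U) with ha'
    set b' := im f (β : X U) with hb'
    have hflip : ∀ k, cr (a' - b') (k - b') = - cr (b' - a') (k - a') := by
      intro k; simp only [cr, PiLp.sub_apply]; ring
    have ha : a' ∈ convexHull ℝ (frontier V.set) := subset_convexHull ℝ _ (im_mem_frontier f α.2)
    have hb : b' ∈ convexHull ℝ (frontier V.set) := subset_convexHull ℝ _ (im_mem_frontier f β.2)
    have hx'm : (1 - t) • a' + t • b' ∈ openSegment ℝ a' b' := oseg_mem ht
    rw [hflip] at h2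
    obtain ⟨r1, hr1, hb1⟩ := exists_half_ball (convex_convexHull ℝ _) ha hb hk2 hx'm (by linarith)
    obtain ⟨r2, hr2, hb2⟩ := exists_half_ball (convex_convexHull ℝ _) hb ha hk1
      (by rwa [openSegment_symm]) (by rw [hflip]; linarith)
    refine mem_interior.2 ⟨ball ((1 - t) • a' + t • b') (min r1 r2), fun z hz => ?_, isOpen_ball,
      mem_ball_self (lt_min hr1 hr2)⟩
    rcases le_total 0 (cr (b' - a') (z - a')) with hc | hc
    · exact (hb1 z (ball_subset_ball (min_le_left _ _) hz)).1 hc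
    · exact (hb2 z (ball_subset_ball (min_le_right _ _) hz)).1 (by rw [hflip]; linarith)
  · rw [T.unf_pt f hs hu.le hv.le hw.le (by linarith) (by linarith) (by linarith)]
    exact (T.pt'_mem_core f hs hu hv hw (T.free f u v w hs hu hv hw)).2

theorem unf_symm_unf (hy : y ∈ core U) : unf f.symm (unf f y) = y :=
  unf_symm_unf_of_mem f hy (unf_mem_core f hy)

theorem Tri.image_access (hs : u + v + w = 1)
    (hu : 0 < u) (hv : 0 < v) (hw : 0 < w) (hV : T.pt' f u v w ∈ V.set) :
    dist (ι (T.pt' f u v w) hV : X V) (f T.α) = dist (T.pt u v w) (sp (T.α : X U)) := by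
  set S : Set E2 := {x | ∃ u v w : ℝ, u + v + w = 1 ∧ 0 < u ∧ 0 < v ∧ 0 ≤ w ∧ x = T.pt' f u v w}
  have hSc : Convex ℝ S := by
    rintro _ ⟨u1, v1, w1, h1, hu1, hv1, hw1, rfl⟩ _ ⟨u2, v2, w2, h2, hu2, hv2, hw2, rfl⟩ A B hA hB hAB
    obtain rfl : A = 1 - B := by linarith
    have key : ∀ {p q : ℝ}, 0 < p → 0 < q → 0 < (1 - B) * p + B * q := by
      intro p q hp hq
      rcases hA.eq_or_lt with h | h
      · have : B = 1 := by linarith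
        subst this; simpa using hq
      · have := mul_pos h hp
        have := mul_nonneg hB hq.le
        linarith
    exact ⟨_, _, _, by linear_combination (1 - B) * h1 + B * h2, key hu1 hu2, key hv1 hv2,
      add_nonneg (mul_nonneg hA hw1) (mul_nonneg hB hw2), T.pt'_combo f B u1 v1 w1 u2 v2 w2⟩
  have hSV : S ⊆ V.set := by
    rintro _ ⟨u, v, w, h, hu, hv, hw, rfl⟩
    rcases hw.eq_or_lt with rfl | hw
    · refine (T.visαβ.map f).subset' ?_
      exact ⟨u, v, hu, hv, by linarith, by simp [Tri.pt']⟩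
    · exact T.free f u v w h hu hv hw
  have hos : openSegment ℝ (sp (f T.α : X V)) (sp (f T.β : X V)) ⊆ S := by
    rintro _ ⟨A, B, hA, hB, hAB, rfl⟩
    exact ⟨A, B, 0, by linarith, hA, hB, le_rfl, by simp [Tri.pt']⟩
  have := (T.visαβ.map f).1.convex hSc hSV (by
    rw [inter_eq_left.2 hos]
    exact segment_subset_closure_openSegment (left_mem_segment ℝ _ _))
  rw [this.dist_eq ⟨u, v, w, hs, hu, hv, hw.le, rfl⟩, ← T.pt'_one f, ← T.pt_one]
  exact T.dist_pt f hs (by ring)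

theorem Rep.exists_near (R : Rep U y) (f : bd U ≃ᵢ bd V) (hy : y ∈ core U) :
    ∃ α : bd U, dist (ι y hy.1 : X U) α ≤ √(-pw R.D y) ∧
      dist (ι (unf f y) (unf_mem f hy) : X V) (f α) ≤ √(-pw R.D y) := by
  have hV := unf_mem f hy
  rcases R.exists_cell with ⟨α, β, h, hm, hα, hβ, h0, h1⟩ | ⟨T, hD, u, v, w, hs, hu, hv, hw, rfl⟩
  · have hm' := hm
    obtain ⟨t, ht, he⟩ := mem_oseg.1 hm
    have hF : unf f y = (1 - t) • im f (α : X U) + t • im f (β : X U) := by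
      rw [← he] at hy ⊢; exact h.unf_eq f ht hy
    rw [im_coe, im_coe] at hF
    have hFm : unf f y ∈ openSegment ℝ (sp (f α : X V)) (sp (f β : X V)) := by
      rw [hF, openSegment_eq_image]; exact ⟨t, ht, rfl⟩
    have hd := h.dist_map f
    have d1 : dist (unf f y) (sp (f α : X V)) = dist y (sp (α : X U)) := by
      rw [hF, ← he, dist_eq_norm, dist_eq_norm,
        show (1 - t) • sp (f α : X V) + t • sp (f β : X V) - sp (f α : X V) =
          t • (sp (f β : X V) - sp (f α : X V)) by module,
        show (1 - t) • sp (α : X U) + t • sp (β : X U) - sp (α : X U) =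
          t • (sp (β : X U) - sp (α : X U)) by module, norm_smul, norm_smul, ← dist_eq_norm,
        ← dist_eq_norm, dist_comm (sp (f β : X V)), hd, dist_comm (sp (α : X U)) (sp (β : X U))]
    have d2 : dist (unf f y) (sp (f β : X V)) = dist y (sp (β : X U)) := by
      rw [hF, ← he, dist_eq_norm, dist_eq_norm,
        show (1 - t) • sp (f α : X V) + t • sp (f β : X V) - sp (f β : X V) =
          (1 - t) • (sp (f α : X V) - sp (f β : X V)) by module,
        show (1 - t) • sp (α : X U) + t • sp (β : X U) - sp (β : X U) =
          (1 - t) • (sp (α : X U) - sp (β : X U)) by module, norm_smul, norm_smul, ← dist_eq_norm,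
        ← dist_eq_norm, hd, dist_eq_norm (sp (α : X U))]
    have hp := pw_combo R.D (sp (α : X U)) (sp (β : X U)) t
    rw [he, h0, h1] at hp
    have dd := dist_combo_sq y (sp (α : X U)) (sp (β : X U)) t
    rw [he, dist_self, dist_eq_norm (sp (α : X U))] at dd
    by_cases hle : dist y (sp (α : X U)) ^ 2 ≤ -pw R.D y
    · refine ⟨α, ?_, ?_⟩
      · rw [h.1.dist_eq hm']; exact Real.le_sqrt_of_sq_le hle
      · rw [(h.map f).1.dist_eq hFm, d1]; exact Real.le_sqrt_of_sq_le hle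
    · have hle' : dist y (sp (β : X U)) ^ 2 ≤ -pw R.D y := by
        by_contra! hc
        push Not at hle
        nlinarith [mul_pos (sub_pos.2 ht.2) (sub_pos.2 hle), mul_pos ht.1 (sub_pos.2 hc)]
      refine ⟨β, ?_, ?_⟩
      · rw [h.2.dist_eq hm']; exact Real.le_sqrt_of_sq_le hle'
      · rw [(h.map f).2.dist_eq hFm, d2]; exact Real.le_sqrt_of_sq_le hle'
  · have hsum := (T.rep hs hu.le hv.le hw.le (by linarith) (by linarith) (by linarith)).neg_pw
    have hF := T.unf_pt f hs hu.le hv.le hw.le (by linarith) (by linarith) (by linarith)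
    have hsum' : -pw T.D (T.pt u v w) = u * ‖sp (T.α : X U) - T.pt u v w‖ ^ 2 +
        v * ‖sp (T.β : X U) - T.pt u v w‖ ^ 2 + w * ‖sp (T.γ : X U) - T.pt u v w‖ ^ 2 :=
      hsum.trans (Fin.sum_univ_three _)
    rw [← hD]
    have fin : ∀ {ξ : bd U}, dist (T.pt u v w) (sp (ξ : X U)) ^ 2 ≤ -pw T.D (T.pt u v w) →
        AccOn (disk T.D) (ξ : X U) →
        (∀ hV : T.pt' f u v w ∈ V.set, dist (ι (T.pt' f u v w) hV : X V) (f ξ) =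
          dist (T.pt u v w) (sp (ξ : X U))) →
        ∃ α : bd U, dist (ι (T.pt u v w) hy.1 : X U) α ≤ √(-pw T.D (T.pt u v w)) ∧
          dist (ι (unf f (T.pt u v w)) hV : X V) (f α) ≤ √(-pw T.D (T.pt u v w)) := by
      intro ξ h1 h2 h3
      refine ⟨ξ, ?_, ?_⟩
      · rw [h2.dist_eq (T.pt_mem_disk hs hu.le hv.le hw.le (by linarith) (by linarith) (by linarith))]
        exact Real.le_sqrt_of_sq_le h1
      · simp only [hF]
        rw [h3]
        exact Real.le_sqrt_of_sq_le h1
    by_cases c1 : dist (T.pt u v w) (sp (T.α : X U)) ^ 2 ≤ -pw T.D (T.pt u v w)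
    · exact fin c1 T.accα fun hV => T.image_access f hs hu hv hw hV
    by_cases c2 : dist (T.pt u v w) (sp (T.γ : X U)) ^ 2 ≤ -pw T.D (T.pt u v w)
    · refine fin c2 T.accγ fun hV => ?_
      have e3 := (T.rot.rot_pt w u v).trans (T.rot_pt v w u)
      have e4 := (T.rot.rot_pt' f w u v).trans (T.rot_pt' f v w u)
      have := T.rot.rot.image_access f (u := w) (v := u) (w := v) (by linarith) hw hu hv
        (by rwa [e4])
      simp only [e3, e4] at this
      exact this
    by_cases c3 : dist (T.pt u v w) (sp (T.β : X U)) ^ 2 ≤ -pw T.D (T.pt u v w)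
    · refine fin c3 T.accβ fun hV => ?_
      have e1 := T.rot_pt v w u
      have e2 := T.rot_pt' f v w u
      have := T.rot.image_access f (u := v) (v := w) (w := u) (by linarith) hv hw hu (by rwa [e2])
      simp only [e1, e2] at this
      exact this
    · exfalso
      push Not at c1 c2 c3
      simp only [dist_comm (T.pt u v w), dist_eq_norm] at c1 c2 c3
      have := mul_lt_mul_of_pos_left c1 hu
      have := mul_lt_mul_of_pos_left c2 hw
      have := mul_lt_mul_of_pos_left c3 hv
      have e : u * -pw T.D (T.pt u v w) + v * -pw T.D (T.pt u v w) + w * -pw T.D (T.pt u v w) =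
        -pw T.D (T.pt u v w) := by rw [← add_mul, ← add_mul, hs, one_mul]
      linarith

theorem iso_combo (Q : E2 ≃ᵢ E2) (x y : E2) (t : ℝ) :
    Q ((1 - t) • x + t • y) = (1 - t) • Q x + t • Q y := by
  have h := Q.toRealAffineIsometryEquiv.toAffineEquiv.toAffineMap.apply_lineMap x y t
  rw [AffineMap.lineMap_apply_module, AffineMap.lineMap_apply_module] at h
  exact h

theorem iso_openSegment (Q : E2 ≃ᵢ E2) (x y : E2) :
    Q '' openSegment ℝ x y = openSegment ℝ (Q x) (Q y) := by
  simp only [openSegment_eq_image, image_image, iso_combo]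

theorem iso_ext {Q Q' : E2 ≃ᵢ E2} (h : ∀ᶠ z in nhds y, Q z = Q' z) : Q = Q' := by
  ext1 z
  have hl : Tendsto (fun t : ℝ => (1 - t) • y + t • z) (nhds 0) (nhds ((1 - (0:ℝ)) • y + (0:ℝ) • z)) :=
    (by fun_prop : Continuous fun t : ℝ => (1 - t) • y + t • z).tendsto 0
  rw [sub_zero, one_smul, zero_smul, add_zero] at hl
  have h2 := (hl.eventually h).filter_mono (nhdsWithin_le_nhds (s := Ioi 0))
  obtain ⟨t, ht, ht0⟩ := (h2.and self_mem_nhdsWithin).exists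
  rw [iso_combo, iso_combo, h.self_of_nhds] at ht
  exact smul_right_injective _ (ne_of_gt ht0) (add_left_cancel ht)

theorem exists_iso_of_ball {F : E2 → E2} {r : ℝ} (hr : 0 < r)
    (h : ∀ z₁ ∈ ball y r, ∀ z₂ ∈ ball y r, dist (F z₁) (F z₂) = dist z₁ z₂) :
    ∃ Q : E2 ≃ᵢ E2, ∀ z ∈ ball y r, F z = Q z := by
  set g : E2 → E2 := fun v => F (y + v) - F y with hg
  have hmem : ∀ v ∈ ball (0 : E2) r, y + v ∈ ball y r := by
    intro v hv
    rw [mem_ball_zero_iff] at hv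
    rwa [mem_ball, dist_eq_norm, add_sub_cancel_left]
  have hn : ∀ v ∈ ball (0 : E2) r, ‖g v‖ = ‖v‖ := by
    intro v hv
    rw [hg, ← dist_eq_norm, h _ (hmem v hv) _ (mem_ball_self hr), dist_eq_norm, add_sub_cancel_left]
  have hsub : ∀ v ∈ ball (0 : E2) r, ∀ w ∈ ball (0 : E2) r, ‖g v - g w‖ = ‖v - w‖ := by
    intro v hv w hw
    rw [hg]
    simp only [sub_sub_sub_cancel_right]
    rw [← dist_eq_norm, h _ (hmem v hv) _ (hmem w hw), dist_eq_norm, add_sub_add_left_eq_sub]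
  have hin : ∀ v ∈ ball (0 : E2) r, ∀ w ∈ ball (0 : E2) r, inner ℝ (g v) (g w) = inner ℝ v w := by
    intro v hv w hw
    rw [real_inner_eq_norm_mul_self_add_norm_mul_self_sub_norm_sub_mul_self_div_two,
      real_inner_eq_norm_mul_self_add_norm_mul_self_sub_norm_sub_mul_self_div_two,
      hn v hv, hn w hw, hsub v hv w hw]
  set b := EuclideanSpace.basisFun (Fin 2) ℝ with hb
  have hbm : ∀ i, (r / 2) • b i ∈ ball (0 : E2) r := by
    intro i
    rw [mem_ball_zero_iff, norm_smul, b.orthonormal.1 i, mul_one, Real.norm_of_nonneg (by linarith)]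
    linarith
  set e : Fin 2 → E2 := fun i => (2 / r) • g ((r / 2) • b i) with he
  have hin' : ∀ i, ∀ v ∈ ball (0 : E2) r, inner ℝ (e i) (g v) = inner ℝ (b i) v := by
    intro i v hv
    rw [he]
    simp only [inner_smul_left, hin _ (hbm i) _ hv]
    simp
    field_simp
  have hon : Orthonormal ℝ e := by
    rw [orthonormal_iff_ite]
    intro i j
    have : inner ℝ (e i) (e j) = (2 / r) * inner ℝ (e i) (g ((r / 2) • b j)) := by
      conv_lhs => rw [show e j = (2 / r) • g ((r / 2) • b j) from rfl]
      rw [inner_smul_right]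
    rw [this, hin' i _ (hbm j), inner_smul_right, orthonormal_iff_ite.1 b.orthonormal i j]
    field_simp
  set b' := (basisOfOrthonormalOfCardEqFinrank hon (by simp)).toOrthonormalBasis (by simpa using hon)
    with hb'
  have hb'e : ∀ i, b' i = e i := by intro i; simp [hb']
  set L := b.equiv b' (Equiv.refl _) with hL
  have hLb : ∀ i, L (b i) = e i := by
    intro i
    rw [hL, OrthonormalBasis.equiv_apply_basis, Equiv.refl_apply, hb'e]
  refine ⟨((IsometryEquiv.subRight y).trans L.toIsometryEquiv).trans (IsometryEquiv.addRight (F y)),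
    fun z hz => ?_⟩
  have hzv : z - y ∈ ball (0 : E2) r := by
    rwa [mem_ball_zero_iff, ← dist_eq_norm]
  have key : g (z - y) = L (z - y) := by
    refine b'.repr.injective ?_
    ext i
    rw [OrthonormalBasis.repr_apply_apply, OrthonormalBasis.repr_apply_apply, hb'e, hin' i _ hzv,
      ← hLb, LinearIsometryEquiv.inner_map_map]
  simp only [hg, add_sub_cancel] at key
  simp only [IsometryEquiv.trans_apply, IsometryEquiv.subRight_apply, IsometryEquiv.addRight_apply,
    LinearIsometryEquiv.coe_toIsometryEquiv, ← key, sub_add_cancel]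

theorem exists_local_iso (hy : y ∈ core U) :
    ∃ Q : E2 ≃ᵢ E2, ∀ᶠ z in nhds y, unf f z = Q z := by
  obtain ⟨r, hr, hrb⟩ := Metric.isOpen_iff.1 (isOpen_core U) y hy
  obtain ⟨r', hr', hrb'⟩ := Metric.isOpen_iff.1 (isOpen_core V) _ (unf_mem_core f hy)
  have hm : 0 < min r r' := lt_min hr hr'
  have hb : ball y (min r r') ⊆ core U := (ball_subset_ball (min_le_left _ _)).trans hrb
  have hb' : ball (unf f y) (min r r') ⊆ core V := (ball_subset_ball (min_le_right _ _)).trans hrb'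
  have h1 : ∀ z₁ ∈ ball y (min r r'), ∀ z₂ ∈ ball y (min r r'),
      dist (unf f z₁) (unf f z₂) ≤ dist z₁ z₂ := fun z₁ h₁ z₂ h₂ =>
    dist_unf_le f (((convex_ball _ _).segment_subset h₁ h₂).trans hb)
  have h2 : ∀ z ∈ ball y (min r r'), unf f z ∈ ball (unf f y) (min r r') := fun z hz =>
    mem_ball.2 ((h1 z hz y (mem_ball_self hm)).trans_lt hz)
  obtain ⟨Q, hQ⟩ := exists_iso_of_ball (F := unf f) hm fun z₁ h₁ z₂ h₂ => by
    refine le_antisymm (h1 _ h₁ _ h₂) ?_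
    have := dist_unf_le f.symm
      (((convex_ball _ _).segment_subset (h2 z₁ h₁) (h2 z₂ h₂)).trans hb')
    rwa [unf_symm_unf f (hb h₁), unf_symm_unf f (hb h₂)] at this
  exact ⟨Q, eventually_of_mem (ball_mem_nhds _ hm) hQ⟩

theorem exists_component_iso (hC : C ∈ componentsOf (core U)) :
    ∃ Q : E2 ≃ᵢ E2, ∀ z ∈ C, unf f z = Q z := by
  obtain ⟨x, hx, rfl⟩ := hC
  obtain ⟨Q, hQ⟩ := exists_local_iso f hx
  refine ⟨Q, fun z hz => ?_⟩
  have hsub := (isPreconnected_connectedComponentIn (F := core U) (x := x)).subset_of_closure_inter_subset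
    (isOpen_setOfPred_eventually_nhds (p := fun w => unf f w = Q w))
    ⟨x, mem_connectedComponentIn hx, hQ⟩ ?_
  · exact (hsub hz).self_of_nhds
  · rintro p ⟨hp, hpC⟩
    obtain ⟨Q', hQ'⟩ := exists_local_iso f (connectedComponentIn_subset _ _ hpC)
    have hopen := isOpen_setOfPred_eventually_nhds (p := fun w => unf f w = Q' w)
    obtain ⟨q, hq', hq⟩ := mem_closure_iff.1 hp _ hopen hQ'
    have : Q' = Q := iso_ext (hq'.and hq |>.mono fun w hw => hw.1.symm.trans hw.2)
    rw [← this]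
    exact hQ'

/-- The plane isometry unfolding a component of the core. -/
def comp (C : Set E2) : E2 ≃ᵢ E2 :=
  open Classical in
  if h : ∃ Q : E2 ≃ᵢ E2, ∀ z ∈ C, unf f z = Q z then h.choose else IsometryEquiv.refl E2

theorem comp_eq (hC : C ∈ componentsOf (core U)) {z : E2}
    (hz : z ∈ C) : comp f C z = unf f z := by
  have h := exists_component_iso f hC
  rw [comp, dif_pos h]
  exact (h.choose_spec z hz).symm

theorem sub_core (hC : C ∈ componentsOf (core U)) : C ⊆ core U := by
  obtain ⟨x, hx, rfl⟩ := hC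
  exact connectedComponentIn_subset _ _

theorem isOpen_component (hC : C ∈ componentsOf (core U)) : IsOpen C := by
  obtain ⟨x, hx, rfl⟩ := hC
  exact (isOpen_core U).connectedComponentIn

theorem nonempty_component (hC : C ∈ componentsOf (core U)) : C.Nonempty := by
  obtain ⟨x, hx, rfl⟩ := hC
  exact ⟨x, mem_connectedComponentIn hx⟩

theorem component_eq (hC : C ∈ componentsOf (core U)) (hx : x ∈ C) :
    C = connectedComponentIn (core U) x := by
  obtain ⟨y, hy, rfl⟩ := hC
  exact connectedComponentIn_eq hx

theorem unf_mem_component {x z : E2} (hx : x ∈ core U)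
    (hz : z ∈ connectedComponentIn (core U) x) :
    unf f z ∈ connectedComponentIn (core V) (unf f x) := by
  have hC : connectedComponentIn (core U) x ∈ componentsOf (core U) := ⟨x, hx, rfl⟩
  have hpre : IsPreconnected (unf f '' connectedComponentIn (core U) x) := by
    rw [← image_congr fun z hz => comp_eq f hC hz]
    exact isPreconnected_connectedComponentIn.image _ (comp f _).continuous.continuousOn
  refine hpre.subset_connectedComponentIn (mem_image_of_mem _ (mem_connectedComponentIn hx)) ?_
    (mem_image_of_mem _ hz)
  rintro _ ⟨w, hw, rfl⟩
  exact unf_mem_core f (connectedComponentIn_subset _ _ hw)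

theorem comp_image (hx : x ∈ core U) :
    comp f (connectedComponentIn (core U) x) '' connectedComponentIn (core U) x =
      connectedComponentIn (core V) (unf f x) := by
  have hC : connectedComponentIn (core U) x ∈ componentsOf (core U) := ⟨x, hx, rfl⟩
  rw [image_congr fun z hz => comp_eq f hC hz]
  refine Subset.antisymm ?_ fun d hd => ?_
  · rintro _ ⟨z, hz, rfl⟩
    exact unf_mem_component f hx hz
  · have := unf_mem_component f.symm (unf_mem_core f hx) hd
    rw [unf_symm_unf f hx] at this
    refine ⟨_, this, ?_⟩
    have h2 := unf_symm_unf f.symm (connectedComponentIn_subset _ _ hd)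
    rwa [IsometryEquiv.symm_symm] at h2

theorem comp_mem (hC : C ∈ componentsOf (core U)) :
    comp f C '' C ∈ componentsOf (core V) := by
  obtain ⟨x, hx, rfl⟩ := hC
  exact ⟨_, unf_mem_core f hx, comp_image f hx⟩

theorem comp_symm (hC : C ∈ componentsOf (core U)) :
    comp f.symm (comp f C '' C) = (comp f C).symm := by
  obtain ⟨x, hx⟩ := nonempty_component hC
  have ho := (comp f C).toHomeomorph.isOpenMap C (isOpen_component hC)
  refine iso_ext (y := comp f C x) (eventually_of_mem (ho.mem_nhds ⟨x, hx, rfl⟩) ?_)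
  rintro _ ⟨z, hz, rfl⟩
  change comp f.symm (comp f C '' C) (comp f C z) = (comp f C).symm (comp f C z)
  rw [IsometryEquiv.symm_apply_apply, comp_eq f.symm (comp_mem f hC) ⟨z, hz, rfl⟩, comp_eq f hC hz,
    unf_symm_unf f (sub_core hC hz)]

theorem comp_image_symm (hC : C ∈ componentsOf (core U)) :
    comp f.symm (comp f C '' C) '' (comp f C '' C) = C := by
  rw [comp_symm f hC, image_image]
  simp

theorem access_image (hC : C ∈ componentsOf (core U))
    (hy : y ∈ C) {α : bd U} (hα : AccOn (openSegment ℝ y (sp (α : X U))) (α : X U))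
    (hs : openSegment ℝ y (sp (α : X U)) ⊆ C) :
    sp (f α : X V) = comp f C (sp (α : X U)) ∧
      AccOn (openSegment ℝ (comp f C y) (comp f C (sp (α : X U)))) (f α : X V) := by
  set a := sp (α : X U) with ha
  set Q := comp f C with hQ
  have hyc := sub_core hC hy
  have hyh : y ∈ convexHull ℝ (frontier U.set) := interior_subset hyc.2
  have hseg : ∀ t ∈ Ioo (0:ℝ) 1, (1 - t) • y + t • a ∈ openSegment ℝ y a := fun t ht => oseg_mem ht
  have hFt : ∀ t ∈ Ioo (0:ℝ) 1, unf f ((1 - t) • y + t • a) = (1 - t) • Q y + t • Q a :=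
    fun t ht => by rw [← comp_eq f hC (hs (hseg t ht)), ← hQ, iso_combo]
  have hda : ∀ t ∈ Ioo (0:ℝ) 1, dist ((1 - t) • Q y + t • Q a) (Q a) = (1 - t) * dist y a := by
    intro t ht
    rw [dist_eq_norm, show (1 - t) • Q y + t • Q a - Q a = (1 - t) • (Q y - Q a) by module,
      norm_smul, ← dist_eq_norm (Q y), Q.dist_eq, Real.norm_of_nonneg (by linarith [ht.2])]
  have hsp : sp (f α : X V) = Q a := by
    by_contra hne
    have hd := dist_pos.2 hne
    obtain ⟨t₀, ht₀, hb⟩ := unf_near_im f hyh hα (half_pos hd)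
    have h1 : Tendsto (fun t : ℝ => (1 - t) * dist y a) (nhds 1) (nhds ((1 - 1) * dist y a)) :=
      (by fun_prop : Continuous fun t : ℝ => (1 - t) * dist y a).tendsto 1
    rw [sub_self, zero_mul] at h1
    obtain ⟨t, hlt, htm⟩ := (((h1.eventually_lt_const (half_pos hd)).filter_mono
      (nhdsWithin_le_nhds (s := Iio 1))).and
        (Ioo_mem_nhdsLT ht₀.2)).exists
    have htI : t ∈ Ioo (0:ℝ) 1 := ⟨ht₀.1.trans_lt htm.1, htm.2⟩
    have h2 := hb t htm (sub_core hC (hs (hseg t htI)))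
    rw [hFt t htI, im_coe] at h2
    have h3 := hda t htI
    have := dist_triangle_left (sp (f α : X V)) (Q a) ((1 - t) • Q y + t • Q a)
    linarith
  refine ⟨hsp, ?_⟩
  have hsV : openSegment ℝ (Q y) (Q a) ⊆ V.set := by
    rw [← iso_openSegment]
    rintro _ ⟨z, hz, rfl⟩
    rw [hQ, comp_eq f hC (hs hz)]
    exact unf_mem f (sub_core hC (hs hz))
  obtain ⟨β, hβ, hβA⟩ := exists_accOn (W := V) (convex_openSegment (Q y) (Q a)) hsV
    (segment_subset_closure_openSegment (right_mem_segment ℝ _ _)) (hsp ▸ sp_bd_notMem (f α))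
  have : (f α : X V) = β := by
    by_contra hne
    have hd := dist_pos.2 hne
    obtain ⟨K, hK⟩ := exists_pw_bound hyh (sp_mem_frontier α.2)
    have h1 : Tendsto (fun t : ℝ => √((1 - t) * K) + (√((1 - t) * K) + (1 - t) * dist y a) +
        (1 - t) * dist y a) (nhds 1) (nhds (√((1 - 1) * K) + (√((1 - 1) * K) + (1 - 1) * dist y a) +
        (1 - 1) * dist y a)) :=
      (by fun_prop : Continuous fun t : ℝ => √((1 - t) * K) + (√((1 - t) * K) + (1 - t) * dist y a) +
        (1 - t) * dist y a).tendsto 1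
    simp only [sub_self, zero_mul, Real.sqrt_zero, add_zero] at h1
    obtain ⟨t, hlt, htm⟩ := (((h1.eventually_lt_const hd).filter_mono
      (nhdsWithin_le_nhds (s := Iio 1))).and
        (Ioo_mem_nhdsLT one_pos)).exists
    have hzc := sub_core hC (hs (hseg t htm))
    obtain ⟨R⟩ := exists_rep hzc
    obtain ⟨δ, hδ1, hδ2⟩ := R.exists_near f hzc
    have hb := Real.sqrt_le_sqrt (hK t ⟨htm.1.le, htm.2.le⟩ R.D R.empty)
    have e1 := hα.dist_eq (hseg t htm) hzc.1
    have e2 : dist ((1 - t) • y + t • a) a = (1 - t) * dist y a := by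
      rw [← hda t htm, ← iso_combo, Q.dist_eq]
    have hm : unf f ((1 - t) • y + t • a) ∈ openSegment ℝ (Q y) (Q a) := by
      rw [hFt t htm, openSegment_eq_image]; exact ⟨t, htm, rfl⟩
    have e3 := hβA.dist_eq hm (unf_mem f hzc)
    rw [hβ] at e3
    have e4 : dist (unf f ((1 - t) • y + t • a)) (Q a) = (1 - t) * dist y a := by
      rw [hFt t htm, hda t htm]
    have e5 : dist (f δ : X V) (f α) = dist (δ : X U) α := f.dist_eq δ α
    have t1 := dist_triangle_left (f α : X V) β (ι (unf f ((1 - t) • y + t • a)) (unf_mem f hzc))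
    have t2 := dist_triangle (ι (unf f ((1 - t) • y + t • a)) (unf_mem f hzc) : X V) (f δ) (f α)
    have t3 := dist_triangle_left (δ : X U) α (ι ((1 - t) • y + t • a) hzc.1)
    linarith
  rw [this]
  exact hβA

theorem dist_ι_unf_le (hy : y ∈ core U) (ξ : bd U) :
    dist (ι (unf f y) (unf_mem f hy) : X V) (f ξ) ≤ 3 * dist (ι y hy.1 : X U) ξ := by
  obtain ⟨η, hη, hacc, hd, h0⟩ := exists_nearest_bd (ne_univ_of_mem_bd ξ.2) hy.1
  set r := infDist y U.setᶜ
  have hC : connectedComponentIn (core U) y ∈ componentsOf (core U) := ⟨y, hy, rfl⟩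
  have hyC := mem_connectedComponentIn hy
  have hdy : dist y (sp η) = r := by
    rw [← hacc.dist_eq (mem_ball_self h0) hy.1, hd]
  have hos : openSegment ℝ y (sp η) ⊆ ball y r := by
    intro z hz
    obtain ⟨t, ht, rfl⟩ := mem_oseg.1 hz
    rw [mem_ball, dist_comm, dist_eq_norm, show y - ((1 - t) • y + t • sp η) = t • (y - sp η) by module,
      norm_smul, ← dist_eq_norm, hdy, Real.norm_of_nonneg ht.1.le]
    nlinarith [ht.2]
  have hoc : openSegment ℝ y (sp η) ⊆ core U := fun z hz =>
    ⟨hacc.subset (hos hz), (convex_convexHull ℝ _).openSegment_interior_self_subset_interior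
      hy.2 (mem_hull_of_bd hη) hz⟩
  have hoC : openSegment ℝ y (sp η) ⊆ connectedComponentIn (core U) y := by
    have hic : IsPreconnected (insert y (openSegment ℝ y (sp η))) := by
      refine (convex_openSegment y (sp η)).isPreconnected.subset_closure (subset_insert _ _) ?_
      exact insert_subset (segment_subset_closure_openSegment (left_mem_segment ℝ _ _)) subset_closure
    exact (subset_insert _ _).trans (hic.subset_connectedComponentIn (mem_insert _ _)
      (insert_subset hy hoc))
  obtain ⟨h1, h2⟩ := access_image f hC hyC (α := ⟨η, hη⟩) (hacc.mono hos) hoC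
  have hx : dist (ι (unf f y) (unf_mem f hy) : X V) (f ⟨η, hη⟩) ≤ r := by
    refine AccOn.dist_le_of_openSegment (unf_mem f hy) (by rw [h1]; rwa [comp_eq f hC hyC] at h2) |>.trans ?_
    rw [h1, ← comp_eq f hC hyC, IsometryEquiv.dist_eq, hdy]
  have e5 : dist (f ⟨η, hη⟩ : X V) (f ξ) = dist η ξ := f.dist_eq ⟨η, hη⟩ ξ
  have t2 := dist_triangle (ι (unf f y) (unf_mem f hy) : X V) (f ⟨η, hη⟩) (f ξ)
  have t3 := dist_triangle_left η (ξ : X U) (ι y hy.1)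
  have hr : r ≤ dist (ι y hy.1 : X U) ξ := by
    refine (infDist_le_dist_of_mem (sp_bd_notMem ξ)).trans ?_
    have := dist_sp_le (ι y hy.1 : X U) ξ
    rwa [sp_ι] at this
  linarith

/-- A closed convex set with an interior ball, containing the boundary of `W`. -/
structure Body (W : Dom) where
  K : Set E2
  closed : IsClosed K
  convex : Convex ℝ K
  o : E2
  r : ℝ
  r_pos : 0 < r
  ball_subset : ball o r ⊆ K
  frontier_subset : frontier W.set ⊆ K

namespace Body

variable (B : Body W)

/-- The part of the domain outside the body. -/
def F : Set E2 := W.set \ B.K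

/-- Dilation about the centre. -/
def dil (l : ℝ) (x : E2) : E2 := B.o + l • (x - B.o)

theorem dist_dil (l : ℝ) (x y : E2) : dist (B.dil l x) (B.dil l y) = |l| * dist x y := by
  rw [dil, dil, dist_add_left, dist_eq_norm, ← smul_sub, sub_sub_sub_cancel_right, norm_smul,
    Real.norm_eq_abs, dist_eq_norm]

theorem dist_dil_dil (l m : ℝ) (x : E2) : dist (B.dil l x) (B.dil m x) = |l - m| * dist x B.o := by
  rw [dil, dil, dist_add_left, dist_eq_norm, ← sub_smul, norm_smul, Real.norm_eq_abs, dist_eq_norm]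

@[simp] theorem dil_one (x : E2) : B.dil 1 x = x := by simp [dil]

theorem isOpen_F : IsOpen B.F := W.isDom.1.sdiff B.closed

theorem continuous_dil (l : ℝ) : Continuous (B.dil l) := by unfold dil; fun_prop

theorem continuous_dil_left (x : E2) : Continuous fun l => B.dil l x := by unfold dil; fun_prop

theorem notMem_of_mem_ball_dil {x p : E2} (hx : x ∉ interior B.K) {l : ℝ} (hl : 1 < l)
    (hp : p ∈ ball (B.dil l x) ((l - 1) * B.r)) : p ∉ B.K := by
  intro hpK
  apply hx
  have hl1 : 0 < l - 1 := by linarith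
  set z := B.o + (l - 1)⁻¹ • (B.dil l x - p) with hz
  have hzb : z ∈ ball B.o B.r := by
    rw [mem_ball, dist_eq_norm, hz, add_sub_cancel_left, norm_smul, norm_inv,
      Real.norm_of_nonneg hl1.le, ← dist_eq_norm, dist_comm, inv_mul_lt_iff₀ hl1]
    exact hp
  have hzi : z ∈ interior B.K := interior_maximal B.ball_subset isOpen_ball hzb
  have hl0 : l ≠ 0 := by linarith
  have : x = (l⁻¹) • p + (1 - l⁻¹) • z := by
    have e : (1 - l⁻¹) * (l - 1)⁻¹ = l⁻¹ := by field_simp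
    rw [hz, smul_add, smul_smul, e, dil]
    match_scalars <;> field_simp <;> ring
  rw [this]
  exact B.convex.combo_self_interior_mem_interior hpK hzi (by positivity)
    (by rw [sub_pos]; exact inv_lt_one_of_one_lt₀ hl) (by ring)

theorem subset_of_disjoint {s : Set E2} (hs : IsPreconnected s) (hK : Disjoint s B.K)
    (hx : x ∈ s) (hxW : x ∈ W.set) : s ⊆ W.set := by
  intro y hy
  by_contra hyW
  obtain ⟨p, hp, hpf⟩ := exists_mem_frontier_of_isPreconnected hs hx hxW hy hyW
  exact disjoint_left.1 hK hp (B.frontier_subset hpf)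

theorem notMem_interior (hx : x ∈ closure B.F) : x ∉ interior B.K := by
  intro hi
  obtain ⟨y, hy, hyF⟩ := mem_closure_iff.1 hx _ isOpen_interior hi
  exact hyF.2 (interior_subset hy)

theorem dil_mem_F (hx : x ∈ B.F) {l : ℝ} (hl : 1 ≤ l) : B.dil l x ∈ B.F := by
  have hn : ∀ m ∈ Icc 1 l, B.dil m x ∉ B.K := by
    intro m hm
    rcases hm.1.eq_or_lt with rfl | h
    · simpa using hx.2
    · exact B.notMem_of_mem_ball_dil (B.notMem_interior (subset_closure hx)) h
        (mem_ball_self (mul_pos (by linarith) B.r_pos))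
  refine ⟨B.subset_of_disjoint (s := (fun m => B.dil m x) '' Icc 1 l)
    (isPreconnected_Icc.image _ (B.continuous_dil_left x).continuousOn) ?_
    ⟨1, ⟨le_rfl, hl⟩, B.dil_one x⟩ hx.1 ⟨l, ⟨hl, le_rfl⟩, rfl⟩, hn l ⟨hl, le_rfl⟩⟩
  rw [disjoint_left]
  rintro _ ⟨m, hm, rfl⟩
  exact hn m hm

theorem ball_dil_subset (hx : x ∈ closure B.F) {l : ℝ} (hl : 1 < l) :
    ball (B.dil l x) ((l - 1) * B.r) ⊆ B.F := by
  have hpos : 0 < (l - 1) * B.r := mul_pos (by linarith) B.r_pos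
  have hd : Disjoint (ball (B.dil l x) ((l - 1) * B.r)) B.K := disjoint_left.2 fun p hp =>
    B.notMem_of_mem_ball_dil (B.notMem_interior hx) hl hp
  have hnb : B.dil l ⁻¹' ball (B.dil l x) ((l - 1) * B.r) ∈ nhds x :=
    (B.continuous_dil l).continuousAt (ball_mem_nhds _ hpos)
  obtain ⟨z, hz, hzF⟩ := mem_closure_iff_nhds.1 hx _ hnb
  exact fun y hy => ⟨B.subset_of_disjoint (convex_ball _ _).isPreconnected hd hz
    (B.dil_mem_F hzF hl.le).1 hy, disjoint_left.1 hd hy⟩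

theorem dil_mem (hx : x ∈ closure B.F) {l : ℝ} (hl : 1 < l) : B.dil l x ∈ B.F :=
  B.ball_dil_subset hx hl (mem_ball_self (mul_pos (by linarith) B.r_pos))

theorem tendsto_dil (x : E2) : Tendsto (fun l => B.dil l x) (nhdsWithin 1 (Ioi 1)) (nhds x) := by
  have := (B.continuous_dil_left x).tendsto 1
  rw [dil_one] at this
  exact this.mono_left nhdsWithin_le_nhds

theorem mem_closure_F_of_notMem_interior (hx : x ∈ W.set) (hi : x ∉ interior B.K) :
    x ∈ closure B.F := by
  refine mem_closure_of_tendsto (B.tendsto_dil x) ?_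
  filter_upwards [B.tendsto_dil x (W.isDom.1.mem_nhds hx), self_mem_nhdsWithin] with l hl hl1
  exact ⟨hl, B.notMem_of_mem_ball_dil hi hl1
    (mem_ball_self (mul_pos (sub_pos.2 hl1) B.r_pos))⟩

theorem mem_frontier_F_iff : x ∈ frontier B.F ↔ x ∈ closure B.F ∧ x ∈ B.K := by
  rw [frontier, B.isOpen_F.interior_eq]
  constructor
  · rintro ⟨h, hn⟩
    refine ⟨h, ?_⟩
    by_contra hK
    by_cases hW : x ∈ W.set
    · exact hn ⟨hW, hK⟩
    · apply hK
      apply B.frontier_subset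
      rw [frontier, W.isDom.1.interior_eq]
      exact ⟨closure_mono sdiff_subset h, hW⟩
  · rintro ⟨h, hK⟩
    exact ⟨h, fun h => h.2 hK⟩

theorem frontier_F_subset : frontier B.F ⊆ frontier B.K := fun x hx => by
  rw [mem_frontier_F_iff] at hx
  exact ⟨subset_closure hx.2, B.notMem_interior hx.1⟩

theorem segment_dil_subset {l m : ℝ} {s : Set E2} (hl : ∀ k ∈ uIcc l m, B.dil k x ∈ s) :
    segment ℝ (B.dil l x) (B.dil m x) ⊆ s := by
  rintro _ ⟨a, b, ha, hb, hab, rfl⟩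
  have : a • B.dil l x + b • B.dil m x = B.dil (a * l + b * m) x := by
    simp only [dil]
    rw [show a = 1 - b by linarith]
    module
  rw [this]
  refine hl _ ?_
  rw [← segment_eq_uIcc]
  exact ⟨a, b, ha, hb, hab, rfl⟩

theorem exists_e (hx : x ∈ closure B.F) : ∃ ξ : X W, sp ξ = x ∧
    ∀ l, ∀ hl : 1 < l, dist (ι (B.dil l x) (B.dil_mem hx hl).1 : X W) ξ = (l - 1) * dist x B.o := by
  by_cases hW : x ∈ W.set
  · refine ⟨ι x hW, sp_ι _ _, fun l hl => ?_⟩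
    have := B.dist_dil_dil l 1 x
    rw [dil_one, abs_of_pos (sub_pos.2 hl)] at this
    rw [← this]
    refine dist_ι_of_segment _ _ ?_
    have h := B.segment_dil_subset (x := x) (l := l) (m := 1) (s := W.set) fun k hk => by
      rw [uIcc_of_ge hl.le] at hk
      rcases hk.1.eq_or_lt with rfl | h
      · simpa
      · exact (B.dil_mem hx h).1
    simpa using h
  · set S : Set E2 := (fun l => B.dil l x) '' Ioi 1
    have hSc : Convex ℝ S := by
      have : S = (AffineMap.lineMap B.o x : ℝ →ᵃ[ℝ] E2) '' Ioi 1 := by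
        refine image_congr fun l _ => ?_
        simp [dil, AffineMap.lineMap_apply, add_comm]
      rw [this]
      exact (convex_Ioi _).affine_image _
    obtain ⟨α, hα, hacc⟩ := exists_accOn hSc (by
      rintro _ ⟨l, hl, rfl⟩; exact (B.dil_mem hx hl).1) (a := x)
      (mem_closure_of_tendsto (B.tendsto_dil x) (by
        filter_upwards [self_mem_nhdsWithin] with l hl using ⟨l, hl, rfl⟩)) hW
    refine ⟨α, hα, fun l hl => ?_⟩
    rw [hacc.dist_eq ⟨l, hl, rfl⟩, hα]
    have := B.dist_dil_dil l 1 x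
    rwa [dil_one, abs_of_pos (sub_pos.2 hl)] at this

/-- The point of the completion accessed radially from outside at `x`. -/
def e (hx : x ∈ closure B.F) : X W := (B.exists_e hx).choose

@[simp] theorem sp_e (hx : x ∈ closure B.F) : sp (B.e hx) = x :=
  (B.exists_e hx).choose_spec.1

theorem dist_e (hx : x ∈ closure B.F) {l : ℝ} (hl : 1 < l) :
    dist (ι (B.dil l x) (B.dil_mem hx hl).1 : X W) (B.e hx) = (l - 1) * dist x B.o :=
  (B.exists_e hx).choose_spec.2 l hl

theorem e_eq_ι (hx : x ∈ closure B.F) (hW : x ∈ W.set) : B.e hx = ι x hW := by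
  have h : sp (B.e hx) ∈ W.set := by rwa [sp_e]
  rw [eq_ι_of_sp_mem h]
  congr 1
  exact B.sp_e hx

theorem e_mem_bd (hx : x ∈ closure B.F) (hW : x ∉ W.set) : B.e hx ∈ bd W :=
  mem_bd_of_sp_notMem (by rwa [sp_e])

theorem dist_e_le (hx : x ∈ closure B.F) (hy : y ∈ closure B.F) {l : ℝ} (hl : 1 < l)
    {L : ℝ} (h : dist (ι (B.dil l x) (B.dil_mem hx hl).1 : X W)
      (ι (B.dil l y) (B.dil_mem hy hl).1) ≤ L) :
    dist (B.e hx) (B.e hy) ≤ (l - 1) * (dist x B.o + dist y B.o) + L := by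
  have h1 := B.dist_e hx hl
  have h2 := B.dist_e hy hl
  have h3 := dist_triangle4 (B.e hx) (ι (B.dil l x) (B.dil_mem hx hl).1)
    (ι (B.dil l y) (B.dil_mem hy hl).1) (B.e hy)
  rw [dist_comm] at h1
  linarith

theorem dist_e_lt (hx : x ∈ closure B.F) {ε : ℝ} (hε : 0 < ε) :
    ∃ δ > 0, ∀ y, ∀ hy : y ∈ closure B.F, dist y x < δ → dist (B.e hy) (B.e hx) < ε := by
  set M := dist x B.o + dist x B.o + 2 with hM
  have hMp : 0 < M := by positivity
  obtain ⟨l, hl, hlM⟩ : ∃ l > 1, (l - 1) * M < ε / 2 := by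
    refine ⟨1 + ε / (4 * M), by linarith [show 0 < ε / (4 * M) by positivity], ?_⟩
    rw [add_sub_cancel_left, div_mul_eq_mul_div, div_lt_div_iff₀ (by positivity) (by norm_num)]
    nlinarith [mul_pos hε hMp]
  have hr : 0 < (l - 1) * B.r := mul_pos (by linarith) B.r_pos
  refine ⟨min 1 (min (ε / (2 * l)) ((l - 1) * B.r / l)), by positivity, fun y hy hd => ?_⟩
  simp only [lt_min_iff] at hd
  obtain ⟨hd1, hd2, hd3⟩ := hd
  have hl0 : 0 < l := by linarith
  rw [lt_div_iff₀ (by positivity)] at hd2 hd3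
  have e1 : dist (B.dil l y) (B.dil l x) = l * dist y x := by rw [dist_dil, abs_of_pos hl0]
  have hb : ball (B.dil l x) ((l - 1) * B.r) ⊆ W.set :=
    (B.ball_dil_subset hx hl).trans sdiff_subset
  have hyb : B.dil l y ∈ ball (B.dil l x) ((l - 1) * B.r) := by rw [mem_ball, e1]; linarith
  have := B.dist_e_le hy hx hl (dist_ι_of_ball hb hyb (mem_ball_self hr)).le
  have h4 : dist y B.o ≤ dist y x + dist x B.o := dist_triangle _ _ _
  rw [e1] at this
  nlinarith

theorem dist_e_le_of_path {γ : ℝ → E2} {a b : ℝ} (hab : a ≤ b) (hγ : ContinuousOn γ (Icc a b))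
    (hm : MapsTo γ (Icc a b) (closure B.F)) :
    edist (B.e (hm ⟨le_rfl, hab⟩)) (B.e (hm ⟨hab, le_rfl⟩)) ≤ eVariationOn γ (Icc a b) := by
  by_cases htop : eVariationOn γ (Icc a b) = ⊤
  · rw [htop]; exact le_top
  set L := (eVariationOn γ (Icc a b)).toReal with hL
  have hLe : eVariationOn γ (Icc a b) = ENNReal.ofReal L := (ENNReal.ofReal_toReal htop).symm
  rw [hLe, edist_dist]
  refine ENNReal.ofReal_le_ofReal ?_
  set ea := B.e (hm ⟨le_rfl, hab⟩)
  set eb := B.e (hm ⟨hab, le_rfl⟩)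
  set M := dist (γ a) B.o + dist (γ b) B.o
  have key : ∀ l : ℝ, 1 < l → dist ea eb ≤ (l - 1) * M + l * L := by
    intro l hl
    refine B.dist_e_le _ _ hl ?_
    have h := edist_ι_le_of_path (W := W) (γ := fun t => B.dil l (γ t)) hab
      ((B.continuous_dil l).comp_continuousOn hγ) fun t ht => (B.dil_mem (hm ht) hl).1
    have hv : eVariationOn (fun t => B.dil l (γ t)) (Icc a b) ≤ ENNReal.ofReal (l * L) := by
      have hlip : LipschitzWith (Real.toNNReal l) (B.dil l) := LipschitzWith.of_dist_le_mul
        fun x y => by rw [dist_dil, abs_of_pos (by linarith), Real.coe_toNNReal _ (by linarith)]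
      refine ((hlip.lipschitzOnWith (s := univ)).comp_eVariationOn_le (mapsTo_univ _ _)).trans ?_
      rw [hLe, ENNReal.ofReal_mul (by linarith)]
      rfl
    have := h.trans hv
    rw [edist_dist, ENNReal.ofReal_le_ofReal_iff (by
      have := ENNReal.toReal_nonneg (a := eVariationOn γ (Icc a b)); nlinarith)] at this
    exact this
  have hlim : Tendsto (fun l : ℝ => (l - 1) * M + l * L) (nhdsWithin 1 (Ioi 1)) (nhds L) := by
    have : Continuous fun l : ℝ => (l - 1) * M + l * L := by fun_prop
    have := this.tendsto 1
    simp only [sub_self, zero_mul, one_mul, zero_add] at this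
    exact this.mono_left nhdsWithin_le_nhds
  refine ge_of_tendsto hlim ?_
  filter_upwards [self_mem_nhdsWithin] with l hl using key l hl

/-- `β` is a limit of points outside the interior of the body. -/
def Outer (β : X W) : Prop :=
  ∀ ε > 0, ∃ p, ∃ hp : p ∈ W.set, p ∉ interior B.K ∧ dist (ι p hp) β < ε

/-- `β` is a limit of points in the interior of the body. -/
def Inner (β : X W) : Prop :=
  ∀ ε > 0, ∃ p, ∃ hp : p ∈ W.set, p ∈ interior B.K ∧ dist (ι p hp) β < ε

theorem outer_of_not_inner {β : X W} (h : ¬ B.Inner β) : B.Outer β := by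
  simp only [Inner, not_forall, not_exists, not_and, not_lt] at h
  obtain ⟨ε₀, h0, h⟩ := h
  intro ε hε
  obtain ⟨p, hp, hd⟩ := exists_ι_near β (lt_min h0 hε)
  rw [dist_comm, lt_min_iff] at hd
  exact ⟨p, hp, fun hi => (h p hp hi).not_gt hd.1, hd.2⟩

theorem outer_e (hx : x ∈ closure B.F) : B.Outer (B.e hx) := by
  intro ε hε
  have hlim := tendsto_sub_one_mul (dist x B.o)
  obtain ⟨l, hl, hl1⟩ := ((hlim.eventually_lt_const hε).and self_mem_nhdsWithin).exists
  exact ⟨_, (B.dil_mem hx hl1).1, B.notMem_interior (subset_closure (B.dil_mem hx hl1)), by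
    rwa [B.dist_e hx hl1]⟩

theorem Outer.exists_e {β : X W} (h : B.Outer β) :
    ∃ hx : sp β ∈ closure B.F, B.e hx = β := by
  have hx : sp β ∈ closure B.F := by
    rw [← closure_closure, Metric.mem_closure_iff]
    intro ε hε
    obtain ⟨p, hp, hpi, hd⟩ := h ε hε
    refine ⟨p, B.mem_closure_F_of_notMem_interior hp hpi, ?_⟩
    have := dist_sp_le (ι p hp) β
    rw [sp_ι, dist_comm] at this
    linarith
  refine ⟨hx, ?_⟩
  rw [← dist_le_zero]
  refine le_of_forall_pos_le_add fun ε hε => ?_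
  obtain ⟨δ, hδ, hδe⟩ := B.dist_e_lt hx (half_pos hε)
  obtain ⟨p, hp, hpi, hd⟩ := h (min δ (ε / 2)) (lt_min hδ (half_pos hε))
  have h1 := dist_sp_le (ι p hp) β
  rw [sp_ι] at h1
  have h2 := hδe p (B.mem_closure_F_of_notMem_interior hp hpi)
    (h1.trans_lt (hd.trans_le (min_le_left _ _)))
  rw [B.e_eq_ι _ hp] at h2
  have h3 := dist_triangle_left (B.e hx) β (ι p hp)
  have := hd.trans_le (min_le_right _ _)
  linarith

end Body

namespace Body

/-- The interior of the body is the interior of the convex hull of the boundary. -/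
def Std (B : Body W) : Prop := interior B.K = interior (convexHull ℝ (frontier W.set))

theorem Std.core_eq {B : Body W} (hB : B.Std) : core W = W.set ∩ interior B.K := by
  rw [core, corePart, hB]

theorem combo_o_mem_interior (B : Body W) {w : E2} (hw : w ∈ B.K) {t : ℝ} (ht : t ∈ Ioc 0 1) :
    B.dil (1 - t) w ∈ interior B.K := by
  have : B.dil (1 - t) w = t • B.o + (1 - t) • w := by simp only [dil]; module
  rw [this]
  exact B.convex.combo_interior_self_mem_interior (interior_maximal B.ball_subset isOpen_ball
    (mem_ball_self B.r_pos)) hw ht.1 (by linarith [ht.2]) (by ring)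

theorem mem_closure_interior (B : Body W) {w : E2} (hw : w ∈ B.K) :
    w ∈ closure (interior B.K) := by
  have h : Tendsto (fun t : ℝ => B.dil (1 - t) w) (nhdsWithin 0 (Ioi 0)) (nhds w) := by
    have := ((B.continuous_dil_left w).comp (by fun_prop : Continuous fun t : ℝ => 1 - t)).tendsto 0
    simp only [Function.comp_apply, sub_zero, dil_one] at this
    exact this.mono_left nhdsWithin_le_nhds
  refine mem_closure_of_tendsto h ?_
  filter_upwards [Ioc_mem_nhdsGT (zero_lt_one' ℝ)] with t ht using B.combo_o_mem_interior hw ht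

theorem eq_of_inter {C C' : Set E2} (hC : C ∈ componentsOf (core W))
    (hC' : C' ∈ componentsOf (core W)) (h : x ∈ C) (h' : x ∈ C') : C = C' := by
  rw [component_eq hC h, component_eq hC' h']

theorem exists_local {B : Body W} (hB : B.Std) {w : E2} (hw : w ∈ W.set) (hK : w ∈ B.K) :
    ∃ C ∈ componentsOf (core W), ∃ s > 0, ball w s ⊆ W.set ∧ ball w s ∩ interior B.K ⊆ C ∧
      (∀ z ∈ ball w s, z ∈ B.K → z ∈ closure C) ∧
      ∀ C' ∈ componentsOf (core W), ∀ z ∈ ball w s, z ∈ closure C' → C' = C := by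
  obtain ⟨s, hs, hsW⟩ := Metric.isOpen_iff.1 W.isDom.1 w hw
  have hcl : ∀ z ∈ ball w s, z ∈ B.K → z ∈ closure (ball w s ∩ interior B.K) := fun z hz hzK =>
    isOpen_ball.inter_closure ⟨hz, B.mem_closure_interior hzK⟩
  obtain ⟨y, hy⟩ : (ball w s ∩ interior B.K).Nonempty :=
    closure_nonempty_iff.1 ⟨w, hcl w (mem_ball_self hs) hK⟩
  have hsub : ball w s ∩ interior B.K ⊆ core W := by
    rw [hB.core_eq]; exact inter_subset_inter_left _ hsW
  have hC : ball w s ∩ interior B.K ⊆ connectedComponentIn (core W) y :=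
    ((convex_ball w s).inter B.convex.interior).isPreconnected.subset_connectedComponentIn hy hsub
  have hCm : connectedComponentIn (core W) y ∈ componentsOf (core W) := ⟨y, hsub hy, rfl⟩
  refine ⟨_, hCm, s, hs, hsW, hC, fun z hz hzK => closure_mono hC (hcl z hz hzK),
    fun C' hC' z hz hzC => ?_⟩
  obtain ⟨p, hp, hpC⟩ := _root_.mem_closure_iff.1 hzC _ isOpen_ball hz
  have hpc := sub_core hC' hpC
  rw [hB.core_eq] at hpc
  exact eq_of_inter hC' hCm hpC (hC ⟨hp, hpc.2⟩)

theorem closure_component_subset {B : Body W} (hB : B.Std)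
    (hC : C ∈ componentsOf (core W)) : closure C ⊆ B.K := by
  refine closure_minimal (fun x hx => ?_) B.closed
  have := sub_core hC hx
  rw [hB.core_eq] at this
  exact interior_subset this.2

theorem frontier_component_iff {B : Body W} (hB : B.Std)
    (hC : C ∈ componentsOf (core W)) {w : E2} (hw : w ∈ W.set) :
    w ∈ frontier C ↔ w ∈ closure C ∧ w ∉ interior B.K := by
  rw [frontier, (isOpen_component hC).interior_eq, Set.mem_sdiff]
  refine and_congr_right fun hcl => not_congr ⟨fun h => ?_, fun hi => ?_⟩
  · have := sub_core hC h
    rw [hB.core_eq] at this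
    exact this.2
  · have hwc : w ∈ core W := by rw [hB.core_eq]; exact ⟨hw, hi⟩
    have hCw : connectedComponentIn (core W) w ∈ componentsOf (core W) := ⟨w, hwc, rfl⟩
    obtain ⟨p, hp, hpC⟩ := _root_.mem_closure_iff.1 hcl _ (isOpen_component hCw)
      (mem_connectedComponentIn hwc)
    rw [eq_of_inter hC hCw hpC hp]
    exact mem_connectedComponentIn hwc

theorem exists_access {B : Body W} (hB : B.Std) (hC : C ∈ componentsOf (core W))
    {w : E2} (hw : w ∈ W.set) (hwC : w ∈ closure C) :
    ∃ y ∈ C, openSegment ℝ y w ⊆ C := by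
  have hK := closure_component_subset hB hC hwC
  obtain ⟨C₀, hC₀, s, hs, hsW, hsC, -, hu⟩ := exists_local hB hw hK
  obtain rfl := hu C hC w (mem_ball_self hs) hwC
  obtain ⟨y, hy, hyi⟩ := _root_.mem_closure_iff.1 (B.mem_closure_interior hK) _ isOpen_ball
    (mem_ball_self hs)
  refine ⟨y, hsC ⟨hy, hyi⟩, fun z hz => hsC ⟨?_, ?_⟩⟩
  · exact (convex_ball w s).segment_subset hy (mem_ball_self hs) (openSegment_subset_segment _ _ _ hz)
  · exact B.convex.openSegment_interior_self_subset_interior hyi hK hz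

section Map

variable {B : Body U} {B' : Body V}

theorem comp_mem_carrier (hB : B.Std) (hC : C ∈ componentsOf (core U)) {w : E2}
    (hw : w ∈ U.set) (hwC : w ∈ closure C) : comp f C w ∈ V.set := by
  by_contra hV
  obtain ⟨y, hy, hyw⟩ := exists_access hB hC hw hwC
  have hC' := comp_mem f hC
  have hsub : openSegment ℝ (comp f C y) (comp f C w) ⊆ comp f C '' C := by
    rw [← iso_openSegment]; exact image_mono hyw
  obtain ⟨α, hα, hacc⟩ := exists_accOn (convex_openSegment (comp f C y) (comp f C w))
    (hsub.trans ((sub_core hC').trans inter_subset_left)) (a := comp f C w)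
    (segment_subset_closure_openSegment (right_mem_segment ℝ _ _)) hV
  have hαb : α ∈ bd V := mem_bd_of_sp_notMem (by rwa [hα])
  obtain ⟨h, -⟩ := access_image f.symm hC' (mem_image_of_mem _ hy) (α := ⟨α, hαb⟩)
    (by simpa only [hα] using hacc) (by simpa only [hα] using hsub)
  rw [comp_symm f hC] at h
  simp only [hα, IsometryEquiv.symm_apply_apply] at h
  exact sp_bd_notMem _ (h ▸ hw)

theorem closure_comp_iff {w : E2} :
    comp f C w ∈ closure (comp f C '' C) ↔ w ∈ closure C := by
  rw [← IsometryEquiv.coe_toHomeomorph, ← Homeomorph.image_closure]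
  exact (comp f C).injective.mem_set_image

theorem comp_mem_carrier_iff (hB : B.Std) (hB' : B'.Std)
    (hC : C ∈ componentsOf (core U)) {w : E2} (hwC : w ∈ closure C) :
    comp f C w ∈ V.set ↔ w ∈ U.set := by
  refine ⟨fun h => ?_, fun h => comp_mem_carrier f hB hC h hwC⟩
  have := comp_mem_carrier f.symm hB' (comp_mem f hC) h ((closure_comp_iff f).2 hwC)
  rwa [comp_symm f hC, IsometryEquiv.symm_apply_apply] at this

theorem frontier_comp_iff {w : E2} :
    comp f C w ∈ frontier (comp f C '' C) ↔ w ∈ frontier C := by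
  rw [← IsometryEquiv.coe_toHomeomorph, ← Homeomorph.image_frontier]
  exact (comp f C).injective.mem_set_image

theorem comp_notMem_interior (hB : B.Std) (hB' : B'.Std)
    (hC : C ∈ componentsOf (core U)) {w : E2} (hw : w ∈ U.set) (hwC : w ∈ closure C)
    (hi : w ∉ interior B.K) : comp f C w ∉ interior B'.K := by
  have h := (frontier_component_iff hB hC hw).2 ⟨hwC, hi⟩
  rw [← frontier_comp_iff f, frontier_component_iff hB' (comp_mem f hC)
    (comp_mem_carrier f hB hC hw hwC)] at h
  exact h.2

theorem dist_ι_comp_le (hB : B.Std) (hC : C ∈ componentsOf (core U)) {w : E2}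
    (hw : w ∈ U.set) (hwC : w ∈ closure C) (ξ : bd U) :
    dist (ι (comp f C w) (comp_mem_carrier f hB hC hw hwC) : X V) (f ξ) ≤
      3 * dist (ι w hw : X U) ξ := by
  set A : Set U.set := {z | (z : E2) ∈ closure C}
  set φ : A → X V := fun z => ι (comp f C z.1) (comp_mem_carrier f hB hC z.1.2 z.2)
  have hφ : Continuous φ := continuousOn_ι.comp
    (f := fun z : A => (⟨comp f C z.1, comp_mem_carrier f hB hC z.1.2 z.2⟩ : V.set))
    (Continuous.subtype_mk ((comp f C).continuous.comp
      (continuous_subtype_val.comp continuous_subtype_val)) _)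
  have hψ : Continuous fun z : A => (ι z.1.1 z.1.2 : X U) :=
    continuousOn_ι.comp continuous_subtype_val
  have hcl : IsClosed {z : A | dist (φ z) (f ξ) ≤ 3 * dist (ι z.1.1 z.1.2 : X U) ξ} :=
    isClosed_le (hφ.dist continuous_const) (continuous_const.mul (hψ.dist continuous_const))
  obtain ⟨y, hy, hyw⟩ := exists_access hB hC hw hwC
  have hCU : C ⊆ U.set := (sub_core hC).trans inter_subset_left
  have hmem : (⟨⟨w, hw⟩, hwC⟩ : A) ∈ closure {z : A | z.1.1 ∈ C} := by
    rw [Metric.mem_closure_iff]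
    intro ε hε
    obtain ⟨p, hp, hd⟩ := Metric.mem_closure_iff.1 hwC ε hε
    exact ⟨⟨⟨p, hCU hp⟩, subset_closure hp⟩, hp, hd⟩
  refine hcl.closure_subset_iff.2 ?_ hmem
  rintro ⟨⟨z, hz⟩, hz'⟩ hzC
  have h := dist_ι_unf_le f (sub_core hC hzC) ξ
  simp only [φ, mem_ofPred_eq]
  simp only [comp_eq f hC hzC]
  exact h

theorem Inner.map (hB : B.Std) (hB' : B'.Std) {β : bd U} (h : B.Inner (β : X U)) :
    B'.Inner (f β : X V) := by
  intro ε hε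
  obtain ⟨p, hp, hpi, hd⟩ := h (ε / 3) (by positivity)
  have hpc : p ∈ core U := by rw [hB.core_eq]; exact ⟨hp, hpi⟩
  have := unf_mem_core f hpc
  rw [hB'.core_eq] at this
  exact ⟨unf f p, this.1, this.2, (dist_ι_unf_le f hpc β).trans_lt (by linarith)⟩

theorem exists_mem_frontier_near (B : Body W) {β : X W} (hi : B.Inner β) (ho : B.Outer β) {ε : ℝ}
    (hε : 0 < ε) : ∃ w, ∃ hw : w ∈ W.set, w ∈ B.K ∧ w ∉ interior B.K ∧
      dist (ι w hw) β < ε := by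
  obtain ⟨y, hy, hyi, hyd⟩ := hi (ε / 4) (by positivity)
  obtain ⟨p, hp, hpi, hpd⟩ := ho (ε / 4) (by positivity)
  have hd : dist (ι y hy : X W) (ι p hp) < ε / 2 := by
    linarith [dist_triangle_right (ι y hy : X W) (ι p hp) β]
  obtain ⟨γ, hγ, h0, h1, hm, hv⟩ := exists_path_near hy hp hd
  obtain ⟨w, ⟨t, ht, rfl⟩, hw⟩ := exists_mem_frontier_of_isPreconnected
    (isPreconnected_Icc.image γ hγ) (t := interior B.K) (x := y) (y := p)
    ⟨0, by simp, h0⟩ hyi ⟨1, by simp, h1⟩ hpi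
  rw [frontier, interior_interior] at hw
  refine ⟨γ t, hm ht, closure_minimal interior_subset B.closed hw.1, hw.2, ?_⟩
  have h2 := edist_ι_le_of_path (W := W) (γ := γ) ht.1 (hγ.mono (Icc_subset_Icc_right ht.2))
    (hm.mono_left (Icc_subset_Icc_right ht.2))
  have h3 := (h2.trans (eVariationOn.mono γ (Icc_subset_Icc_right ht.2))).trans_lt hv
  simp only [h0] at h3
  rw [edist_dist, ENNReal.ofReal_lt_ofReal_iff (by positivity)] at h3
  have h4 := dist_triangle_left (ι (γ t) (hm ht)) β (ι y hy)
  linarith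

theorem Outer.map (hB : B.Std) (hB' : B'.Std) {β : bd U} (h : B.Outer (β : X U)) :
    B'.Outer (f β : X V) := by
  by_cases hi : B.Inner (β : X U)
  · intro ε hε
    obtain ⟨w, hw, hwK, hwi, hd⟩ := exists_mem_frontier_near B hi h (ε := ε / 3) (by positivity)
    obtain ⟨C, hC, s, hs, -, -, hcl, -⟩ := exists_local hB hw hwK
    have hwC := hcl w (mem_ball_self hs) hwK
    exact ⟨comp f C w, comp_mem_carrier f hB hC hw hwC, comp_notMem_interior f hB hB' hC hw hwC hwi,
      (dist_ι_comp_le f hB hC hw hwC β).trans_lt (by linarith)⟩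
  · refine outer_of_not_inner B' fun h' => hi ?_
    simpa using Inner.map f.symm hB' hB h'

end Map

end Body

namespace Body

section Theta

open Classical in
/-- The boundary map of the outer parts. -/
def theta (B : Body U) (x : E2) : E2 :=
  if h : ∃ C ∈ componentsOf (core U), x ∈ U.set ∩ closure C then comp f h.choose x
  else if hx : x ∈ closure B.F ∧ x ∉ U.set then sp (f ⟨B.e hx.1, B.e_mem_bd hx.1 hx.2⟩ : X V)
  else x

variable {B : Body U} {B' : Body V}

theorem theta_of_mem (hB : B.Std) (hC : C ∈ componentsOf (core U))
    (hx : x ∈ U.set) (hxC : x ∈ closure C) : theta f B x = comp f C x := by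
  have h : ∃ C ∈ componentsOf (core U), x ∈ U.set ∩ closure C := ⟨C, hC, hx, hxC⟩
  obtain ⟨C₀, -, s, hs, -, -, -, hu⟩ := exists_local hB hx (closure_component_subset hB hC hxC)
  rw [theta, dif_pos h, hu C hC x (mem_ball_self hs) hxC,
    hu _ h.choose_spec.1 x (mem_ball_self hs) h.choose_spec.2.2]

theorem theta_of_notMem (hx : x ∈ closure B.F) (hU : x ∉ U.set) :
    theta f B x = sp (f ⟨B.e hx, B.e_mem_bd hx hU⟩ : X V) := by
  rw [theta, dif_neg (by rintro ⟨C, -, h⟩; exact hU h.1), dif_pos ⟨hx, hU⟩]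

theorem exists_component (hB : B.Std) (hx : x ∈ frontier B.F) (hU : x ∈ U.set) :
    ∃ C ∈ componentsOf (core U), x ∈ closure C ∧ x ∉ interior B.K := by
  rw [mem_frontier_F_iff] at hx
  obtain ⟨C, hC, s, hs, -, -, hcl, -⟩ := exists_local hB hU hx.2
  exact ⟨C, hC, hcl x (mem_ball_self hs) hx.2, B.notMem_interior hx.1⟩

theorem theta_mem (hB : B.Std) (hB' : B'.Std) (hx : x ∈ frontier B.F) :
    theta f B x ∈ frontier B'.F := by
  by_cases hU : x ∈ U.set
  · obtain ⟨C, hC, hxC, hxi⟩ := exists_component hB hx hU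
    rw [theta_of_mem f hB hC hU hxC, mem_frontier_F_iff]
    exact ⟨B'.mem_closure_F_of_notMem_interior (comp_mem_carrier f hB hC hU hxC)
      (comp_notMem_interior f hB hB' hC hU hxC hxi),
      closure_component_subset hB' (comp_mem f hC) ((closure_comp_iff f).2 hxC)⟩
  · have hc := frontier_subset_closure hx
    have ho := Outer.map f hB hB' (β := ⟨B.e hc, B.e_mem_bd hc hU⟩) (B.outer_e hc)
    obtain ⟨h, -⟩ := ho.exists_e
    rw [theta_of_notMem f hc hU, mem_frontier_F_iff]
    exact ⟨h, B'.frontier_subset (sp_mem_frontier (f _).2)⟩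

theorem theta_symm_theta (hB : B.Std) (hB' : B'.Std) (hx : x ∈ frontier B.F) :
    theta f.symm B' (theta f B x) = x := by
  by_cases hU : x ∈ U.set
  · obtain ⟨C, hC, hxC, hxi⟩ := exists_component hB hx hU
    rw [theta_of_mem f hB hC hU hxC, theta_of_mem f.symm hB' (comp_mem f hC)
      (comp_mem_carrier f hB hC hU hxC) ((closure_comp_iff f).2 hxC), comp_symm f hC,
      IsometryEquiv.symm_apply_apply]
  · have hc := frontier_subset_closure hx
    have ho := Outer.map f hB hB' (β := ⟨B.e hc, B.e_mem_bd hc hU⟩) (B.outer_e hc)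
    obtain ⟨h, he⟩ := ho.exists_e
    rw [theta_of_notMem f hc hU, theta_of_notMem f.symm h (sp_bd_notMem _)]
    have : (⟨B'.e h, B'.e_mem_bd h (sp_bd_notMem _)⟩ : bd V) = f ⟨B.e hc, B.e_mem_bd hc hU⟩ :=
      Subtype.ext he
    rw [this, IsometryEquiv.symm_apply_apply, sp_e]

theorem dist_theta_le (hB : B.Std) (hx : x ∈ frontier B.F) (hy : y ∈ frontier B.F)
    (hU : x ∉ U.set) : dist (theta f B y) (theta f B x) ≤
      3 * dist (B.e (frontier_subset_closure hy)) (B.e (frontier_subset_closure hx)) := by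
  rw [theta_of_notMem f (frontier_subset_closure hx) hU]
  by_cases hyU : y ∈ U.set
  · obtain ⟨C, hC, hyC, -⟩ := exists_component hB hy hyU
    rw [theta_of_mem f hB hC hyU hyC, B.e_eq_ι _ hyU]
    have h := dist_sp_le (ι (comp f C y) (comp_mem_carrier f hB hC hyU hyC) : X V)
      (f ⟨_, B.e_mem_bd (frontier_subset_closure hx) hU⟩)
    rw [sp_ι] at h
    exact h.trans (dist_ι_comp_le f hB hC hyU hyC _)
  · rw [theta_of_notMem f (frontier_subset_closure hy) hyU]
    refine (dist_sp_le _ _).trans ?_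
    rw [← Subtype.dist_eq, f.dist_eq, Subtype.dist_eq]
    linarith [dist_nonneg (x := B.e (frontier_subset_closure hy))
      (y := B.e (frontier_subset_closure hx))]

theorem dist_theta_of_notMem (hx : x ∈ frontier B.F) (hy : y ∈ frontier B.F)
    (hU : x ∉ U.set) (hyU : y ∉ U.set) : dist (theta f B x) (theta f B y) ≤
      dist (B.e (frontier_subset_closure hx)) (B.e (frontier_subset_closure hy)) := by
  rw [theta_of_notMem f (frontier_subset_closure hx) hU,
    theta_of_notMem f (frontier_subset_closure hy) hyU]
  refine (dist_sp_le _ _).trans ?_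
  rw [← Subtype.dist_eq, f.dist_eq, Subtype.dist_eq]

theorem eventually_component (hB : B.Std) (hx : x ∈ frontier B.F) (hU : x ∈ U.set) :
    ∃ C ∈ componentsOf (core U), (∀ᶠ y in nhds x, y ∈ U.set) ∧
      (∀ᶠ y in nhds x, y ∈ frontier B.F → y ∈ closure C) ∧
      ∀ᶠ y in nhds x, ∀ C' ∈ componentsOf (core U), y ∈ closure C' → C' = C := by
  obtain ⟨C, hC, s, hs, hsU, -, hcl, hu⟩ := exists_local hB hU ((mem_frontier_F_iff B).1 hx).2
  refine ⟨C, hC, U.isDom.1.mem_nhds hU, ?_, ?_⟩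
  · filter_upwards [ball_mem_nhds x hs] with y hy hyF
    exact hcl y hy ((mem_frontier_F_iff B).1 hyF).2
  · filter_upwards [ball_mem_nhds x hs] with y hy C' hC' hyC
    exact hu C' hC' y hy hyC

theorem continuousOn_theta (hB : B.Std) : ContinuousOn (theta f B) (frontier B.F) := by
  intro x hx
  by_cases hU : x ∈ U.set
  · obtain ⟨C, hC, h1, h2, -⟩ := eventually_component hB hx hU
    refine ((comp f C).continuous.continuousWithinAt).congr_of_eventuallyEq ?_ ?_
    · filter_upwards [self_mem_nhdsWithin, nhdsWithin_le_nhds h1, nhdsWithin_le_nhds h2]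
        with y hy hyU hyC
      exact theta_of_mem f hB hC hyU (hyC hy)
    · exact theta_of_mem f hB hC hU (h2.self_of_nhds hx)
  · rw [Metric.continuousWithinAt_iff]
    intro ε hε
    obtain ⟨δ, hδ, h⟩ := B.dist_e_lt (frontier_subset_closure hx) (ε := ε / 3) (by positivity)
    refine ⟨δ, hδ, fun y hy hd => (dist_theta_le f hB hx hy hU).trans_lt ?_⟩
    linarith [h y (frontier_subset_closure hy) hd]

theorem edist_theta_of_subset (hB : B.Std) {γ : ℝ → E2} {a b : ℝ} (hab : a ≤ b)
    (hγ : ContinuousOn γ (Icc a b)) (hm : MapsTo γ (Icc a b) (frontier B.F))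
    (hU : MapsTo γ (Icc a b) U.set) :
    edist (theta f B (γ a)) (theta f B (γ b)) = edist (γ a) (γ b) := by
  have key := isPreconnected_Icc.induction₂ (s := Icc a b)
    (fun u v => ∀ C ∈ componentsOf (core U), γ u ∈ closure C ↔ γ v ∈ closure C) ?_ ?_ ?_
    (x := a) (y := b) ⟨le_rfl, hab⟩ ⟨hab, le_rfl⟩
  · obtain ⟨C, hC, hxC, -⟩ := exists_component hB (hm ⟨le_rfl, hab⟩) (hU ⟨le_rfl, hab⟩)
    rw [theta_of_mem f hB hC (hU ⟨le_rfl, hab⟩) hxC,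
      theta_of_mem f hB hC (hU ⟨hab, le_rfl⟩) ((key C hC).1 hxC), IsometryEquiv.edist_eq]
  · intro u hu
    obtain ⟨C, hC, h1, h2, h3⟩ := eventually_component hB (hm hu) (hU hu)
    filter_upwards [self_mem_nhdsWithin, (hγ u hu).eventually h2, (hγ u hu).eventually h3]
      with v hv hv2 hv3 C' hC'
    constructor
    · intro h
      rw [h3.self_of_nhds C' hC' h]
      exact hv2 (hm hv)
    · intro h
      rw [hv3 C' hC' h]
      exact h2.self_of_nhds (hm hu)
  · intro x y z _ _ _ h h' C hC
    exact (h C hC).trans (h' C hC)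
  · intro x y _ _ h C hC
    exact (h C hC).symm

theorem edist_theta_of_Ico (hB : B.Std) {γ : ℝ → E2} {a b : ℝ} (hab : a ≤ b)
    (hγ : ContinuousOn γ (Icc a b)) (hm : MapsTo γ (Icc a b) (frontier B.F))
    (hU : MapsTo γ (Ico a b) U.set) :
    edist (theta f B (γ a)) (theta f B (γ b)) ≤ edist (γ a) (γ b) := by
  rcases hab.eq_or_lt with rfl | hab
  · simp
  have hc : ContinuousWithinAt γ (Ico a b) b := (hγ b ⟨hab.le, le_rfl⟩).mono Ico_subset_Icc_self
  have hθ : ContinuousWithinAt (theta f B ∘ γ) (Ico a b) b :=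
    (((continuousOn_theta f hB).comp hγ hm) b ⟨hab.le, le_rfl⟩).mono Ico_subset_Icc_self
  have : (nhdsWithin b (Ico a b)).NeBot := by
    rw [← mem_closure_iff_nhdsWithin_neBot, closure_Ico hab.ne]; exact ⟨hab.le, le_rfl⟩
  refine le_of_tendsto_of_tendsto (tendsto_const_nhds.edist hθ.tendsto)
    (tendsto_const_nhds.edist hc.tendsto) ?_
  filter_upwards [self_mem_nhdsWithin] with t ht
  have hs : Icc a t ⊆ Ico a b := fun u hu => ⟨hu.1, hu.2.trans_lt ht.2⟩
  exact (edist_theta_of_subset f hB ht.1 (hγ.mono (hs.trans Ico_subset_Icc_self))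
    (hm.mono_left (hs.trans Ico_subset_Icc_self)) (hU.mono_left hs)).le

theorem edist_theta_of_Ioc (hB : B.Std) {γ : ℝ → E2} {a b : ℝ} (hab : a ≤ b)
    (hγ : ContinuousOn γ (Icc a b)) (hm : MapsTo γ (Icc a b) (frontier B.F))
    (hU : MapsTo γ (Ioc a b) U.set) :
    edist (theta f B (γ a)) (theta f B (γ b)) ≤ edist (γ a) (γ b) := by
  have hn : ∀ t ∈ Icc (-b) (-a), -t ∈ Icc a b := fun t ht => ⟨by linarith [ht.2], by linarith [ht.1]⟩
  have := edist_theta_of_Ico f hB (γ := fun t => γ (-t)) (a := -b) (b := -a) (by linarith)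
    (hγ.comp continuous_neg.continuousOn hn) (fun t ht => hm (hn t ht))
    (fun t ht => hU ⟨by linarith [ht.2], by linarith [ht.1]⟩)
  simp only [neg_neg] at this
  rwa [edist_comm, edist_comm (γ a)]

theorem edist_theta_le (hB : B.Std) {γ : ℝ → E2} {a b : ℝ} (hab : a ≤ b)
    (hγ : ContinuousOn γ (Icc a b)) (hm : MapsTo γ (Icc a b) (frontier B.F)) :
    edist (theta f B (γ a)) (theta f B (γ b)) ≤ eVariationOn γ (Icc a b) := by
  set Z : Set ℝ := Icc a b ∩ γ ⁻¹' U.setᶜ with hZ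
  rcases Z.eq_empty_or_nonempty with he | hne
  · rw [edist_theta_of_subset f hB hab hγ hm fun t ht => by
      by_contra h
      exact (he ▸ (⟨ht, h⟩ : t ∈ Z) : t ∈ (∅ : Set ℝ))]
    exact eVariationOn.edist_le γ ⟨le_rfl, hab⟩ ⟨hab, le_rfl⟩
  have hZc : IsCompact Z := isCompact_Icc.of_isClosed_subset
    (hγ.preimage_isClosed_of_isClosed isClosed_Icc U.isDom.1.isClosed_compl) inter_subset_left
  obtain ⟨s, hs, hsl⟩ := hZc.exists_isLeast hne
  obtain ⟨t, ht, htg⟩ := hZc.exists_isGreatest hne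
  have hst : s ≤ t := hsl ht
  have h1 : edist (theta f B (γ a)) (theta f B (γ s)) ≤ eVariationOn γ (Icc a s) := by
    have hsub : Icc a s ⊆ Icc a b := Icc_subset_Icc_right hs.1.2
    refine (edist_theta_of_Ico f hB hs.1.1 (hγ.mono hsub) (hm.mono_left hsub) fun u hu => ?_).trans
      (eVariationOn.edist_le γ ⟨le_rfl, hs.1.1⟩ ⟨hs.1.1, le_rfl⟩)
    by_contra h
    exact (hsl ⟨hsub ⟨hu.1, hu.2.le⟩, h⟩).not_gt hu.2
  have h3 : edist (theta f B (γ t)) (theta f B (γ b)) ≤ eVariationOn γ (Icc t b) := by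
    have hsub : Icc t b ⊆ Icc a b := Icc_subset_Icc_left ht.1.1
    refine (edist_theta_of_Ioc f hB ht.1.2 (hγ.mono hsub) (hm.mono_left hsub) fun u hu => ?_).trans
      (eVariationOn.edist_le γ ⟨le_rfl, ht.1.2⟩ ⟨ht.1.2, le_rfl⟩)
    by_contra h
    exact (htg ⟨hsub ⟨hu.1.le, hu.2⟩, h⟩).not_gt hu.1
  have h2 : edist (theta f B (γ s)) (theta f B (γ t)) ≤ eVariationOn γ (Icc s t) := by
    have hsub : Icc s t ⊆ Icc a b := Icc_subset_Icc hs.1.1 ht.1.2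
    refine le_trans ?_ (B.dist_e_le_of_path hst (hγ.mono hsub)
      ((hm.mono_left hsub).mono_right frontier_subset_closure))
    rw [edist_dist, edist_dist]
    exact ENNReal.ofReal_le_ofReal (dist_theta_of_notMem f (hm hs.1) (hm ht.1) hs.2 ht.2)
  rw [← eVariationOn_Icc_add γ (hst.trans' hs.1.1) ht.1.2, ← eVariationOn_Icc_add γ hs.1.1 hst]
  exact (edist_triangle4 _ _ _ _).trans (add_le_add (add_le_add h1 h2) h3)

end Theta

end Body

theorem eVariationOn_le_of_edist_le {E E' : Type*} [PseudoEMetricSpace E] [PseudoEMetricSpace E']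
    {γ : ℝ → E} {η : ℝ → E'} {a b : ℝ}
    (h : ∀ s t, a ≤ s → s ≤ t → t ≤ b → edist (η s) (η t) ≤ eVariationOn γ (Icc s t)) :
    eVariationOn η (Icc a b) ≤ eVariationOn γ (Icc a b) := by
  refine iSup_le fun ⟨n, u, hu, hus⟩ => ?_
  simp only
  have key : ∀ m, ∑ i ∈ Finset.range m, edist (η (u (i + 1))) (η (u i)) ≤
      eVariationOn γ (Icc a b ∩ Iic (u m)) := by
    intro m
    induction m with
    | zero => simp
    | succ m ih =>
      rw [Finset.sum_range_succ]
      refine (add_le_add ih ?_).trans (eVariationOn.add_le_union γ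
        (s := Icc a b ∩ Iic (u m)) (t := Icc (u m) (u (m + 1))) ?_ |>.trans
        (eVariationOn.mono γ ?_))
      · rw [edist_comm]
        exact h _ _ (hus m).1 (hu (Nat.le_succ m)) (hus (m + 1)).2
      · intro x hx y hy
        exact hx.2.trans hy.1
      · rintro x (hx | hx)
        · exact ⟨hx.1, hx.2.trans (hu (Nat.le_succ m))⟩
        · exact ⟨⟨(hus m).1.trans hx.1, hx.2.trans (hus (m + 1)).2⟩, hx.2⟩
  exact (key n).trans (eVariationOn.mono γ inter_subset_left)

theorem Body.eVariationOn_theta {B : Body U} {B' : Body V} (hB : B.Std)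
    (hB' : B'.Std) {γ : ℝ → E2} (hγ : ContinuousOn γ (Icc 0 1))
    (hm : MapsTo γ (Icc 0 1) (frontier B.F)) :
    eVariationOn (theta f B ∘ γ) (Icc 0 1) = eVariationOn γ (Icc 0 1) := by
  have hle : ∀ {U V : Dom} (f : bd U ≃ᵢ bd V) {B : Body U}, B.Std → ∀ {γ : ℝ → E2},
      ContinuousOn γ (Icc 0 1) → MapsTo γ (Icc 0 1) (frontier B.F) →
      eVariationOn (theta f B ∘ γ) (Icc 0 1) ≤ eVariationOn γ (Icc 0 1) := by
    intro U V f B hB γ hγ hm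
    refine eVariationOn_le_of_edist_le fun s t hs hst ht => ?_
    have hsub : Icc s t ⊆ Icc 0 1 := Icc_subset_Icc hs ht
    exact edist_theta_le f hB hst (hγ.mono hsub) (hm.mono_left hsub)
  refine le_antisymm (hle f hB hγ hm) ?_
  have h := hle f.symm hB' (γ := theta f B ∘ γ) ((continuousOn_theta f hB).comp hγ hm)
    fun t ht => theta_mem f hB hB' (hm ht)
  refine le_trans (le_of_eq (eVariationOn.congr fun t ht => ?_)) h
  exact (theta_symm_theta f hB hB' (hm ht)).symm

/-- The data of component isometries and of a boundary homeomorphism of the outer parts. -/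
structure IsUnfolding (U V : Set E2) (Q : Set E2 → (E2 ≃ᵢ E2)) (θ θinv : E2 → E2) : Prop where
  cont : ContinuousOn θ (frontier (FPart U))
  cont_inv : ContinuousOn θinv (frontier (FPart V))
  maps : MapsTo θ (frontier (FPart U)) (frontier (FPart V))
  maps_inv : MapsTo θinv (frontier (FPart V)) (frontier (FPart U))
  inv : InvOn θinv θ (frontier (FPart U)) (frontier (FPart V))
  comp_mem : ∀ C ∈ componentsOf (corePart U), (Q C) '' C ∈ componentsOf (corePart V)
  comp_surj : ∀ D ∈ componentsOf (corePart V), ∃ C ∈ componentsOf (corePart U), (Q C) '' C = D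
  bdry : ∀ C ∈ componentsOf (corePart U), ∀ x : Euc 2,
    (x ∈ U ∩ frontier C ↔ Q C x ∈ V ∩ frontier ((Q C) '' C)) ∧ (x ∈ U ∩ frontier C → θ x = Q C x)
  len : ∀ γ : ℝ → Euc 2, ContinuousOn γ (Icc (0:ℝ) 1) → InjOn γ (Icc (0:ℝ) 1) →
    MapsTo γ (Icc (0:ℝ) 1) (frontier (FPart U)) →
    eVariationOn (θ ∘ γ) (Icc (0:ℝ) 1) = eVariationOn γ (Icc (0:ℝ) 1)

theorem interior_closure_hull
    (h : (interior (convexHull ℝ (frontier W.set))).Nonempty) :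
    interior (closure (convexHull ℝ (frontier W.set))) =
      interior (convexHull ℝ (frontier W.set)) :=
  (convex_convexHull ℝ _).interior_closure_eq_interior_of_nonempty_interior h

theorem exists_std_body (h : (interior (convexHull ℝ (frontier W.set))).Nonempty) :
    ∃ B : Body W, B.K = closure (convexHull ℝ (frontier W.set)) ∧ B.Std := by
  obtain ⟨o, ho⟩ := id h
  obtain ⟨r, hr, hb⟩ := Metric.isOpen_iff.1 isOpen_interior o ho
  exact ⟨⟨closure (convexHull ℝ (frontier W.set)), isClosed_closure,
    (convex_convexHull ℝ _).closure, o, r, hr, hb.trans (interior_subset.trans subset_closure),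
    (subset_convexHull ℝ _).trans subset_closure⟩, rfl, interior_closure_hull h⟩

theorem Body.F_eq {B : Body W} (h : B.K = closure (convexHull ℝ (frontier W.set))) :
    FPart W.set = B.F := by
  rw [FPart, Body.F, h]

theorem exists_isUnfolding (f : bd U ≃ᵢ bd V) (h : (core U).Nonempty) :
    ∃ Q θ θinv, IsUnfolding U.set V.set Q θ θinv := by
  obtain ⟨y, hy⟩ := h
  obtain ⟨B, hBK, hB⟩ := exists_std_body ⟨y, hy.2⟩
  obtain ⟨B', hBK', hB'⟩ := exists_std_body ⟨_, (unf_mem_core f hy).2⟩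
  refine ⟨comp f, Body.theta f B, Body.theta f.symm B', ?_⟩
  have e : FPart U.set = B.F := Body.F_eq hBK
  have e' : FPart V.set = B'.F := Body.F_eq hBK'
  have hcl : ∀ {C}, C ∈ componentsOf (core U) → ∀ {x}, x ∈ U.set → x ∈ frontier C →
      Body.theta f B x = comp f C x := fun hC _ hU hx =>
    Body.theta_of_mem f hB hC hU (frontier_subset_closure hx)
  constructor
  · rw [e]; exact Body.continuousOn_theta f hB
  · rw [e']; exact Body.continuousOn_theta f.symm hB'
  · rw [e, e']; exact fun x hx => Body.theta_mem f hB hB' hx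
  · rw [e, e']; exact fun x hx => Body.theta_mem f.symm hB' hB hx
  · rw [e, e']
    exact ⟨fun x hx => Body.theta_symm_theta f hB hB' hx,
      fun x hx => Body.theta_symm_theta f.symm hB' hB hx⟩
  · exact fun C hC => comp_mem f hC
  · intro D hD
    refine ⟨_, comp_mem f.symm hD, ?_⟩
    simpa using comp_image_symm f.symm hD
  · intro C hC x
    refine ⟨?_, fun hx => hcl hC hx.1 hx.2⟩
    rw [mem_inter_iff, mem_inter_iff, Body.frontier_comp_iff]
    exact and_congr_left fun hx =>
      (Body.comp_mem_carrier_iff f hB hB' hC (frontier_subset_closure hx)).symm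
  · rw [e]
    exact fun γ hγ _ hm => Body.eVariationOn_theta f hB hB' hγ hm

theorem edist_le_eVariationOn_of_local {E : Type*} [PseudoEMetricSpace E] {σ : ℝ → E2}
    {ψ : ℝ → E}
    (h : ∀ t ∈ Icc (0 : ℝ) 1, ∃ ε > 0, ∀ s ∈ Icc (0 : ℝ) 1, ∀ s' ∈ Icc (0 : ℝ) 1, dist s t < ε →
      dist s' t < ε → s ≤ s' → edist (ψ s) (ψ s') ≤ eVariationOn σ (Icc s s')) :
    edist (ψ 0) (ψ 1) ≤ eVariationOn σ (Icc 0 1) := by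
  choose! ε hε h using h
  obtain ⟨t, ht0, htm, ⟨m, hm⟩, ht⟩ := exists_monotone_Icc_subset_open_cover_Icc
    (zero_le_one (α := ℝ)) (c := fun i : Icc (0 : ℝ) 1 => ball i (ε i)) (fun i => isOpen_ball)
    fun i _ => mem_iUnion.2 ⟨i, mem_ball_self (hε i i.2)⟩
  have key : ∀ n, edist (ψ 0) (ψ (t n)) ≤ eVariationOn σ (Icc 0 (t n)) := by
    intro n
    induction n with
    | zero => simp [ht0]
    | succ n ih =>
      obtain ⟨i, hi⟩ := ht n
      have hn := htm n.le_succ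
      rw [← eVariationOn_Icc_add σ (t n).2.1 (Subtype.coe_le_coe.2 hn)]
      refine (edist_triangle _ (ψ (t n)) _).trans (add_le_add ih (h i i.2 _ (t n).2 _ (t (n + 1)).2
        (hi ⟨le_rfl, hn⟩) (hi ⟨hn, le_rfl⟩) hn))
  simpa [hm m le_rfl] using key m

theorem exists_monotoneOn_section {f : ℝ → ℝ} {s s' : ℝ} (hs : s ≤ s')
    (hf : ContinuousOn f (Icc s s')) :
    ∃ k : ℝ → ℝ, MonotoneOn k (Icc (f s) (f s')) ∧ MapsTo k (Icc (f s) (f s')) (Icc s s') ∧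
      ∀ l ∈ Icc (f s) (f s'), f (k l) = l := by
  have hex : ∀ l ∈ Icc (f s) (f s'), ∃ k ∈ Icc s s', f k = l ∧ ∀ τ ∈ Icc s s', f τ = l → k ≤ τ := by
    intro l hl
    obtain ⟨τ, hτ, hτl⟩ := intermediate_value_Icc hs hf hl
    have hc : IsCompact (Icc s s' ∩ f ⁻¹' {l}) :=
      isCompact_Icc.of_isClosed_subset
        (hf.preimage_isClosed_of_isClosed isClosed_Icc isClosed_singleton) inter_subset_left
    obtain ⟨k, hk, hkl⟩ := hc.exists_isLeast ⟨τ, hτ, hτl⟩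
    exact ⟨k, hk.1, hk.2, fun τ hτ h => hkl ⟨hτ, h⟩⟩
  choose! k hk hkl hkm using hex
  refine ⟨k, fun l hl l' hl' hll => ?_, hk, hkl⟩
  have hk' := hk l' hl'
  obtain ⟨τ, hτ, hτl⟩ := intermediate_value_Icc hk'.1 (hf.mono (Icc_subset_Icc_right hk'.2))
    (show l ∈ Icc (f s) (f (k l')) from ⟨hl.1, (hkl l' hl').symm ▸ hll⟩)
  exact (hkm l hl τ ⟨hτ.1, hτ.2.trans hk'.2⟩ hτl).trans hτ.2

theorem exists_arc_of_lt {E : Type*} [PseudoEMetricSpace E] {σ : ℝ → E} {s s' : ℝ} (hs : s ≤ s')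
    {u : E → ℝ} {v : ℝ → E} (hu : ContinuousOn (u ∘ σ) (Icc s s'))
    (hv : ContinuousOn v ((u ∘ σ) '' Icc s s')) (huv : ∀ τ ∈ Icc s s', v (u (σ τ)) = σ τ)
    (hlt : u (σ s) < u (σ s')) :
    ∃ γ : ℝ → E, ContinuousOn γ (Icc 0 1) ∧ InjOn γ (Icc 0 1) ∧
      MapsTo γ (Icc 0 1) (σ '' Icc s s') ∧ γ 0 = σ s ∧ γ 1 = σ s' ∧
      eVariationOn γ (Icc 0 1) ≤ eVariationOn σ (Icc s s') := by
  set l : ℝ → ℝ := fun t => u (σ s) + t * (u (σ s') - u (σ s)) with hl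
  have hd : 0 < u (σ s') - u (σ s) := sub_pos.2 hlt
  have hlm : StrictMono l := fun a b hab => by simp only [hl]; nlinarith
  have hl0 : l 0 = u (σ s) := by simp [hl]
  have hl1 : l 1 = u (σ s') := by simp [hl]
  obtain ⟨k, hkm, hk, hkl⟩ := exists_monotoneOn_section hs hu
  have hm : MapsTo l (Icc 0 1) (Icc ((u ∘ σ) s) ((u ∘ σ) s')) := fun t ht =>
    show l t ∈ Icc (u (σ s)) (u (σ s')) from
      ⟨hl0 ▸ hlm.monotone ht.1, hl1 ▸ hlm.monotone ht.2⟩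
  have hγ : EqOn (v ∘ l) (σ ∘ k ∘ l) (Icc 0 1) := fun t ht => by
    simp only [Function.comp_apply]
    rw [← huv _ (hk (hm ht))]
    exact congrArg v (hkl _ (hm ht)).symm
  refine ⟨v ∘ l, hv.comp (by fun_prop) fun t ht => ⟨k (l t), hk (hm ht), hkl _ (hm ht)⟩,
    ?_, ?_, ?_, ?_, ?_⟩
  · intro t ht t' ht' h
    rw [hγ ht, hγ ht'] at h
    apply hlm.injective
    rw [← hkl _ (hm ht), ← hkl _ (hm ht')]
    exact congrArg u h
  · intro t ht
    rw [hγ ht]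
    exact ⟨_, hk (hm ht), rfl⟩
  · simp only [Function.comp_apply, hl0]; exact huv s ⟨le_rfl, hs⟩
  · simp only [Function.comp_apply, hl1]; exact huv s' ⟨hs, le_rfl⟩
  · rw [eVariationOn.congr hγ]
    exact eVariationOn.comp_le_of_monotoneOn σ (k ∘ l)
      (hkm.comp (hlm.monotone.monotoneOn _) hm) (hk.comp hm)

theorem exists_arc {E : Type*} [PseudoEMetricSpace E] {σ : ℝ → E} {s s' : ℝ} (hs : s ≤ s')
    {u : E → ℝ} {v : ℝ → E} (hu : ContinuousOn (u ∘ σ) (Icc s s'))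
    (hv : ContinuousOn v ((u ∘ σ) '' Icc s s')) (huv : ∀ τ ∈ Icc s s', v (u (σ τ)) = σ τ)
    (hne : σ s ≠ σ s') :
    ∃ γ : ℝ → E, ContinuousOn γ (Icc 0 1) ∧ InjOn γ (Icc 0 1) ∧
      MapsTo γ (Icc 0 1) (σ '' Icc s s') ∧ γ 0 = σ s ∧ γ 1 = σ s' ∧
      eVariationOn γ (Icc 0 1) ≤ eVariationOn σ (Icc s s') := by
  have hne' : u (σ s) ≠ u (σ s') := fun h => hne <| by
    rw [← huv s ⟨le_rfl, hs⟩, ← huv s' ⟨hs, le_rfl⟩, h]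
  rcases hne'.lt_or_gt with h | h
  · exact exists_arc_of_lt hs hu hv huv h
  · refine exists_arc_of_lt hs (u := fun x => -u x) (v := fun x => v (-x)) hu.neg ?_
      (fun τ hτ => by simpa using huv τ hτ) (neg_lt_neg h)
    refine hv.comp continuousOn_neg ?_
    rintro _ ⟨τ, hτ, rfl⟩
    exact ⟨τ, hτ, by simp⟩

namespace Body

variable (B : Body W)

/-- The Minkowski functional of the body. -/
def gf (y : E2) : ℝ := gauge ((fun y => B.o + y) ⁻¹' B.K) y

theorem convex_pre : Convex ℝ ((fun y => B.o + y) ⁻¹' B.K) :=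
  B.convex.translate_preimage_right B.o

theorem pre_mem_nhds : (fun y => B.o + y) ⁻¹' B.K ∈ nhds (0 : E2) :=
  (continuous_const_add B.o).continuousAt.preimage_mem_nhds (by
    simpa using mem_of_superset (ball_mem_nhds _ B.r_pos) B.ball_subset)

theorem continuous_gf : Continuous B.gf := continuous_gauge B.convex_pre B.pre_mem_nhds

theorem gf_nonneg (y : E2) : 0 ≤ B.gf y := gauge_nonneg _

theorem gf_smul {c : ℝ} (hc : 0 ≤ c) (y : E2) : B.gf (c • y) = c * B.gf y :=
  gauge_smul_of_nonneg hc _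

theorem gf_eq_one_iff : B.gf y = 1 ↔ B.o + y ∈ frontier B.K := by
  rw [gf, gauge_eq_one_iff_mem_frontier B.convex_pre B.pre_mem_nhds]
  exact Set.ext_iff.1 ((Homeomorph.addLeft B.o).preimage_frontier B.K).symm y

theorem radial_eq {n x : E2} (hx : x ∈ frontier B.K) (hn : 0 < inner ℝ (x - B.o) n) :
    0 < B.gf (n + (inner ℝ (x - B.o) !₂[-n 1, n 0] / inner ℝ (x - B.o) n) • !₂[-n 1, n 0]) ∧
    B.o + (B.gf (n + (inner ℝ (x - B.o) !₂[-n 1, n 0] / inner ℝ (x - B.o) n) • !₂[-n 1, n 0]))⁻¹ •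
      (n + (inner ℝ (x - B.o) !₂[-n 1, n 0] / inner ℝ (x - B.o) n) • !₂[-n 1, n 0]) = x := by
  set y := x - B.o with hy
  have hy1 : B.gf y = 1 := by rw [gf_eq_one_iff]; simpa [hy] using hx
  have hn0 : n ≠ 0 := by rintro rfl; simp at hn
  have hc : 0 < ‖n‖ ^ 2 / inner ℝ y n := by positivity
  have e : n + (inner ℝ y !₂[-n 1, n 0] / inner ℝ y n) • !₂[-n 1, n 0] =
      (‖n‖ ^ 2 / inner ℝ y n) • y := by
    rw [div_eq_inv_mul, div_eq_inv_mul, mul_smul, mul_smul, ← smul_right_injective _ hn.ne' |>.eq_iff]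
    simp only [smul_add, smul_inv_smul₀ hn.ne']
    ext i
    fin_cases i <;>
    · simp [EuclideanSpace.norm_sq_eq, Fin.sum_univ_two, PiLp.inner_apply]
      ring
  rw [e, B.gf_smul hc.le, hy1, mul_one, inv_smul_smul₀ hc.ne']
  exact ⟨hc, by simp [hy]⟩

theorem exists_arc_frontier {σ : ℝ → E2} {s s' : ℝ} (hs : s ≤ s') (hσ : ContinuousOn σ (Icc s s'))
    (hm : MapsTo σ (Icc s s') (frontier B.K)) {n : E2}
    (hn : ∀ τ ∈ Icc s s', 0 < inner ℝ (σ τ - B.o) n) (hne : σ s ≠ σ s') :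
    ∃ γ : ℝ → E2, ContinuousOn γ (Icc 0 1) ∧ InjOn γ (Icc 0 1) ∧
      MapsTo γ (Icc 0 1) (σ '' Icc s s') ∧ γ 0 = σ s ∧ γ 1 = σ s' ∧
      eVariationOn γ (Icc 0 1) ≤ eVariationOn σ (Icc s s') := by
  set m : E2 := !₂[-n 1, n 0] with hmdef
  refine exists_arc hs (u := fun x => inner ℝ (x - B.o) m / inner ℝ (x - B.o) n)
    (v := fun l => B.o + (B.gf (n + l • m))⁻¹ • (n + l • m)) ?_ ?_ ?_ hne
  · exact ContinuousOn.div₀ (by fun_prop) (by fun_prop) fun τ hτ => (hn τ hτ).ne'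
  · have : ContinuousOn (fun l : ℝ => (B.gf (n + l • m))⁻¹)
        ((fun x => inner ℝ (σ x - B.o) m / inner ℝ (σ x - B.o) n) '' Icc s s') := by
      refine ContinuousOn.inv₀ (B.continuous_gf.comp (by fun_prop)).continuousOn ?_
      rintro _ ⟨τ, hτ, rfl⟩
      exact (B.radial_eq (hm hτ) (hn τ hτ)).1.ne'
    exact continuousOn_const.add (this.smul (by fun_prop))
  · exact fun τ hτ => (B.radial_eq (hm hτ) (hn τ hτ)).2

theorem exists_proj (x : E2) : ∃ v ∈ B.K, ∀ w ∈ B.K, inner ℝ (x - v) (w - v) ≤ 0 := by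
  obtain ⟨v, hv, h⟩ := exists_norm_eq_iInf_of_complete_convex
    ⟨B.o, B.ball_subset (mem_ball_self B.r_pos)⟩ B.closed.isComplete B.convex x
  exact ⟨v, hv, (norm_eq_iInf_iff_real_inner_le_zero B.convex hv).1 h⟩

/-- The metric projection onto the body. -/
def proj (x : E2) : E2 := (B.exists_proj x).choose

theorem proj_mem (x : E2) : B.proj x ∈ B.K := (B.exists_proj x).choose_spec.1

theorem inner_proj_le (x : E2) {w : E2} (hw : w ∈ B.K) :
    inner ℝ (x - B.proj x) (w - B.proj x) ≤ 0 := (B.exists_proj x).choose_spec.2 w hw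

theorem proj_eq (hx : x ∈ B.K) : B.proj x = x := by
  have := B.inner_proj_le x hx
  rw [real_inner_self_nonpos, sub_eq_zero] at this
  exact this.symm

theorem lipschitz_proj : LipschitzWith 1 B.proj := by
  refine LipschitzWith.of_dist_le_mul fun x y => ?_
  have h1 := B.inner_proj_le x (B.proj_mem y)
  have h2 := B.inner_proj_le y (B.proj_mem x)
  set a := B.proj x
  set b := B.proj y
  have h3 : ‖a - b‖ ^ 2 ≤ inner ℝ (x - y) (a - b) := by
    rw [← real_inner_self_eq_norm_sq]
    have e1 : inner ℝ (x - a) (b - a) = -inner ℝ (x - a) (a - b) := by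
      rw [← inner_neg_right, neg_sub]
    have e2 : inner ℝ (x - y) (a - b) - inner ℝ (a - b) (a - b) =
        inner ℝ (x - a) (a - b) - inner ℝ (y - b) (a - b) := by
      simp only [← inner_sub_left]; congr 1; abel
    linarith
  have h4 := h3.trans (real_inner_le_norm _ _)
  rw [NNReal.coe_one, one_mul, dist_eq_norm, dist_eq_norm]
  rcases (norm_nonneg (a - b)).eq_or_lt with h | h
  · rw [← h]; positivity
  · nlinarith

theorem proj_notMem (hx : x ∉ B.K) {t : ℝ} (ht : 0 < t) :
    B.proj x + t • (x - B.proj x) ∉ B.K := fun h => by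
  have := B.inner_proj_le x h
  rw [add_sub_cancel_left, real_inner_smul_right] at this
  have h0 : 0 < inner ℝ (x - B.proj x) (x - B.proj x) := by
    rw [real_inner_self_pos, sub_ne_zero]
    rintro e
    exact hx (e ▸ B.proj_mem x)
  nlinarith

theorem proj_mem_frontier (hx : x ∈ B.F) : B.proj x ∈ frontier B.F := by
  rw [mem_frontier_F_iff]
  refine ⟨?_, B.proj_mem x⟩
  have hc : Continuous fun t : ℝ => B.proj x + t • (x - B.proj x) := by fun_prop
  have hF : ∀ t : ℝ, 0 < t → B.proj x + t • (x - B.proj x) ∈ B.F := fun t ht =>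
    ⟨B.subset_of_disjoint (s := (fun t : ℝ => B.proj x + t • (x - B.proj x)) '' Ioi 0)
      (isPreconnected_Ioi.image _ hc.continuousOn)
      (disjoint_left.2 (by rintro _ ⟨t, ht, rfl⟩; exact B.proj_notMem hx.2 ht))
      ⟨1, mem_Ioi.2 one_pos, by simp⟩ hx.1 ⟨t, ht, rfl⟩, B.proj_notMem hx.2 ht⟩
  have := (hc.tendsto 0).mono_left (nhdsWithin_le_nhds (s := Ioi 0))
  simp only [zero_smul, add_zero] at this
  exact mem_closure_of_tendsto this (eventually_mem_nhdsWithin.mono hF)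

theorem mem_frontier_F_of_mem (hx : x ∈ W.set) (hK : x ∈ B.K)
    (hi : x ∉ interior B.K) : x ∈ frontier B.F :=
  B.mem_frontier_F_iff.2 ⟨B.mem_closure_F_of_notMem_interior hx hi, hK⟩

open Classical in
/-- Points of the domain and of the closure of the outer part, as points of the completion. -/
def j (x : E2) : X W :=
  if h : x ∈ closure B.F then B.e h
  else if h : x ∈ W.set then ι x h else ι _ W.isDom.2.nonempty.some_mem

theorem j_e (h : x ∈ closure B.F) : B.j x = B.e h := dif_pos h

theorem j_ι (h : x ∈ W.set) : B.j x = ι x h := by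
  by_cases hF : x ∈ closure B.F
  · rw [j_e B hF, B.e_eq_ι hF h]
  · rw [j, dif_neg hF, dif_pos h]

end Body

/-- A map that is locally isometric on the part of `U` in the body and does not increase the length
of arcs on the frontier of the outer part. -/
structure Fold (B : Body U) (B' : Body V) (Φ : E2 → E2) : Prop where
  core_mem : ∀ p ∈ U.set, p ∈ interior B.K → Φ p ∈ V.set ∧ Φ p ∈ interior B'.K
  outer : MapsTo Φ (frontier B.F) (frontier B'.F)
  mem : ∀ x ∈ frontier B.F, Φ x ∈ V.set ↔ x ∈ U.set
  cont : ContinuousOn Φ (frontier B.F)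
  loc : ∀ w ∈ U.set, w ∈ B.K → ∃ Q : E2 ≃ᵢ E2, ∀ᶠ z in nhds w, z ∈ B.K → Φ z = Q z
  len : ∀ γ : ℝ → E2, ContinuousOn γ (Icc (0:ℝ) 1) → InjOn γ (Icc (0:ℝ) 1) →
    MapsTo γ (Icc (0:ℝ) 1) (frontier B.F) →
    eVariationOn (Φ ∘ γ) (Icc (0:ℝ) 1) ≤ eVariationOn γ (Icc (0:ℝ) 1)

namespace Fold

variable {B : Body U} {B' : Body V} {Φ Φ' : E2 → E2}

theorem mem_carrier (h : Fold B B' Φ) {p : E2} (hp : p ∈ U.set) (hK : p ∈ B.K) :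
    Φ p ∈ V.set := by
  by_cases hi : p ∈ interior B.K
  · exact (h.core_mem p hp hi).1
  · exact (h.mem p (B.mem_frontier_F_of_mem hp hK hi)).2 hp

theorem local_edist_of_mem (h : Fold B B' Φ) {α : ℝ → E2} (hα : ContinuousOn α (Icc 0 1))
    {t : ℝ} (ht : t ∈ Icc (0 : ℝ) 1) (hU : α t ∈ U.set) (hK : α t ∈ B.K) :
    ∃ ε > 0, ∀ s ∈ Icc (0 : ℝ) 1, ∀ s' ∈ Icc (0 : ℝ) 1, dist s t < ε →
      dist s' t < ε → s ≤ s' → edist (B'.j (Φ (B.proj (α s)))) (B'.j (Φ (B.proj (α s')))) ≤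
        eVariationOn (B.proj ∘ α) (Icc s s') := by
  obtain ⟨Q, hQ⟩ := h.loc _ hU hK
  have hV := h.mem_carrier hU hK
  rw [hQ.self_of_nhds hK] at hV
  obtain ⟨ρ, hρ, hb⟩ := Metric.isOpen_iff.1 V.isDom.1 _ hV
  obtain ⟨ρ', hρ', hQ⟩ := Metric.eventually_nhds_iff.1 hQ
  obtain ⟨ε, hε, hε'⟩ := Metric.continuousWithinAt_iff.1
    ((B.lipschitz_proj.continuous.comp_continuousOn hα) t ht) _ (lt_min hρ hρ')
  have key : ∀ s ∈ Icc (0 : ℝ) 1, dist s t < ε → Φ (B.proj (α s)) = Q (B.proj (α s)) ∧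
      Q (B.proj (α s)) ∈ ball (Q (α t)) ρ := fun s hs hst => by
    have := hε' hs hst
    rw [Function.comp_apply, Function.comp_apply, B.proj_eq hK, lt_min_iff] at this
    exact ⟨hQ this.2 (B.proj_mem _), by rw [mem_ball, Q.isometry.dist_eq]; exact this.1⟩
  refine ⟨ε, hε, fun s hs s' hs' h1 h2 hss => ?_⟩
  obtain ⟨e1, m1⟩ := key s hs h1
  obtain ⟨e2, m2⟩ := key s' hs' h2
  rw [e1, e2, B'.j_ι (hb m1), B'.j_ι (hb m2), edist_dist, dist_ι_of_ball hb m1 m2,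
    Q.isometry.dist_eq, ← edist_dist]
  exact eVariationOn.edist_le (B.proj ∘ α) (left_mem_Icc.2 hss) (right_mem_Icc.2 hss)

theorem edist_of_arc (h : Fold B B' Φ) {σ : ℝ → E2} {s s' : ℝ} (hs : s ≤ s')
    (hσ : ContinuousOn σ (Icc s s')) (hm : MapsTo σ (Icc s s') (frontier B.F)) {n : E2}
    (hn : ∀ τ ∈ Icc s s', 0 < inner ℝ (σ τ - B.o) n) :
    edist (B'.j (Φ (σ s))) (B'.j (Φ (σ s'))) ≤ eVariationOn σ (Icc s s') := by
  by_cases hne : σ s = σ s'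
  · rw [hne, edist_self]; exact zero_le
  obtain ⟨γ, hγ, hi, hmγ, h0, h1, hl⟩ := B.exists_arc_frontier hs hσ
    (fun τ hτ => B.frontier_F_subset (hm hτ)) hn hne
  have hmF : MapsTo γ (Icc 0 1) (frontier B.F) := fun t ht => by
    obtain ⟨τ, hτ, e⟩ := hmγ ht
    exact e ▸ hm hτ
  have hm' : MapsTo (Φ ∘ γ) (Icc 0 1) (closure B'.F) := fun t ht =>
    frontier_subset_closure (h.outer (hmF ht))
  have := B'.dist_e_le_of_path zero_le_one (h.cont.comp hγ hmF) hm'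
  rw [← B'.j_e, ← B'.j_e, Function.comp_apply, Function.comp_apply, h0, h1] at this
  exact this.trans ((h.len γ hγ hi hmF).trans hl)

theorem local_edist_of_notMem (h : Fold B B' Φ) {α : ℝ → E2} (hα : ContinuousOn α (Icc 0 1))
    {t : ℝ} (ht : t ∈ Icc (0 : ℝ) 1) (hF : α t ∈ B.F) :
    ∃ ε > 0, ∀ s ∈ Icc (0 : ℝ) 1, ∀ s' ∈ Icc (0 : ℝ) 1, dist s t < ε →
      dist s' t < ε → s ≤ s' → edist (B'.j (Φ (B.proj (α s)))) (B'.j (Φ (B.proj (α s')))) ≤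
        eVariationOn (B.proj ∘ α) (Icc s s') := by
  have hσ : ContinuousOn (B.proj ∘ α) (Icc 0 1) := B.lipschitz_proj.continuous.comp_continuousOn hα
  set n := B.proj (α t) - B.o with hn
  have hn0 : 0 < inner ℝ (B.proj (α t) - B.o) n := by
    rw [← hn, real_inner_self_pos, hn, sub_ne_zero]
    intro e
    apply B.notMem_interior (frontier_subset_closure (B.proj_mem_frontier hF))
    rw [e]
    exact interior_maximal B.ball_subset isOpen_ball (mem_ball_self B.r_pos)
  have hc : ContinuousOn (fun s => inner ℝ ((B.proj ∘ α) s - B.o) n) (Icc 0 1) := by fun_prop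
  obtain ⟨ε, hε, hε'⟩ := Metric.mem_nhdsWithin_iff.1 (((hα t ht).eventually
    (B.isOpen_F.mem_nhds hF)).and ((hc t ht).eventually_const_lt hn0))
  refine ⟨ε, hε, fun s hs s' hs' h1 h2 hss => ?_⟩
  have hI : ∀ τ ∈ Icc s s', τ ∈ ball t ε ∩ Icc 0 1 := fun τ hτ => by
    refine ⟨?_, hs.1.trans hτ.1, hτ.2.trans hs'.2⟩
    rw [Real.dist_eq, abs_lt] at h1 h2
    rw [mem_ball, Real.dist_eq, abs_lt]
    constructor <;> linarith [hτ.1, hτ.2]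
  exact h.edist_of_arc hss (hσ.mono fun τ hτ => (hI τ hτ).2)
    (fun τ hτ => B.proj_mem_frontier (hε' (hI τ hτ)).1) fun τ hτ => (hε' (hI τ hτ)).2

theorem edist_j_le (h : Fold B B' Φ) {p q : E2} (hp : p ∈ U.set) (hq : q ∈ U.set) :
    edist (B'.j (Φ (B.proj p))) (B'.j (Φ (B.proj q))) ≤ edist (ι p hp : X U) (ι q hq) := by
  rw [edist_ι, intrinsicDist]
  refine le_iInf fun α => le_iInf fun hα => le_iInf fun h0 => le_iInf fun h1 => le_iInf fun hm => ?_
  have := edist_le_eVariationOn_of_local (σ := B.proj ∘ α) (ψ := fun t => B'.j (Φ (B.proj (α t))))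
    fun t ht => by
      by_cases hK : α t ∈ B.K
      · exact h.local_edist_of_mem hα ht (hm ht) hK
      · exact h.local_edist_of_notMem hα ht ⟨hm ht, hK⟩
  rw [← h0, ← h1]
  refine this.trans ?_
  simpa using (B.lipschitz_proj.lipschitzOnWith (s := univ)).comp_eVariationOn_le
    (mapsTo_univ α (Icc 0 1))

/-- The extension of a fold to the completions. -/
def ext (B : Body U) (B' : Body V) (Φ : E2 → E2) : X U → X V :=
  UniformSpace.Completion.extension fun p : IM U => B'.j (Φ (B.proj p.1))

theorem lipschitz (h : Fold B B' Φ) : LipschitzWith 1 fun p : IM U => B'.j (Φ (B.proj p.1)) := by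
  intro p q
  rw [ENNReal.coe_one, one_mul]
  refine (h.edist_j_le p.2 q.2).trans_eq ?_
  exact UniformSpace.Completion.edist_eq _ _

theorem lipschitz_ext (h : Fold B B' Φ) : LipschitzWith 1 (ext B B' Φ) :=
  h.lipschitz.completion_extension

theorem ext_ι (h : Fold B B' Φ) {p : E2} (hp : p ∈ U.set) :
    ext B B' Φ (ι p hp) = B'.j (Φ (B.proj p)) :=
  UniformSpace.Completion.extension_coe h.lipschitz.uniformContinuous _

theorem ext_e (h : Fold B B' Φ) (hx : x ∈ frontier B.F) :
    ext B B' Φ (B.e (frontier_subset_closure hx)) =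
      B'.e (frontier_subset_closure (h.outer hx)) := by
  have hx' := frontier_subset_closure hx
  refine eq_of_forall_dist_le fun ε hε => ?_
  obtain ⟨δ, hδ, hd⟩ := B'.dist_e_lt (frontier_subset_closure (h.outer hx)) (half_pos hε)
  have hp : Tendsto (fun l => B.proj (B.dil l x)) (nhdsWithin 1 (Ioi 1)) (nhds x) := by
    have := (B.lipschitz_proj.continuous.tendsto x).comp (B.tendsto_dil x)
    rwa [B.proj_eq (B.mem_frontier_F_iff.1 hx).2] at this
  have hm : ∀ᶠ l in nhdsWithin (1 : ℝ) (Ioi 1), B.proj (B.dil l x) ∈ frontier B.F :=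
    eventually_mem_nhdsWithin.mono fun l hl => B.proj_mem_frontier (B.dil_mem hx' hl)
  have h1 := ((h.cont x hx).tendsto.comp (tendsto_nhdsWithin_iff.2 ⟨hp, hm⟩)).eventually
    (Metric.ball_mem_nhds _ hδ)
  have hlim := tendsto_sub_one_mul (dist x B.o)
  obtain ⟨l, ⟨⟨h1, h2⟩, hm⟩, hl⟩ := (((h1.and (hlim.eventually_lt_const (half_pos hε))).and
    hm).and self_mem_nhdsWithin).exists
  have e := h.ext_ι (B.dil_mem hx' hl).1
  rw [B'.j_e (frontier_subset_closure (h.outer hm))] at e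
  have h3 := hd _ (frontier_subset_closure (h.outer hm)) h1
  have h4 := h.lipschitz_ext.dist_le_mul (ι (B.dil l x) (B.dil_mem hx' hl).1) (B.e hx')
  rw [B.dist_e hx' hl, e, NNReal.coe_one, one_mul, dist_comm] at h4
  linarith [dist_triangle (ext B B' Φ (B.e hx')) (B'.e (frontier_subset_closure (h.outer hm)))
    (B'.e (frontier_subset_closure (h.outer hx)))]

theorem exists_e_of_outer {β : X U} (hβ : β ∈ bd U) (ho : B.Outer β) :
    ∃ hx : sp β ∈ frontier B.F, B.e (frontier_subset_closure hx) = β := by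
  obtain ⟨hx, he⟩ := ho.exists_e
  exact ⟨B.mem_frontier_F_iff.2 ⟨hx, B.frontier_subset (sp_mem_frontier hβ)⟩, he⟩

theorem ext_mem_of_outer (h : Fold B B' Φ) {β : X U} (hβ : β ∈ bd U) (ho : B.Outer β) :
    ext B B' Φ β ∈ bd V := by
  obtain ⟨hx, he⟩ := exists_e_of_outer hβ ho
  rw [← he, h.ext_e hx]
  exact B'.e_mem_bd _ fun hv => sp_bd_notMem ⟨β, hβ⟩ ((h.mem _ hx).1 hv)

theorem ext_ext (h : Fold B B' Φ) (h' : Fold B' B Φ')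
    (hin : ∀ p ∈ U.set, p ∈ interior B.K → Φ' (Φ p) = p)
    (hout : ∀ x ∈ frontier B.F, Φ' (Φ x) = x) {β : X U} (hβ : β ∈ bd U) :
    ext B' B Φ' (ext B B' Φ β) = β := by
  by_cases hi : B.Inner β
  · refine eq_of_forall_dist_le fun ε hε => ?_
    obtain ⟨p, hp, hpi, hd⟩ := hi (ε / 2) (half_pos hε)
    obtain ⟨h1, h2⟩ := h.core_mem p hp hpi
    have e : ext B' B Φ' (ext B B' Φ (ι p hp)) = ι p hp := by
      rw [h.ext_ι hp, B.proj_eq (interior_subset hpi), B'.j_ι h1, h'.ext_ι h1,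
        B'.proj_eq (interior_subset h2), hin p hp hpi, B.j_ι hp]
    have := (h'.lipschitz_ext.comp h.lipschitz_ext).dist_le_mul β (ι p hp)
    simp only [Function.comp_apply, e, mul_one, NNReal.coe_one, one_mul] at this
    rw [dist_comm] at hd
    linarith [dist_triangle (ext B' B Φ' (ext B B' Φ β)) (ι p hp) β, dist_comm β (ι p hp)]
  · obtain ⟨hx, he⟩ := exists_e_of_outer hβ (B.outer_of_not_inner hi)
    rw [← he, h.ext_e hx, h'.ext_e (h.outer hx)]
    congr 1
    exact hout _ hx

theorem ext_mem (h : Fold B B' Φ) (h' : Fold B' B Φ')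
    (hin : ∀ p ∈ U.set, p ∈ interior B.K → Φ' (Φ p) = p)
    (hout : ∀ x ∈ frontier B.F, Φ' (Φ x) = x) {β : X U} (hβ : β ∈ bd U) :
    ext B B' Φ β ∈ bd V := by
  by_contra hv
  obtain ⟨v, hvV, e⟩ := exists_ι_of_notMem_bd hv
  have e' := ext_ext h h' hin hout hβ
  rw [e, h'.ext_ι hvV] at e'
  by_cases hK : v ∈ B'.K
  · rw [B'.proj_eq hK, B.j_ι (h'.mem_carrier hvV hK)] at e'
    exact ι_notMem_bd _ (e' ▸ hβ)
  · have hm := frontier_subset_closure (h'.outer (B'.proj_mem_frontier ⟨hvV, hK⟩))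
    rw [B.j_e hm] at e'
    exact hv (h.ext_mem_of_outer hβ (e' ▸ B.outer_e hm))

theorem exists_isometryEquiv (h : Fold B B' Φ) (h' : Fold B' B Φ')
    (hin : ∀ p ∈ U.set, p ∈ interior B.K → Φ' (Φ p) = p)
    (hout : ∀ x ∈ frontier B.F, Φ' (Φ x) = x)
    (hin' : ∀ p ∈ V.set, p ∈ interior B'.K → Φ (Φ' p) = p)
    (hout' : ∀ x ∈ frontier B'.F, Φ (Φ' x) = x) : Nonempty (bd U ≃ᵢ bd V) := by
  refine ⟨⟨⟨fun β => ⟨ext B B' Φ β, ext_mem h h' hin hout β.2⟩,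
    fun β => ⟨ext B' B Φ' β, ext_mem h' h hin' hout' β.2⟩,
    fun β => Subtype.ext (ext_ext h h' hin hout β.2),
    fun β => Subtype.ext (ext_ext h' h hin' hout' β.2)⟩, fun β β' => le_antisymm ?_ ?_⟩⟩
  · have := h.lipschitz_ext β.1 β'.1
    rwa [ENNReal.coe_one, one_mul] at this
  · have := h'.lipschitz_ext (ext B B' Φ β) (ext B B' Φ β')
    rw [ext_ext h h' hin hout β.2, ext_ext h h' hin hout β'.2, ENNReal.coe_one, one_mul] at this
    exact this

end Fold

theorem subset_component_of_disjoint (hC : C ∈ componentsOf (core W))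
    (h : ∀ x ∈ W.set, x ∉ frontier C) : W.set = C := by
  refine Subset.antisymm (fun y hy => ?_) ((sub_core hC).trans inter_subset_left)
  by_contra hyC
  obtain ⟨x, hx⟩ := nonempty_component hC
  obtain ⟨p, hp, hpC⟩ := exists_mem_frontier_of_isPreconnected W.isDom.2.isPreconnected
    (sub_core hC hx).1 hx hy hyC
  exact h p hp hpC

namespace IsUnfolding

variable {Q Q' : Set E2 → (E2 ≃ᵢ E2)} {θ θinv : E2 → E2}

theorem exists_mem_frontier (h : IsUnfolding U.set V.set Q θ θinv)
    (hn : ¬ ∃ J : E2 ≃ᵢ E2, J '' U.set = V.set)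
    (hC : C ∈ componentsOf (core U)) : ∃ x ∈ U.set, x ∈ frontier C := by
  by_contra! hx
  refine hn ⟨Q C, ?_⟩
  rw [subset_component_of_disjoint (h.comp_mem C hC) fun y hy hyC => ?_,
    ← subset_component_of_disjoint hC hx]
  obtain ⟨x, rfl⟩ := (Q C).surjective y
  have := ((h.bdry C hC x).1).2 ⟨hy, hyC⟩
  exact hx x this.1 this.2

variable {B : Body U} {B' : Body V}

theorem mem_frontier (hB : B.Std) (hK : B.K = closure (convexHull ℝ (frontier U.set))) (hC : C ∈ componentsOf (core U)) (hx : x ∈ U.set ∩ frontier C) :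
    x ∈ frontier (FPart U.set) := by
  rw [Body.F_eq hK]
  obtain ⟨h1, h2⟩ := (Body.frontier_component_iff hB hC hx.1).1 hx.2
  exact B.mem_frontier_F_of_mem hx.1 (Body.closure_component_subset hB hC h1) h2

theorem apply_mem_iff (h : IsUnfolding U.set V.set Q θ θinv) (hB : B.Std)
    (hK : B.K = closure (convexHull ℝ (frontier U.set))) (hB' : B'.Std)
    (hK' : B'.K = closure (convexHull ℝ (frontier V.set)))
    (hx : x ∈ frontier (FPart U.set)) : θ x ∈ V.set ↔ x ∈ U.set := by
  constructor
  · intro hV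
    have hm := h.maps hx
    rw [Body.F_eq hK'] at hm
    obtain ⟨D, hD, hxD, hxi⟩ := Body.exists_component hB' hm hV
    obtain ⟨C, hC, rfl⟩ := h.comp_surj D hD
    have hf := (Body.frontier_component_iff hB' hD hV).2 ⟨hxD, hxi⟩
    obtain ⟨y, hy⟩ := (Q C).surjective (θ x)
    obtain ⟨h1, h2⟩ := h.bdry C hC y
    rw [hy] at h1 h2
    have hyU := h1.2 ⟨hV, hf⟩
    rw [← h.inv.1.injOn (mem_frontier hB hK hC hyU) hx (h2 hyU)]
    exact hyU.1
  · intro hU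
    have hx' := hx
    rw [Body.F_eq hK] at hx'
    obtain ⟨C, hC, hxC, hxi⟩ := Body.exists_component hB hx' hU
    have hf := (Body.frontier_component_iff hB hC hU).2 ⟨hxC, hxi⟩
    rw [(h.bdry C hC x).2 ⟨hU, hf⟩]
    exact ((h.bdry C hC x).1.1 ⟨hU, hf⟩).1

theorem component_injective (h : IsUnfolding U.set V.set Q θ θinv) (hB : B.Std)
    (hK : B.K = closure (convexHull ℝ (frontier U.set)))
    (hn : ¬ ∃ J : E2 ≃ᵢ E2, J '' U.set = V.set) {C C' : Set E2}
    (hC : C ∈ componentsOf (core U)) (hC' : C' ∈ componentsOf (core U))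
    (he : Q C '' C = image (Q C') C') : C = C' := by
  obtain ⟨x, hxU, hxC⟩ := h.exists_mem_frontier hn hC
  obtain ⟨h1, h2⟩ := h.bdry C hC x
  obtain ⟨x', hx'⟩ := (Q C').surjective (Q C x)
  obtain ⟨h1', h2'⟩ := h.bdry C' hC' x'
  have hm := h1.1 ⟨hxU, hxC⟩
  rw [he, ← hx'] at hm
  have hm' := h1'.2 hm
  have e : x = x' := h.inv.1.injOn (mem_frontier hB hK hC ⟨hxU, hxC⟩) (mem_frontier hB hK hC' hm')
    (by rw [h2 ⟨hxU, hxC⟩, h2' hm', hx'])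
  subst e
  obtain ⟨C'', _, s, hs, _, _, _, hu⟩ := Body.exists_local hB hxU
    (Body.closure_component_subset hB hC (frontier_subset_closure hxC))
  rw [hu C hC x (mem_ball_self hs) (frontier_subset_closure hxC),
    hu C' hC' x (mem_ball_self hs) (frontier_subset_closure hm'.2)]

theorem symm (h : IsUnfolding U.set V.set Q θ θinv)
    (hQ : ∀ C ∈ componentsOf (core U), Q' (Q C '' C) = (Q C).symm) :
    IsUnfolding V.set U.set Q' θinv θ := by
  have key : ∀ D ∈ componentsOf (core V), ∃ C ∈ componentsOf (core U), Q C '' C = D ∧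
      Q' D = (Q C).symm ∧ Q' D '' D = C := fun D hD => by
    obtain ⟨C, hC, rfl⟩ := h.comp_surj D hD
    refine ⟨C, hC, rfl, hQ C hC, ?_⟩
    rw [hQ C hC, image_image]
    simp
  refine ⟨h.cont_inv, h.cont, h.maps_inv, h.maps, h.inv.symm, ?_, ?_, ?_, ?_⟩
  · intro D hD
    obtain ⟨C, hC, -, -, e⟩ := key D hD
    exact e ▸ hC
  · intro C hC
    obtain ⟨C', hC', e1, -, e⟩ := key _ (h.comp_mem C hC)
    refine ⟨_, h.comp_mem C hC, ?_⟩
    rw [hQ C hC, image_image]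
    simp
  · intro D hD x
    obtain ⟨C, hC, rfl, e, e'⟩ := key D hD
    obtain ⟨y, rfl⟩ := (Q C).surjective x
    obtain ⟨h1, h2⟩ := h.bdry C hC y
    rw [e', e, IsometryEquiv.symm_apply_apply]
    refine ⟨h1.symm, fun hx => ?_⟩
    have hy := h1.2 hx
    obtain ⟨B, hK, hB⟩ := exists_std_body (W := U)
      ⟨_, ((sub_core hC) (nonempty_component hC).some_mem).2⟩
    rw [← h2 hy, h.inv.1 (mem_frontier hB hK hC hy)]
  · intro γ hγ hi hm
    rw [← h.len (θinv ∘ γ) (h.cont_inv.comp hγ hm) (h.inv.2.injOn.comp hi hm)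
      (h.maps_inv.comp hm)]
    exact eVariationOn.congr fun t ht => h.inv.2 (hm ht)

open Classical in
/-- The global map assembled from the component isometries and the boundary homeomorphism. -/
def glue (U : Dom) (Q : Set E2 → (E2 ≃ᵢ E2)) (θ : E2 → E2) (x : E2) : E2 :=
  if x ∈ core U then Q (connectedComponentIn (core U) x) x else θ x

theorem glue_of_mem (hC : C ∈ componentsOf (core U)) (hx : x ∈ C) :
    glue U Q θ x = Q C x := by
  rw [glue, if_pos (sub_core hC hx), ← component_eq hC hx]

theorem glue_of_notMem (hx : x ∉ core U) : glue U Q θ x = θ x := if_neg hx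

theorem notMem_core (hB : B.Std) (hx : x ∈ frontier B.F) : x ∉ core U := fun h => by
  rw [hB.core_eq] at h
  exact B.notMem_interior (frontier_subset_closure hx) h.2

theorem fold (h : IsUnfolding U.set V.set Q θ θinv) (hB : B.Std)
    (hK : B.K = closure (convexHull ℝ (frontier U.set))) (hB' : B'.Std)
    (hK' : B'.K = closure (convexHull ℝ (frontier V.set))) : Fold B B' (glue U Q θ) := by
  have e : FPart U.set = B.F := Body.F_eq hK
  have e' : FPart V.set = B'.F := Body.F_eq hK'
  have hg : ∀ x ∈ frontier B.F, glue U Q θ x = θ x := fun x hx => glue_of_notMem (notMem_core hB hx)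
  constructor
  · intro p hp hi
    have hc : p ∈ core U := by rw [hB.core_eq]; exact ⟨hp, hi⟩
    have hC : connectedComponentIn (core U) p ∈ componentsOf (core U) := ⟨p, hc, rfl⟩
    have hpC := mem_connectedComponentIn hc
    rw [glue_of_mem hC hpC]
    have := sub_core (h.comp_mem _ hC) (mem_image_of_mem _ hpC)
    rwa [hB'.core_eq] at this
  · intro x hx
    rw [hg x hx, ← e']
    exact h.maps (e ▸ hx)
  · intro x hx
    rw [hg x hx]
    exact h.apply_mem_iff hB hK hB' hK' (e ▸ hx)
  · exact (e ▸ h.cont).congr hg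
  · intro w hw hwK
    obtain ⟨C, hC, s, hs, h1, h2, h3, -⟩ := Body.exists_local hB hw hwK
    refine ⟨Q C, (eventually_mem_set.2 (ball_mem_nhds w hs)).mono fun z hz hzK => ?_⟩
    by_cases hi : z ∈ interior B.K
    · exact glue_of_mem hC (h2 ⟨hz, hi⟩)
    · rw [hg z (B.mem_frontier_F_of_mem (h1 hz) hzK hi)]
      exact (h.bdry C hC z).2 ⟨h1 hz,
        (Body.frontier_component_iff hB hC (h1 hz)).2 ⟨h3 z hz hzK, hi⟩⟩
  · intro γ hγ hi hm
    rw [eVariationOn.congr (f := glue U Q θ ∘ γ) (g := θ ∘ γ) fun t ht => hg _ (hm ht)]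
    exact (h.len γ hγ hi (e ▸ hm)).le

theorem glue_glue (h : IsUnfolding U.set V.set Q θ θinv) (hB : B.Std)
    (hQ : ∀ C ∈ componentsOf (core U), Q' (Q C '' C) = (Q C).symm) {p : E2} (hp : p ∈ U.set)
    (hi : p ∈ interior B.K) : glue V Q' θinv (glue U Q θ p) = p := by
  have hc : p ∈ core U := by rw [hB.core_eq]; exact ⟨hp, hi⟩
  have hC : connectedComponentIn (core U) p ∈ componentsOf (core U) := ⟨p, hc, rfl⟩
  have hpC := mem_connectedComponentIn hc
  rw [glue_of_mem hC hpC, glue_of_mem (h.comp_mem _ hC) (mem_image_of_mem _ hpC), hQ _ hC,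
    IsometryEquiv.symm_apply_apply]

theorem glue_glue_frontier (h : IsUnfolding U.set V.set Q θ θinv) (hB : B.Std)
    (hK : B.K = closure (convexHull ℝ (frontier U.set))) (hB' : B'.Std)
    (hK' : B'.K = closure (convexHull ℝ (frontier V.set))) (hx : x ∈ frontier B.F) :
    glue V Q' θinv (glue U Q θ x) = x := by
  rw [glue_of_notMem (notMem_core hB hx)]
  have hx' := hx
  rw [← Body.F_eq hK] at hx'
  have := h.maps hx'
  rw [Body.F_eq hK'] at this
  rw [glue_of_notMem (notMem_core hB' this), h.inv.1 hx']

theorem nonempty_isometryEquiv (h : IsUnfolding U.set V.set Q θ θinv)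
    (hc : (core U).Nonempty) (hn : ¬ ∃ J : E2 ≃ᵢ E2, J '' U.set = V.set) :
    Nonempty (bd U ≃ᵢ bd V) := by
  classical
  obtain ⟨y, hy⟩ := hc
  obtain ⟨B, hK, hB⟩ := exists_std_body ⟨y, hy.2⟩
  have hC : connectedComponentIn (core U) y ∈ componentsOf (core U) := ⟨y, hy, rfl⟩
  obtain ⟨B', hK', hB'⟩ := exists_std_body (W := V)
    ⟨_, ((sub_core (h.comp_mem _ hC))
      (nonempty_component (h.comp_mem _ hC)).some_mem).2⟩
  obtain ⟨Q', hQ⟩ : ∃ Q' : Set E2 → (E2 ≃ᵢ E2),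
      ∀ C ∈ componentsOf (core U), Q' (Q C '' C) = (Q C).symm := by
    refine ⟨fun D => if h : ∃ C ∈ componentsOf (core U), Q C '' C = D then (Q h.choose).symm
      else IsometryEquiv.refl E2, fun C hC => ?_⟩
    have hex : ∃ C' ∈ componentsOf (core U), image (Q C') C' = Q C '' C := ⟨C, hC, rfl⟩
    beta_reduce
    rw [dif_pos hex, h.component_injective hB hK hn hex.choose_spec.1 hC hex.choose_spec.2]
  have h' := h.symm hQ
  have hQ' : ∀ D ∈ componentsOf (core V), Q (Q' D '' D) = (Q' D).symm := fun D hD => by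
    obtain ⟨C, hC, rfl⟩ := h.comp_surj D hD
    rw [hQ C hC, image_image]
    simp only [IsometryEquiv.symm_apply_apply, image_id', IsometryEquiv.symm_symm]
  exact (h.fold hB hK hB' hK').exists_isometryEquiv (h'.fold hB' hK' hB hK)
    (fun p hp hi => h.glue_glue hB hQ hp hi)
    (fun x hx => h.glue_glue_frontier hB hK hB' hK' hx)
    (fun p hp hi => h'.glue_glue hB' hQ' hp hi)
    (fun x hx => h'.glue_glue_frontier hB' hK' hB hK hx)

end IsUnfolding

/-- A unit speed parametrization of a curve by the real line, with continuous local inverses. -/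
structure UnitParam (S : Set E2) (ψ : ℝ → E2) : Prop where
  range_eq : range ψ = S
  speed : HasUnitSpeedOn ψ univ
  loc : ∀ t, ∃ u : E2 → ℝ, ∃ N ∈ nhds (ψ t), ContinuousOn u (N ∩ S) ∧ ∀ y ∈ N ∩ S, ψ (u y) = y

theorem eVariationOn_Icc_of_unitSpeed {ψ : ℝ → E2} (h : HasUnitSpeedOn ψ univ) (s t : ℝ) :
    eVariationOn ψ (Icc s t) = ENNReal.ofReal (t - s) := by
  simpa using h (mem_univ s) (mem_univ t)

theorem eVariationOn_Icc_comp_neg (ψ : ℝ → E2) (s t : ℝ) :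
    eVariationOn (ψ ∘ Neg.neg) (Icc s t) = eVariationOn ψ (Icc (-t) (-s)) := by
  rw [eVariationOn.comp_eq_of_antitoneOn ψ Neg.neg fun _ _ _ _ h => neg_le_neg h]
  congr 1
  exact image_neg_Icc s t

theorem edist_le_of_unitSpeed {ψ : ℝ → E2} (h : HasUnitSpeedOn ψ univ) (s t : ℝ) :
    edist (ψ s) (ψ t) ≤ ENNReal.ofReal |t - s| := by
  wlog hst : s ≤ t generalizing s t
  · rw [edist_comm, abs_sub_comm]; exact this t s (le_of_not_ge hst)
  rw [abs_of_nonneg (sub_nonneg.2 hst), ← eVariationOn_Icc_of_unitSpeed h]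
  exact eVariationOn.edist_le ψ (left_mem_Icc.2 hst) (right_mem_Icc.2 hst)

theorem continuous_of_unitSpeed {ψ : ℝ → E2} (h : HasUnitSpeedOn ψ univ) : Continuous ψ := by
  refine LipschitzWith.continuous (K := 1) fun s t => ?_
  rw [ENNReal.coe_one, one_mul, edist_comm s, edist_dist t, Real.dist_eq]
  exact edist_le_of_unitSpeed h s t

theorem ofReal_abs_le_of_unitSpeed {ψ σ : ℝ → E2} (h : HasUnitSpeedOn ψ univ) {f : ℝ → ℝ}
    {s s' : ℝ} (hs : s ≤ s') (hf : ContinuousOn f (Icc s s'))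
    (hψ : ∀ τ ∈ Icc s s', ψ (f τ) = σ τ) :
    ENNReal.ofReal |f s' - f s| ≤ eVariationOn σ (Icc s s') := by
  have key : ∀ (φ : ℝ → E2) (g : ℝ → ℝ), (∀ s t, eVariationOn φ (Icc s t) = ENNReal.ofReal (t - s)) →
      ContinuousOn g (Icc s s') → (∀ τ ∈ Icc s s', φ (g τ) = σ τ) →
      ENNReal.ofReal (g s' - g s) ≤ eVariationOn σ (Icc s s') := by
    intro φ g hφ hg hφg
    obtain ⟨k, hkm, hk, hkl⟩ := exists_monotoneOn_section hs hg
    rw [← hφ, eVariationOn.congr (f := φ) (g := σ ∘ k) fun l hl => by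
      rw [Function.comp_apply, ← hφg _ (hk hl), hkl _ hl]]
    exact eVariationOn.comp_le_of_monotoneOn σ k hkm hk
  rcases le_total (f s) (f s') with hle | hle
  · rw [abs_of_nonneg (sub_nonneg.2 hle)]
    exact key ψ f (eVariationOn_Icc_of_unitSpeed h) hf hψ
  · rw [abs_of_nonpos (sub_nonpos.2 hle)]
    convert key (ψ ∘ Neg.neg) (fun t => -f t) (fun a b => ?_) hf.neg fun τ hτ => by
      simpa using hψ τ hτ using 2
    · ring
    · rw [eVariationOn_Icc_comp_neg, eVariationOn_Icc_of_unitSpeed h, neg_sub_neg]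

/-- The correspondence between two parametrized curves. -/
def transfer (ψ ψ' : ℝ → E2) (x : E2) : E2 := ψ' (Function.invFun ψ x)

theorem transfer_apply {ψ ψ' : ℝ → E2} (h : ∀ s t, ψ s = ψ t ↔ ψ' s = ψ' t) (s : ℝ) :
    transfer ψ ψ' (ψ s) = ψ' s :=
  (h _ _).1 (Function.invFun_eq ⟨s, rfl⟩)

theorem Body.frontier_F_of_compl (B : Body U) (hU : U.set = B.Kᶜ) :
    frontier B.F = frontier B.K := by
  rw [Body.F, hU, sdiff_eq, inter_self, frontier_compl]

namespace UnitParam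

variable {S S' : Set E2} {ψ ψ' : ℝ → E2}

theorem mem (h : UnitParam S ψ) (s : ℝ) : ψ s ∈ S := h.range_eq ▸ mem_range_self s

theorem exists_eq (h : UnitParam S ψ) (hx : x ∈ S) : ∃ s, ψ s = x :=
  (h.range_eq.symm ▸ hx : x ∈ range ψ)

theorem mapsTo (_ : UnitParam S ψ) (h' : UnitParam S' ψ') : MapsTo (transfer ψ ψ') S S' :=
  fun _ _ => h'.mem _

theorem transfer_transfer (h : UnitParam S ψ) (hψ : ∀ s t, ψ s = ψ t ↔ ψ' s = ψ' t)
    (hx : x ∈ S) : transfer ψ' ψ (transfer ψ ψ' x) = x := by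
  obtain ⟨s, rfl⟩ := h.exists_eq hx
  rw [transfer_apply hψ, transfer_apply fun s t => (hψ s t).symm]

theorem transfer_eq {u : E2 → ℝ} (hψ : ∀ s t, ψ s = ψ t ↔ ψ' s = ψ' t)
    (hu : ψ (u y) = y) : transfer ψ ψ' y = ψ' (u y) := by
  rw [← transfer_apply hψ, hu]

theorem continuousOn (h : UnitParam S ψ) (h' : UnitParam S' ψ')
    (hψ : ∀ s t, ψ s = ψ t ↔ ψ' s = ψ' t) : ContinuousOn (transfer ψ ψ') S := by
  intro x hx
  obtain ⟨t, rfl⟩ := h.exists_eq hx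
  obtain ⟨u, N, hN, hu, hNu⟩ := h.loc t
  refine ContinuousWithinAt.mono_of_mem_nhdsWithin (t := N ∩ S) ?_
    (inter_mem (mem_nhdsWithin_of_mem_nhds hN) self_mem_nhdsWithin)
  exact ((continuous_of_unitSpeed h'.speed).comp_continuousOn hu).congr
    (fun y hy => transfer_eq hψ (hNu y hy)) _ ⟨mem_of_mem_nhds hN, hx⟩

theorem eVariationOn_le (h : UnitParam S ψ) (h' : UnitParam S' ψ')
    (hψ : ∀ s t, ψ s = ψ t ↔ ψ' s = ψ' t) {γ : ℝ → E2} (hγ : ContinuousOn γ (Icc 0 1))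
    (hm : MapsTo γ (Icc 0 1) S) :
    eVariationOn (transfer ψ ψ' ∘ γ) (Icc 0 1) ≤ eVariationOn γ (Icc 0 1) := by
  refine eVariationOn_le_of_edist_le fun a b ha hab hb => ?_
  set l : ℝ → ℝ := fun t => a + t * (b - a) with hl
  have hlm : Monotone l := fun s t hst => by simp only [hl]; nlinarith
  have hmap : MapsTo l (Icc 0 1) (Icc a b) := fun t ht =>
    ⟨by simpa [hl] using hlm ht.1, by simpa [hl] using hlm ht.2⟩
  have hab' : Icc a b ⊆ Icc 0 1 := Icc_subset_Icc ha hb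
  have hσ : ContinuousOn (γ ∘ l) (Icc 0 1) :=
    (hγ.mono hab').comp (by fun_prop) hmap
  refine le_trans (le_of_eq_of_le ?_ (edist_le_eVariationOn_of_local (σ := γ ∘ l)
    (ψ := transfer ψ ψ' ∘ γ ∘ l) fun t ht => ?_))
    (eVariationOn.comp_le_of_monotoneOn γ l (hlm.monotoneOn _) hmap)
  · simp [hl]
  · obtain ⟨r, hr⟩ := h.exists_eq (hm (hab' (hmap ht)))
    obtain ⟨u, N, hN, hu, hNu⟩ := h.loc r
    rw [hr] at hN
    obtain ⟨ε, hε, hε'⟩ := Metric.mem_nhdsWithin_iff.1 ((hσ t ht).preimage_mem_nhdsWithin hN)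
    refine ⟨ε, hε, fun s hs s' hs' h1 h2 hss => ?_⟩
    have hsub : MapsTo (γ ∘ l) (Icc s s') (N ∩ S) := fun τ hτ => by
      have hτ1 : τ ∈ Icc (0 : ℝ) 1 := ⟨hs.1.trans hτ.1, hτ.2.trans hs'.2⟩
      rw [Real.dist_eq, abs_lt] at h1 h2
      refine ⟨hε' ⟨?_, hτ1⟩, hm (hab' (hmap hτ1))⟩
      rw [mem_ball, Real.dist_eq, abs_lt]
      constructor <;> linarith [hτ.1, hτ.2]
    have e1 := hNu _ (hsub (left_mem_Icc.2 hss))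
    have e2 := hNu _ (hsub (right_mem_Icc.2 hss))
    change edist (transfer ψ ψ' ((γ ∘ l) s)) (transfer ψ ψ' ((γ ∘ l) s')) ≤ _
    rw [transfer_eq hψ e1, transfer_eq hψ e2]
    exact (edist_le_of_unitSpeed h'.speed _ _).trans (ofReal_abs_le_of_unitSpeed h.speed hss
      (f := u ∘ γ ∘ l)
      (hu.comp (hσ.mono (Icc_subset_Icc hs.1 hs'.2)) hsub) fun τ hτ => hNu _ (hsub hτ))

theorem fold {B : Body U} {B' : Body V} (hU : U.set = B.Kᶜ) (hV : V.set = B'.Kᶜ)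
    (h : UnitParam (frontier B.K) ψ) (h' : UnitParam (frontier B'.K) ψ')
    (hψ : ∀ s t, ψ s = ψ t ↔ ψ' s = ψ' t) : Fold B B' (transfer ψ ψ') := by
  have e := B.frontier_F_of_compl hU
  have e' := B'.frontier_F_of_compl hV
  refine ⟨fun p hp hi => absurd (interior_subset hi) (hU.subset hp), ?_, fun x hx => ?_, ?_,
    fun w hw hK => absurd hK (hU.subset hw), fun γ hγ _ hm => ?_⟩
  · rw [e, e']; exact h.mapsTo h'
  · rw [hU, hV]
    rw [e] at hx
    exact ⟨fun H => absurd (B'.closed.frontier_subset (h.mapsTo h' hx)) H,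
      fun H => absurd (B.closed.frontier_subset hx) H⟩
  · rw [e]; exact h.continuousOn h' hψ
  · exact h.eVariationOn_le h' hψ hγ (e ▸ hm)

theorem exists_of_compl {B : Body U} {B' : Body V} (hU : U.set = B.Kᶜ)
    (hV : V.set = B'.Kᶜ) (h : UnitParam (frontier B.K) ψ) (h' : UnitParam (frontier B'.K) ψ')
    (hψ : ∀ s t, ψ s = ψ t ↔ ψ' s = ψ' t) :
    Nonempty (bd U ≃ᵢ bd V) ∧ ∃ Q θ θinv, IsUnfolding U.set V.set Q θ θinv := by
  have hψ' := fun s t => (hψ s t).symm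
  constructor
  · refine (fold hU hV h h' hψ).exists_isometryEquiv (fold hV hU h' h hψ')
      (fun p hp hi => absurd (interior_subset hi) (hU.subset hp)) (fun x hx => ?_)
      (fun p hp hi => absurd (interior_subset hi) (hV.subset hp)) (fun x hx => ?_)
    · rw [B.frontier_F_of_compl hU] at hx
      exact h.transfer_transfer hψ hx
    · rw [B'.frontier_F_of_compl hV] at hx
      exact h'.transfer_transfer hψ' hx
  · have hF : ∀ {W : Dom} (B : Body W), W.set = B.Kᶜ →
        frontier (FPart W.set) = frontier B.K ∧ componentsOf (corePart W.set) = ∅ := by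
      intro W B hW
      have hs : closure (convexHull ℝ (frontier W.set)) ⊆ B.K :=
        closure_minimal (convexHull_min B.frontier_subset B.convex) B.closed
      have hd : Disjoint W.set (closure (convexHull ℝ (frontier W.set))) :=
        disjoint_left.2 fun x hx hx' => hW.subset hx (hs hx')
      rw [FPart, corePart, hd.sdiff_eq_left, hd.mono_right
        (interior_subset.trans subset_closure) |>.inter_eq, hW, frontier_compl]
      exact ⟨rfl, eq_empty_of_forall_notMem fun _ ⟨x, hx, _⟩ => hx⟩
    obtain ⟨e1, e2⟩ := hF B hU
    obtain ⟨e1', e2'⟩ := hF B' hV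
    refine ⟨fun _ => IsometryEquiv.refl _, transfer ψ ψ', transfer ψ' ψ,
      e1 ▸ h.continuousOn h' hψ, e1' ▸ h'.continuousOn h hψ', ?_, ?_, ?_, by simp [e2],
      by simp [e2'], by simp [e2], fun γ hγ _ hm => ?_⟩
    · rw [e1, e1']; exact h.mapsTo h'
    · rw [e1, e1']; exact h'.mapsTo h
    · rw [e1, e1']
      exact ⟨fun x hx => h.transfer_transfer hψ hx, fun x hx => h'.transfer_transfer hψ' hx⟩
    · rw [e1] at hm
      refine (h.eVariationOn_le h' hψ hγ hm).antisymm ?_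
      conv_lhs => rw [eVariationOn.congr (f := γ) (g := transfer ψ' ψ ∘ transfer ψ ψ' ∘ γ)
        fun t ht => (h.transfer_transfer hψ (hm ht)).symm]
      exact h'.eVariationOn_le h hψ' ((h.continuousOn h' hψ).comp hγ hm) fun t ht =>
        h.mapsTo h' (hm ht)

end UnitParam

/-- The unit vector with polar angle `φ`. -/
def wv (φ : ℝ) : E2 := !₂[Real.cos φ, Real.sin φ]

theorem inner_wv (s t : ℝ) : inner ℝ (wv s) (wv t) = Real.cos (s - t) := by
  simp [wv, PiLp.inner_apply, Fin.sum_univ_two, Real.cos_sub]; ring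

theorem norm_wv (φ : ℝ) : ‖wv φ‖ = 1 := by
  rw [← sq_eq_sq₀ (norm_nonneg _) zero_le_one, ← real_inner_self_eq_norm_sq, inner_wv]; simp

theorem norm_wv_sub_le (s t : ℝ) : ‖wv s - wv t‖ ≤ |s - t| := by
  refine abs_le_of_sq_le_sq' ?_ (abs_nonneg _) |>.2
  rw [norm_sub_sq_real, norm_wv, norm_wv, inner_wv, sq_abs]
  linarith [Real.one_sub_sq_div_two_le_cos (x := s - t)]

theorem continuous_wv : Continuous wv :=
  (LipschitzWith.of_dist_le_mul (K := 1) fun s t => by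
    simpa [dist_eq_norm] using norm_wv_sub_le s t).continuous

theorem wv_add_int (φ : ℝ) (n : ℤ) : wv (φ + n * (2 * Real.pi)) = wv φ := by
  simp only [wv, Real.cos_add_int_mul_two_pi, Real.sin_add_int_mul_two_pi]

theorem exists_int_of_wv_eq {s t : ℝ} (h : wv s = wv t) : ∃ n : ℤ, t = s + n * (2 * Real.pi) := by
  obtain ⟨n, hn⟩ := Real.Angle.angle_eq_iff_two_pi_dvd_sub.1 (Real.Angle.cos_sin_inj
    (congrArg (fun x : E2 => x 0) h.symm) (congrArg (fun x : E2 => x 1) h.symm))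
  exact ⟨n, by linarith⟩

theorem exists_polar (a : ℝ) (y : E2) :
    ∃ φ ∈ Ioc (a - Real.pi) (a + Real.pi), ∃ r ≥ (0 : ℝ), y = r • wv φ := by
  have hm := toIocMod_mem_Ioc Real.two_pi_pos (a - Real.pi) (Complex.arg ⟨y 0, y 1⟩)
  refine ⟨_, ⟨hm.1, hm.2.trans_eq (by ring)⟩, _, norm_nonneg (⟨y 0, y 1⟩ : ℂ), ?_⟩
  rw [toIocMod, zsmul_eq_mul, sub_eq_add_neg, ← neg_mul, ← Int.cast_neg, wv_add_int]
  ext i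
  fin_cases i
  · simp [wv, Complex.norm_mul_cos_arg]
  · simp [wv, Complex.norm_mul_sin_arg]

theorem eq_smul_wv (a : ℝ) (hy : 0 < inner ℝ y (wv a)) :
    ∃ r > (0 : ℝ), y = r • wv (a + Real.arctan
      (inner ℝ y (wv (a + Real.pi / 2)) / inner ℝ y (wv a))) := by
  set q := inner ℝ y (wv (a + Real.pi / 2)) / inner ℝ y (wv a) with hq
  have hq' : q * inner ℝ y (wv a) = inner ℝ y (wv (a + Real.pi / 2)) := div_mul_cancel₀ _ hy.ne'
  have hs : 0 < √(1 + q ^ 2) := Real.sqrt_pos.2 (by positivity)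
  refine ⟨_, mul_pos hy hs, ?_⟩
  have h2 := Real.cos_sq_add_sin_sq a
  simp only [wv, PiLp.inner_apply, Fin.sum_univ_two, Real.cos_add_pi_div_two,
    Real.sin_add_pi_div_two, RCLike.inner_apply, conj_trivial] at hq' ⊢
  ext i
  fin_cases i
  · simp [Real.cos_add, Real.cos_arctan, Real.sin_arctan]
    field_simp
    simp at hq'
    linear_combination Real.sin a * hq' - y 0 * h2
  · simp [Real.sin_add, Real.cos_arctan, Real.sin_arctan]
    field_simp
    simp at hq'
    linear_combination -Real.cos a * hq' - y 1 * h2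

namespace Body

variable (B : Body W)

theorem gf_le_one_iff : B.gf y ≤ 1 ↔ B.o + y ∈ B.K := by
  rw [gf, gauge_le_one_iff_mem_closure B.convex_pre B.pre_mem_nhds,
    (B.closed.preimage (continuous_const_add B.o)).closure_eq, mem_preimage]

/-- The radial parametrization of the frontier. -/
def rc (φ : ℝ) : E2 := B.o + (B.gf (wv φ))⁻¹ • wv φ

/-- A set of polar angles of an unrolled frontier. -/
structure Chart (A : Set ℝ) : Prop where
  isOpen : IsOpen A
  ordConnected : A.OrdConnected
  pos : ∀ φ ∈ A, 0 < B.gf (wv φ)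
  surj : ∀ y, 0 < B.gf y → ∃ φ ∈ A, ∃ r > (0 : ℝ), y = r • wv φ

/-- Length of the frontier measured from the angle `a`. -/
def len (A : Set ℝ) (a φ : ℝ) : ℝ := variationOnFromTo B.rc A a φ

theorem rc_eq {φ r : ℝ} (hr : 0 < r) (hy : y = r • wv φ) (h : B.o + y ∈ frontier B.K) :
    B.rc φ = B.o + y := by
  rw [← B.gf_eq_one_iff, hy, B.gf_smul hr.le] at h
  rw [rc, hy, eq_inv_of_mul_eq_one_left h]

theorem dist_rc (φ : ℝ) : dist (B.rc φ) B.o = (B.gf (wv φ))⁻¹ := by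
  rw [rc, dist_self_add_left, norm_smul, norm_wv, mul_one,
    Real.norm_of_nonneg (inv_nonneg.2 (B.gf_nonneg _))]

theorem wv_eq_of_rc_eq {s t : ℝ} (hs : 0 < B.gf (wv s)) (h : B.rc s = B.rc t) : wv s = wv t := by
  have e := B.dist_rc s
  rw [h, B.dist_rc t] at e
  rw [rc, rc, e, add_right_inj] at h
  exact smul_right_injective _ (inv_pos.2 hs).ne' h

variable {B} {A : Set ℝ} {a : ℝ}

theorem exists_lipschitz_rc {s t : ℝ} (h : ∀ φ ∈ Icc s t, 0 < B.gf (wv φ)) :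
    ∃ C, LipschitzOnWith C B.rc (Icc s t) := by
  rcases (Icc s t).eq_empty_or_nonempty with he | hne
  · exact ⟨0, by simp [he]⟩
  obtain ⟨x, hx, hmin⟩ := isCompact_Icc.exists_isMinOn hne
    (B.continuous_gf.comp continuous_wv).continuousOn
  obtain ⟨G, hG⟩ := B.convex_pre.lipschitz_gauge B.pre_mem_nhds
  set m := B.gf (wv x)
  have hm : 0 < m := h x hx
  refine ⟨Real.toNNReal (m⁻¹ + G * m⁻¹ * m⁻¹), LipschitzOnWith.of_dist_le_mul fun p hp q hq => ?_⟩
  have hp' : (B.gf (wv p))⁻¹ ≤ m⁻¹ := inv_anti₀ hm (hmin hp)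
  have hq' : (B.gf (wv q))⁻¹ ≤ m⁻¹ := inv_anti₀ hm (hmin hq)
  have hG' : |B.gf (wv q) - B.gf (wv p)| ≤ G * |p - q| := by
    have := hG.dist_le_mul (wv q) (wv p)
    rw [Real.dist_eq, dist_eq_norm, norm_sub_rev] at this
    exact this.trans (mul_le_mul_of_nonneg_left (norm_wv_sub_le p q) G.2)
  have hp0 := h p hp
  have hq0 := h q hq
  have e : B.rc p - B.rc q = (B.gf (wv p))⁻¹ • (wv p - wv q) +
      ((B.gf (wv p))⁻¹ * (B.gf (wv q) - B.gf (wv p)) * (B.gf (wv q))⁻¹) • wv q := by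
    have : (B.gf (wv p))⁻¹ * (B.gf (wv q) - B.gf (wv p)) * (B.gf (wv q))⁻¹ =
      (B.gf (wv p))⁻¹ - (B.gf (wv q))⁻¹ := by field_simp
    rw [this, rc, rc]; module
  rw [dist_eq_norm, e, Real.coe_toNNReal _ (by positivity), Real.dist_eq]
  refine (norm_add_le _ _).trans ?_
  rw [norm_smul, norm_smul, norm_wv, mul_one, norm_mul, norm_mul, norm_inv, norm_inv,
    Real.norm_of_nonneg hp0.le, Real.norm_of_nonneg hq0.le, Real.norm_eq_abs]
  calc _ ≤ m⁻¹ * |p - q| + m⁻¹ * (G * |p - q|) * m⁻¹ := by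
        have := norm_wv_sub_le p q; gcongr
    _ = _ := by ring

namespace Chart

theorem rc_mem (h : B.Chart A) {φ : ℝ} (hφ : φ ∈ A) : B.rc φ ∈ frontier B.K := by
  rw [rc, ← B.gf_eq_one_iff, B.gf_smul (inv_nonneg.2 (B.gf_nonneg _)),
    inv_mul_cancel₀ (h.pos φ hφ).ne']

theorem exists_rc_eq (h : B.Chart A) (hx : x ∈ frontier B.K) : ∃ φ ∈ A, B.rc φ = x := by
  have e : B.o + (x - B.o) = x := by abel
  rw [← e] at hx
  obtain ⟨φ, hφ, r, hr, hy⟩ := h.surj (x - B.o) (by rw [B.gf_eq_one_iff.2 hx]; exact one_pos)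
  exact ⟨φ, hφ, (B.rc_eq hr hy hx).trans e⟩

theorem isConnected_compl (h : B.Chart A) (ha : a ∈ A) : IsConnected B.Kᶜ := by
  have hc : IsConnected (A ×ˢ Ioi (1 : ℝ)) :=
    ⟨⟨(a, 2), ha, by norm_num⟩, (isPreconnected_iff_ordConnected.2 h.ordConnected).prod
      isPreconnected_Ioi⟩
  have hf : ContinuousOn (fun p : ℝ × ℝ => B.o + (p.2 * (B.gf (wv p.1))⁻¹) • wv p.1)
      (A ×ˢ Ioi (1 : ℝ)) := by
    have h1 : Continuous fun p : ℝ × ℝ => wv p.1 := continuous_wv.comp continuous_fst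
    exact continuousOn_const.add ((continuousOn_snd.mul
      ((B.continuous_gf.comp h1).continuousOn.inv₀ fun p hp => (h.pos _ hp.1).ne')).smul
      h1.continuousOn)
  convert hc.image _ hf using 1
  ext x
  constructor
  · intro hx
    have e : B.o + (x - B.o) = x := by abel
    have h1 : 1 < B.gf (x - B.o) := not_le.1 fun H => hx (e ▸ B.gf_le_one_iff.1 H)
    obtain ⟨φ, hφ, r, hr, hy⟩ := h.surj _ (one_pos.trans h1)
    refine ⟨(φ, B.gf (x - B.o)), ⟨hφ, h1⟩, ?_⟩
    simp only
    rw [hy, B.gf_smul hr.le, mul_inv_cancel_right₀ (h.pos _ hφ).ne', ← hy, e]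
  · rintro ⟨⟨φ, l⟩, ⟨hφ, hl⟩, rfl⟩ hx
    have hl0 : 0 < l := one_pos.trans hl
    have hg := h.pos φ hφ
    rw [← B.gf_le_one_iff, B.gf_smul (by positivity), inv_mul_cancel_right₀ hg.ne'] at hx
    exact hx.not_gt hl

theorem exists_eVariationOn_le (h : B.Chart A) {s t : ℝ} (hs : s ∈ A) (ht : t ∈ A) :
    ∃ C : NNReal, ∀ p ∈ Icc s t, ∀ q ∈ Icc s t,
      eVariationOn B.rc (A ∩ Icc p q) ≤ C * ENNReal.ofReal (q - p) := by
  have hA := h.ordConnected.out hs ht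
  obtain ⟨C, hC⟩ := exists_lipschitz_rc fun φ hφ => h.pos φ (hA hφ)
  refine ⟨C, fun p hp q hq => (hC.comp_eVariationOn_le (g := id) fun x hx =>
    ⟨hp.1.trans hx.2.1, hx.2.2.trans hq.2⟩).trans ?_⟩
  gcongr
  exact (monotoneOn_id.eVariationOn_eq (hA hp) (hA hq)).le

theorem lbv (h : B.Chart A) : LocallyBoundedVariationOn B.rc A := by
  intro s t hs ht
  rcases le_total s t with hst | hst
  · obtain ⟨C, hC⟩ := h.exists_eVariationOn_le hs ht
    exact ((hC s ⟨le_rfl, hst⟩ t ⟨hst, le_rfl⟩).trans_lt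
      (ENNReal.mul_lt_top ENNReal.coe_lt_top ENNReal.ofReal_lt_top)).ne
  · rw [BoundedVariationOn, eVariationOn.subsingleton]
    · exact ENNReal.zero_ne_top
    · exact fun x hx y hy => le_antisymm (hx.2.2.trans (hst.trans hy.2.1))
        (hy.2.2.trans (hst.trans hx.2.1))

theorem len_sub (h : B.Chart A) (ha : a ∈ A) {s t : ℝ} (hs : s ∈ A) (ht : t ∈ A) (hst : s ≤ t) :
    B.len A a t - B.len A a s = (eVariationOn B.rc (A ∩ Icc s t)).toReal := by
  rw [← variationOnFromTo.eq_of_le _ _ hst, len, len,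
    ← variationOnFromTo.add h.lbv ha hs ht, add_sub_cancel_left]

theorem dist_le_len_sub (h : B.Chart A) (ha : a ∈ A) {s t : ℝ} (hs : s ∈ A) (ht : t ∈ A) (hst : s ≤ t) :
    dist (B.rc s) (B.rc t) ≤ B.len A a t - B.len A a s := by
  rw [h.len_sub ha hs ht hst, dist_edist]
  exact ENNReal.toReal_mono (h.lbv s t hs ht)
    (eVariationOn.edist_le _ ⟨hs, le_rfl, hst⟩ ⟨ht, hst, le_rfl⟩)

theorem continuousOn_len (h : B.Chart A) (ha : a ∈ A) : ContinuousOn (B.len A a) A := by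
  intro x hx
  obtain ⟨ε, hε, hb⟩ := Metric.isOpen_iff.1 h.isOpen x hx
  rw [Real.ball_eq_Ioo] at hb
  have hs : x - ε / 2 ∈ A := hb ⟨by linarith, by linarith⟩
  have ht : x + ε / 2 ∈ A := hb ⟨by linarith, by linarith⟩
  obtain ⟨C, hC⟩ := h.exists_eVariationOn_le hs ht
  have hA := h.ordConnected.out hs ht
  have : LipschitzOnWith C (B.len A a) (Icc (x - ε / 2) (x + ε / 2)) := by
    refine LipschitzOnWith.of_dist_le_mul fun p hp q hq => ?_
    wlog hpq : p ≤ q generalizing p q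
    · rw [dist_comm, dist_comm p]; exact this q hq p hp (le_of_not_ge hpq)
    have h0 := (dist_nonneg).trans (h.dist_le_len_sub ha (hA hp) (hA hq) hpq)
    rw [dist_comm, Real.dist_eq, abs_of_nonneg h0, h.len_sub ha (hA hp) (hA hq) hpq, dist_comm,
      Real.dist_eq, abs_of_nonneg (sub_nonneg.2 hpq)]
    refine ENNReal.toReal_le_of_le_ofReal (by have := sub_nonneg.2 hpq; positivity) ?_
    rw [ENNReal.ofReal_mul C.coe_nonneg, ENNReal.ofReal_coe_nnreal]
    exact hC p hp q hq
  exact (this.continuousOn.continuousAt (Icc_mem_nhds (by linarith) (by linarith))).continuousWithinAt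

theorem exists_unitParam (h : B.Chart A) (ha : a ∈ A) (hlow : ∀ M, ∃ φ ∈ A, B.len A a φ ≤ M)
    (hhigh : ∀ M, ∃ φ ∈ A, M ≤ B.len A a φ) :
    ∃ ψ, UnitParam (frontier B.K) ψ ∧ (∀ φ ∈ A, ψ (B.len A a φ) = B.rc φ) ∧
      ∀ s, ∃ φ ∈ A, B.len A a φ = s := by
  have hsurj : ∀ s, ∃ φ ∈ A, B.len A a φ = s := fun s => by
    obtain ⟨p, hp, hps⟩ := hlow s
    obtain ⟨q, hq, hqs⟩ := hhigh s
    exact (isPreconnected_iff_ordConnected.2 h.ordConnected).intermediate_value hp hq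
      (h.continuousOn_len ha) ⟨hps, hqs⟩
  have hψ : ∀ φ ∈ A, naturalParameterization B.rc A a (B.len A a φ) = B.rc φ := fun φ hφ =>
    edist_eq_zero.1 (edist_naturalParameterization_eq_zero h.lbv ha hφ)
  refine ⟨naturalParameterization B.rc A a, ⟨?_, ?_, fun t => ?_⟩, hψ, hsurj⟩
  · ext x
    constructor
    · rintro ⟨s, rfl⟩
      obtain ⟨φ, hφ, rfl⟩ := hsurj s
      rw [hψ φ hφ]
      exact h.rc_mem hφ
    · intro hx
      obtain ⟨φ, hφ, rfl⟩ := h.exists_rc_eq hx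
      exact ⟨_, hψ φ hφ⟩
  · have : variationOnFromTo B.rc A a '' A = univ := eq_univ_of_forall hsurj
    exact this ▸ has_unit_speed_naturalParameterization B.rc h.lbv ha
  · obtain ⟨φ, hφ, rfl⟩ := hsurj t
    rw [hψ φ hφ]
    set β : E2 → ℝ := fun y => φ + Real.arctan
      (inner ℝ (y - B.o) (wv (φ + Real.pi / 2)) / inner ℝ (y - B.o) (wv φ))
    have hg := h.pos φ hφ
    have hpos : 0 < inner ℝ (B.rc φ - B.o) (wv φ) := by
      rw [rc, add_sub_cancel_left, inner_smul_left, inner_wv]; simpa using hg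
    have hβ : ∀ y, 0 < inner ℝ (y - B.o) (wv φ) → ContinuousAt β y := fun y hy =>
      continuousAt_const.add (Real.continuous_arctan.continuousAt.comp
        (ContinuousAt.div₀ (by fun_prop) (by fun_prop) hy.ne'))
    have hβ0 : β (B.rc φ) = φ := by
      simp only [β, rc, add_sub_cancel_left, inner_smul_left, inner_wv]; simp
    refine ⟨B.len A a ∘ β, {y | 0 < inner ℝ (y - B.o) (wv φ) ∧ β y ∈ A}, ?_, ?_, ?_⟩
    · refine Filter.inter_mem (ContinuousAt.eventually_lt (f := fun _ => (0 : ℝ))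
        (g := fun y => inner ℝ (y - B.o) (wv φ)) continuousAt_const (by fun_prop) hpos)
        ((hβ _ hpos).preimage_mem_nhds (h.isOpen.mem_nhds (hβ0.symm ▸ hφ)))
    · exact (h.continuousOn_len ha).comp (fun y hy => (hβ y hy.1.1).continuousWithinAt)
        fun y hy => hy.1.2
    · rintro y ⟨⟨hy, hyA⟩, hyK⟩
      have e : B.o + (y - B.o) = y := by abel
      obtain ⟨r, hr, hy'⟩ := eq_smul_wv φ hy
      rw [Function.comp_apply, hψ _ hyA, B.rc_eq hr hy' (e.symm ▸ hyK), e]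

end Chart

end Body

theorem exists_line {s : Set E2} {n : E2} (hn : n ≠ 0)
    (h : ∀ x ∈ s, ∀ y ∈ s, inner ℝ (x - y) n = (0 : ℝ)) :
    ∃ p v : E2, v ≠ 0 ∧ ∀ x ∈ s, ∃ t : ℝ, x = p + t • v := by
  have hn2 : n 0 * n 0 + n 1 * n 1 ≠ 0 := fun H => hn <| by
    have := mul_self_add_mul_self_eq_zero.1 H
    ext i; fin_cases i <;> simp [this]
  rcases s.eq_empty_or_nonempty with rfl | ⟨p, hp⟩
  · exact ⟨0, n, hn, by simp⟩
  refine ⟨p, !₂[-n 1, n 0], fun H => hn2 ?_, fun x hx => ⟨((x 1 - p 1) * n 0 - (x 0 - p 0) * n 1) /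
    (n 0 * n 0 + n 1 * n 1), ?_⟩⟩
  · have h0 := congrArg (fun x : E2 => x 0) H
    have h1 := congrArg (fun x : E2 => x 1) H
    simp at h0 h1
    simp [h0, h1]
  · have := h x hx p hp
    simp only [PiLp.inner_apply, Fin.sum_univ_two, RCLike.inner_apply, conj_trivial,
      PiLp.sub_apply] at this
    have e := div_mul_cancel₀ ((x 1 - p 1) * n 0 - (x 0 - p 0) * n 1) hn2
    ext i
    fin_cases i <;> refine mul_right_cancel₀ hn2 ?_ <;>
      simp only [PiLp.add_apply, PiLp.smul_apply, smul_eq_mul, Fin.zero_eta, Fin.mk_one,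
        Matrix.cons_val_zero, Matrix.cons_val_one]
    · linear_combination n 0 * this + n 1 * e
    · linear_combination n 1 * this - n 0 * e

theorem interior_hull_nonempty {s : Set E2}
    (h : ¬ ∃ p v : E2, v ≠ 0 ∧ ∀ x ∈ s, ∃ t : ℝ, x = p + t • v) :
    (interior (convexHull ℝ s)).Nonempty := by
  rw [interior_convexHull_nonempty_iff_affineSpan_eq_top]
  rcases s.eq_empty_or_nonempty with rfl | hs
  · exact absurd (exists_line (n := wv 0) (by simp [← norm_ne_zero_iff, norm_wv]) (by simp)) h
  rw [AffineSubspace.affineSpan_eq_top_iff_vectorSpan_eq_top_of_nonempty ℝ E2 E2 hs]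
  by_contra ht
  obtain ⟨n, hn, hn0⟩ := Submodule.exists_mem_ne_zero_of_ne_bot
    (mt (Submodule.orthogonal_eq_bot_iff (K := vectorSpan ℝ s)).1 ht)
  exact h (exists_line hn0 fun x hx y hy => hn _ (vsub_mem_vectorSpan ℝ hx hy))

namespace Body

variable (B : Body W)

theorem ray_mem (h : B.gf y = 0) {c : ℝ} (hc : 0 ≤ c) : B.o + c • y ∈ B.K := by
  rw [← B.gf_le_one_iff, B.gf_smul hc, h, mul_zero]; exact zero_le_one

theorem gf_wv_pos {R : ℝ} (h : B.K ⊆ closedBall B.o R) (φ : ℝ) : 0 < B.gf (wv φ) := by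
  refine (B.gf_nonneg _).lt_of_ne' fun h0 => ?_
  have := h (B.ray_mem h0 (add_nonneg (abs_nonneg R) zero_le_one))
  rw [mem_closedBall, dist_self_add_left, norm_smul, norm_wv, mul_one,
    Real.norm_of_nonneg (by positivity)] at this
  linarith [le_abs_self R]

theorem wv_add_pi (a : ℝ) : wv (a + Real.pi) = -wv a := by
  ext i; fin_cases i <;> simp [wv]

theorem wv_sub_pi (a : ℝ) : wv (a - Real.pi) = -wv a := by
  ext i; fin_cases i <;> simp [wv]

theorem chart_univ (h : ∀ φ, 0 < B.gf (wv φ)) : B.Chart univ := by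
  refine ⟨isOpen_univ, ordConnected_univ, fun φ _ => h φ, fun y hy => ?_⟩
  obtain ⟨φ, -, r, hr, rfl⟩ := exists_polar 0 y
  refine ⟨φ, mem_univ _, r, hr.lt_of_ne ?_, rfl⟩
  rintro rfl
  simp [gf] at hy

theorem gf_pos_of_between {a : ℝ} (h0 : B.gf (-wv a) = 0) {σ : ℝ} (hσ : σ = 1 ∨ σ = -1)
    {t t' : ℝ} (ht : 0 < t) (htt : t ≤ t') (ht' : t' < Real.pi)
    (h : 0 < B.gf (wv (a + σ * t'))) : 0 < B.gf (wv (a + σ * t)) := by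
  refine (B.gf_nonneg _).lt_of_ne' fun H => ?_
  have h1 : 0 < Real.sin t := Real.sin_pos_of_pos_of_lt_pi ht (by linarith)
  have h2 : 0 ≤ Real.sin t' := Real.sin_nonneg_of_nonneg_of_le_pi (by linarith) ht'.le
  have h3 : 0 ≤ Real.sin (t' - t) :=
    Real.sin_nonneg_of_nonneg_of_le_pi (by linarith) (by linarith)
  have e : Real.sin t • wv (a + σ * t') =
      Real.sin t' • wv (a + σ * t) + Real.sin (t' - t) • (-wv a) := by
    rcases hσ with rfl | rfl <;> ext i <;> fin_cases i <;>
    · simp [wv, Real.cos_add, Real.sin_add, Real.sin_sub]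
      ring
  have := gauge_add_le B.convex_pre (absorbent_nhds_zero B.pre_mem_nhds)
    (Real.sin t' • wv (a + σ * t)) (Real.sin (t' - t) • (-wv a))
  rw [← e] at this
  change B.gf _ ≤ B.gf _ + B.gf _ at this
  rw [B.gf_smul h1.le, B.gf_smul h2, B.gf_smul h3, H, h0] at this
  nlinarith [mul_pos h1 h]

/-- The angles at which the frontier is visible when it is unbounded. -/
def angles (a : ℝ) : Set ℝ := Ioo (a - Real.pi) (a + Real.pi) ∩ {φ | 0 < B.gf (wv φ)}

theorem chart_angles {a : ℝ} (h0 : B.gf (-wv a) = 0) (h : 0 < B.gf (wv a)) :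
    B.Chart (B.angles a) := by
  refine ⟨isOpen_Ioo.inter (isOpen_lt continuous_const (B.continuous_gf.comp continuous_wv)),
    ⟨fun x hx y hy z hz => ⟨⟨hx.1.1.trans_le hz.1, hz.2.trans_lt hy.1.2⟩, ?_⟩⟩,
    fun φ hφ => hφ.2, fun y hy => ?_⟩
  · rcases lt_trichotomy z a with hza | rfl | hza
    · simpa using B.gf_pos_of_between h0 (Or.inr rfl) (sub_pos.2 hza) (sub_le_sub_left hz.1 a)
        (by linarith [hx.1.1]) (by simpa using hx.2)
    · exact h
    · simpa using B.gf_pos_of_between h0 (Or.inl rfl) (sub_pos.2 hza) (sub_le_sub_right hz.2 a)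
        (by linarith [hy.1.2]) (by simpa using hy.2)
  · obtain ⟨φ, hφ, r, hr, rfl⟩ := exists_polar a y
    rw [B.gf_smul hr] at hy
    have hφ' := pos_of_mul_pos_right hy hr
    refine ⟨φ, ⟨⟨hφ.1, hφ.2.lt_of_ne ?_⟩, hφ'⟩, r, hr.lt_of_ne' (left_ne_zero_of_mul hy.ne'), rfl⟩
    rintro rfl
    rw [wv_add_pi, h0] at hφ'
    exact hφ'.false

theorem exists_far {a b : ℝ} (h : 0 < B.gf (wv a)) (hb : B.gf (wv b) = 0) (M : ℝ) :
    ∃ φ ∈ uIcc a b, 0 < B.gf (wv φ) ∧ M ≤ dist (B.rc a) (B.rc φ) := by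
  have hε : 0 < (B.gf (wv a))⁻¹ + |M| := by positivity
  obtain ⟨φ, hφ, e⟩ := intermediate_value_uIcc (B.continuous_gf.comp continuous_wv).continuousOn
    (show ((B.gf (wv a))⁻¹ + |M|)⁻¹ ∈ uIcc ((B.gf ∘ wv) a) ((B.gf ∘ wv) b) by
      rw [Function.comp_apply, Function.comp_apply, hb, uIcc_of_ge h.le]
      exact ⟨(inv_pos.2 hε).le, inv_le_of_inv_le₀ h (le_add_of_nonneg_right (abs_nonneg M))⟩)
  rw [Function.comp_apply] at e
  refine ⟨φ, hφ, e ▸ inv_pos.2 hε, ?_⟩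
  have h1 := B.dist_rc φ
  rw [e, inv_inv] at h1
  linarith [dist_triangle (B.rc φ) (B.rc a) B.o, B.dist_rc a, dist_comm (B.rc φ) (B.rc a),
    le_abs_self M]

theorem exists_unitParam_injective {a : ℝ} (h0 : B.gf (-wv a) = 0) (h : 0 < B.gf (wv a)) :
    ∃ ψ, UnitParam (frontier B.K) ψ ∧ Function.Injective ψ := by
  have hc := B.chart_angles h0 h
  have hπ := Real.pi_pos
  have ha : a ∈ B.angles a := ⟨⟨by linarith, by linarith⟩, h⟩
  have hl : B.len (B.angles a) a a = 0 := variationOnFromTo.self _ _ _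
  obtain ⟨ψ, hψ, hψl, hs⟩ := hc.exists_unitParam ha (fun M => by
    obtain ⟨φ, hφ, hg, hM⟩ := B.exists_far h (b := a - Real.pi) (by rwa [wv_sub_pi]) (-M)
    rw [uIcc_of_ge (by linarith)] at hφ
    have hφA : φ ∈ B.angles a := ⟨⟨hφ.1.lt_of_ne ?_, by linarith [hφ.2]⟩, hg⟩
    · refine ⟨φ, hφA, ?_⟩
      linarith [hc.dist_le_len_sub ha hφA ha hφ.2, dist_comm (B.rc a) (B.rc φ)]
    · rintro rfl
      rw [wv_sub_pi, h0] at hg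
      exact hg.false) (fun M => by
    obtain ⟨φ, hφ, hg, hM⟩ := B.exists_far h (b := a + Real.pi) (by rwa [wv_add_pi]) M
    rw [uIcc_of_le (by linarith)] at hφ
    have hφA : φ ∈ B.angles a := ⟨⟨by linarith [hφ.1], hφ.2.lt_of_ne ?_⟩, hg⟩
    · refine ⟨φ, hφA, ?_⟩
      linarith [hc.dist_le_len_sub ha ha hφA hφ.1]
    · rintro rfl
      rw [wv_add_pi, h0] at hg
      exact hg.false)
  refine ⟨ψ, hψ, fun s t hst => ?_⟩
  obtain ⟨φ, hφ, rfl⟩ := hs s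
  obtain ⟨φ', hφ', rfl⟩ := hs t
  rw [hψl _ hφ, hψl _ hφ'] at hst
  obtain ⟨n, rfl⟩ := exists_int_of_wv_eq (B.wv_eq_of_rc_eq hφ.2 hst)
  have h1 : (n : ℝ) < 1 := by by_contra!; nlinarith [hφ.1.1, hφ'.1.2]
  have h2 : (-1 : ℝ) < n := by by_contra!; nlinarith [hφ.1.2, hφ'.1.1]
  have : n = 0 := by
    have h1' : n < 1 := by exact_mod_cast h1
    have h2' : -1 < n := by exact_mod_cast h2
    omega
  simp [this]

/-- The perimeter of the body. -/
def perim : ℝ := B.len univ 0 (2 * Real.pi)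

theorem perim_pos (h : ∀ φ, 0 < B.gf (wv φ)) : 0 < B.perim := by
  have hc := B.chart_univ h
  have hπ := Real.pi_pos
  have hl : B.len univ 0 0 = 0 := variationOnFromTo.self _ _ _
  have h1 := hc.dist_le_len_sub (mem_univ 0) (mem_univ 0) (mem_univ Real.pi) hπ.le
  have h2 := hc.dist_le_len_sub (mem_univ 0) (mem_univ Real.pi) (mem_univ (2 * Real.pi))
    (by linarith)
  have h3 : 0 < dist (B.rc 0) (B.rc Real.pi) := dist_pos.2 fun H => by
    have := congrArg (fun x : E2 => x 0) (B.wv_eq_of_rc_eq (h 0) H)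
    norm_num [wv] at this
  rw [perim]
  linarith [dist_nonneg (x := B.rc Real.pi) (y := B.rc (2 * Real.pi))]

theorem len_add_int (h : ∀ φ, 0 < B.gf (wv φ)) (φ : ℝ) (n : ℤ) :
    B.len univ 0 (φ + n * (2 * Real.pi)) = B.len univ 0 φ + n * B.perim := by
  have hc := B.chart_univ h
  have hs : ∀ φ, B.len univ 0 (φ + 2 * Real.pi) = B.len univ 0 φ + B.perim := fun φ => by
    have e : B.rc ∘ (fun x => x + 2 * Real.pi) = B.rc := funext fun x => by
      have := wv_add_int x 1
      simp only [Int.cast_one, one_mul] at this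
      simp only [Function.comp_apply, rc, this]
    have := variationOnFromTo.comp_eq_of_monotoneOn B.rc (t := univ) (fun x => x + 2 * Real.pi)
      (fun _ _ _ _ h => add_le_add_left h _) (mem_univ 0) (mem_univ φ)
    rw [e, image_univ_of_surjective (add_right_surjective _), zero_add] at this
    have h2 := variationOnFromTo.add hc.lbv (mem_univ 0) (mem_univ (2 * Real.pi))
      (mem_univ (φ + 2 * Real.pi))
    rw [perim, len, len, len, this, ← h2, add_comm]
  have hπ := Real.pi_pos
  have hp : Function.Periodic (fun x => B.len univ 0 x - B.perim / (2 * Real.pi) * x)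
      (2 * Real.pi) := fun x => by
    simp only [hs]
    field_simp
    ring
  have := hp.int_mul n φ
  beta_reduce at this
  linear_combination this + n * div_mul_cancel₀ B.perim Real.two_pi_pos.ne'

theorem exists_unitParam_periodic (h : ∀ φ, 0 < B.gf (wv φ)) :
    ∃ ψ, UnitParam (frontier B.K) ψ ∧ ∀ s t, ψ s = ψ t ↔ ∃ n : ℤ, t = s + n * B.perim := by
  have hc := B.chart_univ h
  have hP := B.perim_pos h
  have hl : B.len univ 0 0 = 0 := variationOnFromTo.self _ _ _
  have key : ∀ n : ℤ, B.len univ 0 (n * (2 * Real.pi)) = n * B.perim := fun n => by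
    simpa [hl] using B.len_add_int h 0 n
  obtain ⟨ψ, hψ, hψl, hs⟩ := hc.exists_unitParam (mem_univ 0) (fun M => by
    obtain ⟨n, hn⟩ := exists_int_lt (M / B.perim)
    exact ⟨_, mem_univ _, (key n).trans_le ((le_div_iff₀ hP).1 hn.le)⟩) (fun M => by
    obtain ⟨n, hn⟩ := exists_int_gt (M / B.perim)
    exact ⟨_, mem_univ _, ((div_le_iff₀ hP).1 hn.le).trans_eq (key n).symm⟩)
  refine ⟨ψ, hψ, fun s t => ?_⟩
  obtain ⟨φ, -, rfl⟩ := hs s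
  obtain ⟨φ', -, rfl⟩ := hs t
  rw [hψl _ (mem_univ _), hψl _ (mem_univ _)]
  constructor
  · intro H
    obtain ⟨n, rfl⟩ := exists_int_of_wv_eq (B.wv_eq_of_rc_eq (h φ) H)
    exact ⟨n, B.len_add_int h φ n⟩
  · rintro ⟨n, hn⟩
    rw [← hψl _ (mem_univ _), ← hψl _ (mem_univ _), hn, ← B.len_add_int h, hψl _ (mem_univ _),
      hψl _ (mem_univ _), rc, rc, wv_add_int]

end Body

open scoped Pointwise

/-- The whole plane. -/
def univDom : Dom := ⟨univ, isOpen_univ, isConnected_univ⟩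

namespace Body

variable (B : Body W)

theorem Chart.exists_dom {B : Body W} {A : Set ℝ} (h : B.Chart A) {a : ℝ} (ha : a ∈ A) :
    ∃ (V : Dom) (B' : Body V), V.set = B'.Kᶜ ∧ B'.K = B.K :=
  ⟨⟨B.Kᶜ, B.closed.isOpen_compl, h.isConnected_compl ha⟩, ⟨B.K, B.closed, B.convex, B.o, B.r,
    B.r_pos, B.ball_subset, by rw [frontier_compl]; exact B.closed.frontier_subset⟩, rfl, rfl⟩

/-- The body scaled by `l`. -/
def scale {l : ℝ} (hl : 0 < l) : Body univDom where
  K := l • B.K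
  closed := B.closed.smul_of_ne_zero hl.ne'
  convex := B.convex.smul l
  o := l • B.o
  r := l * B.r
  r_pos := mul_pos hl B.r_pos
  ball_subset := by
    have := smul_ball hl.ne' B.o B.r
    rw [Real.norm_of_nonneg hl.le] at this
    exact this ▸ smul_set_mono B.ball_subset
  frontier_subset := by simp [univDom]

variable {l : ℝ} (hl : 0 < l)

theorem gf_scale (y : E2) : (B.scale hl).gf y = l⁻¹ * B.gf y := by
  have : (fun y => (B.scale hl).o + y) ⁻¹' (B.scale hl).K = l • ((fun y => B.o + y) ⁻¹' B.K) := by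
    ext y
    rw [mem_preimage, mem_smul_set_iff_inv_smul_mem₀ hl.ne', mem_preimage, scale,
      mem_smul_set_iff_inv_smul_mem₀ hl.ne', smul_add, inv_smul_smul₀ hl.ne']
  rw [gf, this, gauge_smul_left_of_nonneg hl.le]
  rfl

theorem perim_scale : (B.scale hl).perim = l * B.perim := by
  have e : (B.scale hl).rc = fun φ => l • B.rc φ := funext fun φ => by
    rw [rc, rc, gf_scale, mul_inv, inv_inv, mul_smul, smul_add]; rfl
  rw [perim, perim, len, len, variationOnFromTo.eq_of_le _ _ Real.two_pi_pos.le,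
    variationOnFromTo.eq_of_le _ _ Real.two_pi_pos.le, e]
  simp only [eVariationOn, edist_smul₀, ENNReal.smul_def, smul_eq_mul, ← Finset.mul_sum,
    ← ENNReal.mul_iSup]
  simp [abs_of_pos hl]

theorem frontier_line {u : E2} (hu : u ∈ W.set) (hd : Disjoint W.set B.K) {a : ℝ}
    (h1 : B.gf (wv a) = 0) (h2 : B.gf (-wv a) = 0) :
    ∃ p v : E2, v ≠ 0 ∧ ∀ x ∈ frontier W.set, ∃ t : ℝ, x = p + t • v := by
  have hline : ∀ t : ℝ, B.o + t • wv a ∈ B.K := fun t => by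
    rcases le_total 0 t with h | h
    · exact B.ray_mem h1 h
    · simpa using B.ray_mem h2 (neg_nonneg.2 h)
  set n := wv (a + Real.pi / 2) with hn
  have hdec : ∀ z : E2, inner ℝ z n = (0 : ℝ) → z = (inner ℝ z (wv a) : ℝ) • wv a := fun z hz => by
    have h2 := Real.cos_sq_add_sin_sq a
    simp only [hn, wv, PiLp.inner_apply, Fin.sum_univ_two, Real.cos_add_pi_div_two,
      Real.sin_add_pi_div_two, RCLike.inner_apply, conj_trivial] at hz ⊢
    ext i
    fin_cases i <;> simp at hz ⊢
    · linear_combination -z 0 * h2 - Real.sin a * hz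
    · linear_combination -z 1 * h2 + Real.cos a * hz
  set f : E2 → ℝ := fun y => inner ℝ (y - B.o) n * inner ℝ (u - B.o) n with hf
  have hfc : Continuous f := by fun_prop
  have hmem : ∀ y, ∀ k ∈ B.K, ∀ c : ℝ, 0 ≤ c → c < 1 →
      (inner ℝ (y - B.o) n : ℝ) = c * inner ℝ (k - B.o) n → y ∈ B.K := fun y k hk c h0 hc e => by
    have e1 := hdec (y - B.o - c • (k - B.o)) (by rw [inner_sub_left, real_inner_smul_left, e, sub_self])
    set t : ℝ := inner ℝ (y - B.o - c • (k - B.o)) (wv a)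
    have hc' : 1 - c ≠ 0 := (sub_pos.2 hc).ne'
    have : y = (1 - c) • (B.o + (t / (1 - c)) • wv a) + c • k := by
      rw [smul_add, smul_smul, mul_div_cancel₀ _ hc', ← e1]; module
    rw [this]
    exact B.convex (hline _) hk (sub_pos.2 hc).le h0 (by ring)
  have hne : ∀ y ∈ W.set, (inner ℝ (y - B.o) n : ℝ) ≠ 0 := fun y hy h =>
    disjoint_left.1 hd hy (hmem y B.o (by simpa using hline 0) 0 le_rfl one_pos (by simpa using h))
  have hpos : ∀ y ∈ W.set, 0 < f y := fun y hy => by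
    by_contra! h
    obtain ⟨z, hz, h0⟩ := W.isDom.2.isPreconnected.intermediate_value hy hu hfc.continuousOn
      ⟨h, mul_self_nonneg _⟩
    exact mul_ne_zero (hne z hz) (hne u hu) h0
  have hle : ∀ x ∈ frontier W.set, ∀ x' ∈ frontier W.set, f x' ≤ f x := by
    intro x hx x' hx'
    by_contra! h
    obtain ⟨y, hy, hyW⟩ := mem_closure_iff.1 hx.1 _ (isOpen_lt hfc continuous_const) h
    have hy0 := hpos y hyW
    have hx0 : 0 < f x' := hy0.trans hy
    refine disjoint_left.1 hd hyW (hmem y x' (B.frontier_subset hx') _ (div_pos hy0 hx0).le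
      ((div_lt_one hx0).2 hy) (mul_right_cancel₀ (hne u hu) ?_))
    rw [mul_assoc]
    exact (div_mul_cancel₀ _ hx0.ne').symm
  refine exists_line (n := n) (by simp [← norm_ne_zero_iff, hn, norm_wv]) fun x hx y hy => ?_
  have := mul_right_cancel₀ (hne u hu) (le_antisymm (hle y hy x hx) (hle x hx y hy))
  rw [← sub_sub_sub_cancel_right x y B.o, inner_sub_left, this, sub_self]

end Body

/-- A half plane. -/
def halfBody : Body univDom where
  K := {x | x 0 ≤ 1}
  closed := isClosed_le (by fun_prop) continuous_const
  convex := fun x hx y hy a b ha hb hab => by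
    simp only [mem_ofPred_eq, PiLp.add_apply, PiLp.smul_apply, smul_eq_mul] at *
    nlinarith
  o := 0
  r := 1
  r_pos := one_pos
  ball_subset := fun x hx => by
    rw [mem_ball_zero_iff] at hx
    exact (le_abs_self _).trans ((PiLp.norm_apply_le x 0).trans hx.le)
  frontier_subset := by simp [univDom]

/-- The unit disk. -/
def diskBody : Body univDom where
  K := closedBall 0 1
  closed := isClosed_closedBall
  convex := convex_closedBall 0 1
  o := 0
  r := 1
  r_pos := one_pos
  ball_subset := ball_subset_closedBall
  frontier_subset := by simp [univDom]

/-- A square. -/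
def squareBody : Body univDom where
  K := {x | ∀ i, |x i| ≤ 1}
  closed := by
    simp only [ofPred_forall]
    exact isClosed_iInter fun i => isClosed_le (by fun_prop) continuous_const
  convex := fun x hx y hy a b ha hb hab i => by
    have hx := abs_le.1 (hx i)
    have hy := abs_le.1 (hy i)
    simp only [PiLp.add_apply, PiLp.smul_apply, smul_eq_mul, abs_le]
    constructor <;> nlinarith
  o := 0
  r := 1
  r_pos := one_pos
  ball_subset := fun x hx i => by
    rw [mem_ball_zero_iff] at hx
    exact (PiLp.norm_apply_le x i).trans hx.le
  frontier_subset := by simp [univDom]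

theorem image_disk_ne_square {l l' : ℝ} (hl : 0 < l) (hl' : 0 < l') (J : E2 ≃ᵢ E2) :
    J '' (diskBody.scale hl).K ≠ (squareBody.scale hl').K := by
  intro h
  have e : (diskBody.scale hl).K = closedBall 0 l := by
    change l • closedBall (0 : E2) 1 = _
    rw [_root_.smul_closedBall _ _ zero_le_one, smul_zero, mul_one, Real.norm_of_nonneg hl.le]
  rw [e, J.image_closedBall] at h
  set c := J 0
  have h1 : ∀ s : ℝ, |s| = 1 → |c 0 + s * l| ≤ l' := fun s hs => by
    have : c + (s * l) • wv 0 ∈ closedBall c l := by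
      simp [norm_smul, norm_wv, hs, abs_of_pos hl]
    rw [h] at this
    obtain ⟨y, hy, e⟩ := this
    have e0 := congrArg (fun x : E2 => x 0) e
    simp [wv] at e0
    rw [← e0, abs_mul, abs_of_pos hl']
    exact mul_le_of_le_one_right hl'.le (hy 0)
  have h2 : ∀ s : ℝ, |s| = 1 → (s * l' - c 0) ^ 2 + (s * l' - c 1) ^ 2 ≤ l ^ 2 := fun s hs => by
    have : l' • !₂[s, s] ∈ (squareBody.scale hl').K :=
      smul_mem_smul_set (show ∀ i, _ by intro i; fin_cases i <;> simp [hs])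
    rw [← h, mem_closedBall, EuclideanSpace.dist_eq, Real.sqrt_le_left hl.le] at this
    simpa [Real.dist_eq, sq_abs, mul_comm s] using this
  have a1 := abs_le.1 (h1 1 (by simp))
  have a2 := abs_le.1 (h1 (-1) (by simp))
  have b1 := h2 1 (by simp)
  have b2 := h2 (-1) (by simp)
  nlinarith [sq_nonneg (c 0), sq_nonneg (c 1)]

theorem not_congruent_half (hn : ¬ ∃ p v : E2, v ≠ 0 ∧ ∀ x ∈ frontier U.set, ∃ t : ℝ, x = p + t • v)
    (J : E2 ≃ᵢ E2) : J '' U.set ≠ halfBody.Kᶜ := by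
  intro h
  refine hn (exists_line (n := J.symm.toRealAffineIsometryEquiv.linearIsometryEquiv (wv 0)) ?_ ?_)
  · simp [← norm_ne_zero_iff, norm_wv]
  · have hx : ∀ x ∈ frontier U.set, J x 0 = 1 := fun x hx => by
      have : J x ∈ frontier halfBody.Kᶜ := by
        rw [← h]
        exact (J.toHomeomorph.image_frontier U.set).subset (mem_image_of_mem _ hx)
      rw [frontier_compl] at this
      exact frontier_le_subset_eq (f := fun x : E2 => x 0) (g := fun _ => 1) (by fun_prop) continuous_const this
    intro x hx' y hy'
    have e : J.symm.toRealAffineIsometryEquiv.linearIsometryEquiv (J x - J y) = x - y := by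
      rw [← vsub_eq_sub, AffineIsometryEquiv.map_vsub]
      simp
    rw [← e, LinearIsometryEquiv.inner_map_map]
    simp [wv, PiLp.inner_apply, Fin.sum_univ_two, hx x hx', hx y hy']

theorem exists_of_core_empty (h : core U = ∅)
    (hn : ¬ ∃ p v : E2, v ≠ 0 ∧ ∀ x ∈ frontier U.set, ∃ t : ℝ, x = p + t • v) :
    ∃ V : Dom, (¬ ∃ J : E2 ≃ᵢ E2, J '' U.set = V.set) ∧ Nonempty (bd U ≃ᵢ bd V) ∧
      ∃ Q θ θinv, IsUnfolding U.set V.set Q θ θinv := by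
  obtain ⟨B, -, hB⟩ := exists_std_body (interior_hull_nonempty hn)
  obtain ⟨u, hu⟩ := U.isDom.2.nonempty
  have hd : Disjoint U.set B.K := disjoint_left.2 fun x hx hxK => by
    obtain ⟨y, hy, hyi⟩ := mem_closure_iff.1 (B.mem_closure_interior hxK) _ U.isDom.1 hx
    exact (h ▸ hB.core_eq.symm.subset ⟨hy, hyi⟩ : y ∈ (∅ : Set E2))
  have hU : ∀ {A : Set ℝ} {a : ℝ}, B.Chart A → a ∈ A → U.set = B.Kᶜ := fun hc ha =>
    (subset_compl_iff_disjoint_right.2 hd).antisymm (B.subset_of_disjoint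
      (hc.isConnected_compl ha).isPreconnected disjoint_compl_left (disjoint_left.1 hd hu) hu)
  by_cases hpos : ∀ φ, 0 < B.gf (wv φ)
  · have hUK := hU (B.chart_univ hpos) (mem_univ 0)
    obtain ⟨ψ, hψ, hψi⟩ := B.exists_unitParam_periodic hpos
    have key : ∀ (B₀ : Body univDom) (h₀ : ∀ φ, 0 < B₀.gf (wv φ)), ∃ (l : ℝ) (hl : 0 < l),
        (¬ ∃ J : E2 ≃ᵢ E2, J '' U.set = (B₀.scale hl).Kᶜ) → ∃ V : Dom,
          (¬ ∃ J : E2 ≃ᵢ E2, J '' U.set = V.set) ∧ Nonempty (bd U ≃ᵢ bd V) ∧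
            ∃ Q θ θinv, IsUnfolding U.set V.set Q θ θinv := fun B₀ h₀ => by
      have hl := div_pos (B.perim_pos hpos) (B₀.perim_pos h₀)
      refine ⟨_, hl, fun hJ => ?_⟩
      have h₁ : ∀ φ, 0 < (B₀.scale hl).gf (wv φ) := fun φ => by
        rw [Body.gf_scale]; exact mul_pos (inv_pos.2 hl) (h₀ φ)
      obtain ⟨V, B', hV, hK⟩ := ((B₀.scale hl).chart_univ h₁).exists_dom (mem_univ 0)
      obtain ⟨ψ', hψ', hψi'⟩ := (B₀.scale hl).exists_unitParam_periodic h₁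
      refine ⟨V, by rwa [hV, hK], UnitParam.exists_of_compl hUK hV hψ (hK ▸ hψ') fun s t => ?_⟩
      rw [hψi, hψi', Body.perim_scale, div_mul_cancel₀ _ (B₀.perim_pos h₀).ne']
    obtain ⟨l, hl, h1⟩ := key diskBody (diskBody.gf_wv_pos subset_rfl)
    obtain ⟨l', hl', h2⟩ := key squareBody (squareBody.gf_wv_pos (R := 2) fun x hx => by
      have h0 := (sq_le_one_iff_abs_le_one _).2 (hx 0)
      have h1 := (sq_le_one_iff_abs_le_one _).2 (hx 1)
      rw [mem_closedBall, EuclideanSpace.dist_eq, Real.sqrt_le_left zero_le_two]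
      simp [squareBody]
      linarith)
    by_contra hno
    obtain ⟨J, hJ⟩ := not_not.1 (mt h1 hno)
    obtain ⟨J', hJ'⟩ := not_not.1 (mt h2 hno)
    refine image_disk_ne_square hl hl' (J.symm.trans J') (compl_injective ?_)
    rw [← image_compl_eq (IsometryEquiv.bijective _), ← hJ, ← hJ', ← image_comp]
    congr 1
    ext x; simp
  · push Not at hpos
    obtain ⟨φ, hφ⟩ := hpos
    have h0 : B.gf (-wv (φ - Real.pi)) = 0 := by
      rw [Body.wv_sub_pi, neg_neg]; exact hφ.antisymm (B.gf_nonneg _)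
    have h1 : 0 < B.gf (wv (φ - Real.pi)) :=
      (B.gf_nonneg _).lt_of_ne' fun h1 => hn (B.frontier_line hu hd h1 h0)
    have hπ := Real.pi_pos
    have hUK := hU (B.chart_angles h0 h1) ⟨⟨by linarith, by linarith⟩, h1⟩
    have h0' : halfBody.gf (-wv 0) = 0 := by
      by_contra hne
      have hp := (halfBody.gf_nonneg (-wv 0)).lt_of_ne' hne
      have := halfBody.gf_le_one_iff.2 (show halfBody.o + (2 / halfBody.gf (-wv 0)) • -wv 0 ∈
        halfBody.K by
          have := (div_pos two_pos hp).le
          simp [halfBody, wv] at this ⊢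
          linarith)
      rw [halfBody.gf_smul (div_pos two_pos hp).le, div_mul_cancel₀ _ hne] at this
      norm_num at this
    have h1' : 0 < halfBody.gf (wv 0) := (halfBody.gf_nonneg _).lt_of_ne' fun h => by
      have := halfBody.ray_mem h zero_le_two
      norm_num [halfBody, wv] at this
    obtain ⟨V, B', hV, hK⟩ := (halfBody.chart_angles h0' h1').exists_dom
      (a := 0) ⟨⟨by linarith, by linarith⟩, h1'⟩
    obtain ⟨ψ, hψ, hi⟩ := B.exists_unitParam_injective h0 h1
    obtain ⟨ψ', hψ', hi'⟩ := halfBody.exists_unitParam_injective h0' h1'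
    refine ⟨V, fun ⟨J, hJ⟩ => not_congruent_half hn J (hJ.trans (hV.trans (by rw [hK]))),
      UnitParam.exists_of_compl hUK hV hψ (hK ▸ hψ') fun s t => ?_⟩
    rw [hi.eq_iff, hi'.eq_iff]

end HBoundary

/-- Theorem 1.1 (II): if no straight line contains `∂U`, then `U` fails to be
uniquely determined in the class of all plane domains by the relative metric of
its Hausdorff boundary iff there exist a domain `V` not isometric to `U`, a
family of Euclidean isometries `Q_i` (indexed by the components `U_i` of
`U ∩ Int (conv ∂U)`), and an arclength-preserving homeomorphism
`θ : ∂F_U → ∂F_V` satisfying (IIa)–(IIc). -/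
theorem not_uniquely_determined_iff_exists_unfolding
    (U : Set (Euc 2)) (hU : IsEucDomain U)
    (hnoline : ¬ ∃ p v : Euc 2, v ≠ 0 ∧ ∀ x ∈ frontier U, ∃ t : ℝ, x = p + t • v) :
    ¬ UniquelyDeterminedIn {V | IsEucDomain V} U ↔
      ∃ V : Set (Euc 2), IsEucDomain V ∧
        (¬ ∃ J : Euc 2 ≃ᵢ Euc 2, J '' U = V) ∧
        ∃ Q : Set (Euc 2) → (Euc 2 ≃ᵢ Euc 2), ∃ θ θinv : Euc 2 → Euc 2,
          -- `θ` is a homeomorphism of `∂F_U` onto `∂F_V`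
          ContinuousOn θ (frontier (FPart U)) ∧
          ContinuousOn θinv (frontier (FPart V)) ∧
          MapsTo θ (frontier (FPart U)) (frontier (FPart V)) ∧
          MapsTo θinv (frontier (FPart V)) (frontier (FPart U)) ∧
          InvOn θinv θ (frontier (FPart U)) (frontier (FPart V)) ∧
          -- (IIa): `Q_i (U_i) = V_i` for each component `U_i`, and every
          -- component `V_i` arises this way
          (∀ C ∈ componentsOf (corePart U), (Q C) '' C ∈ componentsOf (corePart V)) ∧
          (∀ D ∈ componentsOf (corePart V),
            ∃ C ∈ componentsOf (corePart U), (Q C) '' C = D) ∧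
          -- (IIb)
          (∀ C ∈ componentsOf (corePart U), ∀ x : Euc 2,
            (x ∈ U ∩ frontier C ↔ Q C x ∈ V ∩ frontier ((Q C) '' C)) ∧
            (x ∈ U ∩ frontier C → θ x = Q C x)) ∧
          -- (IIc): `θ` preserves the length of arcs of `∂F_U`
          (∀ γ : ℝ → Euc 2, ContinuousOn γ (Icc (0:ℝ) 1) → InjOn γ (Icc (0:ℝ) 1) →
            MapsTo γ (Icc (0:ℝ) 1) (frontier (FPart U)) →
            eVariationOn (θ ∘ γ) (Icc (0:ℝ) 1) = eVariationOn γ (Icc (0:ℝ) 1)) := by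
  open HBoundary in
  set D : Dom := ⟨U, hU⟩
  rcases (core D).eq_empty_or_nonempty with hc | hc
  · obtain ⟨V, hJ, hf, Q, θ, θinv, h⟩ := exists_of_core_empty hc hnoline
    exact iff_of_true (fun hd => hJ (hd _ V.isDom ((exists_isHBIsometry_iff D V).2 hf)))
      ⟨V.set, V.isDom, hJ, Q, θ, θinv, h.cont, h.cont_inv, h.maps, h.maps_inv, h.inv,
        h.comp_mem, h.comp_surj, h.bdry, h.len⟩
  constructor
  · intro hd
    unfold UniquelyDeterminedIn at hd
    push Not at hd
    obtain ⟨V, hV, hf, hJ⟩ := hd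
    obtain ⟨f⟩ := (exists_isHBIsometry_iff D ⟨V, hV⟩).1 hf
    obtain ⟨Q, θ, θinv, h⟩ := exists_isUnfolding f hc
    exact ⟨V, hV, fun ⟨J, e⟩ => hJ J e, Q, θ, θinv, h.cont, h.cont_inv, h.maps, h.maps_inv,
      h.inv, h.comp_mem, h.comp_surj, h.bdry, h.len⟩
  · rintro ⟨V, hV, hJ, Q, θ, θinv, h1, h2, h3, h4, h5, h6, h7, h8, h9⟩ hd
    have h : IsUnfolding D.set (⟨V, hV⟩ : Dom).set Q θ θinv :=
      ⟨h1, h2, h3, h4, h5, h6, h7, h8, h9⟩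
    exact hJ (hd V hV ((exists_isHBIsometry_iff D ⟨V, hV⟩).2
      (h.nonempty_isometryEquiv hc hJ)))
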